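/- Let n ≥ 4 and let ρ : B_n → B_{n+1} be an injective group homomorphism. Then there exist an element c ∈ B_{n+1}, e ∈ {0,1}, and integers s and t such that ρ(g) = c·ι(χ^e(g)·z_n^{s·ℓ(g)})·c^{−1}·z_{n+1}^{t·ℓ(g)} for all g ∈ B_n, where ι : B_n → B_{n+1} is the standard inclusion and z_n, z_{n+1} are the full twists of B_n and B_{n+1}. (This is the algebraic form of the statement that ρ is induced by an embedding h : D_n → D_{n+1} of punctured disks, with ρ(H_a) = H_{h(a)}^{ε(h)}·T_A^s·z^t for every half-twist H_a, where T_A is the Dehn twist about the curve A = h(∂D_n).) -/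

import Mathlib

/-- Relators for the braid group with generators `σ_0, …, σ_{m-1}`:
the braid relations `σ_i σ_j σ_i = σ_j σ_i σ_j` for `j = i+1`, and the
commutation relations `σ_i σ_j = σ_j σ_i` for `j ≥ i+2`. -/
def braidRels (m : ℕ) : Set (FreeGroup (Fin m)) :=
  { r | ∃ i j : Fin m,
      ((i : ℕ) + 1 = (j : ℕ) ∧
        r = FreeGroup.of i * FreeGroup.of j * FreeGroup.of i *
            (FreeGroup.of j * FreeGroup.of i * FreeGroup.of j)⁻¹) ∨
      ((i : ℕ) + 2 ≤ (j : ℕ) ∧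
        r = FreeGroup.of i * FreeGroup.of j * (FreeGroup.of j * FreeGroup.of i)⁻¹) }

/-- The braid group on `n` strands: the presented group with generators
`σ_1, …, σ_{n-1}` (indexed by `Fin (n-1)`) and the braid relators. -/
abbrev BraidGroup (n : ℕ) : Type := PresentedGroup (braidRels (n - 1))

/-- The standard generator `σ_{i+1}` of the braid group (0-indexed). -/
def braidσ (n : ℕ) (i : Fin (n - 1)) : BraidGroup n := PresentedGroup.of i

/-- The element `δ = σ_1 σ_2 ⋯ σ_{n-1}` of the braid group. -/
def braidδ (n : ℕ) : BraidGroup n := (List.ofFn (braidσ n)).prod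

/-- The full twist `z = (σ_1 σ_2 ⋯ σ_{n-1})^n`. -/
def fullTwist (n : ℕ) : BraidGroup n := braidδ n ^ n

/-- The braid group with `m` generators, on the strands `0, …, m`. -/
abbrev Br (m : ℕ) : Type := PresentedGroup (braidRels m)

namespace Br

/-- The generator `σ_i` of `Br m`, extended by `1` to all `i : ℕ`. -/
def sig (m i : ℕ) : Br m := if h : i < m then PresentedGroup.of ⟨i, h⟩ else 1

theorem sig_of_le {m i : ℕ} (h : m ≤ i) : sig m i = 1 := by
  simp [sig, Nat.not_lt.mpr h]

theorem of_eq_sig {m : ℕ} (i : Fin m) :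
    (PresentedGroup.of i : Br m) = sig m i := by
  simp [sig]

/-- A sequence in a group satisfying the relations of `Br m`. -/
structure IsBraid {G : Type*} [Group G] (m : ℕ) (g : ℕ → G) : Prop where
  braid : ∀ i, i + 1 < m → g i * g (i + 1) * g i = g (i + 1) * g i * g (i + 1)
  comm : ∀ i j, i + 2 ≤ j → j < m → g i * g j = g j * g i

variable {G : Type*} [Group G] {m : ℕ}

theorem isBraid_sig : IsBraid m (sig m) where
  braid i hi := by
    have h1 : i < m := by omega
    have := PresentedGroup.one_of_mem (rels := braidRels m)
      (x := FreeGroup.of ⟨i, h1⟩ * FreeGroup.of ⟨i + 1, hi⟩ * FreeGroup.of ⟨i, h1⟩ *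
            (FreeGroup.of ⟨i + 1, hi⟩ * FreeGroup.of ⟨i, h1⟩ * FreeGroup.of ⟨i + 1, hi⟩)⁻¹)
      ⟨_, _, Or.inl ⟨rfl, rfl⟩⟩
    simp only [map_mul, map_inv] at this
    rw [mul_inv_eq_one] at this
    simp only [sig, hi, h1, dif_pos]
    exact this
  comm i j hij hj := by
    have h1 : i < m := by omega
    have := PresentedGroup.one_of_mem (rels := braidRels m)
      (x := FreeGroup.of ⟨i, h1⟩ * FreeGroup.of ⟨j, hj⟩ *
        (FreeGroup.of ⟨j, hj⟩ * FreeGroup.of ⟨i, h1⟩)⁻¹)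
      ⟨_, _, Or.inr ⟨hij, rfl⟩⟩
    simp only [map_mul, map_inv] at this
    rw [mul_inv_eq_one] at this
    simp only [sig, hj, h1, dif_pos]
    exact this

theorem sig_braid {i : ℕ} (hi : i + 1 < m) :
    sig m i * sig m (i + 1) * sig m i = sig m (i + 1) * sig m i * sig m (i + 1) :=
  isBraid_sig.braid i hi

theorem sig_comm {i j : ℕ} (hij : i + 2 ≤ j) : Commute (sig m i) (sig m j) := by
  rcases lt_or_ge j m with h | h
  · exact isBraid_sig.comm i j hij h
  · rw [sig_of_le h]; exact Commute.one_right _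

theorem sig_comm' {i j : ℕ} (h : i + 2 ≤ j ∨ j + 2 ≤ i) : Commute (sig m i) (sig m j) :=
  h.elim sig_comm fun h => (sig_comm h).symm

/-- The homomorphism out of `Br m` with given images of the generators. -/
def lift (g : ℕ → G) (hg : IsBraid m g) : Br m →* G :=
  PresentedGroup.toGroup (f := fun i : Fin m => g i) <| by
    rintro r ⟨i, j, ⟨h, rfl⟩ | ⟨h, rfl⟩⟩
    · have := hg.braid i (h ▸ j.2)
      simp only [map_mul, map_inv, FreeGroup.lift_apply_of, mul_inv_eq_one]
      rw [← h, this]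
    · have := hg.comm i j h j.2
      simp only [map_mul, map_inv, FreeGroup.lift_apply_of, mul_inv_eq_one]
      exact this

theorem lift_sig {g : ℕ → G} (hg : IsBraid m g) {i : ℕ} (hi : i < m) :
    lift g hg (sig m i) = g i := by
  simp [lift, sig, hi]

theorem hom_ext {f f' : Br m →* G} (h : ∀ i < m, f (sig m i) = f' (sig m i)) : f = f' := by
  apply PresentedGroup.ext
  intro i
  rw [of_eq_sig]
  exact h i i.2

theorem closure_sig : Subgroup.closure {x : Br m | ∃ i < m, sig m i = x} = ⊤ := by
  rw [← PresentedGroup.closure_range_of (braidRels m)]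
  congr 1
  ext x
  constructor
  · rintro ⟨i, hi, rfl⟩; exact ⟨⟨i, hi⟩, of_eq_sig _⟩
  · rintro ⟨i, rfl⟩; exact ⟨i, i.2, (of_eq_sig _).symm⟩

theorem induction {p : Br m → Prop} (one : p 1) (gen : ∀ i < m, p (sig m i))
    (mul : ∀ x y, p x → p y → p (x * y)) (inv : ∀ x, p x → p x⁻¹) (x : Br m) : p x := by
  have hx : x ∈ Subgroup.closure {x : Br m | ∃ i < m, sig m i = x} := by
    rw [closure_sig]; trivial
  induction hx using Subgroup.closure_induction with
  | mem x h => obtain ⟨i, hi, rfl⟩ := h; exact gen i hi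
  | one => exact one
  | mul x y _ _ hx hy => exact mul x y hx hy
  | inv x _ hx => exact inv x hx

/-- A subgroup containing the generators is everything. -/
theorem mem_of_sig_mem {H : Subgroup (Br m)} (h : ∀ i < m, sig m i ∈ H) (x : Br m) : x ∈ H :=
  induction H.one_mem h (fun _ _ => H.mul_mem) (fun _ => H.inv_mem) x

theorem IsBraid.mono {g : ℕ → G} {m' : ℕ} (hg : IsBraid m g) (h : m' ≤ m) : IsBraid m' g where
  braid i hi := hg.braid i (by omega)
  comm i j h hj := hg.comm i j h (by omega)

/-- The inclusion adding strands on the right. -/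
def incl (m : ℕ) : Br m →* Br (m + 1) := lift (sig (m + 1)) (isBraid_sig.mono (Nat.le_succ m))

@[simp] theorem incl_sig {i : ℕ} (hi : i < m) : incl m (sig m i) = sig (m + 1) i := lift_sig _ hi

/-- The length homomorphism. -/
def len (m : ℕ) : Br m →* Multiplicative ℤ :=
  lift (fun _ => Multiplicative.ofAdd 1) ⟨fun _ _ => rfl, fun _ _ _ _ => rfl⟩

@[simp] theorem len_sig {i : ℕ} (hi : i < m) : len m (sig m i) = Multiplicative.ofAdd 1 :=
  lift_sig _ hi

/-- Inversion of all generators. -/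
def chi (m : ℕ) : Br m →* Br m :=
  lift (fun i => (sig m i)⁻¹)
    ⟨fun i hi => by
      have := congrArg (·⁻¹) (sig_braid hi)
      simpa [mul_assoc] using this,
     fun i j h _ => by
      have := congrArg (·⁻¹) (sig_comm (m := m) h).eq
      simpa [mul_assoc] using this.symm⟩

@[simp] theorem chi_sig {i : ℕ} (hi : i < m) : chi m (sig m i) = (sig m i)⁻¹ := lift_sig _ hi

theorem chi_chi (x : Br m) : chi m (chi m x) = x := by
  have : (chi m).comp (chi m) = MonoidHom.id _ := hom_ext fun i hi => by simp [hi]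
  exact DFunLike.congr_fun this x

/-- The underlying permutation of strands. -/
def perm (m : ℕ) : Br m →* Equiv.Perm ℕ :=
  lift (fun i => Equiv.swap i (i + 1))
    ⟨fun i _ => by
      ext x; simp only [Equiv.Perm.mul_apply, Equiv.swap_apply_def]; grind,
     fun i j _ _ => by
      ext x; simp only [Equiv.Perm.mul_apply, Equiv.swap_apply_def]; grind⟩

@[simp] theorem perm_sig {i : ℕ} (hi : i < m) : perm m (sig m i) = Equiv.swap i (i + 1) :=
  lift_sig _ hi

theorem perm_apply_of_lt {x : ℕ} (hx : m < x) (b : Br m) : perm m b x = x := by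
  induction b using induction with
  | one => simp
  | gen i hi => rw [perm_sig hi, Equiv.swap_apply_of_ne_of_ne] <;> omega
  | mul a b ha hb => rw [map_mul, Equiv.Perm.mul_apply, hb, ha]
  | inv a ha => rw [map_inv, Equiv.Perm.inv_eq_iff_eq, ha]

theorem perm_apply_le {x : ℕ} (hx : x ≤ m) (b : Br m) : perm m b x ≤ m := by
  by_contra h
  push Not at h
  have := (perm m b).injective (perm_apply_of_lt h b)
  omega

theorem perm_incl (b : Br m) : perm (m + 1) (incl m b) = perm m b := by
  have : (perm (m + 1)).comp (incl m) = perm m := hom_ext fun i hi => by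
    simp [hi, Nat.lt_succ_of_lt hi]
  exact DFunLike.congr_fun this b

theorem len_incl (b : Br m) : len (m + 1) (incl m b) = len m b := by
  have : (len (m + 1)).comp (incl m) = len m := hom_ext fun i hi => by
    simp [hi, Nat.lt_succ_of_lt hi]
  exact DFunLike.congr_fun this b

/-! ### Linking numbers -/

/-- The action of a generator on pairs of strands and an accumulated crossing number. -/
def lkGen (k : ℕ) : Equiv.Perm (ℕ × ℕ × ℤ) where
  toFun p := (Equiv.swap k (k + 1) p.1, Equiv.swap k (k + 1) p.2.1,
    p.2.2 + if (p.1 = k ∧ p.2.1 = k + 1) ∨ (p.1 = k + 1 ∧ p.2.1 = k) then 1 else 0)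
  invFun p := (Equiv.swap k (k + 1) p.1, Equiv.swap k (k + 1) p.2.1,
    p.2.2 - if (p.1 = k ∧ p.2.1 = k + 1) ∨ (p.1 = k + 1 ∧ p.2.1 = k) then 1 else 0)
  left_inv p := by
    obtain ⟨i, j, z⟩ := p
    simp only [Equiv.swap_apply_def, Prod.mk.injEq]
    grind
  right_inv p := by
    obtain ⟨i, j, z⟩ := p
    simp only [Equiv.swap_apply_def, Prod.mk.injEq]
    grind

/-- The action of `Br m` on pairs of strands with an accumulated crossing number. -/
def lkHom (m : ℕ) : Br m →* Equiv.Perm (ℕ × ℕ × ℤ) :=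
  lift lkGen
    ⟨fun k _ => by
      ext1 ⟨i, j, z⟩
      have A1 : ∀ a : ℕ, ¬ a + 1 + 1 = a := by omega
      have A2 : ∀ a : ℕ, ¬ a = a + 1 + 1 := by omega
      have tri : ∀ i, i = k ∨ i = k + 1 ∨ i = k + 1 + 1 ∨ (i ≠ k ∧ i ≠ k + 1 ∧ i ≠ k + 1 + 1) := by omega
      rcases tri i with rfl | rfl | rfl | ⟨h1, h2, h3⟩ <;>
      rcases tri j with rfl | rfl | rfl | ⟨h4, h5, h6⟩ <;>
      simp [lkGen, Equiv.swap_apply_def, *],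
     fun k l h _ => by
      ext1 ⟨i, j, z⟩
      obtain ⟨d, rfl⟩ := Nat.exists_eq_add_of_le h
      have tri : ∀ i, i = k ∨ i = k + 1 ∨ i = k + 2 + d ∨ i = k + 2 + d + 1 ∨
        (i ≠ k ∧ i ≠ k + 1 ∧ i ≠ k + 2 + d ∧ i ≠ k + 2 + d + 1) := by omega
      have e1 : k ≠ k + 2 + d := by omega
      have e2 : k ≠ k + 2 + d + 1 := by omega
      have e3 : k + 1 ≠ k + 2 + d := by omega
      have e4 : k + 1 ≠ k + 2 + d + 1 := by omega
      rcases tri i with rfl | rfl | rfl | rfl | ⟨h1, h2, h3, h7⟩ <;>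
      rcases tri j with rfl | rfl | rfl | rfl | ⟨h4, h5, h6, h8⟩ <;>
      simp [lkGen, Equiv.swap_apply_def, e1.symm, e2.symm, e3.symm, *]⟩

/-- The number of crossings, with sign, between the strands starting at `i` and `j`. -/
def lk (b : Br m) (i j : ℕ) : ℤ := (lkHom m b (i, j, 0)).2.2

theorem lkHom_apply (b : Br m) (i j : ℕ) (z : ℤ) :
    lkHom m b (i, j, z) = (perm m b i, perm m b j, z + lk b i j) := by
  induction b using induction generalizing i j z with
  | one => simp [lk]
  | gen k hk => simp [lk, lkHom, lift_sig _ hk, lkGen, hk]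
  | mul a b ha hb =>
    have e : lk (a * b) i j = lk b i j + lk a (perm m b i) (perm m b j) := by
      conv_lhs => rw [lk, map_mul, Equiv.Perm.mul_apply, hb, ha]
      simp
    rw [map_mul, Equiv.Perm.mul_apply, hb, ha, e, map_mul, add_assoc]
    rfl
  | inv a ha =>
    have key : ∀ z, lkHom m a⁻¹ (i, j, z) =
        ((perm m a)⁻¹ i, (perm m a)⁻¹ j, z - lk a ((perm m a)⁻¹ i) ((perm m a)⁻¹ j)) := by
      intro z
      rw [map_inv, Equiv.Perm.inv_eq_iff_eq, ha]
      simp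
    have e : lk a⁻¹ i j = - lk a ((perm m a)⁻¹ i) ((perm m a)⁻¹ j) := by
      conv_lhs => rw [lk, key]
      simp
    rw [key, e, map_inv, sub_eq_add_neg]

@[simp] theorem lk_one (i j : ℕ) : lk (1 : Br m) i j = 0 := by simp [lk]

theorem lk_sig {k : ℕ} (hk : k < m) (i j : ℕ) :
    lk (sig m k) i j = if (i = k ∧ j = k + 1) ∨ (i = k + 1 ∧ j = k) then 1 else 0 := by
  simp [lk, lkHom, lift_sig _ hk, lkGen]

theorem lk_mul (a b : Br m) (i j : ℕ) :
    lk (a * b) i j = lk b i j + lk a (perm m b i) (perm m b j) := by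
  conv_lhs => rw [lk, map_mul, Equiv.Perm.mul_apply, lkHom_apply, lkHom_apply]
  simp

theorem lk_inv (a : Br m) (i j : ℕ) :
    lk a⁻¹ i j = - lk a ((perm m a)⁻¹ i) ((perm m a)⁻¹ j) := by
  have := lk_mul a a⁻¹ i j
  simp only [mul_inv_cancel, lk_one, map_inv] at this
  linarith

theorem lk_symm (b : Br m) (i j : ℕ) : lk b i j = lk b j i := by
  induction b using induction generalizing i j with
  | one => simp
  | gen k hk => simp only [lk_sig hk]; grind
  | mul a b ha hb => rw [lk_mul, lk_mul, hb, ha]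
  | inv a ha => rw [lk_inv, lk_inv, ha]

/-- Crossing numbers of a pure braid with prescribed conjugate. -/
theorem lk_conj (g p : Br m) (hp : perm m p = 1) (i j : ℕ) :
    lk (g * p * g⁻¹) (perm m g i) (perm m g j) = lk p i j := by
  simp [lk_mul, lk_inv, hp]

theorem lk_mul_of_pure (a b : Br m) (hb : perm m b = 1) (i j : ℕ) :
    lk (a * b) i j = lk b i j + lk a i j := by simp [lk_mul, hb]

theorem lk_pow_of_pure (a : Br m) (ha : perm m a = 1) (k : ℕ) (i j : ℕ) :
    lk (a ^ k) i j = k * lk a i j := by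
  induction k with
  | zero => simp
  | succ k ih => rw [pow_succ, lk_mul_of_pure _ _ ha, ih]; push_cast; ring

theorem lk_zpow_of_pure (a : Br m) (ha : perm m a = 1) (k : ℤ) (i j : ℕ) :
    lk (a ^ k) i j = k * lk a i j := by
  obtain ⟨k, rfl | rfl⟩ := k.eq_nat_or_neg
  · simp [lk_pow_of_pure a ha]
  · rw [zpow_neg, lk_inv, zpow_natCast, map_pow, ha]; simp [lk_pow_of_pure a ha]

theorem lk_incl (b : Br m) (i j : ℕ) : lk (incl m b) i j = lk b i j := by
  induction b using induction generalizing i j with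
  | one => simp
  | gen k hk => rw [incl_sig hk, lk_sig hk, lk_sig (by omega)]
  | mul a b ha hb => rw [map_mul, lk_mul, lk_mul, hb, ha, perm_incl, ]
  | inv a ha => rw [map_inv, lk_inv, lk_inv, ha, perm_incl]

theorem lk_eq_zero_of_lt {b : Br m} {i j : ℕ} (h : m < j) : lk b i j = 0 := by
  induction b using induction generalizing i with
  | one => simp
  | gen k hk => rw [lk_sig hk, if_neg (by omega)]
  | mul a b ha hb => rw [lk_mul, hb, perm_apply_of_lt h, ha, add_zero]
  | inv a ha => rw [lk_inv, ← map_inv, perm_apply_of_lt h, ha, neg_zero]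

/-- The parity of the crossing number detects whether the order of two strands is reversed. -/
theorem lk_odd_iff (b : Br m) {i j : ℕ} (h : i ≠ j) :
    Odd (lk b i j) ↔ ¬ (i < j ↔ perm m b i < perm m b j) := by
  induction b using induction generalizing i j with
  | one => simp
  | gen k hk =>
    rw [lk_sig hk, perm_sig hk]
    simp only [Equiv.swap_apply_def]
    split_ifs <;> simp <;> omega
  | mul a b ha hb =>
    rw [lk_mul, Int.odd_add', ← Int.not_odd_iff_even, ha ((perm m b).injective.ne h), hb h, map_mul]
    simp only [Equiv.Perm.mul_apply]
    tauto
  | inv a ha =>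
    have h1 : ∀ i, perm m a ((perm m a)⁻¹ i) = i := by simp
    rw [lk_inv, odd_neg, ha ((perm m a)⁻¹.injective.ne h), h1, h1, map_inv]
    tauto

end Br

namespace Br

open FreeGroup (of)

variable {m : ℕ}

/-! ### The Artin representation -/

/-- The free group carrying the Artin representation. -/
abbrev Fr : Type := FreeGroup ℕ

/-- The Artin automorphism of a generator. -/
def artinFun (i : ℕ) : Fr →* Fr :=
  FreeGroup.lift fun k => if k = i then (of i)⁻¹ * of (i + 1) * of i
    else if k = i + 1 then of i else of k

/-- The inverse of the Artin automorphism of a generator. -/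
def artinInv (i : ℕ) : Fr →* Fr :=
  FreeGroup.lift fun k => if k = i then of (i + 1)
    else if k = i + 1 then of (i + 1) * of i * (of (i + 1))⁻¹ else of k

theorem artinFun_of (i k : ℕ) : artinFun i (of k) = if k = i then (of i)⁻¹ * of (i + 1) * of i
    else if k = i + 1 then of i else of k := by simp [artinFun]

theorem artinInv_of (i k : ℕ) : artinInv i (of k) = if k = i then of (i + 1)
    else if k = i + 1 then of (i + 1) * of i * (of (i + 1))⁻¹ else of k := by simp [artinInv]

/-- The Artin automorphism of a generator. -/
def artinGen (i : ℕ) : MulAut Fr :=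
  MonoidHom.toMulEquiv (artinFun i) (artinInv i)
    (by
      ext k
      simp only [MonoidHom.comp_apply, MonoidHom.id_apply, artinFun_of]
      split_ifs with h h
      · subst h; simp [artinInv_of, mul_assoc]
      · subst h; simp [artinInv_of]
      · rw [artinInv_of]; simp_all)
    (by
      ext k
      simp only [MonoidHom.comp_apply, MonoidHom.id_apply, artinInv_of]
      split_ifs with h h
      · subst h; simp [artinFun_of]
      · subst h; simp [artinFun_of, mul_assoc]
      · rw [artinFun_of]; simp_all)

theorem artinGen_of (i k : ℕ) : artinGen i (of k) = if k = i then (of i)⁻¹ * of (i + 1) * of i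
    else if k = i + 1 then of i else of k := artinFun_of i k

theorem mulAut_ext {f g : MulAut Fr} (h : ∀ k, f (of k) = g (of k)) : f = g := by
  have : f.toMonoidHom = g.toMonoidHom := by ext k; exact h k
  ext w
  exact DFunLike.congr_fun this w

/-- The Artin representation. -/
def artin (m : ℕ) : Br m →* MulAut Fr :=
  lift artinGen
    ⟨fun i _ => by
      apply mulAut_ext
      intro k
      have A1 : ∀ a : ℕ, ¬ a + 1 + 1 = a := by omega
      have A2 : ∀ a : ℕ, ¬ a = a + 1 + 1 := by omega
      have tri : k = i ∨ k = i + 1 ∨ k = i + 1 + 1 ∨ (k ≠ i ∧ k ≠ i + 1 ∧ k ≠ i + 1 + 1) := by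
        omega
      rcases tri with rfl | rfl | rfl | ⟨h1, h2, h3⟩ <;>
      simp [artinGen_of, mul_assoc, *],
     fun i j h _ => by
      apply mulAut_ext
      intro k
      obtain ⟨d, rfl⟩ := Nat.exists_eq_add_of_le h
      have tri : k = i ∨ k = i + 1 ∨ k = i + 2 + d ∨ k = i + 2 + d + 1 ∨
        (k ≠ i ∧ k ≠ i + 1 ∧ k ≠ i + 2 + d ∧ k ≠ i + 2 + d + 1) := by omega
      have e1 : i ≠ i + 2 + d := by omega
      have e2 : i ≠ i + 2 + d + 1 := by omega
      have e3 : i + 1 ≠ i + 2 + d := by omega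
      have e4 : i + 1 ≠ i + 2 + d + 1 := by omega
      rcases tri with rfl | rfl | rfl | rfl | ⟨h1, h2, h3, h7⟩ <;>
      simp [artinGen_of, e1.symm, e2.symm, e3.symm, *]⟩

theorem artin_sig_of {i : ℕ} (hi : i < m) (k : ℕ) :
    artin m (sig m i) (of k) = if k = i then (of i)⁻¹ * of (i + 1) * of i
      else if k = i + 1 then of i else of k := by
  rw [artin, lift_sig _ hi, artinGen_of]

theorem artin_incl (b : Br m) : artin (m + 1) (incl m b) = artin m b := by
  have : (artin (m + 1)).comp (incl m) = artin m := hom_ext fun i hi => by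
    apply mulAut_ext; intro k
    simp [hi, artin_sig_of, Nat.lt_succ_of_lt hi]
  exact DFunLike.congr_fun this b

theorem artin_of_gt {k : ℕ} (hk : m < k) (b : Br m) : artin m b (of k) = of k := by
  induction b using induction with
  | one => simp
  | gen i hi => rw [artin_sig_of hi, if_neg (by omega), if_neg (by omega)]
  | mul a b ha hb => rw [map_mul, MulAut.mul_apply, hb, ha]
  | inv a ha => conv_lhs => rw [← ha, map_inv, MulAut.inv_apply_self]

/-- The product `a_{k-1} ⋯ a_0`. -/
def T : ℕ → Fr
  | 0 => 1
  | k + 1 => of k * T k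

@[simp] theorem T_zero : T 0 = 1 := rfl

theorem T_succ (k : ℕ) : T (k + 1) = of k * T k := rfl

theorem artinGen_T {i k : ℕ} (h : k ≤ i ∨ i + 2 ≤ k) : artinGen i (T k) = T k := by
  induction k using Nat.strong_induction_on with
  | _ k ih =>
    rcases k with _ | k
    · simp
    rcases Nat.lt_or_ge (i + 1) k with h1 | h1
    · rw [T_succ, map_mul, ih k (by omega) (by omega), artinGen_of, if_neg (by omega),
        if_neg (by omega)]
    rcases Nat.lt_or_ge i k with h2 | h2
    · obtain rfl : k = i + 1 := by omega
      rw [T_succ, T_succ, map_mul, map_mul, ih i (by omega) (by omega), artinGen_of, artinGen_of]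
      simp [mul_assoc]
    · rw [T_succ, map_mul, ih k (by omega) (by omega), artinGen_of, if_neg (by omega),
        if_neg (by omega)]

theorem artin_T (b : Br m) {k : ℕ} (hk : m < k) : artin m b (T k) = T k := by
  induction b using induction with
  | one => simp
  | gen i hi => rw [artin, lift_sig _ hi, artinGen_T (by omega)]
  | mul a b ha hb => rw [map_mul, MulAut.mul_apply, hb, ha]
  | inv a ha => conv_lhs => rw [← ha, map_inv, MulAut.inv_apply_self]

/-! ### The semidirect product and the stabilizer of the last strand -/

/-- The semidirect product of the free group with the braid group along the Artin
representation. -/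
abbrev Gm (m : ℕ) : Type := Fr ⋊[artin m] Br m

/-- Free generators in `Gm m`. -/
def gA (m k : ℕ) : Gm m := SemidirectProduct.inl (of k)

/-- Braid generators in `Gm m`. -/
def gS (m k : ℕ) : Gm m := SemidirectProduct.inr (sig m k)

theorem gS_mul_inl (b : Br m) (w : Fr) :
    (SemidirectProduct.inr b * SemidirectProduct.inl w : Gm m) =
      SemidirectProduct.inl (artin m b w) * SemidirectProduct.inr b := by
  rw [SemidirectProduct.inl_aut]; simp

theorem gS_gA_succ {i : ℕ} (hi : i < m) : gS m i * gA m (i + 1) = gA m i * gS m i := by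
  rw [gS, gA, gS_mul_inl, artin_sig_of hi]; simp [gA]

theorem gS_gA_ne {i k : ℕ} (hi : i < m) (h1 : k ≠ i) (h2 : k ≠ i + 1) :
    gS m i * gA m k = gA m k * gS m i := by
  rw [gS, gA, gS_mul_inl, artin_sig_of hi]; simp [h1, h2]

theorem gS_gA_gA {i : ℕ} (hi : i < m) :
    gS m i * gA m (i + 1) * gA m i = gA m (i + 1) * gA m i * gS m i := by
  simp only [gS, gA]
  rw [mul_assoc, ← map_mul, gS_mul_inl, map_mul, artin_sig_of hi, artin_sig_of hi]
  simp [mul_assoc]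

theorem gS_braid {i : ℕ} (hi : i + 1 < m) :
    gS m i * gS m (i + 1) * gS m i = gS m (i + 1) * gS m i * gS m (i + 1) := by
  simp only [gS, ← map_mul, sig_braid hi]

theorem gS_comm {i j : ℕ} (h : i + 2 ≤ j) : gS m i * gS m j = gS m j * gS m i := by
  simp only [gS, ← map_mul, (sig_comm h).eq]

/-- Auxiliary cocycle for the action of generators on cosets of the stabilizer. -/
def cosGen (m i k : ℕ) : Gm m :=
  if m + 1 < k then 1 else
  if k < i then gS m (i - 1) else if k = i then gA m i else if k = i + 1 then 1 else gS m i

/-- The action of the generator `σ_i` on `ℕ × Gm m`. -/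
def thetaGen (m i : ℕ) : Equiv.Perm (ℕ × Gm m) where
  toFun p := (Equiv.swap i (i + 1) p.1, cosGen m i p.1 * p.2)
  invFun p := (Equiv.swap i (i + 1) p.1, (cosGen m i (Equiv.swap i (i + 1) p.1))⁻¹ * p.2)
  left_inv p := by simp
  right_inv p := by simp

theorem thetaGen_apply (m i k : ℕ) (g : Gm m) :
    thetaGen m i (k, g) = (Equiv.swap i (i + 1) k, cosGen m i k * g) := rfl

theorem cos_lt {i k : ℕ} (h : k < i) (hi : i ≤ m) : cosGen m i k = gS m (i - 1) := by
  rw [cosGen, if_neg (by omega), if_pos h]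

theorem cos_self {i : ℕ} (hi : i ≤ m) : cosGen m i i = gA m i := by
  rw [cosGen, if_neg (by omega), if_neg (by omega), if_pos rfl]

theorem cos_succ {i : ℕ} : cosGen m i (i + 1) = 1 := by
  simp [cosGen]

theorem cos_gt {i k : ℕ} (h : i + 1 < k) (hk : k ≤ m + 1) : cosGen m i k = gS m i := by
  rw [cosGen, if_neg (by omega), if_neg (by omega), if_neg (by omega), if_neg (by omega)]

theorem cos_big {i k : ℕ} (h : m + 1 < k) : cosGen m i k = 1 := by
  rw [cosGen, if_pos h]

theorem isBraid_thetaGen : IsBraid (m + 1) (thetaGen m) where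
  braid i hi := by
    ext1 ⟨k, g⟩
    simp only [Equiv.Perm.mul_apply, thetaGen_apply]
    rcases Nat.lt_or_ge k i with h | h
    · rw [Equiv.swap_apply_of_ne_of_ne (a := i) (x := k) (by omega) (by omega),
        Equiv.swap_apply_of_ne_of_ne (a := i + 1) (x := k) (by omega) (by omega),
        Equiv.swap_apply_of_ne_of_ne (a := i) (x := k) (by omega) (by omega),
        Equiv.swap_apply_of_ne_of_ne (a := i + 1) (x := k) (by omega) (by omega),
        cos_lt h (by omega), cos_lt (by omega) (by omega)]
      obtain ⟨i, rfl⟩ := Nat.exists_eq_add_of_lt (Nat.zero_lt_of_lt h)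
      have := gS_braid (m := m) (i := i) (by omega)
      simp only [Nat.zero_add, Nat.add_sub_cancel, ← mul_assoc] at this ⊢
      rw [this]
    rcases eq_or_ne k i with rfl | h1
    · have e1 : Equiv.swap (k + 1) (k + 1 + 1) k = k :=
        Equiv.swap_apply_of_ne_of_ne (by omega) (by omega)
      have e2 : Equiv.swap k (k + 1) (k + 1 + 1) = k + 1 + 1 :=
        Equiv.swap_apply_of_ne_of_ne (by omega) (by omega)
      simp only [Equiv.swap_apply_left, e1, e2]
      rw [cos_self (by omega), cos_self (by omega), cos_gt (by omega) (by omega),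
        cos_lt (by omega) (by omega), Nat.add_sub_cancel]
      simp only [← mul_assoc]
      rw [gS_gA_gA (by omega)]
    rcases eq_or_ne k (i + 1) with rfl | h2
    · have e1 : Equiv.swap (i + 1) (i + 1 + 1) i = i :=
        Equiv.swap_apply_of_ne_of_ne (by omega) (by omega)
      have e2 : Equiv.swap i (i + 1) (i + 1 + 1) = i + 1 + 1 :=
        Equiv.swap_apply_of_ne_of_ne (by omega) (by omega)
      simp only [Equiv.swap_apply_left, Equiv.swap_apply_right, e1, e2]
      rw [cos_self (i := i) (by omega), cos_self (i := i + 1) (by omega),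
        cos_gt (i := i) (k := i + 1 + 1) (by omega) (by omega),
        cos_lt (i := i + 1) (k := i) (by omega) (by omega), Nat.add_sub_cancel, cos_succ, cos_succ]
      simp only [← mul_assoc, one_mul]
      rw [gS_gA_succ (by omega)]
    rcases eq_or_ne k (i + 1 + 1) with rfl | h3
    · have e1 : Equiv.swap (i + 1) (i + 1 + 1) i = i :=
        Equiv.swap_apply_of_ne_of_ne (by omega) (by omega)
      have e2 : Equiv.swap i (i + 1) (i + 1 + 1) = i + 1 + 1 :=
        Equiv.swap_apply_of_ne_of_ne (by omega) (by omega)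
      simp only [Equiv.swap_apply_right, e1, e2]
      rw [cos_gt (i := i) (k := i + 1 + 1) (by omega) (by omega),
        cos_lt (i := i + 1) (k := i) (by omega) (by omega), Nat.add_sub_cancel, cos_succ, cos_succ]
      simp only [one_mul]
    rw [Equiv.swap_apply_of_ne_of_ne (a := i) (x := k) (by omega) (by omega),
        Equiv.swap_apply_of_ne_of_ne (a := i + 1) (x := k) (by omega) (by omega),
        Equiv.swap_apply_of_ne_of_ne (a := i) (x := k) (by omega) (by omega),
        Equiv.swap_apply_of_ne_of_ne (a := i + 1) (x := k) (by omega) (by omega)]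
    rcases Nat.lt_or_ge (m + 1) k with h4 | h4
    · simp only [cos_big h4]
    · rw [cos_gt (by omega) h4, cos_gt (by omega) h4]
      simp only [← mul_assoc]
      rw [gS_braid (by omega)]
  comm i j h hj := by
    ext1 ⟨k, g⟩
    simp only [Equiv.Perm.mul_apply, thetaGen_apply]
    rcases Nat.lt_or_ge (m + 1) k with h4 | h4
    · rw [Equiv.swap_apply_of_ne_of_ne (a := i) (x := k) (by omega) (by omega),
        Equiv.swap_apply_of_ne_of_ne (a := j) (x := k) (by omega) (by omega),
        Equiv.swap_apply_of_ne_of_ne (a := i) (x := k) (by omega) (by omega)]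
      simp only [cos_big h4]
    rcases Nat.lt_or_ge k i with h1 | h1
    · rw [Equiv.swap_apply_of_ne_of_ne (a := i) (x := k) (by omega) (by omega),
        Equiv.swap_apply_of_ne_of_ne (a := j) (x := k) (by omega) (by omega),
        Equiv.swap_apply_of_ne_of_ne (a := i) (x := k) (by omega) (by omega),
        cos_lt h1 (by omega), cos_lt (by omega) (by omega), ← mul_assoc, ← mul_assoc,
        gS_comm (by omega)]
    rcases eq_or_ne k i with rfl | h2
    · rw [Equiv.swap_apply_of_ne_of_ne (a := j) (x := k) (by omega) (by omega),
        Equiv.swap_apply_left,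
        Equiv.swap_apply_of_ne_of_ne (a := j) (x := k + 1) (by omega) (by omega),
        cos_self (by omega), cos_lt (by omega) (by omega), cos_lt (by omega) (by omega),
        ← mul_assoc, ← mul_assoc, gS_gA_ne (by omega) (by omega) (by omega)]
    rcases eq_or_ne k (i + 1) with rfl | h3
    · rw [Equiv.swap_apply_of_ne_of_ne (a := j) (x := i + 1) (by omega) (by omega),
        Equiv.swap_apply_right,
        Equiv.swap_apply_of_ne_of_ne (a := j) (x := i) (by omega) (by omega),
        cos_succ, cos_lt (by omega) (by omega), cos_lt (by omega) (by omega), one_mul, one_mul]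
    rcases Nat.lt_or_ge k j with h5 | h5
    · rw [Equiv.swap_apply_of_ne_of_ne (a := i) (x := k) (by omega) (by omega),
        Equiv.swap_apply_of_ne_of_ne (a := j) (x := k) (by omega) (by omega),
        Equiv.swap_apply_of_ne_of_ne (a := i) (x := k) (by omega) (by omega),
        cos_lt h5 (by omega), cos_gt (by omega) (by omega), ← mul_assoc, ← mul_assoc,
        gS_comm (by omega)]
    rcases eq_or_ne k j with rfl | h6
    · rw [Equiv.swap_apply_of_ne_of_ne (a := i) (x := k) (by omega) (by omega),
        Equiv.swap_apply_left,
        Equiv.swap_apply_of_ne_of_ne (a := i) (x := k + 1) (by omega) (by omega),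
        cos_self (by omega), cos_gt (by omega) (by omega), cos_gt (by omega) (by omega),
        ← mul_assoc, ← mul_assoc, gS_gA_ne (by omega) (by omega) (by omega)]
    rcases eq_or_ne k (j + 1) with rfl | h7
    · rw [Equiv.swap_apply_of_ne_of_ne (a := i) (x := j + 1) (by omega) (by omega),
        Equiv.swap_apply_right,
        Equiv.swap_apply_of_ne_of_ne (a := i) (x := j) (by omega) (by omega),
        cos_succ, cos_gt (by omega) (by omega), cos_gt (by omega) (by omega), one_mul, one_mul]
    rw [Equiv.swap_apply_of_ne_of_ne (a := i) (x := k) (by omega) (by omega),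
        Equiv.swap_apply_of_ne_of_ne (a := j) (x := k) (by omega) (by omega),
        Equiv.swap_apply_of_ne_of_ne (a := i) (x := k) (by omega) (by omega),
        cos_gt (by omega) (by omega), cos_gt (by omega) (by omega), ← mul_assoc, ← mul_assoc,
        gS_comm (by omega)]

/-- The action of `Br (m + 1)` on `ℕ × Gm m`. -/
def theta (m : ℕ) : Br (m + 1) →* Equiv.Perm (ℕ × Gm m) := lift _ isBraid_thetaGen

/-- The `Gm m`-component of the action, a cocycle. -/
def cos (h : Br (m + 1)) (k : ℕ) : Gm m := (theta m h (k, 1)).2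

theorem theta_apply (h : Br (m + 1)) (k : ℕ) (g : Gm m) :
    theta m h (k, g) = (perm (m + 1) h k, cos h k * g) := by
  induction h using induction generalizing k g with
  | one => simp [cos]
  | gen i hi => simp [cos, theta, lift_sig _ hi, thetaGen_apply, hi]
  | mul a b ha hb =>
    have e : cos (a * b) k = cos a (perm _ b k) * cos b k := by
      conv_lhs => rw [cos, map_mul, Equiv.Perm.mul_apply, hb, ha]
      simp
    rw [map_mul, Equiv.Perm.mul_apply, hb, ha, e, map_mul, mul_assoc]
    rfl
  | inv a ha =>
    have key : ∀ g, theta m a⁻¹ (k, g) =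
        ((perm _ a)⁻¹ k, (cos a ((perm _ a)⁻¹ k))⁻¹ * g) := by
      intro g
      rw [map_inv, Equiv.Perm.inv_eq_iff_eq, ha]
      simp
    have e : cos a⁻¹ k = (cos a ((perm _ a)⁻¹ k))⁻¹ := by
      conv_lhs => rw [cos, key]
      simp
    rw [key, e, map_inv]

theorem cos_mul (a b : Br (m + 1)) (k : ℕ) :
    cos (a * b) k = cos a (perm (m + 1) b k) * cos b k := by
  conv_lhs => rw [cos, map_mul, Equiv.Perm.mul_apply, theta_apply, theta_apply]
  simp

@[simp] theorem cos_one (k : ℕ) : cos (1 : Br (m + 1)) k = 1 := by simp [cos]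

theorem cos_inv (a : Br (m + 1)) (k : ℕ) :
    cos a⁻¹ k = (cos a ((perm (m + 1) a)⁻¹ k))⁻¹ := by
  have := cos_mul a a⁻¹ k
  rw [mul_inv_cancel, cos_one, map_inv] at this
  exact (inv_eq_of_mul_eq_one_right this.symm).symm

theorem cos_sig {i : ℕ} (hi : i < m + 1) (k : ℕ) : cos (sig (m + 1) i) k = cosGen m i k := by
  simp [cos, theta, lift_sig _ hi, thetaGen_apply]

/-- The braid `σ_k σ_{k+1} ⋯ σ_m`. -/
def tau (m k : ℕ) : Br (m + 1) := ((List.range' k (m + 1 - k)).map (sig (m + 1))).prod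

theorem tau_eq {k : ℕ} (hk : k ≤ m) : tau m k = sig (m + 1) k * tau m (k + 1) := by
  rw [tau, tau, show m + 1 - k = (m + 1 - (k + 1)) + 1 by omega, List.range'_succ]
  simp

@[simp] theorem tau_last : tau m (m + 1) = 1 := by simp [tau]

theorem sig_tau_comm {i k : ℕ} (h : i + 1 < k) (hk : k ≤ m + 1) :
    Commute (sig (m + 1) i) (tau m k) := by
  induction hk using Nat.decreasingInduction with
  | self => simp
  | of_succ k hk ih =>
    rw [tau_eq (by omega)]
    exact (sig_comm (by omega)).mul_right (ih (by omega))

theorem sig_tau {j k : ℕ} (h : k < j) (hj : j ≤ m) :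
    sig (m + 1) j * tau m k = tau m k * sig (m + 1) (j - 1) := by
  have hk : k ≤ j - 1 := by omega
  induction hk using Nat.decreasingInduction with
  | self =>
    obtain ⟨j, rfl⟩ := Nat.exists_eq_add_of_lt (Nat.zero_lt_of_lt h)
    simp only [Nat.zero_add, Nat.add_sub_cancel] at *
    rw [tau_eq (by omega), tau_eq (by omega)]
    have h1 := sig_braid (m := m + 1) (i := j) (by omega)
    have h2 := (sig_tau_comm (m := m) (i := j) (k := j + 1 + 1) (by omega) (by omega)).eq
    rw [mul_assoc, mul_assoc, ← h2, ← mul_assoc, ← mul_assoc, ← mul_assoc, ← mul_assoc, h1]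
  | of_succ k hk ih =>
    rw [tau_eq (by omega), mul_assoc, ← ih (by omega), ← mul_assoc, ← mul_assoc,
      (sig_comm (i := k) (j := j) (by omega)).eq]

/-- The pure braid generator linking strand `k` with the last strand. -/
def braidA (m k : ℕ) : Br (m + 1) := (tau m (k + 1))⁻¹ * sig (m + 1) k ^ 2 * tau m (k + 1)

theorem braidA_comm {i k : ℕ} (hi : i < m) (hk : k ≤ m) (h1 : k ≠ i) (h2 : k ≠ i + 1) :
    Commute (sig (m + 1) i) (braidA m k) := by
  rcases Nat.lt_or_ge k i with h | h
  · have e := sig_tau (m := m) (j := i + 1) (k := k + 1) (by omega) (by omega)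
    have c : Commute (sig (m + 1) (i + 1)) (sig (m + 1) k ^ 2) :=
      (sig_comm' (by omega)).pow_right 2
    rw [Nat.add_sub_cancel] at e
    have e' : sig (m + 1) i = (tau m (k + 1))⁻¹ * sig (m + 1) (i + 1) * tau m (k + 1) := by
      rw [mul_assoc, e, inv_mul_cancel_left]
    rw [e', braidA]
    have := c.eq
    simp only [commute_iff_eq, mul_assoc, mul_inv_cancel_left]
    rw [← mul_assoc _ _ (tau m (k + 1)), this]
    simp only [mul_assoc]
  · have c := sig_tau_comm (m := m) (i := i) (k := k + 1) (by omega) (by omega)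
    exact (c.inv_right.mul_right ((sig_comm (by omega)).pow_right 2)).mul_right c

theorem sig_braidA_succ {i : ℕ} (hi : i < m) :
    sig (m + 1) i * braidA m (i + 1) = braidA m i * sig (m + 1) i := by
  have c := sig_tau_comm (m := m) (i := i) (k := i + 1 + 1) (by omega) (by omega)
  have b := sig_braid (m := m + 1) (i := i) (by omega)
  rw [braidA, braidA, tau_eq (k := i + 1) (by omega)]
  generalize tau m (i + 1 + 1) = t at *
  generalize sig (m + 1) i = x at *
  generalize sig (m + 1) (i + 1) = y at *
  have h1 : x * y ^ 2 = y⁻¹ * x ^ 2 * y * x := by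
    have : y * (x * y ^ 2) = x ^ 2 * y * x := by
      calc y * (x * y ^ 2) = (y * x * y) * y := by simp only [pow_two, mul_assoc]
        _ = (x * y * x) * y := by rw [b]
        _ = x * (y * x * y) := by simp only [mul_assoc]
        _ = _ := by rw [← b]; simp only [pow_two, mul_assoc]
    rw [mul_assoc, mul_assoc, eq_inv_mul_iff_mul_eq, this, mul_assoc]
  calc x * (t⁻¹ * y ^ 2 * t) = t⁻¹ * (x * y ^ 2) * t := by
        rw [mul_assoc, ← mul_assoc x, c.inv_right.eq]; simp only [mul_assoc]
    _ = (y * t)⁻¹ * x ^ 2 * (y * t) * x := by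
        rw [h1, mul_inv_rev]
        have := c.eq
        simp only [mul_assoc] at this ⊢
        rw [this]

theorem sig_braidA_mul {i : ℕ} (hi : i < m) :
    Commute (sig (m + 1) i) (braidA m (i + 1) * braidA m i) := by
  have c := sig_tau_comm (m := m) (i := i) (k := i + 1 + 1) (by omega) (by omega)
  have b := sig_braid (m := m + 1) (i := i) (by omega)
  rw [braidA, braidA, tau_eq (k := i + 1) (by omega)]
  generalize tau m (i + 1 + 1) = t at *
  generalize sig (m + 1) i = x at *
  generalize sig (m + 1) (i + 1) = y at *
  have e : t⁻¹ * y ^ 2 * t * ((y * t)⁻¹ * x ^ 2 * (y * t)) = t⁻¹ * (y * x * (x * y)) * t := by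
    simp only [pow_two]; group
  have : Commute x (y * x * (x * y)) := by
    rw [commute_iff_eq]
    calc x * (y * x * (x * y)) = (x * y * x) * (x * y) := by simp only [mul_assoc]
      _ = y * x * (y * x * y) := by rw [b]; simp only [mul_assoc]
      _ = _ := by rw [← b]; simp only [mul_assoc]
  rw [e]
  exact (c.inv_right.mul_right this).mul_right c

/-- The point-pushing homomorphism. -/
def push (m : ℕ) : Fr →* Br (m + 1) :=
  FreeGroup.lift fun k => if k ≤ m then braidA m k else 1

theorem push_of {k : ℕ} (hk : k ≤ m) : push m (of k) = braidA m k := by simp [push, hk]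

theorem push_of_gt {k : ℕ} (hk : m < k) : push m (of k) = 1 := by
  simp [push, Nat.not_le.mpr hk]

theorem push_artin (b : Br m) (w : Fr) :
    push m (artin m b w) = incl m b * push m w * (incl m b)⁻¹ := by
  induction b using induction generalizing w with
  | one => simp
  | gen i hi =>
    have : (push m).comp (artin m (sig m i)).toMonoidHom =
        (MulAut.conj (incl m (sig m i))).toMonoidHom.comp (push m) := by
      ext k
      simp only [MonoidHom.comp_apply, MulEquiv.coe_toMonoidHom, MulAut.conj_apply, incl_sig hi]
      rw [artin_sig_of hi, eq_mul_inv_iff_mul_eq]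
      split_ifs with h1 h2
      · subst h1
        simp only [map_mul, map_inv, push_of hi.le, push_of (k := k + 1) hi]
        have h3 := sig_braidA_succ hi
        have h4 := (sig_braidA_mul hi).eq
        rw [mul_assoc, mul_assoc, inv_mul_eq_iff_eq_mul, ← mul_assoc, ← h4, ← mul_assoc, h3,
          mul_assoc]
      · subst h2
        rw [push_of hi.le, push_of hi, sig_braidA_succ hi]
      · rcases Nat.lt_or_ge m k with h | h
        · simp [push_of_gt h]
        · rw [push_of h, (braidA_comm hi h h1 h2).eq]
    exact DFunLike.congr_fun this w
  | mul a b ha hb => rw [map_mul, MulAut.mul_apply, ha, hb, map_mul]; group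
  | inv a ha =>
    have := ha (artin m a⁻¹ w)
    rw [map_inv, MulAut.apply_inv_self] at this
    rw [this, map_inv, map_inv]
    group

/-- The homomorphism from the semidirect product onto the stabilizer of the last strand. -/
def J (m : ℕ) : Gm m →* Br (m + 1) :=
  SemidirectProduct.lift (push m) (incl m) fun b => by
    ext k
    exact push_artin b (of k)

@[simp] theorem J_inl (w : Fr) : J m (SemidirectProduct.inl w) = push m w := by simp [J]

@[simp] theorem J_inr (b : Br m) : J m (SemidirectProduct.inr b) = incl m b := by simp [J]

theorem J_apply (x : Gm m) : J m x = push m x.left * incl m x.right := rfl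

theorem perm_tau_last {k : ℕ} (hk : k ≤ m + 1) : perm (m + 1) (tau m k) (m + 1) = k := by
  induction hk using Nat.decreasingInduction with
  | self => simp
  | of_succ k hk ih =>
    rw [tau_eq (by omega), map_mul, Equiv.Perm.mul_apply, ih, perm_sig (by omega),
      Equiv.swap_apply_right]

theorem cos_tau_last {k : ℕ} (hk : k ≤ m + 1) : cos (tau m k) (m + 1) = 1 := by
  induction hk using Nat.decreasingInduction with
  | self => simp
  | of_succ k hk ih =>
    rw [tau_eq (by omega), cos_mul, ih, perm_tau_last (by omega), cos_sig (by omega), cos_succ,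
      one_mul]

theorem perm_braidA (k : ℕ) : perm (m + 1) (braidA m k) = 1 := by
  rw [braidA, map_mul, map_mul, map_pow, map_inv]
  rcases Nat.lt_or_ge k (m + 1) with h | h
  · rw [perm_sig h, pow_two, Equiv.swap_mul_self]; simp
  · rw [sig_of_le h]; simp

theorem perm_push (w : Fr) : perm (m + 1) (push m w) = 1 := by
  have : (perm (m + 1)).comp (push m) = 1 := by
    ext1 k
    rcases Nat.lt_or_ge m k with h | h
    · simp [push_of_gt h]
    · simp [push_of h, perm_braidA]
  exact DFunLike.congr_fun this w

theorem cos_braidA {k : ℕ} (hk : k ≤ m) : cos (braidA m k) (m + 1) = gA m k := by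
  have h1 : perm (m + 1) (tau m (k + 1)) (m + 1) = k + 1 := perm_tau_last (by omega)
  have h2 : (perm (m + 1) (tau m (k + 1)))⁻¹ (k + 1) = m + 1 := by
    rw [Equiv.Perm.inv_eq_iff_eq, h1]
  have h3 : cos (sig (m + 1) k ^ 2) (k + 1) = gA m k := by
    rw [pow_two, cos_mul, cos_sig (by omega), cos_sig (by omega), perm_sig (by omega),
      Equiv.swap_apply_right, cos_succ, cos_self hk, mul_one]
  have h4 : perm (m + 1) (sig (m + 1) k ^ 2) = 1 := by
    rw [map_pow, perm_sig (by omega), pow_two, Equiv.swap_mul_self]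
  rw [braidA, cos_mul, cos_mul, h1, h3, h4, cos_tau_last (by omega), cos_inv, Equiv.Perm.one_apply,
    h2, cos_tau_last (by omega)]
  simp

/-- Killing the free generators with index at least `k`. -/
def trunc (k : ℕ) : Fr →* Fr := FreeGroup.lift fun j => if j < k then of j else 1

theorem trunc_of {k j : ℕ} (h : j < k) : trunc k (of j) = of j := by simp [trunc, h]

theorem trunc_of_ge {k j : ℕ} (h : k ≤ j) : trunc k (of j) = 1 := by
  simp [trunc, Nat.not_lt.mpr h]

theorem trunc_trunc_of_le {k l : ℕ} (h : k ≤ l) (w : Fr) : trunc k (trunc l w) = trunc k w := by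
  have : (trunc k).comp (trunc l) = trunc k := by
    ext1 j
    rcases Nat.lt_or_ge j l with h1 | h1
    · simp [trunc_of h1]
    · simp [trunc_of_ge h1, trunc_of_ge (h.trans h1)]
  exact DFunLike.congr_fun this w

theorem trunc_trunc_of_ge {k l : ℕ} (h : k ≤ l) (w : Fr) : trunc l (trunc k w) = trunc k w := by
  have : (trunc l).comp (trunc k) = trunc k := by
    ext1 j
    rcases Nat.lt_or_ge j k with h1 | h1
    · simp [trunc_of h1, trunc_of (h1.trans_le h)]
    · simp [trunc_of_ge h1]
  exact DFunLike.congr_fun this w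

theorem trunc_artin (b : Br m) (w : Fr) {k : ℕ} (hk : m < k) :
    trunc k (artin m b w) = artin m b (trunc k w) := by
  induction b using induction generalizing w with
  | one => simp
  | gen i hi =>
    have : (trunc k).comp (artin m (sig m i)).toMonoidHom =
        (artin m (sig m i)).toMonoidHom.comp (trunc k) := by
      ext1 j
      simp only [MonoidHom.comp_apply, MulEquiv.coe_toMonoidHom]
      rw [artin_sig_of hi]
      rcases Nat.lt_or_ge j k with h1 | h1
      · rw [trunc_of h1, artin_sig_of hi]
        split_ifs
        · simp [trunc_of (show i < k by omega), trunc_of (show i + 1 < k by omega)]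
        · rw [trunc_of (by omega)]
        · rw [trunc_of h1]
      · rw [trunc_of_ge h1, if_neg (by omega), if_neg (by omega), trunc_of_ge h1, map_one]
    exact DFunLike.congr_fun this w
  | mul a b ha hb => rw [map_mul, MulAut.mul_apply, ha, hb, MulAut.mul_apply]
  | inv a ha =>
    apply (artin m a).injective
    rw [← ha, map_inv, MulAut.apply_inv_self, MulAut.apply_inv_self]

/-- Truncation on the semidirect product. -/
def truncG (m : ℕ) : Gm m →* Gm m :=
  SemidirectProduct.map (trunc (m + 1)) (MonoidHom.id _) fun b => by
    ext1 k
    exact trunc_artin b _ (Nat.lt_succ_self m)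

theorem truncG_apply (x : Gm m) : truncG m x = ⟨trunc (m + 1) x.left, x.right⟩ := by
  ext <;> simp [truncG]

theorem cos_incl (b : Br m) : cos (incl m b) (m + 1) = SemidirectProduct.inr b := by
  have hfix : ∀ b : Br m, perm (m + 1) (incl m b) (m + 1) = m + 1 := fun b => by
    rw [perm_incl, perm_apply_of_lt (by omega)]
  induction b using induction with
  | one => simp
  | gen i hi => rw [incl_sig hi, cos_sig (by omega), cos_gt (by omega) le_rfl, gS]
  | mul a b ha hb => rw [map_mul, cos_mul, hfix, ha, hb, map_mul]
  | inv a ha =>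
    have h2 : (perm (m + 1) (incl m a))⁻¹ (m + 1) = m + 1 := by
      rw [Equiv.Perm.inv_eq_iff_eq, hfix]
    rw [map_inv, cos_inv, h2, ha, map_inv]

theorem cos_push (w : Fr) :
    cos (push m w) (m + 1) = SemidirectProduct.inl (trunc (m + 1) w) := by
  induction w using FreeGroup.induction_on with
  | C1 => simp
  | of k =>
    rcases Nat.lt_or_ge m k with h | h
    · rw [push_of_gt h]; change _ = SemidirectProduct.inl (trunc (m + 1) (of k))
      rw [trunc_of_ge h]; simp
    · rw [push_of h, cos_braidA h, gA]; change _ = SemidirectProduct.inl (trunc (m + 1) (of k))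
      rw [trunc_of (by omega)]
  | inv_of k h =>
    rw [map_inv, cos_inv, perm_push, inv_one, Equiv.Perm.one_apply, h, map_inv, map_inv]
  | mul a b ha hb => rw [map_mul, cos_mul, perm_push, Equiv.Perm.one_apply, ha, hb, map_mul, map_mul]

theorem cos_J (x : Gm m) : cos (J m x) (m + 1) = truncG m x := by
  rw [← SemidirectProduct.inl_left_mul_inr_right x, map_mul, cos_mul, J_inr, J_inl, perm_incl,
    perm_apply_of_lt (by omega), cos_incl, cos_push, map_mul, truncG_apply, truncG_apply]
  ext <;> simp

theorem mul_tau (h : Br (m + 1)) {k : ℕ} (hk : k ≤ m + 1) :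
    h * tau m k = tau m (perm (m + 1) h k) * J m (cos h k) := by
  induction h using induction generalizing k with
  | one => simp
  | gen i hi =>
    rw [perm_sig hi, cos_sig hi]
    rcases Nat.lt_or_ge k i with h1 | h1
    · rw [Equiv.swap_apply_of_ne_of_ne (by omega) (by omega), cos_lt h1 (by omega), gS, J_inr,
        incl_sig (by omega), sig_tau h1 (by omega)]
    rcases eq_or_ne k i with rfl | h2
    · rw [Equiv.swap_apply_left, cos_self (by omega), gA, J_inl, push_of (by omega), braidA,
        tau_eq (by omega), pow_two]
      simp only [mul_assoc, mul_inv_cancel_left]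
    rcases eq_or_ne k (i + 1) with rfl | h3
    · rw [Equiv.swap_apply_right, cos_succ, map_one, mul_one, ← tau_eq (by omega)]
    · rw [Equiv.swap_apply_of_ne_of_ne h2 h3, cos_gt (by omega) hk, gS, J_inr,
        incl_sig (by omega), (sig_tau_comm (by omega) hk).eq]
  | mul a b ha hb =>
    rw [mul_assoc, hb hk, ← mul_assoc, ha (perm_apply_le hk b), cos_mul, map_mul, map_mul, mul_assoc]
    rfl
  | inv a ha =>
    rw [inv_mul_eq_iff_eq_mul, ← mul_assoc, ha (perm_apply_le hk _), cos_inv, map_inv, map_inv]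
    simp

/-- Every braid fixing the last strand comes from the semidirect product. -/
theorem J_cos {h : Br (m + 1)} (hh : perm (m + 1) h (m + 1) = m + 1) : J m (cos h (m + 1)) = h := by
  have := mul_tau h (le_refl (m + 1))
  rw [hh] at this
  simpa using this.symm

theorem truncG_cos {h : Br (m + 1)} (hh : perm (m + 1) h (m + 1) = m + 1) :
    truncG m (cos h (m + 1)) = cos h (m + 1) := by
  conv_rhs => rw [← J_cos hh]
  rw [cos_J]

theorem exists_decomp {h : Br (m + 1)} (hh : perm (m + 1) h (m + 1) = m + 1) :
    ∃ (w : Fr) (b : Br m), trunc (m + 1) w = w ∧ h = push m w * incl m b := by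
  refine ⟨(cos h (m + 1)).left, (cos h (m + 1)).right, ?_, ?_⟩
  · have := truncG_cos hh
    rw [truncG_apply] at this
    exact congrArg SemidirectProduct.left this
  · rw [← J_apply, J_cos hh]

theorem decomp_unique {w w' : Fr} {b b' : Br m} (h : push m w * incl m b = push m w' * incl m b') :
    trunc (m + 1) w = trunc (m + 1) w' ∧ b = b' := by
  have e : J m ⟨w, b⟩ = J m ⟨w', b'⟩ := h
  have := congrArg (fun x => cos x (m + 1)) e
  simp only [cos_J, truncG_apply] at this
  exact ⟨congrArg SemidirectProduct.left this, congrArg SemidirectProduct.right this⟩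

theorem push_inj {w w' : Fr} (hw : trunc (m + 1) w = w) (hw' : trunc (m + 1) w' = w')
    (h : push m w = push m w') : w = w' := by
  rw [← hw, ← hw']
  exact (decomp_unique (b := 1) (b' := 1) (by simpa using h)).1

theorem incl_mul_push (b : Br m) (w : Fr) :
    incl m b * push m w = push m (artin m b w) * incl m b := by
  rw [push_artin]; group

end Br

namespace Br

open FreeGroup (of)

variable {m : ℕ}

/-! ### The full twist -/

/-- The braid `σ_0 ⋯ σ_{m-1}`. -/
def dl (m : ℕ) : Br m := ((List.range m).map (sig m)).prod

/-- The full twist. -/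
def zt (m : ℕ) : Br m := dl m ^ (m + 1)

theorem fullTwist_eq : fullTwist (m + 1) = zt m := by
  rw [fullTwist, zt, braidδ, dl]
  congr 2
  apply List.ext_getElem
  · simp
  · intro i h1 h2
    simp [braidσ, sig]
    simp at h1
    omega

theorem dl_succ : dl (m + 1) = incl m (dl m) * sig (m + 1) m := by
  rw [dl, dl, List.range_succ, List.map_append, List.prod_append, map_list_prod, List.map_map]
  congr 2
  · apply List.map_congr_left
    intro i hi
    rw [Function.comp_apply, incl_sig (List.mem_range.mp hi)]
  · simp

theorem dl_eq_tau : dl (m + 1) = tau m 0 := by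
  rw [dl, tau, List.range_eq_range']; rfl

theorem sig_dl {i : ℕ} (hi : i + 1 < m) : sig m (i + 1) * dl m = dl m * sig m i := by
  obtain ⟨m, rfl⟩ : ∃ k, m = k + 1 := ⟨m - 1, by omega⟩
  rw [dl_eq_tau]
  exact sig_tau (by omega) (by omega)

/-- The braid `σ_m ⋯ σ_k`. -/
def tauRev (m k : ℕ) : Br (m + 1) := ((List.range' k (m + 1 - k)).map (sig (m + 1))).reverse.prod

theorem tauRev_eq {k : ℕ} (hk : k ≤ m) : tauRev m k = tauRev m (k + 1) * sig (m + 1) k := by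
  rw [tauRev, tauRev, show m + 1 - k = (m + 1 - (k + 1)) + 1 by omega, List.range'_succ]
  simp

@[simp] theorem tauRev_last : tauRev m (m + 1) = 1 := by simp [tauRev]

theorem tauRev_mul_dl {k : ℕ} (hk : k ≤ m) :
    tauRev m (k + 1) * dl (m + 1) = incl m (dl m) * tauRev m k := by
  induction hk using Nat.decreasingInduction with
  | self => rw [tauRev_eq le_rfl, tauRev_last, dl_succ]; simp
  | of_succ k hk ih =>
    rw [tauRev_eq (by omega), mul_assoc, sig_dl (by omega), ← mul_assoc, ih, mul_assoc,
      ← tauRev_eq (by omega)]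

theorem dl_pow {k : ℕ} (hk : k ≤ m + 1) :
    dl (m + 1) ^ (m + 1 - k) = incl m (dl m) ^ (m + 1 - k) * tauRev m k := by
  induction hk using Nat.decreasingInduction with
  | self => simp
  | of_succ k hk ih =>
    rw [show m + 1 - k = (m + 1 - (k + 1)) + 1 by omega, pow_succ, ih, mul_assoc,
      tauRev_mul_dl (by omega), pow_succ, mul_assoc]

theorem push_T {k : ℕ} (hk : k ≤ m + 1) :
    push m (T (m + 1)) = tauRev m k * tau m k * push m (T k) := by
  induction hk using Nat.decreasingInduction with
  | self => simp
  | of_succ k hk ih =>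
    rw [ih, T_succ, map_mul, push_of (by omega), braidA, tauRev_eq (m := m) (k := k) (by omega),
      tau_eq (m := m) (k := k) (by omega), pow_two]
    simp only [mul_assoc, mul_inv_cancel_left]

theorem zt_succ : zt (m + 1) = incl m (zt m) * push m (T (m + 1)) := by
  rw [push_T (k := 0) (by omega), zt, pow_succ]
  have := dl_pow (m := m) (k := 0) (by omega)
  rw [Nat.sub_zero] at this
  rw [this, zt, map_pow, T_zero, map_one, mul_one, ← dl_eq_tau, mul_assoc]

theorem incl_comm_push_T (b : Br m) : Commute (incl m b) (push m (T (m + 1))) := by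
  rw [commute_iff_eq, incl_mul_push, artin_T b (Nat.lt_succ_self m)]

theorem zt_comm (b : Br m) : Commute (zt m) b := by
  induction m with
  | zero =>
    have : b = 1 := by
      induction b using induction with
      | one => rfl
      | gen i hi => omega
      | mul a b ha hb => rw [ha, hb, one_mul]
      | inv a ha => rw [ha, inv_one]
    rw [this]; exact Commute.one_right _
  | succ m ih =>
    have h0 : Commute (zt (m + 1)) (sig (m + 1) 0) := by
      rcases Nat.eq_zero_or_pos m with rfl | hm
      · have : dl (0 + 1) = sig (0 + 1) 0 := by simp [dl]
        rw [zt, this]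
        exact (Commute.refl _).pow_left _
      · rw [zt_succ, ← incl_sig hm]
        refine Commute.mul_left ?_ (incl_comm_push_T _).symm
        exact (ih _).map (incl m)
    have hd : Commute (zt (m + 1)) (dl (m + 1)) := (Commute.refl _).pow_left _
    have hi : ∀ i < m + 1, Commute (zt (m + 1)) (sig (m + 1) i) := by
      intro i
      induction i with
      | zero => exact fun _ => h0
      | succ i ihi =>
        intro hi
        have : sig (m + 1) (i + 1) = dl (m + 1) * sig (m + 1) i * (dl (m + 1))⁻¹ := by
          rw [← sig_dl hi, mul_inv_cancel_right]
        rw [this]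
        exact (hd.mul_right (ihi (by omega))).mul_right hd.inv_right
    have := mem_of_sig_mem (H := Subgroup.centralizer {zt (m + 1)}) (fun i h => by
      rw [Subgroup.mem_centralizer_singleton_iff]; exact (hi i h).symm.eq) b
    rw [Subgroup.mem_centralizer_singleton_iff] at this
    exact this.symm

theorem trunc_T {k l : ℕ} (h : k ≤ l) : trunc l (T k) = T k := by
  induction k with
  | zero => simp
  | succ k ih => rw [T_succ, map_mul, ih (by omega), trunc_of (by omega)]

theorem artin_zt_of {i : ℕ} (hi : i ≤ m) :
    artin m (zt m) (of i) = (T (m + 1))⁻¹ * of i * T (m + 1) := by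
  have h := (zt_comm (push m (of i))).eq
  have hT := artin_T (zt m) (Nat.lt_succ_self m)
  rw [zt_succ, (incl_comm_push_T (zt m)).eq, mul_assoc, incl_mul_push, ← mul_assoc, ← mul_assoc,
    mul_left_inj, ← map_mul, ← map_mul] at h
  have tr : trunc (m + 1) (of i) = of i := trunc_of (by omega)
  have := push_inj (m := m) ?_ ?_ h
  · rw [mul_assoc, ← this]; group
  · rw [map_mul, trunc_artin _ _ (Nat.lt_succ_self m), trunc_T le_rfl, tr]
  · rw [map_mul, trunc_T le_rfl, tr]

theorem artin_zt {w : Fr} (hw : trunc (m + 1) w = w) :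
    artin m (zt m) w = (T (m + 1))⁻¹ * w * T (m + 1) := by
  have : (artin m (zt m)).toMonoidHom.comp (trunc (m + 1)) =
      (MulAut.conj (T (m + 1))⁻¹).toMonoidHom.comp (trunc (m + 1)) := by
    ext1 k
    rcases Nat.lt_or_ge k (m + 1) with h | h
    · simp [trunc_of h, artin_zt_of (Nat.le_of_lt_succ h)]
    · simp [trunc_of_ge h]
  have := DFunLike.congr_fun this w
  simpa [hw] using this

theorem len_dl : len m (dl m) = Multiplicative.ofAdd (m : ℤ) := by
  induction m with
  | zero => simp [dl]
  | succ m ih =>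
    rw [dl_succ, map_mul, len_incl, ih, len_sig (by omega), ← ofAdd_add]; simp

theorem len_zt : len m (zt m) = Multiplicative.ofAdd ((m : ℤ) * (m + 1)) := by
  rw [zt, map_pow, len_dl, ← ofAdd_nsmul, nsmul_eq_mul]; push_cast; ring_nf

theorem perm_zt : perm m (zt m) = 1 := by
  induction m with
  | zero => simp [zt, dl]
  | succ m ih => rw [zt_succ, map_mul, perm_incl, perm_push, ih, mul_one]

/-- The exponent sum of a letter. -/
def ex (k : ℕ) : Fr →* Multiplicative ℤ :=
  FreeGroup.lift fun j => if j = k then Multiplicative.ofAdd 1 else 1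

theorem ex_of (k j : ℕ) : ex k (of j) = if j = k then Multiplicative.ofAdd 1 else 1 := by simp [ex]

theorem ex_of_self (k : ℕ) : ex k (of k) = Multiplicative.ofAdd 1 := by simp [ex]

theorem ex_of_ne {k j : ℕ} (h : j ≠ k) : ex k (of j) = 1 := by simp [ex, h]

theorem ex_T (k l : ℕ) : ex k (T l) = if k < l then Multiplicative.ofAdd 1 else 1 := by
  induction l with
  | zero => simp
  | succ l ih =>
    rw [T_succ, map_mul, ih, ex_of]
    rcases lt_trichotomy l k with h | rfl | h
    · rw [if_neg (by omega), if_neg (by omega), if_neg (by omega), one_mul]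
    · rw [if_pos rfl, if_neg (by omega), if_pos (by omega), mul_one]
    · rw [if_neg (by omega), if_pos (by omega), if_pos (by omega), one_mul]

theorem lk_braidA {k : ℕ} (hk : k ≤ m) (i j : ℕ) :
    lk (braidA m k) i j = if (i = k ∧ j = m + 1) ∨ (i = m + 1 ∧ j = k) then 2 else 0 := by
  have h1 : perm (m + 1) (tau m (k + 1)) (m + 1) = k + 1 := perm_tau_last (by omega)
  have h2 : perm (m + 1) (tau m (k + 1)) k = k := by
    have hk' : k + 1 ≤ m + 1 := by omega
    suffices ∀ l, k + 1 ≤ l → l ≤ m + 1 → perm (m + 1) (tau m l) k = k from this _ le_rfl hk'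
    intro l h1 hl
    induction hl using Nat.decreasingInduction with
    | self => simp
    | of_succ l hl ih =>
      rw [tau_eq (by omega), map_mul, Equiv.Perm.mul_apply, ih (by omega), perm_sig (by omega),
        Equiv.swap_apply_of_ne_of_ne (by omega) (by omega)]
  have h4 : perm (m + 1) (sig (m + 1) k ^ 2) = 1 := by
    rw [map_pow, perm_sig (by omega), pow_two, Equiv.swap_mul_self]
  have h5 : ∀ i j, lk (sig (m + 1) k ^ 2) i j =
      if (i = k ∧ j = k + 1) ∨ (i = k + 1 ∧ j = k) then 2 else 0 := by
    intro i j
    rw [pow_two, lk_mul, lk_sig (by omega), lk_sig (by omega), perm_sig (by omega)]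
    simp only [Equiv.swap_apply_def]
    grind
  have h6 := lk_conj (tau m (k + 1))⁻¹ _ h4 (perm _ (tau m (k + 1)) i) (perm _ (tau m (k + 1)) j)
  rw [inv_inv, h5, map_inv] at h6
  simp only [Equiv.Perm.inv_def, Equiv.symm_apply_apply] at h6
  rw [braidA, h6]
  have e1 : ∀ i, perm (m + 1) (tau m (k + 1)) i = k ↔ i = k := fun i =>
    ⟨fun h => (perm (m + 1) (tau m (k + 1))).injective (h.trans h2.symm), fun h => h ▸ h2⟩
  have e2 : ∀ i, perm (m + 1) (tau m (k + 1)) i = k + 1 ↔ i = m + 1 := fun i =>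
    ⟨fun h => (perm (m + 1) (tau m (k + 1))).injective (h.trans h1.symm), fun h => h ▸ h1⟩
  simp only [e1, e2]

theorem lk_push_last (w : Fr) {i : ℕ} (hi : i ≤ m) :
    lk (push m w) i (m + 1) = 2 * Multiplicative.toAdd (ex i w) := by
  induction w using FreeGroup.induction_on with
  | C1 => simp
  | of k =>
    rw [ex_of]
    rcases Nat.lt_or_ge m k with h | h
    · rw [push_of_gt h, if_neg (by omega)]; simp
    · rw [push_of h, lk_braidA h]
      split_ifs <;> first | omega | simp
  | inv_of k h => rw [map_inv, lk_inv, perm_push, map_inv]; simp [h]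
  | mul a b ha hb => rw [map_mul, lk_mul_of_pure _ _ (perm_push _), ha, hb, map_mul, toAdd_mul]; ring

theorem lk_push_of_le (w : Fr) {i j : ℕ} (hi : i ≤ m) (hj : j ≤ m) : lk (push m w) i j = 0 := by
  induction w using FreeGroup.induction_on with
  | C1 => simp
  | of k =>
    rcases Nat.lt_or_ge m k with h | h
    · rw [push_of_gt h]; simp
    · rw [push_of h, lk_braidA h, if_neg (by omega)]
  | inv_of k h => rw [map_inv, lk_inv, perm_push]; simp [h]
  | mul a b ha hb => rw [map_mul, lk_mul_of_pure _ _ (perm_push _), ha, hb, add_zero]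

theorem lk_zt {i j : ℕ} (hij : i < j) (hj : j ≤ m) : lk (zt m) i j = 2 := by
  induction m with
  | zero => omega
  | succ m ih =>
    rw [zt_succ, lk_mul_of_pure _ _ (perm_push _), lk_incl]
    rcases Nat.lt_or_ge m j with h | h
    · obtain rfl : j = m + 1 := by omega
      rw [lk_push_last _ (by omega), ex_T, if_pos (by omega), lk_eq_zero_of_lt (by omega)]
      simp
    · rw [lk_push_of_le _ (by omega) h, ih h, zero_add]

/-- The cyclic shift of the first `m + 1` letters. -/
def cyc (m : ℕ) : Fr →* Fr := FreeGroup.lift fun k => if k < m then of (k + 1) else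
  if k = m then of 0 else of k

theorem cyc_lt {m k : ℕ} (h : k < m) : cyc m (of k) = of (k + 1) := by simp [cyc, h]

theorem cyc_self (m : ℕ) : cyc m (of m) = of 0 := by simp [cyc]

theorem artin_dl_of {k : ℕ} (hk : k ≤ m) :
    artin m (dl m) (of k) = (of 0)⁻¹ * cyc m (of k) * of 0 := by
  induction m generalizing k with
  | zero =>
    obtain rfl : k = 0 := by omega
    rw [cyc_self]; simp [dl]
  | succ m ih =>
    rw [dl_succ, map_mul, MulAut.mul_apply, artin_incl, artin_sig_of (by omega)]
    rcases lt_trichotomy k m with h | rfl | h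
    · rw [if_neg (by omega), if_neg (by omega), ih h.le, cyc_lt h, cyc_lt (by omega)]
    · rw [if_pos rfl, map_mul, map_mul, map_inv,
        artin_of_gt (Nat.lt_succ_self k), ih le_rfl, cyc_self,
        cyc_lt (by omega)]
      group
    · obtain rfl : k = m + 1 := by omega
      rw [if_neg (by omega), if_pos rfl, ih le_rfl, cyc_self, cyc_self]

theorem artin_dl {w : Fr} (hw : trunc (m + 1) w = w) :
    artin m (dl m) w = (of 0)⁻¹ * cyc m w * of 0 := by
  have : (artin m (dl m)).toMonoidHom.comp (trunc (m + 1)) =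
      (MulAut.conj (of 0)⁻¹).toMonoidHom.comp ((cyc m).comp (trunc (m + 1))) := by
    ext1 k
    rcases Nat.lt_or_ge k (m + 1) with h | h
    · simp [trunc_of h, artin_dl_of (Nat.le_of_lt_succ h)]
    · simp [trunc_of_ge h]
  have := DFunLike.congr_fun this w
  simpa [hw] using this

end Br

namespace Br

open FreeGroup (of)

section Centralizer

theorem freeGroup_eq_one_of_commute {X : Type*} {x y : X} (hxy : x ≠ y) {v : FreeGroup X}
    (hx : Commute v (of x)) (hy : Commute v (of y)) : v = 1 := by
  classical
  rw [← FreeGroup.toWord_eq_nil_iff]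
  rcases hL : v.toWord with _ | ⟨⟨a, b⟩, L⟩
  · rfl
  exfalso
  obtain ⟨z, hz, hc⟩ : ∃ z, a ≠ z ∧ Commute v (of z) := by
    by_cases h : a = x
    · exact ⟨y, h ▸ hxy, hy⟩
    · exact ⟨x, h, hx⟩
  have h1 : (of z * v).toWord = (z, true) :: v.toWord := by
    rw [FreeGroup.toWord_mul, FreeGroup.toWord_of, List.singleton_append]
    apply FreeGroup.IsReduced.reduce_eq
    have := FreeGroup.isReduced_toWord (x := v)
    rw [hL] at this ⊢
    rw [FreeGroup.IsReduced, List.isChain_cons_cons]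
    exact ⟨fun h => absurd h.symm hz, this⟩
  have h2 : (v * of z).toWord.Sublist (v.toWord ++ [(z, true)]) := by
    simpa using FreeGroup.toWord_mul_sublist v (of z)
  rw [hc.eq, h1] at h2
  have h3 := h2.eq_of_length (by simp)
  rw [hL] at h3
  simp only [List.cons_append, List.cons.injEq, Prod.mk.injEq] at h3
  exact hz h3.1.1.symm

theorem exists_zpow_of_commute {X : Type*} {v : FreeGroup X} (hv : v ≠ 1) :
    ∃ r : FreeGroup X, ∀ u, Commute u v → ∃ k : ℤ, u = r ^ k := by
  set C := Subgroup.centralizer {v} with hC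
  have mem : ∀ u, u ∈ C ↔ Commute u v := by
    intro u
    rw [hC, Subgroup.mem_centralizer_singleton_iff]
    rfl
  let e := IsFreeGroup.toFreeGroup C
  have hsub : Subsingleton (IsFreeGroup.Generators C) := by
    refine ⟨fun x y => ?_⟩
    by_contra hxy
    have hvC : v ∈ C := (mem v).2 rfl
    have : ∀ z : FreeGroup (IsFreeGroup.Generators C), Commute (e ⟨v, hvC⟩) z := by
      intro z
      obtain ⟨u, rfl⟩ := e.surjective z
      have : Commute (⟨v, hvC⟩ : C) u := by
        apply Subtype.ext
        exact ((mem u.1).1 u.2).symm.eq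
      exact this.map e
    have := freeGroup_eq_one_of_commute hxy (this _) (this _)
    rw [map_eq_one_iff e e.injective] at this
    exact hv (congrArg Subtype.val this)
  rcases isEmpty_or_nonempty (IsFreeGroup.Generators C) with h | ⟨⟨g⟩⟩
  · refine ⟨1, fun u hu => ⟨0, ?_⟩⟩
    have h1 : e ⟨u, (mem u).2 hu⟩ = 1 := Subsingleton.elim _ _
    rw [map_eq_one_iff e e.injective] at h1
    simpa using congrArg Subtype.val h1
  · refine ⟨(e.symm (of g) : C), fun u hu => ?_⟩
    have key : ∀ w : FreeGroup (IsFreeGroup.Generators C), ∃ k : ℤ, w = of g ^ k := by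
      intro w
      induction w using FreeGroup.induction_on with
      | C1 => exact ⟨0, by simp⟩
      | of x => exact ⟨1, by rw [zpow_one, Subsingleton.elim g x]⟩
      | inv_of x _ => exact ⟨-1, by rw [zpow_neg, zpow_one, Subsingleton.elim g x]⟩
      | mul x y hx hy =>
        obtain ⟨k, rfl⟩ := hx
        obtain ⟨l, rfl⟩ := hy
        exact ⟨k + l, by rw [zpow_add]⟩
    obtain ⟨k, hk⟩ := key (e ⟨u, (mem u).2 hu⟩)
    refine ⟨k, ?_⟩
    have := congrArg e.symm hk
    rw [MulEquiv.symm_apply_apply, map_zpow] at this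
    simpa using congrArg Subtype.val this

/-- An element of a free group with a primitive homological coordinate generates the centralizers
of its powers. -/
theorem eq_zpow_of_commute {X : Type*} {v : FreeGroup X} (f : FreeGroup X →* Multiplicative ℤ)
    (hf : f v = Multiplicative.ofAdd 1) {k : ℤ} (hk : k ≠ 0) {u : FreeGroup X}
    (hu : Commute u (v ^ k)) : ∃ l : ℤ, u = v ^ l := by
  have hv : v ^ k ≠ 1 := by
    intro h
    have := congrArg f h
    rw [map_zpow f, hf, map_one f] at this
    have := congrArg Multiplicative.toAdd this
    simp at this
    exact hk this
  obtain ⟨r, hr⟩ := exists_zpow_of_commute hv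
  obtain ⟨b, hb⟩ := hr v ((Commute.refl v).zpow_right k)
  obtain ⟨l, hl⟩ := hr u hu
  have h1 : b * (f r).toAdd = 1 := by
    have := congrArg Multiplicative.toAdd hf
    rw [hb, map_zpow, toAdd_zpow, toAdd_ofAdd, smul_eq_mul] at this
    exact this
  have h2 : b * b = 1 := by
    rcases Int.isUnit_iff.1 (IsUnit.of_mul_eq_one _ h1) with h | h <;> simp [h]
  refine ⟨b * l, ?_⟩
  rw [hl, zpow_mul, hb, ← zpow_mul r b b, h2, zpow_one]

theorem eq_zpow_T_of_commute {n : ℕ} (hn : 0 < n) {k : ℤ} (hk : k ≠ 0) {u : Fr}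
    (hu : Commute u (T n ^ k)) : ∃ l : ℤ, u = T n ^ l :=
  eq_zpow_of_commute (ex 0) (by rw [ex_T, if_pos hn]) hk hu

theorem T_ne_one {n : ℕ} (hn : 0 < n) : T n ≠ 1 := by
  intro h
  have := ex_T 0 n
  rw [h, if_pos hn, map_one] at this
  exact absurd this (by decide)

end Centralizer

section PingPong

open Monoid

theorem freeGroup_lift_injective {ι : Type*} [Nontrivial ι] {α : Type*}
    (a : ι → Equiv.Perm α) (X : ι → Set α) (hne : ∀ i, (X i).Nonempty)
    (hdisj : ∀ i j, i ≠ j → Disjoint (X i) (X j))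
    (hpp : ∀ i j, i ≠ j → ∀ k : ℤ, k ≠ 0 → ∀ p ∈ X j, (a i ^ k) p ∈ X i) :
    Function.Injective (FreeGroup.lift a) := by
  have h0 : FreeGroup.lift a =
      (CoprodI.lift fun i => FreeGroup.lift fun _ => a i).comp
        (@freeGroupEquivCoprodI ι).toMonoidHom := by
    ext i
    simp
  rw [h0, MonoidHom.coe_comp]
  refine Function.Injective.comp ?_ (MulEquiv.injective freeGroupEquivCoprodI)
  let H : ι → Type := fun _ => FreeGroup Unit
  let f : ∀ i, H i →* Equiv.Perm α := fun i => FreeGroup.lift fun _ => a i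
  have key : ∀ w : FreeGroup Unit, ∃ k : ℤ, w = of () ^ k := fun w =>
    ⟨FreeGroup.freeGroupUnitEquivInt w, (FreeGroup.freeGroupUnitEquivInt.symm_apply_apply w).symm⟩
  refine CoprodI.lift_injective_of_ping_pong f ?_ X hne (fun i j h => hdisj i j h) ?_
  · right
    obtain ⟨i⟩ : Nonempty ι := inferInstance
    refine ⟨i, ?_⟩
    have : Infinite (H i) := by change Infinite (FreeGroup Unit); infer_instance
    exact (Cardinal.natCast_lt_aleph0 (n := 3)).le.trans (Cardinal.aleph0_le_mk _)
  · intro i j hij h hh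
    obtain ⟨k, rfl⟩ := key h
    have hk : k ≠ 0 := by
      rintro rfl
      exact hh (zpow_zero _)
    rintro _ ⟨p, hp, rfl⟩
    have := hpp i j hij k hk p hp
    have e : f i (of () ^ k) = a i ^ k := by
      rw [map_zpow (f i)]
      exact congrArg (· ^ k) FreeGroup.lift_apply_of
    change (f i (of () ^ k)) p ∈ _
    rw [e]
    exact this

end PingPong

end Br

namespace Br

open FreeGroup (of)

section Unipotent

variable {A R : Type*} [CommRing R] [Ring A] [Algebra R A]

/-- The one-parameter group `t ↦ 1 + tN` of a square-zero element `N`. -/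
def unip (N : A) (hN : N * N = 0) : Multiplicative R →* Aˣ :=
  MonoidHom.toHomUnits
    { toFun := fun t => 1 + t.toAdd • N
      map_one' := by simp
      map_mul' := fun s t => by
        simp only [toAdd_mul, mul_add, add_mul, smul_mul_smul_comm, hN, smul_zero, add_smul, one_mul,
          mul_one]
        abel }

theorem unip_val (N : A) (hN : N * N = 0) (t : R) :
    ((unip N hN (Multiplicative.ofAdd t) : Aˣ) : A) = 1 + t • N := rfl

theorem unip_zpow_val (N : A) (hN : N * N = 0) (t : R) (k : ℤ) :
    ((unip N hN (Multiplicative.ofAdd t) ^ k : Aˣ) : A) = 1 + (k • t) • N := by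
  rw [← map_zpow, ← ofAdd_zsmul, unip_val]

/-- The action of invertible `2 × 2` matrices on the plane. -/
def glAct (R : Type*) [CommRing R] : (Matrix (Fin 2) (Fin 2) R)ˣ →* Equiv.Perm (Fin 2 → R) :=
  MonoidHom.toHomPerm
    { toFun := fun M v => M.1.mulVec v
      map_one' := by
        funext v
        exact Matrix.one_mulVec v
      map_mul' := fun M N => by
        funext v
        exact (Matrix.mulVec_mulVec v M.1 N.1).symm }

theorem glAct_apply (M : (Matrix (Fin 2) (Fin 2) R)ˣ) (v : Fin 2 → R) :
    glAct R M v = M.1.mulVec v := rfl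

end Unipotent

section Magnus

/-- The nilpotent matrix with kernel and image the line of slope `i`. -/
def nilp (R : Type*) [CommRing R] (i : ℕ) : Matrix (Fin 2) (Fin 2) R :=
  !![-(i : R), 1; -(i : R) ^ 2, i]

theorem nilp_sq (R : Type*) [CommRing R] (i : ℕ) : nilp R i * nilp R i = 0 := by
  ext a b
  fin_cases a <;> fin_cases b <;> simp [nilp, Matrix.mul_apply, Fin.sum_univ_two] <;> ring

/-- A linear representation of the free group by unipotent matrices. -/
def magnus {R : Type*} [CommRing R] (t : R) : Fr →* (Matrix (Fin 2) (Fin 2) R)ˣ :=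
  FreeGroup.lift fun i => unip (nilp R i) (nilp_sq R i) (Multiplicative.ofAdd t)

theorem magnus_injective : Function.Injective (magnus (5 : ℚ)) := by
  have h := freeGroup_lift_injective
    (fun i : ℕ => glAct ℚ (unip (nilp ℚ i) (nilp_sq ℚ i) (Multiplicative.ofAdd (5 : ℚ))))
    (fun i => {v | 2 * |v 1 - i * v 0| < |v 0|}) ?_ ?_ ?_
  · have e : FreeGroup.lift (fun i : ℕ => glAct ℚ
        (unip (nilp ℚ i) (nilp_sq ℚ i) (Multiplicative.ofAdd (5 : ℚ)))) = (glAct ℚ).comp (magnus 5) := by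
      ext i : 1
      simp [magnus]
    rw [e] at h
    rw [MonoidHom.coe_comp] at h
    exact h.of_comp
  · intro i
    exact ⟨![1, i], by simp⟩
  · intro i j hij
    rw [Set.disjoint_left]
    rintro v hv hw
    simp only [Set.mem_ofPred_eq] at hv hw
    have h1 : |(i : ℚ) - j| * |v 0| ≤ |v 1 - j * v 0| + |v 1 - i * v 0| := by
      rw [← abs_mul]
      calc _ = |(v 1 - j * v 0) - (v 1 - i * v 0)| := by congr 1; ring
        _ ≤ _ := abs_sub _ _
    have h2 : (1 : ℚ) ≤ |(i : ℚ) - j| := by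
      have : (1 : ℤ) ≤ |(i : ℤ) - j| := Int.one_le_abs (by omega)
      exact_mod_cast this
    nlinarith [abs_nonneg (v 0)]
  · intro i j hij k hk v hv
    simp only [Set.mem_ofPred_eq] at hv ⊢
    rw [← map_zpow, glAct_apply, unip_zpow_val]
    set L := v 1 - i * v 0 with hL
    have e0 : (1 + (k • (5 : ℚ)) • nilp ℚ i).mulVec v 0 = v 0 + 5 * k * L := by
      simp [nilp, Matrix.mulVec, dotProduct,
        Fin.sum_univ_two, hL]
      ring
    have e1 : (1 + (k • (5 : ℚ)) • nilp ℚ i).mulVec v 1 = v 1 + 5 * k * i * L := by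
      simp [nilp, Matrix.mulVec, dotProduct,
        Fin.sum_univ_two, hL]
      ring
    rw [e0, e1]
    have e2 : v 1 + 5 * k * i * L - i * (v 0 + 5 * k * L) = L := by rw [hL]; ring
    rw [e2]
    have h1 : |(i : ℚ) - j| * |v 0| ≤ |v 1 - j * v 0| + |L| := by
      rw [← abs_mul]
      calc _ = |(v 1 - j * v 0) - L| := by congr 1; rw [hL]; ring
        _ ≤ _ := abs_sub _ _
    have h2 : (1 : ℚ) ≤ |(i : ℚ) - j| := by
      have : (1 : ℤ) ≤ |(i : ℤ) - j| := Int.one_le_abs (by omega)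
      exact_mod_cast this
    have h3 : (1 : ℚ) ≤ |(k : ℚ)| := by
      have : (1 : ℤ) ≤ |k| := Int.one_le_abs hk
      exact_mod_cast this
    have h4 : |v 0| < 2 * |L| := by nlinarith [abs_nonneg (v 0)]
    have h5 : 5 * |(k : ℚ)| * |L| ≤ |v 0 + 5 * k * L| + |v 0| := by
      calc 5 * |(k : ℚ)| * |L| = |5 * k * L| := by rw [abs_mul, abs_mul]; norm_num
        _ = |(v 0 + 5 * k * L) - v 0| := by congr 1; ring
        _ ≤ _ := abs_sub _ _
    nlinarith [abs_nonneg (v 0), abs_nonneg L]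

end Magnus

section Dimension

open Polynomial

/-- The group-like element of the rational group algebra. -/
noncomputable abbrev gl (w : Fr) : MonoidAlgebra ℚ Fr := MonoidAlgebra.of ℚ Fr w

/-- The augmentation ideal of the rational group algebra of the free group. -/
noncomputable def aug : Submodule ℚ (MonoidAlgebra ℚ Fr) := Submodule.span ℚ (Set.range fun w => gl w - 1)

theorem sub_one_mem_aug (w : Fr) : gl w - 1 ∈ aug := Submodule.subset_span ⟨w, rfl⟩

theorem aug_mul_gl {x : MonoidAlgebra ℚ Fr} (hx : x ∈ aug) (v : Fr) : x * gl v ∈ aug := by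
  induction hx using Submodule.span_induction with
  | mem x h =>
    obtain ⟨w, rfl⟩ := h
    have : (gl w - 1) * gl v = (gl (w * v) - 1) - (gl v - 1) := by
      rw [sub_mul, one_mul, gl, gl, ← map_mul]; abel
    change (gl w - 1) * gl v ∈ _
    rw [this]
    exact sub_mem (sub_one_mem_aug _) (sub_one_mem_aug _)
  | zero => simp
  | add x y _ _ h1 h2 => rw [add_mul]; exact add_mem h1 h2
  | smul a x _ h => rw [smul_mul_assoc]; exact Submodule.smul_mem _ _ h

theorem gl_mul_aug {x : MonoidAlgebra ℚ Fr} (hx : x ∈ aug) (v : Fr) : gl v * x ∈ aug := by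
  induction hx using Submodule.span_induction with
  | mem x h =>
    obtain ⟨w, rfl⟩ := h
    have : gl v * (gl w - 1) = (gl (v * w) - 1) - (gl v - 1) := by
      rw [mul_sub, mul_one, gl, gl, ← map_mul]; abel
    change gl v * (gl w - 1) ∈ _
    rw [this]
    exact sub_mem (sub_one_mem_aug _) (sub_one_mem_aug _)
  | zero => simp
  | add x y _ _ h1 h2 => rw [mul_add]; exact add_mem h1 h2
  | smul a x _ h => rw [mul_smul_comm]; exact Submodule.smul_mem _ _ h

theorem aug_pow_mul_gl {l : ℕ} {x : MonoidAlgebra ℚ Fr} (hx : x ∈ aug ^ (l + 1)) (v : Fr) :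
    x * gl v ∈ aug ^ (l + 1) := by
  rw [pow_succ] at hx ⊢
  refine Submodule.mul_induction_on hx (fun a ha b hb => ?_) (fun a b h1 h2 => ?_)
  · rw [mul_assoc]
    exact Submodule.mul_mem_mul ha (aug_mul_gl hb v)
  · rw [add_mul]; exact add_mem h1 h2

theorem gl_mul_aug_pow {l : ℕ} {x : MonoidAlgebra ℚ Fr} (hx : x ∈ aug ^ (l + 1)) (v : Fr) :
    gl v * x ∈ aug ^ (l + 1) := by
  rw [pow_succ'] at hx ⊢
  refine Submodule.mul_induction_on hx (fun a ha b hb => ?_) (fun a b h1 h2 => ?_)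
  · rw [← mul_assoc]
    exact Submodule.mul_mem_mul (gl_mul_aug ha v) hb
  · rw [mul_add]; exact add_mem h1 h2

theorem aug_pow_succ_le {l : ℕ} {x : MonoidAlgebra ℚ Fr} (hx : x ∈ aug ^ (l + 2)) :
    x ∈ aug ^ (l + 1) := by
  rw [pow_succ] at hx
  refine Submodule.mul_induction_on hx (fun a ha b hb => ?_) (fun a b h1 h2 => ?_)
  · induction hb using Submodule.span_induction with
    | mem x h =>
      obtain ⟨w, rfl⟩ := h
      change a * (gl w - 1) ∈ _
      rw [mul_sub, mul_one]
      exact sub_mem (aug_pow_mul_gl ha w) ha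
    | zero => simp
    | add x y _ _ h1 h2 => rw [mul_add]; exact add_mem h1 h2
    | smul c x _ h => rw [mul_smul_comm]; exact Submodule.smul_mem _ _ h
  · exact add_mem h1 h2

/-- The dimension filtration of the free group. -/
def dim (l : ℕ) (w : Fr) : Prop := gl w - 1 ∈ aug ^ (l + 1)

theorem dim_zero (w : Fr) : dim 0 w := by
  rw [dim, zero_add, pow_one]; exact sub_one_mem_aug w

theorem dim_root {l N : ℕ} (hN : N ≠ 0) {w : Fr} (h : dim l (w ^ N)) : dim l w := by
  induction l with
  | zero => exact dim_zero w
  | succ l ih =>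
    have hw := ih (aug_pow_succ_le h)
    have key : ∀ n : ℕ, gl (w ^ n) - 1 - (n : ℚ) • (gl w - 1) ∈ aug ^ (l + 2) := by
      intro n
      induction n with
      | zero => simp [MonoidAlgebra.one_def]
      | succ n hn =>
        have e : gl (w ^ (n + 1)) - 1 - ((n + 1 : ℕ) : ℚ) • (gl w - 1) =
            (gl (w ^ n) - 1 - (n : ℚ) • (gl w - 1)) + (gl (w ^ n) - 1) * (gl w - 1) := by
          have : gl (w ^ (n + 1)) = gl (w ^ n) * gl w := by rw [gl, gl, gl, ← map_mul, pow_succ]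
          rw [this, Nat.cast_succ, add_smul, one_smul]
          noncomm_ring
        rw [e]
        refine add_mem hn ?_
        rw [pow_succ' aug (l + 1)]
        exact Submodule.mul_mem_mul (sub_one_mem_aug _) hw
    have h1 := sub_mem h (key N)
    rw [sub_sub_cancel] at h1
    have h2 := Submodule.smul_mem _ ((N : ℚ)⁻¹) h1
    rwa [smul_smul, inv_mul_cancel₀ (by exact_mod_cast hN), one_smul] at h2

theorem dim_inv {l : ℕ} {w : Fr} (h : dim l w) : dim l w⁻¹ := by
  have e : gl w⁻¹ - 1 = -(gl w⁻¹ * (gl w - 1)) := by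
    rw [mul_sub, gl, gl, ← map_mul, inv_mul_cancel, map_one]; simp
  rw [dim, e]
  exact neg_mem (gl_mul_aug_pow h _)

theorem dim_zroot {l : ℕ} {N : ℤ} (hN : N ≠ 0) {w : Fr} (h : dim l (w ^ N)) : dim l w := by
  obtain ⟨n, rfl | rfl⟩ := N.eq_nat_or_neg
  · rw [zpow_natCast] at h
    exact dim_root (by simpa using hN) h
  · rw [zpow_neg, zpow_natCast] at h
    have := dim_inv h
    rw [inv_inv] at this
    exact dim_root (by simpa using hN) this

/-- The extension of the representation `magnus` to the group algebra. -/
noncomputable def magnusAlg : MonoidAlgebra ℚ Fr →ₐ[ℚ] Matrix (Fin 2) (Fin 2) ℚ[X] :=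
  MonoidAlgebra.lift ℚ (Matrix (Fin 2) (Fin 2) ℚ[X]) Fr ((Units.coeHom _).comp (magnus X))

theorem magnusAlg_gl (w : Fr) : magnusAlg (gl w) = (magnus (X : ℚ[X]) w).1 := by
  simp [magnusAlg, gl]

theorem dvd_magnusAlg_gl (w : Fr) : ∃ M : Matrix (Fin 2) (Fin 2) ℚ[X], magnusAlg (gl w) = 1 + (X : ℚ[X]) • M := by
  induction w using FreeGroup.induction_on with
  | C1 => exact ⟨0, by rw [magnusAlg_gl]; simp⟩
  | of k => exact ⟨nilp _ k, by rw [magnusAlg_gl]; simp [magnus, unip_val]⟩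
  | inv_of k _ =>
    refine ⟨-nilp _ k, ?_⟩
    rw [magnusAlg_gl, ← zpow_neg_one, map_zpow, magnus, FreeGroup.lift_apply_of, unip_zpow_val]
    simp
  | mul u v hu hv =>
    obtain ⟨M, hM⟩ := hu
    obtain ⟨N, hN⟩ := hv
    refine ⟨M + N + (X : ℚ[X]) • (M * N), ?_⟩
    rw [gl, map_mul, map_mul, hM, hN]
    simp only [mul_add, add_mul, one_mul, mul_one, smul_add, smul_mul_assoc, mul_smul_comm]
    abel

theorem dvd_magnusAlg {l : ℕ} {x : MonoidAlgebra ℚ Fr} (hx : x ∈ aug ^ l) :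
    ∃ M, magnusAlg x = (X ^ l : ℚ[X]) • M := by
  induction l generalizing x with
  | zero => exact ⟨magnusAlg x, by simp⟩
  | succ l ih =>
    rw [pow_succ] at hx
    refine Submodule.mul_induction_on hx (fun a ha b hb => ?_) (fun a b h1 h2 => ?_)
    · obtain ⟨M, hM⟩ := ih ha
      have : ∃ N, magnusAlg b = (X : ℚ[X]) • N := by
        clear ha hM
        induction hb using Submodule.span_induction with
        | mem x h =>
          obtain ⟨w, rfl⟩ := h
          obtain ⟨N, hN⟩ := dvd_magnusAlg_gl w
          refine ⟨N, ?_⟩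
          change magnusAlg (gl w - 1) = _
          rw [map_sub, hN, map_one, add_sub_cancel_left]
        | zero => exact ⟨0, by simp⟩
        | add x y _ _ h1 h2 =>
          obtain ⟨N1, h1⟩ := h1
          obtain ⟨N2, h2⟩ := h2
          exact ⟨N1 + N2, by rw [map_add, h1, h2, smul_add]⟩
        | smul c x _ h =>
          obtain ⟨N, h⟩ := h
          exact ⟨c • N, by rw [map_smul, h, smul_comm]⟩
      obtain ⟨N, hN⟩ := this
      exact ⟨M * N, by rw [map_mul, hM, hN, smul_mul_smul_comm, pow_succ]⟩
    · obtain ⟨N1, h1⟩ := h1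
      obtain ⟨N2, h2⟩ := h2
      exact ⟨N1 + N2, by rw [map_add, h1, h2, smul_add]⟩

theorem eq_one_of_dim {w : Fr} (h : ∀ l, dim l w) : w = 1 := by
  have h0 : (magnus (X : ℚ[X]) w).1 = 1 := by
    rw [← sub_eq_zero]
    ext1 a b
    by_contra hne
    set p := ((magnus (X : ℚ[X]) w).1 - 1) a b with hp
    have hd : ∀ l, X ^ (l + 1) ∣ p := by
      intro l
      obtain ⟨M, hM⟩ := dvd_magnusAlg (h l)
      rw [map_sub, magnusAlg_gl, map_one] at hM
      exact ⟨M a b, by rw [hp, hM]; rfl⟩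
    have := Polynomial.natDegree_le_of_dvd (hd p.natDegree) hne
    rw [natDegree_X_pow] at this
    omega
  have e : (Units.map (RingHom.mapMatrix (evalRingHom (5 : ℚ))).toMonoidHom).comp
      (magnus (X : ℚ[X])) = magnus (5 : ℚ) := by
    ext i a b
    fin_cases a <;> fin_cases b <;> simp [magnus, unip_val, nilp]
  apply magnus_injective
  rw [map_one, ← e, MonoidHom.comp_apply, Units.ext (v := 1) h0, map_one]

/-- Endomorphisms acting trivially on the abelianisation, in terms of the augmentation ideal. -/
def IsIA (φ : Fr →* Fr) : Prop := ∀ w, gl (φ w) - gl w ∈ aug ^ 2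

theorem isIA_of {φ : Fr →* Fr} (h : ∀ k, gl (φ (of k)) - gl (of k) ∈ aug ^ 2) : IsIA φ := by
  intro w
  induction w using FreeGroup.induction_on with
  | C1 => simp
  | of k => exact h k
  | inv_of k _ =>
    have e : gl (φ (of k)⁻¹) - gl (of k)⁻¹ =
        -(gl (φ (of k))⁻¹ * (gl (φ (of k)) - gl (of k)) * gl (of k)⁻¹) := by
      have h1 : gl (φ (of k))⁻¹ * gl (φ (of k)) = 1 := by
        rw [gl, gl, ← map_mul, inv_mul_cancel, map_one]
      have h2 : gl (of k) * gl (of k)⁻¹ = 1 := by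
        rw [gl, gl, ← map_mul, mul_inv_cancel, map_one]
      rw [mul_sub, sub_mul, h1, mul_assoc, h2, map_inv]
      simp
    change gl (φ (of k)⁻¹) - gl (of k)⁻¹ ∈ _
    rw [e]
    exact neg_mem (aug_pow_mul_gl (gl_mul_aug_pow (h k) _) _)
  | mul u v hu hv =>
    have e : gl (φ (u * v)) - gl (u * v) =
        (gl (φ u) - gl u) * gl (φ v) + gl u * (gl (φ v) - gl v) := by
      simp only [gl, map_mul]
      noncomm_ring
    rw [e]
    exact add_mem (aug_pow_mul_gl hu _) (gl_mul_aug_pow hv _)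

theorem IsIA.dim_succ {φ : Fr →* Fr} (h : IsIA φ) {l : ℕ} {w : Fr} (hw : dim l w) :
    dim (l + 1) (w⁻¹ * φ w) := by
  let Φ : MonoidAlgebra ℚ Fr →ₐ[ℚ] MonoidAlgebra ℚ Fr := MonoidAlgebra.mapDomainAlgHom ℚ ℚ φ
  have hΦ : ∀ w, Φ (gl w) = gl (φ w) := fun w => by simp [Φ, gl]
  have h1 : ∀ x ∈ aug, Φ x ∈ aug ∧ Φ x - x ∈ aug ^ 2 := by
    intro x hx
    induction hx using Submodule.span_induction with
    | mem x h' =>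
      obtain ⟨w, rfl⟩ := h'
      change Φ (gl w - 1) ∈ _ ∧ Φ (gl w - 1) - (gl w - 1) ∈ _
      rw [map_sub, hΦ, map_one, sub_sub_sub_cancel_right]
      exact ⟨sub_one_mem_aug _, h w⟩
    | zero => simp
    | add x y _ _ h1 h2 =>
      rw [map_add, add_sub_add_comm]
      exact ⟨add_mem h1.1 h2.1, add_mem h1.2 h2.2⟩
    | smul c x _ h =>
      rw [map_smul, ← smul_sub]
      exact ⟨Submodule.smul_mem _ _ h.1, Submodule.smul_mem _ _ h.2⟩
  have h2 : ∀ l, ∀ x ∈ aug ^ (l + 1), Φ x ∈ aug ^ (l + 1) ∧ Φ x - x ∈ aug ^ (l + 2) := by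
    intro l
    induction l with
    | zero =>
      intro x hx
      rw [zero_add, pow_one] at hx ⊢
      exact h1 x hx
    | succ l ih =>
      intro x hx
      rw [pow_succ] at hx
      refine Submodule.mul_induction_on hx (fun a ha b hb => ?_) (fun a b h1 h2 => ?_)
      · obtain ⟨a1, a2⟩ := ih a ha
        obtain ⟨b1, b2⟩ := h1 b hb
        rw [map_mul]
        refine ⟨by rw [pow_succ]; exact Submodule.mul_mem_mul a1 b1, ?_⟩
        have e : Φ a * Φ b - a * b = (Φ a - a) * Φ b + a * (Φ b - b) := by noncomm_ring
        rw [e]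
        refine add_mem ?_ ?_
        · rw [pow_succ]; exact Submodule.mul_mem_mul a2 b1
        · rw [show l + 1 + 2 = (l + 1) + 2 from rfl, pow_add]; exact Submodule.mul_mem_mul ha b2
      · rw [map_add, add_sub_add_comm]
        exact ⟨add_mem h1.1 h2.1, add_mem h1.2 h2.2⟩
  have h3 := (h2 l _ hw).2
  rw [map_sub, hΦ, map_one, sub_sub_sub_cancel_right] at h3
  have e : gl (w⁻¹ * φ w) - 1 = gl w⁻¹ * (gl (φ w) - gl w) := by
    rw [mul_sub, gl, gl, gl, gl, ← map_mul, ← map_mul, inv_mul_cancel, map_one]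
  rw [dim, e]
  exact gl_mul_aug_pow h3 _

theorem eq_one_of_isIA {φ ψ : Fr →* Fr} (hφ : IsIA φ) (hψ : IsIA ψ) {p q : Fr} {N M : ℤ}
    (hN : N ≠ 0) (hM : M ≠ 0) (h1 : φ q = q * p ^ N) (h2 : ψ p = p * q ^ M) : p = 1 ∧ q = 1 := by
  have key : ∀ l, dim l p ∧ dim l q := by
    intro l
    induction l with
    | zero => exact ⟨dim_zero p, dim_zero q⟩
    | succ l ih =>
      have a := hφ.dim_succ ih.2
      have b := hψ.dim_succ ih.1
      rw [h1, inv_mul_cancel_left] at a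
      rw [h2, inv_mul_cancel_left] at b
      exact ⟨dim_zroot hN a, dim_zroot hM b⟩
  exact ⟨eq_one_of_dim fun l => (key l).1, eq_one_of_dim fun l => (key l).2⟩

end Dimension

end Br

namespace Br

open FreeGroup (of)

variable {m : ℕ}

section PureIA

theorem map_aug_sq (φ : Fr →* Fr) {x : MonoidAlgebra ℚ Fr} (hx : x ∈ aug ^ 2) :
    MonoidAlgebra.mapDomainAlgHom ℚ ℚ φ x ∈ aug ^ 2 := by
  have h1 : ∀ x ∈ aug, MonoidAlgebra.mapDomainAlgHom ℚ ℚ φ x ∈ aug := by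
    intro x hx
    induction hx using Submodule.span_induction with
    | mem x h' =>
      obtain ⟨w, rfl⟩ := h'
      have : MonoidAlgebra.mapDomainAlgHom ℚ ℚ φ (gl w - 1) = gl (φ w) - 1 := by
        rw [map_sub, map_one]; simp [gl]
      change MonoidAlgebra.mapDomainAlgHom ℚ ℚ φ (gl w - 1) ∈ _
      rw [this]
      exact sub_one_mem_aug _
    | zero => rw [map_zero]; exact zero_mem _
    | add x y _ _ h1 h2 => rw [map_add]; exact add_mem h1 h2
    | smul c x _ h => rw [map_smul]; exact Submodule.smul_mem _ _ h
  rw [pow_two] at hx ⊢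
  refine Submodule.mul_induction_on hx (fun a ha b hb => ?_) (fun a b h1 h2 => ?_)
  · rw [map_mul]; exact Submodule.mul_mem_mul (h1 a ha) (h1 b hb)
  · rw [map_add]; exact add_mem h1 h2

theorem gl_conj_sub (u x : Fr) : gl (u * x * u⁻¹) - gl x ∈ aug ^ 2 := by
  have h1 : gl u * gl u⁻¹ = 1 := by rw [gl, gl, ← map_mul, mul_inv_cancel, map_one]
  have e : gl (u * x * u⁻¹) - gl x =
      ((gl u - 1) * (gl x - 1) - (gl x - 1) * (gl u - 1)) * gl u⁻¹ := by
    have : (gl u - 1) * (gl x - 1) - (gl x - 1) * (gl u - 1) = gl u * gl x - gl x * gl u := by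
      noncomm_ring
    rw [this, sub_mul, mul_assoc (gl x), h1, mul_one]
    simp only [gl, map_mul]
  rw [e]
  refine aug_pow_mul_gl (sub_mem ?_ ?_) _ <;>
  · rw [pow_two]
    exact Submodule.mul_mem_mul (sub_one_mem_aug _) (sub_one_mem_aug _)

theorem gl_artin (b : Br m) : ∀ k, gl (artin m b (of k)) - gl (of (perm m b k)) ∈ aug ^ 2 := by
  have hmap : ∀ (φ : Fr →* Fr) (w : Fr), MonoidAlgebra.mapDomainAlgHom ℚ ℚ φ (gl w) = gl (φ w) :=
    fun φ w => by simp [gl]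
  induction b using Br.induction with
  | one => intro k; simp
  | gen i hi =>
    intro k
    rw [artin_sig_of hi, perm_sig hi]
    split_ifs with h1 h2
    · rw [h1, Equiv.swap_apply_left]
      simpa using gl_conj_sub (of i)⁻¹ (of (i + 1))
    · rw [h2, Equiv.swap_apply_right, sub_self]; exact zero_mem _
    · rw [Equiv.swap_apply_of_ne_of_ne h1 h2, sub_self]; exact zero_mem _
  | mul a b ha hb =>
    intro k
    have h1 := map_aug_sq (artin m a).toMonoidHom (hb k)
    rw [map_sub, hmap, hmap] at h1
    have h2 := add_mem h1 (ha (perm m b k))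
    rw [map_mul, map_mul, MulAut.mul_apply, Equiv.Perm.mul_apply]
    simpa using h2
  | inv a ha =>
    intro k
    obtain ⟨j, rfl⟩ := (perm m a).surjective k
    have h1 := map_aug_sq (artin m a⁻¹).toMonoidHom (ha j)
    rw [map_sub, hmap, hmap] at h1
    have h2 := neg_mem h1
    rw [neg_sub] at h2
    have e1 : (perm m a⁻¹) (perm m a j) = j := by rw [map_inv]; simp
    have e2 : (artin m a⁻¹).toMonoidHom (artin m a (of j)) = of j := by
      rw [map_inv]; exact MulAut.inv_apply_self _ _ _
    rw [e1]
    rw [e2] at h2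
    exact h2

theorem isIA_conj_artin {b : Br m} (hb : perm m b = 1) (w : Fr) :
    IsIA ((MulAut.conj w).toMonoidHom.comp (artin m b).toMonoidHom) := by
  apply isIA_of
  intro k
  have h := gl_artin b k
  rw [hb] at h
  have := add_mem (gl_conj_sub w (artin m b (of k))) h
  simpa using this

end PureIA

theorem eq_one_of_zero (b : Br 0) : b = 1 := by
  induction b using Br.induction with
  | one => rfl
  | gen i hi => omega
  | mul a b ha hb => rw [ha, hb, one_mul]
  | inv a ha => rw [ha, inv_one]

theorem truncG_eq_of_J {x y : Gm m} (h : J m x = J m y) : truncG m x = truncG m y := by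
  rw [← cos_J, ← cos_J, h]

theorem perm_J_eq (x : Gm m) : perm (m + 1) (J m x) = perm m x.right := by
  rw [J_apply, map_mul, perm_push, one_mul, perm_incl]

theorem exists_J {h : Br (m + 1)} (hh : perm (m + 1) h (m + 1) = m + 1) :
    ∃ x : Gm m, truncG m x = x ∧ J m x = h := by
  obtain ⟨w, b, hw, rfl⟩ := exists_decomp hh
  exact ⟨⟨w, b⟩, by rw [truncG_apply]; simp [hw], rfl⟩

theorem exists_J_pure {h : Br (m + 1)} (hh : perm (m + 1) h = 1) :
    ∃ x : Gm m, truncG m x = x ∧ J m x = h ∧ perm m x.right = 1 := by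
  obtain ⟨x, h1, h2⟩ := exists_J (h := h) (by rw [hh]; rfl)
  exact ⟨x, h1, h2, by rw [← perm_J_eq, h2, hh]⟩

theorem eq_one_of_pure_relations {A B p q : Br m} (hA : perm m A = 1) (hB : perm m B = 1)
    (hp : perm m p = 1) (hq : perm m q = 1) {N M : ℤ} (hN : N ≠ 0) (hM : M ≠ 0)
    (h1 : A * q * A⁻¹ = q * p ^ N) (h2 : B * p * B⁻¹ = p * q ^ M) : p = 1 ∧ q = 1 := by
  induction m with
  | zero => exact ⟨eq_one_of_zero p, eq_one_of_zero q⟩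
  | succ m ih =>
    obtain ⟨A, tA, rfl, pA⟩ := exists_J_pure hA
    obtain ⟨B, tB, rfl, pB⟩ := exists_J_pure hB
    obtain ⟨p, tp, rfl, pp⟩ := exists_J_pure hp
    obtain ⟨q, tq, rfl, pq⟩ := exists_J_pure hq
    have e1 : A * q * A⁻¹ = q * p ^ N := by
      have := truncG_eq_of_J (x := A * q * A⁻¹) (y := q * p ^ N)
        (by simp only [map_mul, map_inv, map_zpow]; exact h1)
      simpa only [map_mul, map_inv, map_zpow, tA, tp, tq] using this
    have e2 : B * p * B⁻¹ = p * q ^ M := by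
      have := truncG_eq_of_J (x := B * p * B⁻¹) (y := p * q ^ M)
        (by simp only [map_mul, map_inv, map_zpow]; exact h2)
      simpa only [map_mul, map_inv, map_zpow, tB, tp, tq] using this
    have r1 := congrArg (SemidirectProduct.rightHom (φ := artin m)) e1
    have r2 := congrArg (SemidirectProduct.rightHom (φ := artin m)) e2
    simp only [map_mul, map_inv, map_zpow] at r1 r2
    obtain ⟨p1, q1⟩ := ih pA pB pp pq r1 r2
    have ep : p = SemidirectProduct.inl p.left := by
      ext <;> simp [p1]
    have eq : q = SemidirectProduct.inl q.left := by
      ext <;> simp [q1]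
    have act : ∀ (x : Gm m) (w : Fr), x * SemidirectProduct.inl w * x⁻¹ =
        SemidirectProduct.inl (((MulAut.conj x.left).toMonoidHom.comp
          (artin m x.right).toMonoidHom) w) := by
      intro x w
      ext
      · simp
      · simp
    rw [eq, ep, act, ← map_zpow, ← map_mul] at e1
    rw [eq, ep, act, ← map_zpow, ← map_mul] at e2
    obtain ⟨hp1, hq1⟩ := eq_one_of_isIA (isIA_conj_artin pA A.left) (isIA_conj_artin pB B.left) hN hM
      (SemidirectProduct.inl_injective e1) (SemidirectProduct.inl_injective e2)
    rw [ep, eq, hp1, hq1]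
    simp

theorem zt_zero : zt 0 = 1 := eq_one_of_zero _

theorem zt_succ_zpow (k : ℤ) :
    zt (m + 1) ^ k = push m (T (m + 1) ^ k) * incl m (zt m ^ k) := by
  rw [zt_succ, (incl_comm_push_T (zt m)).eq, (incl_comm_push_T (zt m)).symm.mul_zpow, map_zpow,
    map_zpow]

theorem artin_zt_zpow (k : ℤ) {w : Fr} (hw : trunc (m + 1) w = w) :
    artin m (zt m ^ k) w = T (m + 1) ^ (-k) * w * T (m + 1) ^ k := by
  have hT : ∀ j : ℤ, trunc (m + 1) (T (m + 1) ^ j) = T (m + 1) ^ j := fun j => by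
    rw [map_zpow, trunc_T le_rfl]
  have hz : ∀ j : ℤ, artin m (zt m) (T (m + 1) ^ j) = T (m + 1) ^ j := fun j => by
    rw [map_zpow, artin_T _ (by omega)]
  have step : ∀ j : ℤ, artin m (zt m ^ j) w = T (m + 1) ^ (-j) * w * T (m + 1) ^ j →
      artin m (zt m ^ (j + 1)) w = T (m + 1) ^ (-(j + 1)) * w * T (m + 1) ^ (j + 1) := by
    intro j hj
    rw [add_comm, zpow_add, zpow_one, map_mul, MulAut.mul_apply, hj, map_mul, map_mul, hz, hz,
      artin_zt hw]
    group
  induction k with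
  | zero => simp
  | succ k ih => exact step _ ih
  | pred k ih =>
    have h1 : zt m ^ (-(k : ℤ) - 1) = (zt m)⁻¹ * zt m ^ (-(k : ℤ)) := by
      rw [← zpow_neg_one, ← zpow_add]; congr 1; ring
    rw [h1, map_mul, MulAut.mul_apply, ih, map_inv, MulAut.inv_apply]
    rw [MulEquiv.symm_apply_eq]
    rw [map_mul, map_mul, hz, hz, artin_zt hw]
    group

theorem trunc_one_eq {w : Fr} (hw : trunc 1 w = w) : ∃ k : ℤ, w = of 0 ^ k := by
  rw [← hw]
  clear hw
  induction w using FreeGroup.induction_on with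
  | C1 => exact ⟨0, by simp⟩
  | of k =>
    change ∃ j : ℤ, trunc 1 (of k) = _
    rcases Nat.lt_or_ge k 1 with h | h
    · obtain rfl : k = 0 := by omega
      exact ⟨1, by rw [trunc_of h, zpow_one]⟩
    · exact ⟨0, by rw [trunc_of_ge h, zpow_zero]⟩
  | inv_of k ih =>
    obtain ⟨j, hj⟩ := ih
    exact ⟨-j, by rw [map_inv, hj, zpow_neg]⟩
  | mul u v hu hv =>
    obtain ⟨i, hi⟩ := hu
    obtain ⟨j, hj⟩ := hv
    exact ⟨i + j, by rw [map_mul, hi, hj, zpow_add]⟩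

/-- A pure braid commuting with all pure braids is a power of the full twist. -/
theorem eq_zt_zpow_of_commute_pure {b : Br m} (hb : perm m b = 1)
    (hc : ∀ p, perm m p = 1 → Commute b p) : ∃ k : ℤ, b = zt m ^ k := by
  induction m with
  | zero => exact ⟨0, eq_one_of_zero _⟩
  | succ m ih =>
    obtain ⟨x, tx, rfl, px⟩ := exists_J_pure hb
    have tw : trunc (m + 1) x.left = x.left := by
      have := congrArg SemidirectProduct.left tx
      rw [truncG_apply] at this
      exact this
    rcases Nat.eq_zero_or_pos m with rfl | hm
    · obtain ⟨j, hj⟩ := trunc_one_eq tw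
      refine ⟨j, ?_⟩
      rw [zt_succ_zpow, J_apply, hj, eq_one_of_zero x.right, zt_zero, one_zpow, T_succ, T_zero,
        mul_one]
    obtain ⟨k, hk⟩ := ih px (fun p hp => by
      have h := hc (incl m p) (by rw [perm_incl, hp])
      have h1 := truncG_eq_of_J (x := x * SemidirectProduct.inr p)
        (y := SemidirectProduct.inr p * x) (by rw [map_mul, map_mul, J_inr]; exact h.eq)
      have h2 := congrArg (SemidirectProduct.rightHom (φ := artin m)) h1
      simpa [truncG_apply, commute_iff_eq] using h2)
    refine ⟨k, ?_⟩
    rw [zt_succ_zpow, J_apply, hk]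
    congr 1
    have key : ∀ j ≤ m, Commute (x.left * (T (m + 1) ^ (-k))) (of j) := by
      intro j hj
      have tj : trunc (m + 1) (of j) = of j := trunc_of (by omega)
      have h := hc (push m (of j)) (perm_push _)
      have h1 := truncG_eq_of_J (x := x * SemidirectProduct.inl (of j))
        (y := SemidirectProduct.inl (of j) * x) (by rw [map_mul, map_mul, J_inl]; exact h.eq)
      have h2 := congrArg SemidirectProduct.left h1
      rw [truncG_apply, truncG_apply] at h2
      simp only [SemidirectProduct.mul_left, SemidirectProduct.left_inl,
        SemidirectProduct.right_inl, map_one, MulAut.one_apply, map_mul, tw, tj, hk,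
        artin_zt_zpow k tj] at h2
      have h3 : trunc (m + 1) (T (m + 1)) = T (m + 1) := trunc_T le_rfl
      rw [map_zpow, map_zpow, h3] at h2
      have h4 : x.left * T (m + 1) ^ (-k) * of j = of j * x.left * T (m + 1) ^ (-k) := by
        rw [← h2]; group
      rw [Commute, SemiconjBy, h4, mul_assoc]
    have := freeGroup_eq_one_of_commute (by decide) (key 0 (by omega)) (key 1 (by omega))
    rw [zpow_neg, mul_inv_eq_one] at this
    rw [this]

end Br

namespace Br

open FreeGroup (of)
open Monoid

section Words

/-- Syllables of words in the free product of two groups. -/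
abbrev Syl (G : Type) := Σ _ : Bool, G

variable {G : Type} [Group G]

/-- The product of a list of syllables in the free product `G * G`. -/
def lp (L : List (Syl G)) : CoprodI (fun _ : Bool => G) :=
  (L.map fun s => CoprodI.of (M := fun _ : Bool => G) (i := s.1) s.2).prod

/-- Reduced lists of syllables. -/
def IsRed (L : List (Syl G)) : Prop :=
  (∀ s ∈ L, s.2 ≠ 1) ∧ (L.map Sigma.fst).IsChain (· ≠ ·)

/-- Inverse list of syllables. -/
def invL (L : List (Syl G)) : List (Syl G) := (L.map fun s => (⟨s.1, s.2⁻¹⟩ : Syl G)).reverse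

theorem lp_append (L M : List (Syl G)) : lp (L ++ M) = lp L * lp M := by simp [lp]

theorem lp_cons (s : Syl G) (M : List (Syl G)) : lp (s :: M) = lp [s] * lp M := by simp [lp]

theorem lp_nil : lp ([] : List (Syl G)) = 1 := by simp [lp]

theorem lp_invL (L : List (Syl G)) : lp (invL L) = (lp L)⁻¹ := by
  induction L with
  | nil => simp [lp, invL]
  | cons s L ih =>
    have : invL (s :: L) = invL L ++ [⟨s.1, s.2⁻¹⟩] := by simp [invL]
    rw [this, lp_append, ih, lp_cons s L, mul_inv_rev]
    simp [lp]

theorem lp_inj {L M : List (Syl G)} (hL : IsRed L) (hM : IsRed M) (h : lp L = lp M) : L = M := by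
  classical
  let w : CoprodI.Word (fun _ : Bool => G) := ⟨L, hL.1, (List.isChain_map _).1 hL.2⟩
  let w' : CoprodI.Word (fun _ : Bool => G) := ⟨M, hM.1, (List.isChain_map _).1 hM.2⟩
  have : w.prod = w'.prod := h
  have := CoprodI.Word.equiv.symm.injective this
  exact congrArg CoprodI.Word.toList this

theorem exists_isRed (c : CoprodI (fun _ : Bool => G)) : ∃ L, IsRed L ∧ lp L = c := by
  classical
  refine ⟨(CoprodI.Word.equiv c).toList, ⟨(CoprodI.Word.equiv c).ne_one,
    (List.isChain_map _).2 (CoprodI.Word.equiv c).chain_ne⟩, ?_⟩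
  exact CoprodI.Word.equiv.symm_apply_apply c

theorem lp_pair {s t : Syl G} (h : s.1 = t.1) : lp [s] * lp [t] = lp [⟨s.1, s.2 * t.2⟩] := by
  obtain ⟨i, x⟩ := s
  obtain ⟨j, y⟩ := t
  obtain rfl : i = j := h
  simp [lp]

theorem lp_one (i : Bool) : lp [(⟨i, 1⟩ : Syl G)] = 1 := by simp [lp]

theorem fst_invL (L : List (Syl G)) : (invL L).map Sigma.fst = (L.map Sigma.fst).reverse := by
  simp [invL]

theorem IsRed.cons_iff {s : Syl G} {L : List (Syl G)} : IsRed (s :: L) ↔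
    s.2 ≠ 1 ∧ IsRed L ∧ (s.1 :: L.map Sigma.fst).IsChain (· ≠ ·) := by
  simp only [IsRed, List.mem_cons, forall_eq_or_imp, List.map_cons]
  constructor
  · rintro ⟨⟨h1, h2⟩, h3⟩
    exact ⟨h1, ⟨h2, h3.tail⟩, h3⟩
  · rintro ⟨h1, ⟨h2, _⟩, h3⟩
    exact ⟨⟨h1, h2⟩, h3⟩

theorem IsRed.left {L M : List (Syl G)} (h : IsRed (L ++ M)) : IsRed L :=
  ⟨fun s hs => h.1 s (by simp [hs]), by
    have := h.2
    rw [List.map_append] at this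
    exact this.left_of_append⟩

theorem chain_sandwich {a b : List Bool} {i j : Bool} (ha : (a ++ [i]).IsChain (· ≠ ·))
    (hb : (i :: (b ++ [j])).IsChain (· ≠ ·)) (hij : j ≠ i) :
    (a ++ i :: (b ++ j :: i :: a.reverse)).IsChain (· ≠ ·) := by
  rw [List.isChain_split]
  refine ⟨ha, ?_⟩
  have : i :: (b ++ j :: i :: a.reverse) = (i :: b) ++ j :: i :: a.reverse := rfl
  rw [this, List.isChain_split]
  refine ⟨hb, ?_⟩
  rw [List.isChain_cons_cons]
  refine ⟨hij, ?_⟩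
  have e : i :: a.reverse = (a ++ [i]).reverse := by simp
  rw [e, List.isChain_reverse]
  exact ha.imp fun _ _ h => h.symm

/-- Cyclically reduced lists with at least two syllables. -/
def IsCyc (L : List (Syl G)) : Prop :=
  IsRed L ∧ ∃ x M z, L = x :: (M ++ [z]) ∧ x.1 ≠ z.1

theorem IsCyc.not_palin {L : List (Syl G)} (h : IsCyc L) {a b : List Bool} {i j : Bool}
    (e : L.map Sigma.fst = a ++ i :: (b ++ j :: i :: a.reverse)) : False := by
  obtain ⟨_, x, M, z, rfl, hxz⟩ := h
  have h1 := congrArg List.head? e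
  have h2 := congrArg List.getLast? e
  rcases a with _ | ⟨c, a⟩
  · simp only [List.map_cons, List.nil_append, List.head?_cons, Option.some.injEq] at h1
    apply hxz
    have h3 := congrArg List.getLast? e
    simp [List.getLast?_append, List.getLast?_cons] at h3
    exact h1.trans h3.symm
  · simp [List.getLast?_append, List.getLast?_cons] at h1 h2
    exact hxz (h1.trans h2.symm)

theorem IsCyc.rotate_left {x : Syl G} {M : List (Syl G)} (h : IsCyc (x :: M)) :
    IsCyc (M ++ [x]) := by
  obtain ⟨hr, x', M', z, e, hxz⟩ := h
  obtain ⟨rfl, rfl⟩ := List.cons.inj e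
  have hr' := IsRed.cons_iff.1 hr
  have hch := hr.2
  refine ⟨⟨fun s hs => hr.1 s (by simp at hs ⊢; tauto), ?_⟩, ?_⟩
  · have h1 := hr'.2.1.2
    simp only [List.map_append, List.map_cons, List.map_nil, List.append_assoc,
      List.cons_append, List.nil_append] at h1 ⊢
    rw [List.isChain_split]
    exact ⟨h1, by simp [hxz.symm]⟩
  · rcases M' with _ | ⟨y, M'⟩
    · exact ⟨z, [], x, rfl, hxz.symm⟩
    · refine ⟨y, M' ++ [z], x, by simp, ?_⟩
      simp only [List.map_cons, List.cons_append, List.isChain_cons_cons] at hch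
      exact hch.1.symm

theorem IsCyc.rotate_right {z : Syl G} {M : List (Syl G)} (h : IsCyc (M ++ [z])) :
    IsCyc (z :: M) := by
  obtain ⟨hr, x, M', z', e, hxz⟩ := h
  have hch := hr.2
  have e' : M ++ [z] = (x :: M') ++ [z'] := e
  obtain ⟨rfl, e2⟩ := List.append_inj' e' rfl
  obtain rfl : z = z' := by simpa using e2
  refine ⟨⟨fun s hs => hr.1 s (by simp at hs ⊢; tauto), ?_⟩, ?_⟩
  · have h1 := hr.left.2
    simp only [List.map_cons, List.isChain_cons_cons] at h1 ⊢
    exact ⟨hxz.symm, h1⟩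
  · rcases List.eq_nil_or_concat M' with rfl | ⟨M', y, rfl⟩
    · exact ⟨z, [], x, rfl, hxz.symm⟩
    · simp only [List.concat_eq_append] at *
      refine ⟨z, x :: M', y, by simp, ?_⟩
      simp only [List.map_append, List.map_cons, List.map_nil, List.cons_append,
        List.append_assoc, List.nil_append] at hch
      have : x.1 :: (List.map Sigma.fst M' ++ [y.1, z.1]) =
        (x.1 :: List.map Sigma.fst M') ++ y.1 :: [z.1] := rfl
      rw [this, List.isChain_split] at hch
      have := hch.2
      simp at this
      exact fun h => this h.symm

/-- Conjugate cyclically reduced words are rotations of each other. -/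
theorem isRotated_of_conj {L' : List (Syl G)} (hL' : IsCyc L') (g : List (Syl G)) :
    ∀ L : List (Syl G), IsRed g → IsCyc L → lp g * lp L * (lp g)⁻¹ = lp L' → L.IsRotated L' := by
  induction g using List.reverseRecOn with
  | nil =>
    intro L _ hL h
    rw [lp_nil, one_mul, inv_one, mul_one] at h
    rw [lp_inj hL.1 hL'.1 h]
  | append_singleton g s ih =>
    intro L hg hL h
    have hLc := hL
    obtain ⟨hLr, x, M, z, rfl, hxz⟩ := hL
    have hgc := hg.2
    have hs : s.2 ≠ 1 := hg.1 s (by simp)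
    simp only [List.map_append, List.map_cons, List.map_nil] at hgc
    have hLc' := hLr.2
    simp only [List.map_append, List.map_cons, List.map_nil] at hLc'
    by_cases hsx : s.1 = x.1
    · by_cases h1 : s.2 * x.2 = 1
      · have hsx1 : lp [s] = (lp [x])⁻¹ := by
          rw [eq_inv_iff_mul_eq_one, lp_pair hsx, h1, lp_one]
        have := ih _ hg.left hLc.rotate_left (by
          rw [← h, lp_append g, hsx1, lp_cons x (M ++ [z]), lp_append (M ++ [z])]
          group)
        refine List.IsRotated.trans ?_ this
        exact ⟨1, by simp⟩
      · exfalso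
        have hred : IsRed (g ++ ⟨s.1, s.2 * x.2⟩ :: (M ++ z :: ⟨s.1, s.2⁻¹⟩ :: invL g)) := by
          refine ⟨?_, ?_⟩
          · intro t ht
            simp only [List.mem_append, List.mem_cons, invL, List.mem_reverse, List.mem_map] at ht
            rcases ht with ht | rfl | ht | rfl | rfl | ⟨t, ht, rfl⟩
            · exact hg.1 t (by simp [ht])
            · exact h1
            · exact hLr.1 t (by simp [ht])
            · exact hLr.1 _ (by simp)
            · exact inv_ne_one.2 hs
            · exact inv_ne_one.2 (hg.1 t (by simp [ht]))
          · simp only [List.map_append, List.map_cons, fst_invL]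
            exact chain_sandwich hgc (by rw [hsx]; exact hLc') (by rw [hsx]; exact hxz.symm)
        have e := lp_inj hred hL'.1 (by
          rw [← h, lp_append g, lp_append g, lp_cons, lp_append M, lp_cons z, lp_cons ⟨s.1, s.2⁻¹⟩,
            lp_invL, lp_cons x, lp_append M, ← lp_pair hsx]
          have : lp [(⟨s.1, s.2⁻¹⟩ : Syl G)] = (lp [s])⁻¹ := by rw [← lp_invL]; rfl
          rw [this]
          group)
        refine hL'.not_palin (a := g.map Sigma.fst) (b := M.map Sigma.fst) (i := s.1) (j := z.1) ?_
        rw [← e]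
        simp [fst_invL]
    · have hsz : z.1 = s.1 := by
        revert hsx hxz
        cases s.1 <;> cases x.1 <;> cases z.1 <;> simp
      by_cases h1 : z.2 * s.2⁻¹ = 1
      · have hsx1 : lp [s] = lp [z] := by
          have : z.2 = s.2 := by rwa [mul_inv_eq_one] at h1
          obtain ⟨i, a⟩ := s
          obtain ⟨j, b⟩ := z
          simp only at hsz this
          subst hsz this
          rfl
        have := ih _ hg.left (IsCyc.rotate_right (M := x :: M) hLc) (by
          rw [← h, lp_append g, hsx1, lp_cons z, lp_cons x (M ++ [z]), lp_append M, lp_cons x M]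
          group)
        refine List.IsRotated.trans ?_ this
        refine List.IsRotated.symm ⟨1, by simp⟩
      · exfalso
        have hred : IsRed (g ++ s :: ([] ++ x :: (M ++ ⟨s.1, z.2 * s.2⁻¹⟩ :: invL g))) := by
          refine ⟨?_, ?_⟩
          · intro t ht
            simp only [List.mem_append, List.mem_cons, invL, List.mem_reverse, List.mem_map,
              List.not_mem_nil, false_or] at ht
            rcases ht with ht | rfl | rfl | ht | rfl | ⟨t, ht, rfl⟩
            · exact hg.1 t (by simp [ht])
            · exact hs
            · exact hLr.1 _ (by simp)
            · exact hLr.1 t (by simp [ht])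
            · exact h1
            · exact inv_ne_one.2 (hg.1 t (by simp [ht]))
          · simp only [List.map_append, List.map_cons, fst_invL, List.nil_append]
            rw [List.isChain_split]
            refine ⟨hgc, ?_⟩
            rw [List.isChain_cons_cons]
            refine ⟨hsx, ?_⟩
            have : x.1 :: (M.map Sigma.fst ++ s.1 :: (g.map Sigma.fst).reverse) =
              (x.1 :: M.map Sigma.fst) ++ s.1 :: (g.map Sigma.fst).reverse := rfl
            rw [this, List.isChain_split]
            refine ⟨by rw [← hsz]; exact hLc', ?_⟩
            have e : s.1 :: (g.map Sigma.fst).reverse = (g.map Sigma.fst ++ [s.1]).reverse := by simp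
            rw [e, List.isChain_reverse]
            exact hgc.imp fun _ _ h => h.symm
        have e := lp_inj hred hL'.1 (by
          have : lp [(⟨s.1, z.2 * s.2⁻¹⟩ : Syl G)] = lp [z] * (lp [s])⁻¹ := by
            have h2 : lp [(⟨s.1, s.2⁻¹⟩ : Syl G)] = (lp [s])⁻¹ := by rw [← lp_invL]; rfl
            rw [← h2, lp_pair (by exact hsz), hsz]
          rw [← h, lp_append g, lp_append g, lp_cons s (_ ++ _), List.nil_append, lp_cons x (M ++ _ :: _), lp_append M (_ :: _),
            lp_cons ⟨s.1, z.2 * s.2⁻¹⟩ (invL g), lp_invL, lp_cons x (M ++ [z]), lp_append M [z], this]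
          group)
        have h2 := congrArg (List.map Sigma.fst) e
        simp only [List.map_append, List.map_cons, fst_invL, List.nil_append] at h2
        obtain ⟨_, x', M', z', rfl, hxz'⟩ := hL'
        have h3 := congrArg List.head? h2
        have h4 := congrArg List.getLast? h2
        apply hxz'
        rcases g with _ | ⟨c, g⟩
        · simp [List.getLast?_append, List.getLast?_cons] at h3 h4
          exact h3.symm.trans h4
        · simp [List.getLast?_append, List.getLast?_cons] at h3 h4
          exact h3.symm.trans h4

theorem exists_conj_isCyc (L : List (Syl G)) (hL : IsRed L) :
    ∃ L' c, lp L' = c * lp L * c⁻¹ ∧ (L' = [] ∨ (∃ s, L' = [s]) ∨ IsCyc L') := by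
  induction h : L.length using Nat.strong_induction_on generalizing L with
  | _ n ih =>
    rcases L with _ | ⟨x, L⟩
    · exact ⟨[], 1, by simp, Or.inl rfl⟩
    rcases List.eq_nil_or_concat L with rfl | ⟨M, z, rfl⟩
    · exact ⟨[x], 1, by simp, Or.inr (Or.inl ⟨x, rfl⟩)⟩
    rw [List.concat_eq_append] at *
    by_cases hxz : x.1 = z.1
    · have hM := (IsRed.cons_iff.1 hL).2.1
      by_cases h1 : z.2 * x.2 = 1
      · obtain ⟨L', c, e, hL'⟩ := ih M.length (by simp at h; omega) M hM.left rfl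
        refine ⟨L', c * (lp [x])⁻¹, ?_, hL'⟩
        have hz : lp [z] = (lp [x])⁻¹ := by
          rw [eq_inv_iff_mul_eq_one, lp_pair hxz.symm, h1, lp_one]
        rw [e, lp_cons x (M ++ [z]), lp_append M [z], hz]
        group
      · obtain ⟨L', c, e, hL'⟩ := ih (M.length + 1) (by simp at h; omega)
          (M ++ [⟨z.1, z.2 * x.2⟩]) (by
            refine ⟨?_, ?_⟩
            · intro s hs
              simp only [List.mem_append, List.mem_singleton] at hs
              rcases hs with hs | rfl
              · exact hM.1 s (by simp [hs])
              · exact h1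
            · have := hM.2
              simpa using this) (by simp)
        refine ⟨L', c * (lp [x])⁻¹, ?_, hL'⟩
        rw [e, lp_cons x (M ++ [z]), lp_append, lp_append, ← lp_pair hxz.symm]
        group
    · exact ⟨_, 1, by simp, Or.inr (Or.inr ⟨hL, x, M, z, rfl, hxz⟩)⟩

end Words

end Br

namespace Br

open FreeGroup (of)
open Monoid

variable {m : ℕ}

/-- The free group as a free product, separating the generators of index `≤ m` from the others. -/
def split (m : ℕ) : Fr →* CoprodI (fun _ : Bool => Fr) :=
  FreeGroup.lift fun k =>
    CoprodI.of (M := fun _ : Bool => Fr) (i := decide (k ≤ m)) (of k)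

/-- Kills the generators of index `≤ m` and those of index `> m + 1`. -/
def kill (m : ℕ) : Fr →* Fr := FreeGroup.lift fun k => if k = m + 1 then of k else 1

/-- Recombines the two factors, keeping the generators of index `≤ m + 1`. -/
def unsplit (m : ℕ) : CoprodI (fun _ : Bool => Fr) →* Fr :=
  CoprodI.lift fun b => if b then trunc (m + 1) else kill m

theorem unsplit_true (g : Fr) : unsplit m (lp [⟨true, g⟩]) = trunc (m + 1) g := by
  simp [unsplit, lp]

theorem unsplit_false (g : Fr) : unsplit m (lp [⟨false, g⟩]) = kill m g := by
  simp [unsplit, lp]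

theorem unsplit_split (w : Fr) : unsplit m (split m w) = trunc (m + 2) w := by
  have : (unsplit m).comp (split m) = trunc (m + 2) := by
    ext1 k
    rcases Nat.lt_trichotomy k (m + 1) with h | h | h
    · have h' : k ≤ m := by omega
      simp [split, unsplit, h', trunc_of h, trunc_of (show k < m + 2 by omega)]
    · have h' : ¬ k ≤ m := by omega
      simp [split, unsplit, kill, h, trunc_of (show m + 1 < m + 2 by omega)]
    · have h' : ¬ k ≤ m := by omega
      simp [split, unsplit, h', kill, h.ne', trunc_of_ge (show m + 2 ≤ k by omega)]
  exact DFunLike.congr_fun this w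

theorem kill_mem (g : Fr) : kill m g ∈ Subgroup.zpowers (of (m + 1)) := by
  induction g using FreeGroup.induction_on with
  | C1 => rw [map_one]; exact one_mem _
  | of k =>
    by_cases h : k = m + 1 <;> simp [kill, h]
  | inv_of k h => rw [map_inv]; exact inv_mem h
  | mul a b ha hb => rw [map_mul]; exact mul_mem ha hb

/-- The automorphism of syllables induced by the full twist. -/
def twS (m : ℕ) (s : Syl Fr) : Syl Fr :=
  ⟨s.1, if s.1 then (T (m + 1))⁻¹ * s.2 * T (m + 1) else s.2⟩

/-- The endomorphism of the free product induced by the full twist. -/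
def tw (m : ℕ) : CoprodI (fun _ : Bool => Fr) →* CoprodI (fun _ : Bool => Fr) :=
  CoprodI.lift fun b => (CoprodI.of (M := fun _ : Bool => Fr) (i := b)).comp
    (if b then (MulAut.conj (T (m + 1))⁻¹).toMonoidHom else MonoidHom.id _)

theorem tw_lp (L : List (Syl Fr)) : tw m (lp L) = lp (L.map (twS m)) := by
  induction L with
  | nil => simp [lp]
  | cons s L ih =>
    rw [lp_cons s L, map_mul, ih, List.map_cons, lp_cons (twS m s) (L.map _)]
    congr 1
    obtain ⟨b, g⟩ := s
    cases b <;> simp [lp, tw, twS]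

theorem tw_split (w : Fr) : tw m (split m w) = split m (artin m (zt m) w) := by
  have hT : ∀ k ≤ m + 1, split m (T k) = CoprodI.of (M := fun _ : Bool => Fr) (i := true) (T k) := by
    intro k hk
    induction k with
    | zero => simp
    | succ k ih =>
      rw [T_succ, map_mul, ih (by omega), map_mul]
      have : k ≤ m := by omega
      simp [split, this]
  have : (tw m).comp (split m) = (split m).comp (artin m (zt m)).toMonoidHom := by
    ext1 k
    by_cases h : k ≤ m
    · have h1 : split m (of k) = CoprodI.of (M := fun _ : Bool => Fr) (i := true) (of k) := by
        simp [split, h]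
      change tw m (split m (of k)) = split m (artin m (zt m) (of k))
      rw [artin_zt_of h, map_mul, map_mul, map_inv, hT _ le_rfl, h1]
      simp [tw]
    · have h1 : split m (of k) = CoprodI.of (M := fun _ : Bool => Fr) (i := false) (of k) := by
        simp [split, h]
      change tw m (split m (of k)) = split m (artin m (zt m) (of k))
      rw [artin_of_gt (by omega), h1]
      simp [tw]
  exact DFunLike.congr_fun this w

theorem IsRed.map_twS {L : List (Syl Fr)} (h : IsRed L) : IsRed (L.map (twS m)) := by
  refine ⟨?_, ?_⟩
  · intro s hs
    obtain ⟨⟨b, g⟩, ht, rfl⟩ := List.mem_map.1 hs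
    have := h.1 _ ht
    cases b
    · simpa [twS] using this
    · intro h1
      apply this
      have h1 : (T (m + 1))⁻¹ * g * T (m + 1) = 1 := by simpa [twS] using h1
      change g = 1
      rw [mul_assoc, inv_mul_eq_one] at h1
      exact (mul_eq_right.1 h1.symm)
  · have := h.2
    rw [List.map_map]
    exact this

theorem IsCyc.map_twS {L : List (Syl Fr)} (h : IsCyc L) : IsCyc (L.map (twS m)) := by
  obtain ⟨hr, x, M, z, rfl, hxz⟩ := h
  exact ⟨hr.map_twS, twS m x, M.map (twS m), twS m z, by simp, hxz⟩

theorem twS_iterate (n : ℕ) (s : Syl Fr) : (twS m)^[n] s =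
    ⟨s.1, if s.1 then (T (m + 1) ^ n)⁻¹ * s.2 * T (m + 1) ^ n else s.2⟩ := by
  induction n with
  | zero => obtain ⟨b, g⟩ := s; cases b <;> simp
  | succ n ih =>
    rw [Function.iterate_succ_apply', ih]
    obtain ⟨b, g⟩ := s
    cases b
    · simp [twS]
    · simp [twS, pow_succ, mul_assoc]

theorem unsplit_lp_mem {n : ℕ} (hn : n ≠ 0) (L : List (Syl Fr))
    (h : ∀ s ∈ L, (twS m)^[n] s = s) :
    unsplit m (lp L) ∈ Subgroup.closure {T (m + 1), of (m + 1)} := by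
  induction L with
  | nil => rw [lp_nil, map_one]; exact one_mem _
  | cons s L ih =>
    rw [lp_cons s L, map_mul]
    refine mul_mem ?_ (ih fun t ht => h t (by simp [ht]))
    have hs := h s (by simp)
    rw [twS_iterate] at hs
    obtain ⟨b, g⟩ := s
    cases b
    · rw [unsplit_false]
      refine (Subgroup.zpowers_le (H := Subgroup.closure {T (m + 1), of (m + 1)})).2 ?_ (kill_mem g)
      exact Subgroup.subset_closure (by simp)
    · have hs : (T (m + 1) ^ n)⁻¹ * g * T (m + 1) ^ n = g := by simpa using hs
      obtain ⟨l, rfl⟩ := eq_zpow_T_of_commute (n := m + 1) (by omega) (k := n) (by exact_mod_cast hn)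
        (u := g) (by
          rw [zpow_natCast]
          rw [mul_assoc, inv_mul_eq_iff_eq_mul] at hs
          exact hs)
      rw [unsplit_true, map_zpow, trunc_T le_rfl]
      exact zpow_mem (Subgroup.subset_closure (by simp)) _

/-- Elements fixed by the full twist of a subgroup of strands. -/
theorem mem_closure_of_artin_zt_eq {u : Fr} (hu : trunc (m + 2) u = u)
    (h : artin m (zt m) u = u) : u ∈ Subgroup.closure {T (m + 1), of (m + 1)} := by
  obtain ⟨L, hL, e⟩ := exists_isRed (split m u)
  have h1 : L.map (twS m) = L := lp_inj hL.map_twS hL (by rw [← tw_lp, e, tw_split, h])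
  have := unsplit_lp_mem (m := m) one_ne_zero L fun s hs => by
    rw [Function.iterate_one]
    obtain ⟨i, hi, rfl⟩ := List.getElem_of_mem hs
    conv_rhs => rw [← List.getElem_of_eq h1 (by simpa using hi)]
    simp
  rwa [e, unsplit_split, hu] at this

/-- Conjugacy classes fixed by the full twist of a subgroup of strands. -/
theorem exists_conj_of_artin_zt {u g : Fr} (hu : trunc (m + 2) u = u)
    (h : artin m (zt m) u = g * u * g⁻¹) :
    ∃ h : Fr, trunc (m + 2) h = h ∧ (h * u * h⁻¹ ∈ Subgroup.closure {T (m + 1), of (m + 1)} ∨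
      trunc (m + 1) (h * u * h⁻¹) = h * u * h⁻¹) := by
  obtain ⟨L, hL, e⟩ := exists_isRed (split m u)
  obtain ⟨L', c, e', hc⟩ := exists_conj_isCyc L hL
  rw [e] at e'
  have e2 : unsplit m (lp L') = unsplit m c * u * (unsplit m c)⁻¹ := by
    rw [e', map_mul, map_mul, unsplit_split, hu, map_inv]
  have htr : ∀ c, trunc (m + 2) (unsplit m c) = unsplit m c := by
    intro c
    have : (trunc (m + 2)).comp (unsplit m) = unsplit m := by
      ext b : 1
      ext1 k
      cases b
      · by_cases hk : k = m + 1
        · simp [unsplit, kill, hk, trunc_of (show m + 1 < m + 2 by omega)]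
        · simp [unsplit, kill, hk]
      · simp [unsplit, trunc_trunc_of_ge (show m + 1 ≤ m + 2 by omega)]
    exact DFunLike.congr_fun this c
  refine ⟨unsplit m c, htr c, ?_⟩
  rw [← e2]
  rcases hc with rfl | ⟨⟨b, x⟩, rfl⟩ | hc
  · right
    rw [lp_nil, map_one, map_one]
  · cases b
    · left
      rw [unsplit_false]
      refine (Subgroup.zpowers_le (H := Subgroup.closure {T (m + 1), of (m + 1)})).2 ?_ (kill_mem x)
      exact Subgroup.subset_closure (by simp)
    · right
      rw [unsplit_true, trunc_trunc_of_le le_rfl]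
  · left
    have hlp : tw m (lp L') = tw m c * split m g * c⁻¹ * lp L' * (tw m c * split m g * c⁻¹)⁻¹ := by
      rw [e', map_mul, map_mul, tw_split, h, map_inv]
      simp only [map_mul, map_inv]
      group
    obtain ⟨d, hd, hd'⟩ := exists_isRed (tw m c * split m g * c⁻¹)
    rw [← hd', tw_lp] at hlp
    obtain ⟨k, hk⟩ := isRotated_of_conj hc.map_twS d L' hd hc hlp.symm
    have key : ∀ n : ℕ, L'.rotate (k * n) = L'.map (twS m)^[n] := by
      intro n
      induction n with
      | zero => simp
      | succ n ih =>
        rw [Nat.mul_succ, ← List.rotate_rotate, ih, ← List.map_rotate, hk, List.map_map,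
          ← Function.iterate_succ]
    have hlen : L'.length ≠ 0 := by
      obtain ⟨_, x, M, z, rfl, _⟩ := hc
      simp
    refine unsplit_lp_mem hlen L' fun s hs => ?_
    have := key L'.length
    rw [Nat.mul_comm, List.rotate_length_mul] at this
    obtain ⟨i, hi, rfl⟩ := List.getElem_of_mem hs
    conv_rhs => rw [List.getElem_of_eq this hi]
    simp

end Br

namespace Br

open FreeGroup (of)

variable {m : ℕ}

/-- A homomorphism to a commutative group is constant on the standard generators. -/
theorem map_sig_eq {A : Type*} [CommGroup A] (f : Br m →* A) {i : ℕ} (hi : i < m) :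
    f (sig m i) = f (sig m 0) := by
  induction i with
  | zero => rfl
  | succ i ih =>
    rw [← ih (by omega)]
    have h := congrArg f (sig_braid (m := m) (i := i) (by omega))
    simp only [map_mul] at h
    rw [mul_comm (f (sig m (i + 1))) (f (sig m i))] at h
    exact (mul_left_cancel h).symm

/-- A homomorphism to a commutative group is determined by the length. -/
theorem map_eq_zpow_len {A : Type*} [CommGroup A] (f : Br m →* A) (b : Br m) :
    f b = f (sig m 0) ^ Multiplicative.toAdd (len m b) := by
  have : f = (zpowersHom A (f (sig m 0))).comp (len m) := hom_ext fun i hi => by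
    rw [MonoidHom.comp_apply, len_sig hi, map_sig_eq f hi]
    simp
  conv_lhs => rw [this]
  simp [zpowersHom_apply]

/-- Total exponent. -/
def tot : Fr →* Multiplicative ℤ := FreeGroup.lift fun _ => Multiplicative.ofAdd 1

theorem tot_of (k : ℕ) : tot (of k) = Multiplicative.ofAdd 1 := by simp [tot]

theorem tot_T (k : ℕ) : tot (T k) = Multiplicative.ofAdd (k : ℤ) := by
  induction k with
  | zero => simp
  | succ k ih => rw [T_succ, map_mul, ih, tot_of, ← ofAdd_add]; congr 1; push_cast; ring

theorem tot_artin (b : Br m) (w : Fr) : tot (artin m b w) = tot w := by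
  induction b using induction generalizing w with
  | one => simp
  | gen i hi =>
    have : tot.comp (artin m (sig m i)).toMonoidHom = tot := by
      ext1 k
      change tot (artin m (sig m i) (of k)) = tot (of k)
      rw [artin_sig_of hi]
      split_ifs <;> simp [tot]
    exact DFunLike.congr_fun this w
  | mul a b ha hb => rw [map_mul, MulAut.mul_apply, ha, hb]
  | inv a ha =>
    conv_rhs => rw [← MulAut.apply_inv_self _ (artin m a) w, ha]
    rw [map_inv]

theorem isConj_map_of_isConj {G H : Type*} [Group G] [Group H] (f : G →* H) {a b : G}
    (h : IsConj a b) : IsConj (f a) (f b) := by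
  obtain ⟨c, hc⟩ := isConj_iff.1 h
  exact isConj_iff.2 ⟨f c, by rw [← hc, map_mul, map_mul, map_inv]⟩

theorem trunc_cyc_iterate (k : ℕ) (hk : k < m + 1) : ∀ j, k + j + 1 = m →
    ((trunc m).comp (cyc m))^[j + 1] (of k) = 1 := by
  intro j
  induction j generalizing k with
  | zero =>
    intro h
    rw [zero_add, Function.iterate_one, MonoidHom.comp_apply, cyc_lt (by omega),
      trunc_of_ge (by omega)]
  | succ j ih =>
    intro h
    rw [Function.iterate_succ_apply, MonoidHom.comp_apply, cyc_lt (by omega), trunc_of (by omega),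
      ih _ (by omega) (by omega)]

theorem trunc_cyc_iterate_eq_one {w : Fr} (hw : trunc (m + 1) w = w) :
    ((trunc m).comp (cyc m))^[m + 1] w = 1 := by
  set f : Fr →* Fr := (trunc m).comp (cyc m) with hf
  obtain ⟨F, hF⟩ : ∃ F : Fr →* Fr, ∀ x, F x = f^[m + 1] x :=
    ⟨⟨⟨f^[m + 1], iterate_map_one f _⟩, fun x y => iterate_map_mul f _ x y⟩, fun _ => rfl⟩
  have : F.comp (trunc (m + 1)) = 1 := by
    ext1 k
    rw [MonoidHom.comp_apply]
    by_cases hk : k < m + 1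
    · rw [trunc_of hk]
      rw [hF, MonoidHom.one_apply]
      rcases Nat.lt_or_ge k m with h | h
      · have h2 : m + 1 = (k + 1) + ((m - 1 - k) + 1) := by omega
        rw [h2, Function.iterate_add_apply, trunc_cyc_iterate k (by omega) _ (by omega)]
        exact iterate_map_one f _
      · obtain rfl : k = m := by omega
        rcases Nat.eq_zero_or_pos k with rfl | h0
        · simp [hf, cyc_self, trunc_of_ge]
        · rw [Function.iterate_succ_apply]
          have : f (of k) = of 0 := by
            rw [hf]
            change trunc k (cyc k (of k)) = _
            rw [cyc_self, trunc_of h0]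
          rw [this]
          have h2 : k = (k - 1) + 1 := by omega
          conv_lhs => rw [h2]
          have := trunc_cyc_iterate (m := k) 0 (by omega) (k - 1) (by omega)
          rw [← h2] at this ⊢
          exact this
    · rw [trunc_of_ge (by omega), map_one, MonoidHom.one_apply]
  have := DFunLike.congr_fun this w
  rw [MonoidHom.comp_apply, hw, hF] at this
  exact this

/-- A conjugacy class of the free group invariant under the braid group is that of a power of
the boundary element. -/
theorem exists_eq_conj_T_zpow (hm : 2 ≤ m) {u : Fr} (hu : trunc (m + 1) u = u)
    (h : ∀ b : Br m, IsConj (artin m b u) u) :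
    ∃ (k : ℤ) (v : Fr), trunc (m + 1) v = v ∧ u = v * T (m + 1) ^ k * v⁻¹ := by
  suffices hs : ∃ k : ℤ, IsConj (T (m + 1) ^ k) u by
    obtain ⟨k, hk⟩ := hs
    obtain ⟨v, hv⟩ := isConj_iff.1 hk
    refine ⟨k, trunc (m + 1) v, trunc_trunc_of_le le_rfl _, ?_⟩
    rw [← hu, ← hv, map_mul, map_mul, map_zpow, trunc_T le_rfl, map_inv]
  obtain ⟨m', rfl⟩ : ∃ m', m = m' + 1 := ⟨m - 1, by omega⟩
  have hcyc : IsConj (cyc (m' + 1) u) u := by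
    refine IsConj.trans ?_ (h (dl (m' + 1)))
    rw [artin_dl hu]
    exact isConj_iff.2 ⟨(of 0)⁻¹, by group⟩
  obtain ⟨g, hg⟩ := isConj_iff.1 (h (incl m' (zt m'))).symm
  rw [artin_incl] at hg
  obtain ⟨x, hx, hc | hc⟩ := exists_conj_of_artin_zt hu hg.symm
  · set u' := x * u * x⁻¹ with hu'
    have huu : IsConj u u' := isConj_iff.2 ⟨x, rfl⟩
    -- the shifted word
    have hu2 : cyc (m' + 1) u' ∈ Subgroup.closure {T (m' + 2), of 0} := by
      have : Subgroup.closure {T (m' + 1), of (m' + 1)} ≤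
          (Subgroup.closure {T (m' + 2), of 0}).comap (cyc (m' + 1)) := by
        rw [Subgroup.closure_le]
        have h0 : cyc (m' + 1) (of (m' + 1)) = of 0 := cyc_self _
        have hT : ∀ k ≤ m' + 1, cyc (m' + 1) (T k) = T (k + 1) * (of 0)⁻¹ := by
          intro k hk
          induction k with
          | zero => simp [T_succ]
          | succ k ih => rw [T_succ, map_mul, ih (by omega), cyc_lt (by omega), T_succ (k + 1)]; group
        rintro y (rfl | rfl)
        · rw [SetLike.mem_coe, Subgroup.mem_comap, hT _ le_rfl]
          exact mul_mem (Subgroup.subset_closure (by simp))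
            (inv_mem (Subgroup.subset_closure (by simp)))
        · rw [SetLike.mem_coe, Subgroup.mem_comap, h0]
          exact Subgroup.subset_closure (by simp)
      exact this hc
    let f : Fr →* Fr := FreeGroup.lift fun k => if k = m' + 1 then 1 else
      if k = m' then T (m' + 2) * (T m')⁻¹ else of k
    have hfT : ∀ k ≤ m', f (T k) = T k := by
      intro k hk
      induction k with
      | zero => simp
      | succ k ih =>
        rw [T_succ, map_mul, ih (by omega)]
        simp [f, show k ≠ m' + 1 by omega, show k ≠ m' by omega]
    have hf1 : f (of (m' + 1)) = 1 := by simp [f]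
    have hf0 : f (of m') = T (m' + 2) * (T m')⁻¹ := by simp [f]
    have hfz : f (of 0) = of 0 := by simp [f, show 0 ≠ m' by omega]
    have hft1 : f (T (m' + 1)) = T (m' + 2) := by rw [T_succ, map_mul, hf0, hfT _ le_rfl]; group
    have hft2 : f (T (m' + 2)) = T (m' + 2) := by
      conv_lhs => rw [T_succ, map_mul, hf1, hft1, one_mul]
    have e1 : f u' ∈ Subgroup.zpowers (T (m' + 2)) := by
      have : Subgroup.closure {T (m' + 1), of (m' + 1)} ≤
          (Subgroup.zpowers (T (m' + 2))).comap f := by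
        rw [Subgroup.closure_le]
        rintro y (rfl | rfl)
        · rw [SetLike.mem_coe, Subgroup.mem_comap, hft1]; exact Subgroup.mem_zpowers _
        · rw [SetLike.mem_coe, Subgroup.mem_comap, hf1]; exact one_mem _
      exact this hc
    have e2 : f (cyc (m' + 1) u') = cyc (m' + 1) u' := by
      have : Subgroup.closure {T (m' + 2), of 0} ≤ f.eqLocus (MonoidHom.id _) := by
        rw [Subgroup.closure_le]
        rintro y (rfl | rfl)
        · exact hft2
        · exact hfz
      exact this hu2
    obtain ⟨k, hk⟩ := e1
    refine ⟨k, ?_⟩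
    have hk : T (m' + 2) ^ k = f u' := hk
    have c1 : IsConj u (cyc (m' + 1) u') := hcyc.symm.trans (isConj_map_of_isConj _ huu)
    have c2 : IsConj (f u) (f u') := isConj_map_of_isConj _ huu
    have c3 := isConj_map_of_isConj f c1
    rw [e2] at c3
    rw [hk]
    exact (c1.trans (c3.symm.trans c2)).symm
  · refine ⟨0, ?_⟩
    rw [zpow_zero]
    set u' := x * u * x⁻¹ with hu'
    have huu : IsConj u u' := isConj_iff.2 ⟨x, rfl⟩
    have ht : IsConj (trunc (m' + 1) u) u := by
      have := isConj_map_of_isConj (trunc (m' + 1)) huu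
      rw [hc] at this
      exact this.trans huu.symm
    have : ∀ n, IsConj (((trunc (m' + 1)).comp (cyc (m' + 1)))^[n] u) u := by
      intro n
      induction n with
      | zero => exact IsConj.refl _
      | succ n ih =>
        rw [Function.iterate_succ_apply']
        exact (isConj_map_of_isConj _ ih).trans
          ((isConj_map_of_isConj (trunc (m' + 1)) hcyc).trans ht)
    have h1 := this (m' + 1 + 1)
    rwa [trunc_cyc_iterate_eq_one hu] at h1

/-- Sections of the semidirect product of the free group with the braid group. -/
theorem exists_section (hm : 2 ≤ m) (ψ : Br m →* Gm m) (hψ : ∀ b, (ψ b).right = b)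
    (htr : ∀ b, trunc (m + 1) (ψ b).left = (ψ b).left) :
    ∃ (v : Fr) (k : ℤ), trunc (m + 1) v = v ∧ ∀ b : Br m, (ψ b).left =
      v * T (m + 1) ^ (k * Multiplicative.toAdd (len m b)) * artin m b v⁻¹ := by
  have hmul : ∀ a b, (ψ (a * b)).left = (ψ a).left * artin m a (ψ b).left := by
    intro a b
    rw [map_mul, SemidirectProduct.mul_left, hψ]
  set u := (ψ (zt m)).left * (T (m + 1))⁻¹ with hu
  have hut : trunc (m + 1) u = u := by
    rw [hu, map_mul, htr, map_inv, trunc_T le_rfl]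
  have key : ∀ b, (ψ b).left * artin m b u = u * (ψ b).left := by
    intro b
    have h1 := congrArg (fun x => (ψ x).left) (zt_comm b).eq
    simp only [hmul] at h1
    rw [artin_zt (htr b)] at h1
    rw [hu, map_mul, map_inv, artin_T b (Nat.lt_succ_self m), ← mul_assoc, ← h1]
    group
  obtain ⟨k, v, hv, huv⟩ := exists_eq_conj_T_zpow hm hut fun b => by
    have h1 := key b
    refine isConj_iff.2 ⟨(ψ b).left, ?_⟩
    rw [h1]; group
  have hk : k ≠ 0 := by
    rintro rfl
    rw [zpow_zero, mul_one, mul_inv_cancel, hu, mul_inv_eq_one] at huv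
    let q : Br m →* Multiplicative ℤ :=
      { toFun := fun b => tot (ψ b).left
        map_one' := by simp
        map_mul' := fun a b => by rw [hmul, map_mul, tot_artin] }
    have h1 := map_eq_zpow_len q (zt m)
    have h2 : q (zt m) = Multiplicative.ofAdd ((m + 1 : ℕ) : ℤ) := by
      change tot (ψ (zt m)).left = _
      rw [huv, tot_T]
    rw [h2, len_zt, toAdd_ofAdd] at h1
    have h3 := congrArg Multiplicative.toAdd h1
    rw [toAdd_zpow, toAdd_ofAdd] at h3
    simp only [smul_eq_mul] at h3
    generalize Multiplicative.toAdd (q (sig m 0)) = c at h3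
    push_cast at h3
    have h4 : ((m : ℤ) + 1) * (m * c - 1) = 0 := by linear_combination -h3
    rcases mul_eq_zero.1 h4 with h | h
    · omega
    · have : (m : ℤ) ∣ 1 := ⟨c, by linarith⟩
      have := Int.le_of_dvd one_pos this
      omega
  have hT : T (m + 1) ≠ 1 := T_ne_one (Nat.succ_pos m)
  have hw : ∀ b, ∃ l : ℤ, v⁻¹ * (ψ b).left * artin m b v = T (m + 1) ^ l := by
    intro b
    refine eq_zpow_T_of_commute (Nat.succ_pos m) hk ?_
    have h1 := key b
    rw [huv] at h1
    simp only [map_mul, map_inv, map_zpow, artin_T b (Nat.lt_succ_self m)] at h1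
    change _ = _
    have h2 : v * T (m + 1) ^ k * v⁻¹ * (ψ b).left = (ψ b).left * (artin m b v * T (m + 1) ^ k * (artin m b v)⁻¹) := h1.symm
    calc _ = v⁻¹ * ((ψ b).left * (artin m b v * T (m + 1) ^ k * (artin m b v)⁻¹)) * artin m b v := by group
      _ = _ := by rw [← h2]; group
  choose l hl using hw
  have hinj : ∀ a b : ℤ, T (m + 1) ^ a = T (m + 1) ^ b → a = b := by
    intro a b h
    have := congrArg (ex 0) h
    rw [map_zpow, map_zpow, ex_T, if_pos (Nat.succ_pos m)] at this
    have := congrArg Multiplicative.toAdd this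
    simpa using this
  have hlmul : ∀ a b, l (a * b) = l a + l b := by
    intro a b
    apply hinj
    rw [zpow_add, ← hl (a * b), ← hl a, ← hl b]
    have h1 : artin m a (v⁻¹ * (ψ b).left * artin m b v) = v⁻¹ * (ψ b).left * artin m b v := by
      rw [hl, map_zpow, artin_T a (Nat.lt_succ_self m)]
    conv_rhs => rw [← h1]
    rw [hmul, map_mul (artin m) a b, MulAut.mul_apply, map_mul, map_mul, map_inv]
    group
  let q : Br m →* Multiplicative ℤ :=
    { toFun := fun b => Multiplicative.ofAdd (l b)
      map_one' := by
        have := hlmul 1 1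
        rw [mul_one] at this
        have : l 1 = 0 := by omega
        rw [this, ofAdd_zero]
      map_mul' := fun a b => by rw [hlmul, ofAdd_add] }
  refine ⟨v, l (sig m 0), hv, fun b => ?_⟩
  have h1 := map_eq_zpow_len q b
  have h2 : l b = l (sig m 0) * Multiplicative.toAdd (len m b) := by
    have := congrArg Multiplicative.toAdd h1
    rw [toAdd_zpow] at this
    change l b = _ • l (sig m 0) at this
    rw [this, smul_eq_mul, mul_comm]
  rw [← h2, ← hl, map_inv]
  group

end Br

namespace Br

open FreeGroup (of)

/-- Evaluation of words in two letters. -/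
def ev {G : Type*} [Group G] (x y : G) : FreeGroup Bool →* G := FreeGroup.lift fun b => cond b x y

theorem map_ev {G H : Type*} [Group G] [Group H] (f : G →* H) (x y : G) (W : FreeGroup Bool) :
    f (ev x y W) = ev (f x) (f y) W := by
  have : f.comp (ev x y) = ev (f x) (f y) := by
    ext1 b
    cases b <;> simp [ev]
  exact DFunLike.congr_fun this W

theorem exists_ev_of_mem_closure {G : Type*} [Group G] {x y g : G}
    (h : g ∈ Subgroup.closure {x, y}) : ∃ W, g = ev x y W := by
  have : Subgroup.closure {x, y} ≤ (ev x y).range := by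
    rw [Subgroup.closure_le]
    rintro z (rfl | rfl)
    · exact ⟨of true, by simp [ev]⟩
    · exact ⟨of false, by simp [ev]⟩
  obtain ⟨W, hW⟩ := this h
  exact ⟨W, hW.symm⟩

section Restrict

variable {ι : Type*}

open Classical in
/-- Restriction of words to a set of letters. -/
noncomputable def res (S : Set ι) : FreeGroup ι →* FreeGroup ι :=
  FreeGroup.lift fun k => if k ∈ S then of k else 1

theorem res_of_mem {S : Set ι} {k : ι} (h : k ∈ S) : res S (of k) = of k := by simp [res, h]

theorem res_of_notMem {S : Set ι} {k : ι} (h : k ∉ S) : res S (of k) = 1 := by simp [res, h]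

theorem res_res (S S' : Set ι) (w : FreeGroup ι) : res S (res S' w) = res (S ∩ S') w := by
  have : (res S).comp (res S') = res (S ∩ S') := by
    ext1 k
    by_cases h : k ∈ S'
    · by_cases h1 : k ∈ S
      · simp [res_of_mem, h, h1]
      · rw [MonoidHom.comp_apply, res_of_mem h, res_of_notMem h1, res_of_notMem (by simp [h1])]
    · rw [MonoidHom.comp_apply, res_of_notMem h, map_one, res_of_notMem (by simp [h])]
  exact DFunLike.congr_fun this w

theorem res_empty (w : FreeGroup ι) : res ∅ w = 1 := by
  have : res (∅ : Set ι) = 1 := by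
    ext1 k
    simp [res_of_notMem]
  rw [this, MonoidHom.one_apply]

theorem res_singleton (k : ι) (w : FreeGroup ι) : ∃ n : ℤ, res {k} w = of k ^ n := by
  have : ∀ w, res {k} w ∈ Subgroup.zpowers (of k) := by
    intro w
    induction w using FreeGroup.induction_on with
    | C1 => rw [map_one]; exact one_mem _
    | of j =>
      by_cases h : j = k
      · subst h; rw [res_of_mem (Set.mem_singleton j)]; exact Subgroup.mem_zpowers _
      · rw [res_of_notMem (by exact h)]; exact one_mem _
    | inv_of k h => rw [map_inv]; exact inv_mem h
    | mul a b ha hb => rw [map_mul]; exact mul_mem ha hb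
  obtain ⟨n, hn⟩ := this w
  exact ⟨n, hn.symm⟩

theorem exists_finset_res (w : FreeGroup ι) : ∃ S : Finset ι, res (S : Set ι) w = w := by
  classical
  have mono : ∀ {S S' : Finset ι} {w : FreeGroup ι}, S ⊆ S' → res (S : Set ι) w = w →
      res (S' : Set ι) w = w := by
    intro S S' w h hw
    rw [← hw, res_res, Set.inter_eq_right.2 (by exact_mod_cast h)]
  induction w using FreeGroup.induction_on with
  | C1 => exact ⟨∅, map_one _⟩
  | of j => exact ⟨{j}, res_of_mem (by simp)⟩
  | inv_of k h => obtain ⟨S, hS⟩ := h; exact ⟨S, by rw [map_inv, hS]⟩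
  | mul a b ha hb =>
    obtain ⟨S, hS⟩ := ha
    obtain ⟨S', hS'⟩ := hb
    exact ⟨S ∪ S', by rw [map_mul, mono Finset.subset_union_left hS,
      mono Finset.subset_union_right hS']⟩

theorem res_eq_one {w : FreeGroup ι} (hw : ∀ S : Set ι, res S w * res Sᶜ w = w)
    {A : Set ι} (hA : ∀ k ∈ A, res {k} w = 1) : res A w = 1 := by
  classical
  obtain ⟨S, hS⟩ := exists_finset_res w
  suffices h : ∀ S : Finset ι, res (A ∩ S) w = 1 by
    rw [← hS, res_res, h S]
  intro S
  induction S using Finset.induction_on with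
  | empty => rw [Finset.coe_empty, Set.inter_empty, res_empty]
  | insert k S hk ih =>
    by_cases hkA : k ∈ A
    · rw [← hw {k}, map_mul, res_res, res_res]
      have h1 : A ∩ ↑(insert k S) ∩ {k} = {k} := by
        ext x
        simp only [Set.mem_inter_iff, Set.mem_singleton_iff]
        exact ⟨And.right, fun h => ⟨⟨h ▸ hkA, by simp [h]⟩, h⟩⟩
      have h2 : A ∩ ↑(insert k S) ∩ {k}ᶜ = A ∩ S := by
        ext x
        simp only [Finset.coe_insert, Set.mem_inter_iff, Set.mem_insert_iff, Set.mem_compl_iff,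
          Set.mem_singleton_iff, Finset.mem_coe]
        constructor
        · rintro ⟨⟨h, h1 | h1⟩, h2⟩
          · exact absurd h1 h2
          · exact ⟨h, h1⟩
        · rintro ⟨h, h1⟩
          exact ⟨⟨h, Or.inr h1⟩, fun h2 => hk (h2 ▸ h1)⟩
      rw [h1, h2, hA k hkA, ih, mul_one]
    · have : A ∩ ↑(insert k S) = A ∩ S := by
        ext x
        simp only [Finset.coe_insert, Set.mem_inter_iff, Set.mem_insert_iff, Finset.mem_coe]
        constructor
        · rintro ⟨h, h1 | h1⟩
          · exact absurd (h1 ▸ h) hkA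
          · exact ⟨h, h1⟩
        · rintro ⟨h, h1⟩
          exact ⟨h, Or.inr h1⟩
      rw [this, ih]

/-- A word of total exponent one which is the product of its restrictions, for every partition of
the letters, is a letter. -/
theorem exists_eq_of {w : FreeGroup ι} (hw : ∀ S : Set ι, res S w * res Sᶜ w = w)
    (hdeg : FreeGroup.lift (fun _ => Multiplicative.ofAdd (1 : ℤ)) w =
    Multiplicative.ofAdd 1) : ∃ k, w = of k := by
  classical
  have hw' : ∀ S : Set ι, res Sᶜ w * res S w = w := fun S => by
    have := hw Sᶜ
    rwa [compl_compl] at this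
  by_cases h : ∃ k, res {k} w ≠ 1
  · obtain ⟨k, hk⟩ := h
    obtain ⟨n, hn⟩ := res_singleton k w
    have hn0 : n ≠ 0 := by
      rintro rfl
      exact hk (by rw [hn, zpow_zero])
    have h1 : res {k}ᶜ w = 1 := by
      refine res_eq_one hw fun j hj => ?_
      have hj : j ≠ k := hj
      obtain ⟨l, hl⟩ := res_singleton j w
      have e1 := congrArg (res {j, k}) (hw {k})
      have e2 := congrArg (res {j, k}) (hw' {k})
      rw [map_mul, res_res, res_res] at e1 e2
      have s1 : ({j, k} ∩ {k} : Set ι) = {k} := by ext x; simp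
      have s2 : ({j, k} ∩ {k}ᶜ : Set ι) = {j} := by
        ext x; simp; constructor
        · tauto
        · rintro rfl; exact ⟨Or.inl rfl, hj⟩
      rw [s1, s2] at e1 e2
      have hc : Commute (of j ^ l) (of k ^ n) := by
        rw [← hl, ← hn]; exact e2.trans e1.symm
      let f : ι → FreeGroup ι →* Multiplicative ℤ := fun a =>
        FreeGroup.lift fun b => if b = a then Multiplicative.ofAdd 1 else 1
      obtain ⟨r, hr⟩ := eq_zpow_of_commute (f k) (v := of k) (by simp [f]) hn0 hc
      have := congrArg (f j) hr
      rw [map_zpow, map_zpow] at this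
      simp only [f, FreeGroup.lift_apply_of, if_true, if_neg hj.symm, one_zpow] at this
      have h0 : l = 0 := by
        have := congrArg Multiplicative.toAdd this
        simpa using this
      rw [hl, h0, zpow_zero]
    have h2 := hw {k}
    rw [h1, mul_one, hn] at h2
    refine ⟨k, ?_⟩
    rw [← h2] at hdeg ⊢
    rw [map_zpow, FreeGroup.lift_apply_of] at hdeg
    have : n = 1 := by
      have := congrArg Multiplicative.toAdd hdeg
      simpa using this
    rw [this, zpow_one]
  · push Not at h
    have h1 : res Set.univ w = 1 := res_eq_one hw fun k _ => h k
    have h2 : res Set.univ w = w := by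
      have : res (Set.univ : Set ι) = MonoidHom.id _ := by
        ext1 k
        simp [res_of_mem]
      rw [this, MonoidHom.id_apply]
    rw [← h2, h1, map_one] at hdeg
    exact absurd hdeg (by decide)

end Restrict

/-- Conjugates of the first letter by powers of the second one. -/
def cj {G : Type*} [Group G] (x y : G) : FreeGroup ℤ →* G :=
  FreeGroup.lift fun k => y ^ k * x * (y ^ k)⁻¹

theorem cj_of {G : Type*} [Group G] (x y : G) (k : ℤ) :
    cj x y (of k) = y ^ k * x * (y ^ k)⁻¹ := by simp [cj]

theorem map_cj {G H : Type*} [Group G] [Group H] (f : G →* H) (x y : G) (w : FreeGroup ℤ) :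
    f (cj x y w) = cj (f x) (f y) w := by
  have : f.comp (cj x y) = cj (f x) (f y) := by
    ext1 b
    simp [cj_of]
  exact DFunLike.congr_fun this w

/-- Exponent sum of the second letter. -/
def exF : FreeGroup Bool →* Multiplicative ℤ := ev 1 (Multiplicative.ofAdd 1)

/-- Exponent sum of the first letter. -/
def exT : FreeGroup Bool →* Multiplicative ℤ := ev (Multiplicative.ofAdd 1) 1

theorem zpow_mul_cj {G : Type*} [Group G] (x y : G) (n : ℤ) (w : FreeGroup ℤ) :
    y ^ n * cj x y w = cj x y (FreeGroup.map (n + ·) w) * y ^ n := by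
  have : (MulAut.conj (y ^ n)).toMonoidHom.comp (cj x y) =
      (cj x y).comp (FreeGroup.map (n + ·)) := by
    ext1 k
    change y ^ n * cj x y (of k) * (y ^ n)⁻¹ = cj x y (FreeGroup.map (n + ·) (of k))
    rw [FreeGroup.map.of, cj_of, cj_of, zpow_add]
    group
  have := DFunLike.congr_fun this w
  rw [← mul_inv_eq_iff_eq_mul]
  exact this

theorem exists_cj (W : FreeGroup Bool) : ∃ w : FreeGroup ℤ,
    W = cj (of true) (of false) w * of false ^ (Multiplicative.toAdd (exF W)) := by
  induction W using FreeGroup.induction_on with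
  | C1 => exact ⟨1, by simp⟩
  | of b =>
    cases b
    · exact ⟨1, by simp [exF, ev]⟩
    · exact ⟨of 0, by simp [exF, ev, cj_of]⟩
  | inv_of b h =>
    cases b
    · exact ⟨1, by simp [exF, ev]⟩
    · exact ⟨(of 0)⁻¹, by simp [exF, ev, cj_of]⟩
  | mul a b ha hb =>
    obtain ⟨v, hv⟩ := ha
    obtain ⟨w, hw⟩ := hb
    refine ⟨v * FreeGroup.map (Multiplicative.toAdd (exF a) + ·) w, ?_⟩
    conv_lhs => rw [hv, hw]
    rw [map_mul, map_mul, toAdd_mul, zpow_add, mul_assoc, ← mul_assoc (_ ^ _) (cj _ _ _),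
      zpow_mul_cj]
    simp only [mul_assoc]

/-- The shift on two families of letters indexed by `ℤ`. -/
def sh : Multiplicative ℤ →* MulAut (FreeGroup (ℤ × Bool)) where
  toFun n := FreeGroup.freeGroupCongr
    (Equiv.prodCongr (Equiv.addLeft (Multiplicative.toAdd n)) (Equiv.refl Bool))
  map_one' := by
    apply MulEquiv.toMonoidHom_injective
    ext1 k
    simp
  map_mul' a b := by
    apply MulEquiv.toMonoidHom_injective
    ext1 k
    obtain ⟨k, c⟩ := k
    simp [add_assoc]

theorem sh_of (n k : ℤ) (b : Bool) : sh (Multiplicative.ofAdd n) (of (k, b)) = of (n + k, b) := by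
  simp [sh]

theorem eq_conj_of_mul {W : FreeGroup Bool} (hF : exF W = 1)
    (hT : exT W = Multiplicative.ofAdd 1)
    (h : ev (of 0 : Fr) (of 2) W * ev (of 1) (of 2) W = ev (of 0 * of 1) (of 2) W) :
    ∃ k : ℤ, W = of false ^ k * of true * (of false ^ k)⁻¹ := by
  obtain ⟨w, hw⟩ := exists_cj W
  rw [hF, toAdd_one, zpow_zero, mul_one] at hw
  let G := FreeGroup (ℤ × Bool) ⋊[sh] Multiplicative ℤ
  let t : G := SemidirectProduct.inr (Multiplicative.ofAdd 1)
  let f : Fr →* G := FreeGroup.lift fun k => if k = 0 then SemidirectProduct.inl (of (0, true)) else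
    if k = 1 then SemidirectProduct.inl (of (0, false)) else t
  have h0 : f (of 0) = SemidirectProduct.inl (of (0, true)) := by simp [f]
  have h1 : f (of 1) = SemidirectProduct.inl (of (0, false)) := by simp [f]
  have h2 : f (of 2) = t := by simp [f]
  have hev : ∀ {H : Type} [Group H] (x y : H), ev x y W = cj x y w := by
    intro H _ x y
    rw [hw, map_cj]
    simp [ev]
  rw [hev, hev, hev] at h
  have h3 := congrArg f h
  rw [map_mul, map_cj, map_cj, map_cj, map_mul, h0, h1, h2] at h3
  have ht : ∀ k : ℤ, t ^ k = SemidirectProduct.inr (Multiplicative.ofAdd k) := by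
    intro k
    rw [← map_zpow, ← ofAdd_zsmul]; simp
  have hcj : ∀ x : FreeGroup (ℤ × Bool), cj (SemidirectProduct.inl x) t w =
      SemidirectProduct.inl (FreeGroup.lift (fun k => sh (Multiplicative.ofAdd k) x) w) := by
    intro x
    have : cj (SemidirectProduct.inl x) t = (SemidirectProduct.inl : _ →* G).comp
        (FreeGroup.lift (fun k => sh (Multiplicative.ofAdd k) x)) := by
      ext1 k
      rw [cj_of, ht, MonoidHom.comp_apply, FreeGroup.lift_apply_of, SemidirectProduct.inl_aut]
      rw [map_inv]
    rw [this]; rfl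
  rw [← map_mul, hcj, hcj, hcj, ← map_mul] at h3
  have h4 := SemidirectProduct.inl_injective h3
  simp only [map_mul, sh_of, add_zero] at h4
  obtain ⟨k, hk⟩ := exists_eq_of (w := w) (by
    classical
    intro S
    let g : FreeGroup (ℤ × Bool) →* FreeGroup ℤ := FreeGroup.lift fun p =>
      if p.2 then (if p.1 ∈ S then of p.1 else 1) else (if p.1 ∈ S then 1 else of p.1)
    have h5 := congrArg g h4
    rw [map_mul] at h5
    have e1 : g.comp (FreeGroup.lift fun k => of (k, true)) = res S := by
      ext1 k
      by_cases h : k ∈ S <;> simp [g, res, h]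
    have e2 : g.comp (FreeGroup.lift fun k => of (k, false)) = res Sᶜ := by
      ext1 k
      by_cases h : k ∈ S <;> simp [g, res, h]
    have e3 : g.comp (FreeGroup.lift fun k => of (k, true) * of (k, false)) = MonoidHom.id _ := by
      ext1 k
      by_cases h : k ∈ S <;> simp [g, h]
    rw [← e1, ← e2]
    exact h5.trans (DFunLike.congr_fun e3 w)) (by
    refine Eq.trans ?_ hT
    rw [exT, hev]
    have : FreeGroup.lift (fun _ => Multiplicative.ofAdd (1 : ℤ)) =
      cj (Multiplicative.ofAdd (1 : ℤ)) 1 := by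
      ext1 k
      simp [cj_of]
    rw [this])
  refine ⟨k, ?_⟩
  rw [hw, hk, cj_of]

end Br

namespace Br

open FreeGroup (of)
open Polynomial
open scoped commutatorElement

/-- The sign of a boolean. -/
def sv (b : Bool) : ℤ := if b then 1 else -1

/-- The group element described by a list of signs and exponents. -/
def wd {G : Type*} [Group G] (x y : G) (L : List (Bool × ℤ)) : G :=
  (L.map fun p => y ^ sv p.1 * x ^ p.2).prod

section wd

variable {G H : Type*} [Group G] [Group H]

theorem wd_nil (x y : G) : wd x y [] = 1 := rfl

theorem wd_cons (x y : G) (e : Bool) (k : ℤ) (L : List (Bool × ℤ)) :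
    wd x y ((e, k) :: L) = y ^ sv e * x ^ k * wd x y L := by simp [wd]

theorem wd_append (x y : G) (L M : List (Bool × ℤ)) : wd x y (L ++ M) = wd x y L * wd x y M := by
  simp [wd]

theorem map_wd (f : G →* H) (x y : G) (L : List (Bool × ℤ)) :
    f (wd x y L) = wd (f x) (f y) L := by
  induction L with
  | nil => simp [wd_nil]
  | cons p L ih => obtain ⟨e, k⟩ := p; simp [wd_cons, ih]

end wd

/-- The first sign of a list, with a default value. -/
def nxt : List (Bool × ℤ) → Bool → Bool
  | [], e0 => e0
  | (e, _) :: _, _ => e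

/-- No cancellation occurs in the word, closed up by the sign `e0`. -/
def CRed : List (Bool × ℤ) → Bool → Prop
  | [], _ => True
  | (e, k) :: L, e0 => (k = 0 → e = nxt L e0) ∧ CRed L e0

/-- The signs alternate and the exponents are nonzero. -/
def Alt : List (Bool × ℤ) → Bool → Prop
  | [], _ => True
  | (e, k) :: L, e0 => (e ≠ nxt L e0 ∧ k ≠ 0) ∧ Alt L e0

/-- The contribution of two successive signs to the twist. -/
def cc (e e' : Bool) : ℤ := (if e then 1 else 0) - (if e' then 0 else 1)

/-- The twisted list. -/
def twl (N : ℤ) : List (Bool × ℤ) → Bool → List (Bool × ℤ)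
  | [], _ => []
  | (e, k) :: L, e0 => (e, k + N * cc e (nxt L e0)) :: twl N L e0

theorem wd_twl {G : Type*} [Group G] (x y : G) (N : ℤ) (L : List (Bool × ℤ)) (e0 : Bool) :
    wd x (y * x ^ N) L =
      x ^ (- if nxt L e0 then 0 else N) * wd x y (twl N L e0) * x ^ (if e0 then 0 else N) := by
  induction L with
  | nil => cases e0 <;> simp [wd_nil, twl, nxt]
  | cons p L ih =>
    obtain ⟨e, k⟩ := p
    rw [wd_cons, twl, wd_cons, ih]
    generalize wd x y (twl N L e0) = W
    generalize x ^ (if e0 then 0 else N) = Z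
    cases e <;> cases h : nxt L e0 <;> simp [nxt, cc, sv, mul_assoc, zpow_add] <;> group

/-- A representation of the free group of rank two. -/
noncomputable def R2 : FreeGroup Bool →* Matrix.SpecialLinearGroup (Fin 2) ℤ[X] :=
  ev ⟨!![1, X; 0, 1], by simp [Matrix.det_fin_two]⟩ ⟨!![0, -1; 1, 0], by simp [Matrix.det_fin_two]⟩

theorem R2_x_zpow (k : ℤ) : (R2 (of true ^ k)).1 = !![1, C k * X; 0, 1] := by
  have h1 : (R2 (of true)).1 = !![1, X; 0, 1] := by simp [R2, ev]; rfl
  have h2 : (R2 (of true))⁻¹.1 = !![1, -X; 0, 1] := by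
    rw [Matrix.SpecialLinearGroup.coe_inv, h1, Matrix.adjugate_fin_two_of]; simp
  induction k using Int.induction_on with
  | zero => simp [Matrix.one_fin_two]
  | succ k ih =>
    rw [zpow_add_one, map_mul, Matrix.SpecialLinearGroup.coe_mul, ih, h1]
    simp; ring
  | pred k ih =>
    rw [zpow_sub_one, map_mul, map_inv, Matrix.SpecialLinearGroup.coe_mul, ih, h2]
    simp; ring

theorem R2_y_zpow (e : Bool) : (R2 (of false ^ sv e)).1 = sv e • !![0, -1; 1, 0] := by
  have h1 : (R2 (of false)).1 = !![0, -1; 1, 0] := by simp [R2, ev]; rfl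
  cases e
  · simp only [sv, Bool.false_eq_true, if_false, zpow_neg, zpow_one, map_inv]
    rw [Matrix.SpecialLinearGroup.coe_inv, h1, Matrix.adjugate_fin_two_of]; simp
  · simp only [sv, if_true, zpow_one, one_smul, h1]

theorem R2_wd_eq (L : List (Bool × ℤ)) : (R2 (wd (of true) (of false) L)).1 =
    (L.map fun p => sv p.1).prod •
      (L.map fun p => (!![0, -1; 1, C p.2 * X] : Matrix (Fin 2) (Fin 2) ℤ[X])).prod := by
  induction L with
  | nil => simp [wd_nil]
  | cons p L ih =>
    obtain ⟨e, k⟩ := p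
    rw [wd_cons, map_mul, map_mul, Matrix.SpecialLinearGroup.coe_mul,
      Matrix.SpecialLinearGroup.coe_mul, ih, R2_x_zpow, R2_y_zpow, List.map_cons, List.map_cons,
      List.prod_cons, List.prod_cons]
    rw [smul_mul_assoc, smul_mul_assoc, mul_smul_comm, smul_smul]
    congr 2
    simp

theorem coeff_prod (L : List (Bool × ℤ)) :
    let P := (L.map fun p => (!![0, -1; 1, C p.2 * X] : Matrix (Fin 2) (Fin 2) ℤ[X])).prod
    (∀ n, L.length + 1 ≤ n → (P 0 0).coeff n = 0) ∧ (L ≠ [] → (P 0 0).coeff L.length = 0) ∧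
    (∀ n, L.length + 1 ≤ n → (P 0 1).coeff n = 0) ∧
    (∀ n, L.length ≤ n → (P 1 0).coeff n = 0) ∧ (∀ n, L.length + 1 ≤ n → (P 1 1).coeff n = 0) ∧
    (P 1 1).coeff L.length = (L.map Prod.snd).prod := by
  induction L with
  | nil =>
    refine ⟨fun n hn => ?_, by simp, by simp, by simp, fun n hn => ?_, by simp⟩
    · simp only [List.map_nil, List.prod_nil, Matrix.one_apply_eq, Polynomial.coeff_one]
      exact if_neg (by simp at hn; omega)
    · simp only [List.map_nil, List.prod_nil, Matrix.one_apply_eq, Polynomial.coeff_one]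
      exact if_neg (by simp at hn; omega)
  | cons p L ih =>
    obtain ⟨e, k⟩ := p
    obtain ⟨h00, -, h01, h10, h11, hp⟩ := ih
    set P := (L.map fun p => (!![0, -1; 1, C p.2 * X] : Matrix (Fin 2) (Fin 2) ℤ[X])).prod
    simp only [List.map_cons, List.prod_cons, List.length_cons, Matrix.mul_apply, Fin.sum_univ_two,
      Matrix.of_apply, Matrix.cons_val', Matrix.cons_val_zero, Matrix.cons_val_one,
      Matrix.cons_val_fin_one, zero_mul, zero_add, neg_mul, one_mul, coeff_neg, coeff_add,
      neg_eq_zero, mul_assoc, coeff_C_mul]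
    have hX : ∀ (q : ℤ[X]) n, 1 ≤ n → (X * q).coeff n = q.coeff (n - 1) := by
      intro q n hn
      obtain ⟨n, rfl⟩ : ∃ n', n = n' + 1 := ⟨n - 1, by omega⟩
      rw [coeff_X_mul, Nat.add_sub_cancel]
    refine ⟨fun n hn => h10 n (by omega), fun _ => h10 _ (by omega), fun n hn => h11 n (by omega),
      fun n hn => ?_, fun n hn => ?_, ?_⟩
    · rw [hX _ _ (by omega), h00 n (by omega), h10 _ (by omega)]; simp
    · rw [hX _ _ (by omega), h01 n (by omega), h11 _ (by omega)]; simp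
    · rw [hX _ _ (by omega), h01 _ (by omega), Nat.add_sub_cancel, hp]; simp

theorem coeff_trace_R2_wd {L : List (Bool × ℤ)} (hL : L ≠ []) :
    (Matrix.trace (R2 (wd (of true) (of false) L)).1).coeff L.length =
      (L.map fun p => sv p.1).prod * (L.map Prod.snd).prod := by
  obtain ⟨-, h00, -, -, -, hp⟩ := coeff_prod L
  rw [R2_wd_eq, Matrix.trace_smul, Matrix.trace_fin_two, coeff_smul, coeff_add, h00 hL, hp,
    zero_add, smul_eq_mul]

theorem trace_R2_of_isConj {u v : FreeGroup Bool} (h : IsConj u v) :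
    Matrix.trace (R2 u).1 = Matrix.trace (R2 v).1 := by
  obtain ⟨c, rfl⟩ := isConj_iff.1 h
  rw [map_mul, map_mul, mul_assoc, Matrix.SpecialLinearGroup.coe_mul, Matrix.trace_mul_comm,
    ← Matrix.SpecialLinearGroup.coe_mul, mul_assoc, ← map_mul, inv_mul_cancel, map_one, mul_one]

/-- The product of the exponents of the twisted list as a polynomial in the twisting parameter. -/
noncomputable def pp : List (Bool × ℤ) → Bool → ℤ[X]
  | [], _ => 1
  | (e, k) :: L, e0 => (C k + C (cc e (nxt L e0)) * X) * pp L e0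

theorem eval_pp (N : ℤ) (L : List (Bool × ℤ)) (e0 : Bool) :
    (pp L e0).eval N = ((twl N L e0).map Prod.snd).prod := by
  induction L with
  | nil => simp [pp, twl]
  | cons p L ih =>
    obtain ⟨e, k⟩ := p
    rw [pp, eval_mul, ih, twl, List.map_cons, List.prod_cons, eval_add, eval_mul, eval_C, eval_C,
      eval_X, mul_comm N]

theorem cc_eq_zero {e e' : Bool} : cc e e' = 0 ↔ e ≠ e' := by
  cases e <;> cases e' <;> simp [cc]

theorem pp_ne_zero {L : List (Bool × ℤ)} {e0 : Bool} (h : CRed L e0) : pp L e0 ≠ 0 := by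
  induction L with
  | nil => simp [pp]
  | cons p L ih =>
    obtain ⟨e, k⟩ := p
    refine mul_ne_zero ?_ (ih h.2)
    intro h0
    have h1 := congrArg (fun q => coeff q 0) h0
    have h2 := congrArg (fun q => coeff q 1) h0
    simp only [coeff_add, coeff_C_mul, coeff_C_zero, coeff_X_zero, mul_zero, add_zero,
      coeff_zero] at h1
    simp only [coeff_add, coeff_C_mul, coeff_C_succ, coeff_X_one, mul_one, zero_add,
      coeff_zero] at h2
    exact cc_eq_zero.1 h2 (h.1 h1)

theorem alt_of_natDegree_pp {L : List (Bool × ℤ)} {e0 : Bool} (h : CRed L e0)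
    (hd : (pp L e0).natDegree = 0) : Alt L e0 := by
  induction L with
  | nil => trivial
  | cons p L ih =>
    obtain ⟨e, k⟩ := p
    have h0 := pp_ne_zero h
    rw [pp] at hd h0
    rw [natDegree_mul (left_ne_zero_of_mul h0) (right_ne_zero_of_mul h0)] at hd
    have hc : cc e (nxt L e0) = 0 := by
      have := coeff_eq_zero_of_natDegree_lt (p := C k + C (cc e (nxt L e0)) * X) (n := 1) (by omega)
      simpa only [coeff_add, coeff_C_mul, coeff_C_succ, coeff_X_one, mul_one, zero_add]
        using this
    refine ⟨⟨cc_eq_zero.1 hc, ?_⟩, ih h.2 (by omega)⟩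
    rintro rfl
    apply left_ne_zero_of_mul h0
    rw [hc]; simp

theorem twl_sv (N : ℤ) (L : List (Bool × ℤ)) (e0 : Bool) :
    ((twl N L e0).map fun p => sv p.1) = L.map fun p => sv p.1 := by
  induction L with
  | nil => rfl
  | cons p L ih => obtain ⟨e, k⟩ := p; simp [twl, ih]

theorem twl_length (N : ℤ) (L : List (Bool × ℤ)) (e0 : Bool) :
    (twl N L e0).length = L.length := by
  induction L with
  | nil => rfl
  | cons p L ih => obtain ⟨e, k⟩ := p; simp [twl, ih]

theorem alt_of_isConj {L : List (Bool × ℤ)} (hL : L ≠ []) {e0 : Bool} (he : nxt L e0 = e0)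
    (h : CRed L e0) (hc : ∀ N : ℤ, IsConj (ev (of true) (of false * of true ^ N)
      (wd (of true) (of false) L)) (wd (of true) (of false) L)) : Alt L e0 := by
  apply alt_of_natDegree_pp h
  have key : pp L e0 = C ((L.map Prod.snd).prod) := by
    refine Polynomial.funext fun N => ?_
    rw [eval_pp, eval_C]
    have h1 : IsConj (wd (of true) (of false) (twl N L e0)) (wd (of true) (of false) L) := by
      refine IsConj.trans ?_ (hc N)
      rw [map_wd]
      have : ev (of true) (of false * of true ^ N) (of true) = (of true : FreeGroup Bool) := by
        simp [ev]
      rw [this]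
      have : ev (of true) (of false * of true ^ N) (of false) =
          (of false * of true ^ N : FreeGroup Bool) := by
        simp [ev]
      rw [this, wd_twl _ _ _ _ e0, he, zpow_neg]
      exact isConj_iff.2 ⟨(of true ^ (if e0 = true then 0 else N))⁻¹, by simp⟩
    have h2 := congrArg (fun q => coeff q L.length) (trace_R2_of_isConj h1)
    have hL' : twl N L e0 ≠ [] := by
      rw [← List.length_pos_iff, twl_length, List.length_pos_iff]; exact hL
    have h3 := coeff_trace_R2_wd hL'
    rw [twl_length] at h3
    rw [h3, coeff_trace_R2_wd hL, twl_sv] at h2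
    refine mul_left_cancel₀ ?_ h2
    refine List.prod_ne_zero ?_
    intro h0
    obtain ⟨p, -, hp⟩ := List.mem_map.1 h0
    revert hp
    cases p.1 <;> simp [sv]
  rw [key, natDegree_C]

/-- Conjugation to a word without cancellation. -/
theorem exists_cRed (u : FreeGroup Bool) : (∃ a : ℤ, IsConj u (of true ^ a)) ∨
    ∃ L e0, L ≠ [] ∧ nxt L e0 = e0 ∧ CRed L e0 ∧ IsConj u (wd (of true) (of false) L) := by
  classical
  have ex : ∃ n, ∃ (a : ℤ) (L : List (Bool × ℤ)), L.length = n ∧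
      IsConj u (of true ^ a * wd (of true) (of false) L) := by
    suffices h : ∃ (a : ℤ) (L : List (Bool × ℤ)), u = of true ^ a * wd (of true) (of false) L by
      obtain ⟨a, L, h⟩ := h
      exact ⟨L.length, a, L, rfl, by rw [h]⟩
    have h : ∀ u v : FreeGroup Bool,
        (∃ (a : ℤ) (L : List (Bool × ℤ)), v = of true ^ a * wd (of true) (of false) L) →
        ∃ (a : ℤ) (L : List (Bool × ℤ)), u * v = of true ^ a * wd (of true) (of false) L := by
      intro u
      induction u using FreeGroup.induction_on with
      | C1 => intro v h; rwa [one_mul]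
      | of b =>
        rintro v ⟨a, L, rfl⟩
        change ∃ a' L', of b * _ = _
        cases b
        · exact ⟨0, (true, a) :: L, by simp [wd_cons, sv, mul_assoc]⟩
        · exact ⟨1 + a, L, by rw [zpow_add, zpow_one, mul_assoc]⟩
      | inv_of b =>
        rintro v ⟨a, L, rfl⟩
        change ∃ a' L', (of b)⁻¹ * _ = _
        cases b
        · exact ⟨0, (false, a) :: L, by simp [wd_cons, sv, mul_assoc]⟩
        · exact ⟨-1 + a, L, by rw [zpow_add, zpow_neg, zpow_one, mul_assoc]⟩
      | mul x y hx hy => intro v h; rw [mul_assoc]; exact hx _ (hy _ h)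
    have := h u 1 ⟨0, [], by simp [wd_nil]⟩
    rwa [mul_one] at this
  obtain ⟨a, L, hL, hu⟩ := Nat.find_spec ex
  have hmin : ∀ (a' : ℤ) L', IsConj u (of true ^ a' * wd (of true) (of false) L') →
      L.length ≤ L'.length := fun a' L' h => by
    rw [hL]; exact Nat.find_min' ex ⟨a', L', rfl, h⟩
  clear hL
  rcases List.eq_nil_or_concat L with rfl | ⟨M, ⟨e, k⟩, rfl⟩
  · left; exact ⟨a, by simpa [wd_nil] using hu⟩
  right
  rw [List.concat_eq_append] at *
  set L := M ++ [(e, k + a)] with hLdef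
  have hlen : L.length = (M ++ [(e, k)]).length := by simp [hLdef]
  have huL : IsConj u (wd (of true) (of false) L) := by
    refine hu.trans (isConj_iff.2 ⟨(of true ^ a)⁻¹, ?_⟩)
    rw [hLdef, wd_append, wd_append, wd_cons, wd_cons, wd_nil, zpow_add]
    group
  have hne : L ≠ [] := by simp [hLdef]
  refine ⟨L, nxt L true, hne, ?_, ?_, huL⟩
  · cases h : L with
    | nil => exact absurd h hne
    | cons p L => rfl
  by_contra hred
  have hsplit : ∀ (L : List (Bool × ℤ)) e0, ¬ CRed L e0 →
      ∃ L1 e L2, L = L1 ++ (e, 0) :: L2 ∧ e ≠ nxt L2 e0 := by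
    intro L e0
    induction L with
    | nil => intro h; exact absurd trivial h
    | cons p L ih =>
      obtain ⟨e, k⟩ := p
      intro h
      by_cases h1 : k = 0 → e = nxt L e0
      · obtain ⟨L1, e', L2, rfl, h2⟩ := ih fun h2 => h ⟨h1, h2⟩
        exact ⟨(e, k) :: L1, e', L2, rfl, h2⟩
      · push Not at h1
        exact ⟨[], e, L, by rw [h1.1]; rfl, h1.2⟩
  obtain ⟨L1, e', L2, e1, e2⟩ := hsplit _ _ hred
  have hnx : nxt (L2 ++ L1) e' ≠ e' := by
    intro h
    apply e2
    rcases L2 with _ | ⟨p, L2⟩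
    · rcases L1 with _ | ⟨q, L1⟩
      · rw [e1]; rfl
      · rw [e1]; exact h.symm
    · exact h.symm
  have hrot : IsConj u (wd (of true) (of false) ((e', 0) :: (L2 ++ L1))) := by
    refine huL.trans (isConj_iff.2 ⟨(wd (of true) (of false) L1)⁻¹, ?_⟩)
    rw [e1, wd_append, wd_cons, wd_cons, wd_append]
    group
  have hll : L.length = (L2 ++ L1).length + 1 := by rw [e1]; simp; omega
  rcases h : L2 ++ L1 with _ | ⟨⟨e'', k''⟩, L3⟩
  · rw [h] at hnx; exact hnx rfl
  · rw [h] at hrot hnx hll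
    have h3 : e'' ≠ e' := hnx
    have h4 := hmin k'' L3 (by
      rw [wd_cons, wd_cons] at hrot
      have : (of false : FreeGroup Bool) ^ sv e' * of true ^ (0 : ℤ) *
          (of false ^ sv e'' * of true ^ k'' * wd (of true) (of false) L3) =
          of true ^ k'' * wd (of true) (of false) L3 := by
        revert h3
        cases e' <;> cases e'' <;> simp [sv, mul_assoc]
      rwa [this] at hrot)
    rw [← hlen, hll] at h4
    simp at h4

/-- The same word, with the roles of the letters exchanged. -/
def sw : List (Bool × ℤ) → Bool → List (Bool × ℤ)
  | [], _ => []
  | (_, k) :: L, e0 => List.replicate (k.natAbs - 1) (decide (0 < k), 0) ++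
      (decide (0 < k), sv (nxt L e0)) :: sw L e0

/-- The sign of the first exponent of a list, with a default value. -/
def nxs : List (Bool × ℤ) → Bool → Bool
  | [], s0 => s0
  | (_, k) :: _, _ => decide (0 < k)

/-- Signs and exponents alternate between `1` and `-1`. -/
def Alt2 : List (Bool × ℤ) → Bool → Bool → Prop
  | [], _, _ => True
  | (e, k) :: L, e0, s0 =>
      (e ≠ nxt L e0 ∧ k = sv (decide (0 < k)) ∧ decide (0 < k) ≠ nxs L s0) ∧ Alt2 L e0 s0

theorem nxt_replicate (n : ℕ) (s s0 : Bool) (t : ℤ) (M : List (Bool × ℤ)) :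
    nxt (List.replicate n (s, 0) ++ (s, t) :: M) s0 = s := by
  cases n <;> rfl

theorem nxt_sw (L : List (Bool × ℤ)) (e0 s0 : Bool) : nxt (sw L e0) s0 = nxs L s0 := by
  rcases L with _ | ⟨⟨e, k⟩, L⟩
  · rfl
  · rw [sw, nxt_replicate]; rfl

theorem cRed_replicate (n : ℕ) (s s0 : Bool) (t : ℤ) (ht : t ≠ 0) (M : List (Bool × ℤ))
    (hM : CRed M s0) : CRed (List.replicate n (s, 0) ++ (s, t) :: M) s0 := by
  induction n with
  | zero => exact ⟨fun h => absurd h ht, hM⟩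
  | succ n ih => exact ⟨fun _ => (nxt_replicate n s s0 t M).symm, ih⟩

theorem sv_ne_zero (b : Bool) : sv b ≠ 0 := by cases b <;> simp [sv]

theorem cRed_sw (L : List (Bool × ℤ)) (e0 s0 : Bool) : CRed (sw L e0) s0 := by
  induction L with
  | nil => trivial
  | cons p L ih =>
    obtain ⟨e, k⟩ := p
    exact cRed_replicate _ _ _ _ (sv_ne_zero _) _ ih

theorem eq_sv_mul_natAbs (k : ℤ) : k = sv (decide (0 < k)) * k.natAbs := by
  rcases lt_or_ge 0 k with h | h
  · simp only [sv, decide_eq_true_eq, h, if_true]; omega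
  · simp only [sv, decide_eq_true_eq, not_lt.2 h, if_false]; omega

theorem alt2_of_alt {L : List (Bool × ℤ)} {e0 s0 : Bool} (h : Alt L e0) (h' : Alt (sw L e0) s0) :
    Alt2 L e0 s0 := by
  induction L with
  | nil => trivial
  | cons p L ih =>
    obtain ⟨e, k⟩ := p
    rw [sw] at h'
    have hk := eq_sv_mul_natAbs k
    have hk0 : k ≠ 0 := h.1.2
    rcases hn : k.natAbs - 1 with _ | n
    · rw [hn] at h'
      have h2 : k.natAbs = 1 := by omega
      rw [h2, Nat.cast_one, mul_one] at hk
      refine ⟨⟨h.1.1, hk, ?_⟩, ih h.2 h'.2⟩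
      rw [← nxt_sw L e0 s0]
      exact h'.1.1
    · rw [hn] at h'
      exact absurd rfl h'.1.2

theorem wd_sw {G : Type*} [Group G] (x y : G) {L : List (Bool × ℤ)} {e0 : Bool} (h : Alt L e0) :
    wd x y L = y ^ sv (nxt L e0) * wd y x (sw L e0) * (y ^ sv e0)⁻¹ := by
  induction L with
  | nil => simp [wd_nil, sw, nxt]
  | cons p L ih =>
    obtain ⟨e, k⟩ := p
    have hr : ∀ n s, wd y x (List.replicate n (s, 0)) = (x ^ sv s) ^ n := by
      intro n s; simp [wd]
    have hx : x ^ k = (x ^ sv (decide (0 < k))) ^ (k.natAbs - 1) * x ^ sv (decide (0 < k)) := by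
      have hk0 : k ≠ 0 := h.1.2
      rw [← pow_succ, Nat.sub_add_cancel (by omega), ← zpow_natCast, ← zpow_mul,
        ← eq_sv_mul_natAbs]
    rw [wd_cons, ih h.2, sw, wd_append, hr, wd_cons, hx]
    simp only [nxt, mul_assoc]

theorem wd_of_alt2 {G : Type*} [Group G] (x y : G) (e s : Bool) : ∀ (n : ℕ) (L : List (Bool × ℤ)),
    L.length ≤ n → nxt L e = e → nxs L s = s → Alt2 L e s →
    ∃ p : ℕ, wd x y L = ⁅y ^ sv e, x ^ sv s⁆ ^ p := by
  intro n
  induction n with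
  | zero =>
    intro L hL _ _ _
    obtain rfl : L = [] := List.length_eq_zero_iff.1 (by omega)
    exact ⟨0, by simp [wd_nil]⟩
  | succ n ih =>
    intro L hL h1 h2 h3
    rcases L with _ | ⟨⟨e1, k1⟩, _ | ⟨⟨e2, k2⟩, L⟩⟩
    · exact ⟨0, by simp [wd_nil]⟩
    · exact absurd h1 h3.1.1
    · obtain ⟨⟨a1, a2, a3⟩, ⟨b1, b2, b3⟩, h4⟩ := h3
      have h1 : e1 = e := h1
      have h2 : decide (0 < k1) = s := h2
      change e1 ≠ e2 at a1
      change decide (0 < k1) ≠ decide (0 < k2) at a3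
      rw [h1] at a1
      rw [h2] at a2 a3
      have c1 : nxt L e = e := by revert a1 b1; cases e <;> cases e2 <;> cases nxt L _ <;> simp
      have c2 : nxs L s = s := by
        revert a3 b3
        generalize decide (0 < k2) = t
        cases s <;> cases t <;> cases nxs L _ <;> simp
      obtain ⟨p, hp⟩ := ih L (by simp at hL; omega) c1 c2 h4
      refine ⟨p + 1, ?_⟩
      rw [wd_cons, wd_cons, hp, h1, a2, b2, pow_succ', commutatorElement_def]
      have d1 : sv e2 = - sv e := by revert a1; cases e <;> cases e2 <;> simp [sv]
      have d2 : sv (decide (0 < k2)) = - sv s := by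
        revert a3
        generalize decide (0 < k2) = t
        cases s <;> cases t <;> simp [sv]
      rw [d1, d2]
      group

theorem isConj_commutator {G : Type*} [Group G] (x y : G) (e s : Bool) :
    ∃ k : ℤ, IsConj ⁅y ^ sv e, x ^ sv s⁆ (⁅x, y⁆ ^ k) := by
  cases e <;> cases s
  · exact ⟨-1, isConj_iff.2 ⟨x * y, by simp [sv, commutatorElement_def]; group⟩⟩
  · exact ⟨1, isConj_iff.2 ⟨y, by simp [sv, commutatorElement_def]; group⟩⟩
  · exact ⟨1, isConj_iff.2 ⟨x, by simp [sv, commutatorElement_def]; group⟩⟩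
  · exact ⟨-1, isConj_iff.2 ⟨1, by simp [sv, commutatorElement_def, mul_assoc]⟩⟩

/-- A conjugacy class of the free group of rank two invariant under transvections is that of a
power of the commutator of the generators. -/
theorem exists_isConj_commutator {u : FreeGroup Bool}
    (h1 : ∀ N : ℤ, IsConj (ev (of true) (of false * of true ^ N) u) u)
    (h2 : ∀ N : ℤ, IsConj (ev (of true * of false ^ N) (of false) u) u) :
    ∃ k : ℤ, IsConj u (⁅of true, of false⁆ ^ k) := by
  have hx : ∀ x y : FreeGroup Bool, ev x y (of true) = x := fun x y => by simp [ev]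
  have hy : ∀ x y : FreeGroup Bool, ev x y (of false) = y := fun x y => by simp [ev]
  rcases exists_cRed u with ⟨a, ha⟩ | ⟨L, e0, hL, he, hr, hu⟩
  · refine ⟨0, ?_⟩
    have h3 := ((isConj_map_of_isConj _ ha).symm.trans (h2 1)).trans ha
    have h4 := isConj_map_of_isConj exF h3
    rw [map_zpow, hx, map_zpow, map_zpow, map_mul, map_zpow, isConj_iff_eq] at h4
    have h5 := congrArg Multiplicative.toAdd h4
    have : a = 0 := by simpa [exF, ev] using h5
    rw [zpow_zero]
    rwa [this, zpow_zero] at ha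
  · have hA : Alt L e0 := alt_of_isConj hL he hr fun N =>
      ((isConj_map_of_isConj _ hu).symm.trans (h1 N)).trans hu
    set s : FreeGroup Bool →* FreeGroup Bool := ev (of false) (of true) with hs
    have hw := wd_sw (of true) (of false : FreeGroup Bool) hA
    have hu2 : IsConj u (wd (of false) (of true) (sw L e0)) := by
      refine hu.trans ?_
      rw [hw, he]
      exact isConj_iff.2 ⟨(of false ^ sv e0)⁻¹, by group⟩
    have hss : s (wd (of false) (of true) (sw L e0)) = wd (of true) (of false) (sw L e0) := by
      rw [map_wd, hs, hx, hy]
    have hu3 : IsConj (s u) (wd (of true) (of false) (sw L e0)) := by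
      rw [← hss]; exact isConj_map_of_isConj s hu2
    have hne : sw L e0 ≠ [] := by
      rcases L with _ | ⟨⟨e, k⟩, L⟩
      · exact absurd rfl hL
      · simp [sw]
    obtain ⟨s0, hs0⟩ : ∃ s0, nxs L s0 = s0 := by
      rcases L with _ | ⟨⟨e, k⟩, L⟩
      · exact absurd rfl hL
      · exact ⟨decide (0 < k), rfl⟩
    have hA' : Alt (sw L e0) s0 := by
      refine alt_of_isConj hne (by rw [nxt_sw, hs0]) (cRed_sw _ _ _) fun N => ?_
      refine ((isConj_map_of_isConj _ hu3).symm.trans ?_).trans hu3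
      have := isConj_map_of_isConj s (h2 N)
      rw [map_ev, map_mul, map_zpow] at this
      rw [hs, map_ev, hx, hy]
      rw [hs, hx, hy] at this
      have e1 : ev (of false * of true ^ N) (of true) u =
        ev (of false * of true ^ N) (of true : FreeGroup Bool) u := rfl
      exact this
    obtain ⟨p, hp⟩ := wd_of_alt2 (of true) (of false : FreeGroup Bool) e0 s0 _ L le_rfl he hs0
      (alt2_of_alt hA hA')
    obtain ⟨k, hk⟩ := isConj_commutator (of true) (of false : FreeGroup Bool) e0 s0
    refine ⟨k * p, hu.trans ?_⟩
    rw [hp, zpow_mul, zpow_natCast]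
    obtain ⟨c, hc⟩ := isConj_iff.1 hk
    exact isConj_iff.2 ⟨c, by rw [← hc, conj_pow]⟩

end Br

namespace Br

open FreeGroup (of)

variable {m : ℕ}

theorem len_fix_ne {k : ℤ} (hm : 1 ≤ m) (h : len m (zt m ^ k) = 1) : k = 0 := by
  rw [map_zpow, len_zt] at h
  have h := congrArg Multiplicative.toAdd h
  rw [toAdd_zpow, toAdd_ofAdd, toAdd_one, smul_eq_mul] at h
  have hm' : (1 : ℤ) ≤ m := by exact_mod_cast hm
  rcases mul_eq_zero.1 h with h | h
  · exact h
  · exact absurd h (by positivity)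

theorem perm_zt_zpow (k : ℤ) : perm m (zt m ^ k) = 1 := by rw [map_zpow, perm_zt, one_zpow]

/-- Pure braids on `m + 2` strands commuting with the braids on the first `m + 1` strands. -/
theorem eq_push_T_zpow_mul {z : Br (m + 1)} (hz : perm (m + 1) z = 1)
    (hc : ∀ b, Commute z (incl m b)) :
    ∃ l k : ℤ, z = push m (T (m + 1) ^ l) * incl m (zt m ^ k) := by
  obtain ⟨⟨w, b⟩, h1, h2, h3⟩ := exists_J_pure hz
  rw [J_apply] at h2
  have hw : trunc (m + 1) w = w := by
    have := congrArg SemidirectProduct.left h1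
    rwa [truncG_apply] at this
  change push m w * incl m b = z at h2
  have key : ∀ b', artin m b' w = w ∧ b' * b * b'⁻¹ = b := by
    intro b'
    have h4 : push m (artin m b' w) * incl m (b' * b * b'⁻¹) = push m w * incl m b := by
      rw [push_artin, map_mul, map_mul, map_inv, h2]
      have := (hc b').eq
      rw [← h2] at this ⊢
      rw [eq_comm, ← mul_inv_eq_iff_eq_mul.2 this.symm]
      group
    obtain ⟨h5, h6⟩ := decomp_unique h4
    rw [trunc_artin _ _ (by omega), hw] at h5
    exact ⟨h5, h6⟩
  obtain ⟨k, hk⟩ := eq_zt_zpow_of_commute_pure (b := b) h3 fun p _ => by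
    have := (key p).2
    rw [mul_inv_eq_iff_eq_mul] at this
    exact this.symm
  have h7 := (key (zt m)).1
  rw [artin_zt hw] at h7
  obtain ⟨l, hl⟩ := eq_zpow_T_of_commute (n := m + 1) (by omega) one_ne_zero (u := w) (by
    rw [zpow_one]
    rw [mul_assoc, inv_mul_eq_iff_eq_mul] at h7
    exact h7)
  exact ⟨l, k, by rw [← h2, hk, hl]⟩

theorem lk_push_T_zpow_mul_last (l k : ℤ) {i : ℕ} (hi : i ≤ m) :
    lk (push m (T (m + 1) ^ l) * incl m (zt m ^ k)) i (m + 1) = 2 * l := by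
  rw [lk_mul_of_pure _ _ (by rw [perm_incl, perm_zt_zpow]), lk_incl,
    lk_eq_zero_of_lt (by omega), zero_add, lk_push_last _ hi, map_zpow, ex_T, if_pos (by omega)]
  simp

theorem lk_push_T_zpow_mul (l k : ℤ) {i j : ℕ} (hij : i < j) (hj : j ≤ m) :
    lk (push m (T (m + 1) ^ l) * incl m (zt m ^ k)) i j = 2 * k := by
  rw [lk_mul_of_pure _ _ (by rw [perm_incl, perm_zt_zpow]), lk_incl,
    lk_push_of_le _ (by omega) hj, add_zero, lk_zpow_of_pure _ perm_zt, lk_zt hij hj, mul_comm]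

/-- An endomorphism over the symmetric group fixing most generators is inner. -/
theorem exists_conj_of_fix {m' : ℕ} (hm : 1 ≤ m') (f : Br (m' + 1 + 1) →* Br (m' + 1 + 1))
    (hp : ∀ b, perm (m' + 1 + 1) (f b) = perm (m' + 1 + 1) b)
    (hf : ∀ b, f (incl (m' + 1) b) = incl (m' + 1) b) :
    ∃ c, perm (m' + 1 + 1) c = 1 ∧ ∀ b, f b = c * b * c⁻¹ := by
  set s := sig (m' + 1 + 1) (m' + 1) with hs
  have hps : perm (m' + 1 + 1) s = Equiv.swap (m' + 1) (m' + 1 + 1) := perm_sig (by omega)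
  set v := f s with hv
  have hpv : perm (m' + 1 + 1) v = Equiv.swap (m' + 1) (m' + 1 + 1) := by rw [hv, hp, hps]
  -- lengths are preserved
  have hlen : ∀ b, len (m' + 1 + 1) (f b) = len (m' + 1 + 1) b := by
    intro b
    have h1 := map_eq_zpow_len ((len (m' + 1 + 1)).comp f) b
    have h2 : f (sig (m' + 1 + 1) 0) = sig (m' + 1 + 1) 0 := by
      rw [← incl_sig (by omega), hf]
    rw [MonoidHom.comp_apply, MonoidHom.comp_apply, h2, len_sig (by omega), ← ofAdd_zsmul] at h1
    rw [h1]; simp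
  -- the full twist
  have hz : f (zt (m' + 1 + 1)) = zt (m' + 1 + 1) := by
    have hz1 : perm (m' + 1 + 1) (f (zt (m' + 1 + 1))) = 1 := by rw [hp, perm_zt]
    obtain ⟨l, k, hlk⟩ := eq_push_T_zpow_mul hz1 fun b => by
      rw [← hf b]; exact (zt_comm _).map f
    have hcv : v * f (zt (m' + 1 + 1)) * v⁻¹ = f (zt (m' + 1 + 1)) := by
      rw [hv, ((zt_comm s).map f).symm.eq]; group
    have h1 := lk_conj v _ hz1 0 (m' + 1)
    rw [hcv, hpv, Equiv.swap_apply_left, Equiv.swap_apply_of_ne_of_ne (by omega) (by omega),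
      hlk, lk_push_T_zpow_mul_last _ _ (by omega), lk_push_T_zpow_mul _ _ (by omega) le_rfl] at h1
    obtain rfl : l = k := by omega
    rw [← zt_succ_zpow] at hlk
    have h2 : len (m' + 1 + 1) (zt (m' + 1 + 1) ^ (l - 1)) = 1 := by
      rw [zpow_sub_one, map_mul, map_inv, ← hlk, hlen, mul_inv_cancel]
    have h3 := len_fix_ne (by omega) h2
    rw [hlk, show l = 1 by omega, zpow_one]
  have hfT : f (push (m' + 1) (T (m' + 1 + 1))) = push (m' + 1) (T (m' + 1 + 1)) := by
    have h1 : push (m' + 1) (T (m' + 1 + 1)) = (incl (m' + 1) (zt (m' + 1)))⁻¹ * zt (m' + 1 + 1) := by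
      rw [zt_succ (m := m' + 1), inv_mul_cancel_left]
    rw [h1, map_mul, map_inv, hf, hz]
  -- the square of the image of the last generator
  have hv2 : perm (m' + 1 + 1) (v ^ 2) = 1 := by
    rw [map_pow, hpv, pow_two, Equiv.swap_mul_self]
  have hlk2 : ∀ i j, lk (v ^ 2) i j = lk (s ^ 2) i j := by
    intro i j
    set s' := sig (m' + 1 + 1) m' with hs'
    have hfs' : f s' = s' := by rw [hs', ← incl_sig (by omega), hf]
    have hb : s' * s * s' = s * s' * s := sig_braid (by omega)
    have hb' : s' * v * s' = v * s' * v := by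
      have := congrArg f hb
      simpa only [map_mul, hfs'] using this
    have e1 : ∀ x : Br (m' + 1 + 1), s' * x * s' = x * s' * x → x ^ 2 = (s' * x) * s' ^ 2 * (s' * x)⁻¹ := by
      intro x hx
      have h1 : (s' * x) * s' = x * (s' * x) := by rw [hx, mul_assoc]
      have h2 : x = (s' * x) * s' * (s' * x)⁻¹ := by rw [h1]; group
      conv_lhs => rw [h2]
      rw [conj_pow]
    have hps' : perm (m' + 1 + 1) (s' ^ 2) = 1 := by
      rw [map_pow, hs', perm_sig (by omega), pow_two, Equiv.swap_mul_self]
    have hpg : perm (m' + 1 + 1) (s' * v) = perm (m' + 1 + 1) (s' * s) := by rw [map_mul, map_mul, hpv, hps]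
    obtain ⟨i, rfl⟩ := (perm (m' + 1 + 1) (s' * v)).surjective i
    obtain ⟨j, rfl⟩ := (perm (m' + 1 + 1) (s' * v)).surjective j
    rw [e1 v hb', lk_conj _ _ hps', hpg, e1 s hb, lk_conj _ _ hps']
  obtain ⟨⟨p, r⟩, ht, hpr, hr⟩ := exists_J_pure hv2
  have hpt : trunc (m' + 1 + 1) p = p := by
    have := congrArg SemidirectProduct.left ht
    rwa [truncG_apply] at this
  rw [J_apply] at hpr
  change push (m' + 1) p * incl (m' + 1) r = v ^ 2 at hpr
  change perm (m' + 1) r = 1 at hr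
  have hcomm : ∀ b : Br m', Commute (incl (m' + 1) (incl m' b)) (v ^ 2) := by
    intro b
    have h1 : Commute (incl (m' + 1) (incl m' b)) s := by
      induction b using Br.induction with
      | one => simp
      | gen k hk =>
        rw [incl_sig (by omega), incl_sig (by omega)]
        exact sig_comm (by omega)
      | mul a b ha hb => rw [map_mul, map_mul]; exact ha.mul_left hb
      | inv a ha => rw [map_inv, map_inv]; exact ha.inv_left
    have h2 := h1.map f
    rw [hf] at h2
    exact h2.pow_right 2
  have hfix : ∀ b : Br m', artin (m' + 1) (incl m' b) p = p ∧ incl m' b * r * (incl m' b)⁻¹ = r := by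
    intro b
    have h4 : push (m' + 1) (artin (m' + 1) (incl m' b) p) * incl (m' + 1) (incl m' b * r * (incl m' b)⁻¹) =
        push (m' + 1) p * incl (m' + 1) r := by
      rw [push_artin, map_mul, map_mul, map_inv, hpr]
      have := (hcomm b).eq
      rw [← hpr] at this ⊢
      rw [eq_comm, ← mul_inv_eq_iff_eq_mul.2 this]
      group
    obtain ⟨h5, h6⟩ := decomp_unique h4
    rw [trunc_artin _ _ (by omega), hpt] at h5
    exact ⟨h5, h6⟩
  have hr1 : r = 1 := by
    obtain ⟨l, k, hlk⟩ := eq_push_T_zpow_mul (m := m') hr fun b => by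
      have := (hfix b).2
      rw [mul_inv_eq_iff_eq_mul] at this
      exact this.symm
    have h0 : ∀ i j, i < j → j ≤ (m' + 1) → lk r i j = 0 := by
      intro i j hij hj
      have h1 := hlk2 i j
      rw [← hpr, lk_mul_of_pure _ _ (by rw [perm_incl, hr]), lk_push_of_le _ (by omega) hj,
        lk_incl, add_zero, pow_two, lk_mul, hps, lk_sig (by omega), lk_sig (by omega)] at h1
      rw [h1, if_neg (by omega), if_neg, add_zero]
      rw [Equiv.swap_apply_def, Equiv.swap_apply_def]
      split_ifs <;> omega
    have h1 := h0 0 (m' + 1) (by omega) le_rfl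
    rw [hlk, lk_push_T_zpow_mul_last _ _ (by omega)] at h1
    have h2 := h0 0 1 (by omega) (by omega)
    rw [hlk, lk_push_T_zpow_mul _ _ (by omega) (by omega)] at h2
    rw [hlk, show l = 0 by omega, show k = 0 by omega]
    simp
  rw [hr1, map_one, mul_one] at hpr
  -- the image of the last free generator
  obtain ⟨W, hW⟩ : ∃ W, p = ev (of (m' + 1)) (T (m' + 1 + 1)) W := by
    apply exists_ev_of_mem_closure
    have h1 : p ∈ Subgroup.closure {T (m' + 1), of (m' + 1)} :=
      mem_closure_of_artin_zt_eq hpt (by rw [← artin_incl]; exact (hfix (zt m')).1)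
    refine (Subgroup.closure_le _).2 ?_ h1
    rintro y (rfl | rfl)
    · have : T (m' + 1) = (of (m' + 1))⁻¹ * T (m' + 1 + 1) := by rw [T_succ (m' + 1)]; group
      rw [this]
      exact mul_mem (inv_mem (Subgroup.subset_closure (by simp)))
        (Subgroup.subset_closure (by simp))
    · exact Subgroup.subset_closure (by simp)
  have hexp : ∀ i ≤ (m' + 1), lk (s ^ 2) i (m' + 1 + 1) = 2 * Multiplicative.toAdd (ex i p) := by
    intro i hi
    rw [← hlk2, ← hpr, lk_push_last _ hi]
  have hFT : exF W = 1 ∧ exT W = Multiplicative.ofAdd 1 := by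
    have h0 := hexp 0 (by omega)
    have h1 := hexp (m' + 1) le_rfl
    have hA : ∀ W : FreeGroup Bool, ev 1 (Multiplicative.ofAdd (1 : ℤ)) W = exF W := fun _ => rfl
    have hB : ∀ W : FreeGroup Bool, ev (Multiplicative.ofAdd (1 : ℤ)) (Multiplicative.ofAdd 1) W =
        exF W * exT W := by
      intro W
      have : ev (Multiplicative.ofAdd (1 : ℤ)) (Multiplicative.ofAdd 1) = exF * exT := by
        refine FreeGroup.ext_hom _ _ fun b => ?_
        cases b <;> simp [ev, exF, exT]
      rw [this]; rfl
    rw [hW, map_ev, ex_T, if_pos (by omega), ex_of_ne (by omega), hA, pow_two, lk_mul, hps,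
      lk_sig (by omega), lk_sig (by omega), if_neg (by omega), if_neg (by
        rw [Equiv.swap_apply_of_ne_of_ne (by omega) (by omega), Equiv.swap_apply_right]
        omega)] at h0
    have hF : exF W = 1 := by
      apply Multiplicative.toAdd.injective
      rw [toAdd_one]; omega
    rw [hW, map_ev, ex_T, if_pos (by omega), ex_of_self, hB, hF, one_mul, pow_two, lk_mul, hps,
      lk_sig (by omega), lk_sig (by omega), if_pos (by omega), if_pos (by
        rw [Equiv.swap_apply_left, Equiv.swap_apply_right]; simp)] at h1
    refine ⟨hF, ?_⟩
    apply Multiplicative.toAdd.injective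
    rw [toAdd_ofAdd]; omega
  -- the images of the other free generators
  have hfa : ∀ j ≤ (m' + 1), f (push (m' + 1) (of (m' + 1 - j))) = push (m' + 1) (ev (of (m' + 1 - j)) (T (m' + 1 + 1)) W) := by
    intro j
    induction j with
    | zero =>
      intro _
      rw [Nat.sub_zero, ← hW, hpr, hv, ← map_pow, push_of le_rfl, braidA, tau_last]
      simp [hs]
    | succ j ih =>
      intro hj
      have e1 : artin (m' + 1) (sig (m' + 1) (m' + 1 - (j + 1))) (of (m' + 1 - j)) = of (m' + 1 - (j + 1)) := by
        rw [artin_sig_of (by omega), if_neg (by omega), if_pos (by omega)]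
      have e2 : ∀ w, push (m' + 1) (artin (m' + 1) (sig (m' + 1) (m' + 1 - (j + 1))) w) =
        incl (m' + 1) (sig (m' + 1) (m' + 1 - (j + 1))) * push (m' + 1) w * (incl (m' + 1) (sig (m' + 1) (m' + 1 - (j + 1))))⁻¹ :=
        push_artin _
      have e3 : artin (m' + 1) (sig (m' + 1) (m' + 1 - (j + 1))) (ev (of (m' + 1 - j)) (T (m' + 1 + 1)) W) =
          ev (of (m' + 1 - (j + 1))) (T (m' + 1 + 1)) W := by
        have := map_ev (artin (m' + 1) (sig (m' + 1) (m' + 1 - (j + 1)))).toMonoidHom (of (m' + 1 - j)) (T (m' + 1 + 1)) W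
        refine this.trans ?_
        change ev (artin (m' + 1) _ _) (artin (m' + 1) _ _) W = _
        rw [e1, artin_T _ (by omega)]
      rw [← e3, e2, ← ih (by omega), ← e1, e2, map_mul, map_mul, map_inv, hf]
  have hfa : ∀ j ≤ (m' + 1), f (push (m' + 1) (of j)) = push (m' + 1) (ev (of j) (T (m' + 1 + 1)) W) := by
    intro j hj
    have := hfa (m' + 1 - j) (by omega)
    rwa [Nat.sub_sub_self hj] at this
  set φ : Fr →* Fr := FreeGroup.lift fun k =>
    if k ≤ (m' + 1) then ev (of k) (T (m' + 1 + 1)) W else 1 with hφ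
  have hφ_of : ∀ k ≤ (m' + 1), φ (of k) = ev (of k) (T (m' + 1 + 1)) W := by
    intro k hk; simp [hφ, hk]
  have hfφ : ∀ w, f (push (m' + 1) w) = push (m' + 1) (φ w) := by
    intro w
    have : f.comp (push (m' + 1)) = (push (m' + 1)).comp φ := by
      refine FreeGroup.ext_hom _ _ fun k => ?_
      rw [MonoidHom.comp_apply, MonoidHom.comp_apply]
      by_cases hk : k ≤ (m' + 1)
      · rw [hfa k hk, hφ_of k hk]
      · rw [push_of_gt (by omega)]; simp [hφ, hk]
    exact DFunLike.congr_fun this w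
  have htφ : ∀ w, trunc (m' + 1 + 1) (φ w) = φ w := by
    intro w
    have : (trunc (m' + 1 + 1)).comp φ = φ := by
      refine FreeGroup.ext_hom _ _ fun k => ?_
      rw [MonoidHom.comp_apply]
      by_cases hk : k ≤ (m' + 1)
      · rw [hφ_of k hk, map_ev, trunc_T le_rfl, trunc_of (by omega)]
      · simp [hφ, hk]
    exact DFunLike.congr_fun this w
  have hφT : φ (T (m' + 1 + 1)) = T (m' + 1 + 1) := by
    apply push_inj (htφ _) (trunc_T le_rfl)
    rw [← hfφ, hfT]
  have hWW : ev (of 0 : Fr) (of 2) W * ev (of 1) (of 2) W = ev (of 0 * of 1) (of 2) W := by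
    have hE1 : ∀ t : Fr, ev 1 t W = 1 := by
      intro t
      have : (zpowersHom Fr t).comp exF = ev 1 t := by
        refine FreeGroup.ext_hom _ _ fun b => ?_
        cases b <;> simp [ev, exF]
      rw [← this, MonoidHom.comp_apply, hFT.1, map_one]
    have key : ∀ x1 x2 t : Fr, ev (t * (x1 * x2)⁻¹) t W * ev x1 t W * ev x2 t W = t := by
      intro x1 x2 t
      set θ : Fr →* Fr := FreeGroup.lift fun k => if k = 0 then x2 else if k = 1 then x1 else
        if k = 2 then t * (x1 * x2)⁻¹ else 1 with hθ
      have h0 : θ (of 0) = x2 := by simp [hθ]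
      have h1 : θ (of 1) = x1 := by simp [hθ]
      have h2 : θ (of 2) = t * (x1 * x2)⁻¹ := by simp [hθ]
      have h3 : ∀ k, 3 ≤ k → θ (of k) = 1 := by
        intro k hk
        simp [hθ, show k ≠ 0 by omega, show k ≠ 1 by omega, show k ≠ 2 by omega]
      have hT3 : ∀ k, 3 ≤ k → θ (T k) = t := by
        intro k hk
        induction k, hk using Nat.le_induction with
        | base =>
          simp only [T_succ, T_zero, map_mul, h0, h1, h2, map_one]
          group
        | succ k hk ih => rw [T_succ, map_mul, h3 k hk, ih, one_mul]
      have hT3' : ∀ k, 3 ≤ k → k ≤ m' + 1 + 1 → θ (φ (T k)) =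
          ev (t * (x1 * x2)⁻¹) t W * ev x1 t W * ev x2 t W := by
        intro k hk
        induction k, hk using Nat.le_induction with
        | base =>
          intro _
          have e3 : T 3 = of 2 * (of 1 * of 0) := by simp [T_succ, T_zero]
          rw [e3, map_mul, map_mul, map_mul, map_mul, hφ_of 0 (by omega), hφ_of 1 (by omega),
            hφ_of 2 (by omega), map_ev, map_ev, map_ev, h0, h1, h2, hT3 _ (by omega), mul_assoc]
        | succ k hk ih =>
          intro hk'
          rw [T_succ, map_mul, map_mul, ih (by omega), hφ_of k (by omega), map_ev, h3 k hk,
            hE1, one_mul]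
      rw [← hT3' (m' + 1 + 1) (by omega) le_rfl, hφT, hT3 _ (by omega)]
    have k1 := key (of 0) (of 1) (of 2)
    have k2 := key 1 (of 0 * of 1) (of 2)
    rw [hE1, mul_one, one_mul] at k2
    exact mul_left_cancel (((mul_assoc _ _ _).symm.trans k1).trans k2.symm)
  obtain ⟨k, hk⟩ := eq_conj_of_mul hFT.1 hFT.2 hWW
  have hevW : ∀ x y : Fr, ev x y W = y ^ k * x * (y ^ k)⁻¹ := by
    intro x y; rw [hk]; simp [ev]
  -- conjugate
  set C := push (m' + 1) (T (m' + 1 + 1) ^ k) with hC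
  have hCc : ∀ b, Commute C (incl (m' + 1) b) := by
    intro b
    rw [hC, map_zpow]
    exact (incl_comm_push_T b).symm.zpow_left k
  have hCp : perm (m' + 1 + 1) C = 1 := perm_push _
  have hinc : ∀ b, f (incl (m' + 1) b) = C * incl (m' + 1) b * C⁻¹ := by
    intro b; rw [hf, (hCc b).eq]; group
  have hpure : ∀ q, perm (m' + 1 + 1) q = 1 → f q = C * q * C⁻¹ := by
    intro q hq
    obtain ⟨⟨w, b⟩, h1, h2, h3⟩ := exists_J_pure hq
    rw [J_apply] at h2
    change push (m' + 1) w * incl (m' + 1) b = q at h2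
    have : f.comp (push (m' + 1)) = (MulAut.conj C).toMonoidHom.comp (push (m' + 1)) := by
      refine FreeGroup.ext_hom _ _ fun k => ?_
      rw [MonoidHom.comp_apply, MonoidHom.comp_apply]
      by_cases hk : k ≤ (m' + 1)
      · rw [hfa k hk, hevW, map_mul, map_mul, map_inv]; rfl
      · rw [push_of_gt (by omega)]; simp
    have h4 : f (push (m' + 1) w) = C * push (m' + 1) w * C⁻¹ := DFunLike.congr_fun this w
    rw [← h2, map_mul, h4, hinc]; group
  refine ⟨C, hCp, ?_⟩
  set d := s⁻¹ * (C⁻¹ * v * C) with hd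
  obtain ⟨l, hl⟩ : ∃ l : ℤ, d = zt (m' + 1 + 1) ^ l := by
    apply eq_zt_zpow_of_commute_pure
    · rw [hd, map_mul, map_mul, map_mul, map_inv, map_inv, hps, hCp, hpv]; simp
    intro q hq
    have h1 := hpure (s * q * s⁻¹) (by rw [map_mul, map_mul, hq]; simp)
    rw [map_mul, map_mul, map_inv, ← hv, hpure q hq] at h1
    have h2 : d * q * d⁻¹ = q := by
      calc d * q * d⁻¹ = s⁻¹ * C⁻¹ * (v * (C * q * C⁻¹) * v⁻¹) * C * s := by rw [hd]; group
        _ = q := by rw [h1]; group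
    exact mul_inv_eq_iff_eq_mul.1 h2
  have hd1 : d = 1 := by
    have : l = 0 := by
      apply len_fix_ne (m := m' + 1 + 1) (by omega)
      rw [← hl, hd, map_mul, map_mul, map_mul, map_inv, map_inv, hv, hlen]
      simp
    rw [hl, this, zpow_zero]
  have hvs : v = C * s * C⁻¹ := by
    rw [hd, inv_mul_eq_one] at hd1
    rw [hd1]; group
  have : f = (MulAut.conj C).toMonoidHom := by
    refine hom_ext fun i hi => ?_
    rcases Nat.lt_succ_iff_lt_or_eq.1 hi with h | rfl
    · rw [← incl_sig h, hinc]; rfl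
    · exact hvs
  intro b
  rw [this]; rfl

end Br

namespace Br

open FreeGroup (of)

variable {m : ℕ}

theorem chi_incl (b : Br m) : chi (m + 1) (incl m b) = incl m (chi m b) := by
  have : (chi (m + 1)).comp (incl m) = (incl m).comp (chi m) := by
    refine hom_ext fun i hi => ?_
    rw [MonoidHom.comp_apply, MonoidHom.comp_apply, incl_sig hi, chi_sig (by omega), chi_sig hi,
      map_inv, incl_sig hi]
  exact DFunLike.congr_fun this b

theorem perm_chi (b : Br m) : perm m (chi m b) = perm m b := by
  have : (perm m).comp (chi m) = perm m := by
    refine hom_ext fun i hi => ?_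
    rw [MonoidHom.comp_apply, chi_sig hi, map_inv, perm_sig hi, Equiv.swap_inv]
  exact DFunLike.congr_fun this b

theorem len_chi (b : Br m) : len m (chi m b) = (len m b)⁻¹ := by
  have : (len m).comp (chi m) = (len m)⁻¹ := by
    refine hom_ext fun i hi => ?_
    rw [MonoidHom.comp_apply, chi_sig hi, map_inv, MonoidHom.inv_apply]
  exact DFunLike.congr_fun this b

theorem chi_zt (hm : 1 ≤ m) : chi m (zt m) = (zt m)⁻¹ := by
  obtain ⟨k, hk⟩ := eq_zt_zpow_of_commute_pure (b := chi m (zt m))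
    (by rw [perm_chi, perm_zt]) fun p _ => by
      have := (zt_comm (chi m p)).map (chi m)
      rwa [chi_chi] at this
  have h2 : len m (zt m ^ (k + 1)) = 1 := by
    rw [zpow_add_one, ← hk, map_mul, len_chi, inv_mul_cancel]
  have h3 := len_fix_ne hm h2
  rw [hk, show k = -1 by omega, zpow_neg_one]

/-- Multiplication of a homomorphism by central elements. -/
def twist {G : Type*} [Group G] (f : G →* Br m) (k : G →* Multiplicative ℤ) : G →* Br m where
  toFun b := f b * zt m ^ Multiplicative.toAdd (k b)
  map_one' := by simp
  map_mul' a b := by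
    rw [map_mul, map_mul, toAdd_mul, zpow_add]
    have := ((zt_comm (f b)).zpow_left (Multiplicative.toAdd (k a))).eq
    simp only [mul_assoc]
    rw [← mul_assoc (f b), ← this, mul_assoc]

theorem twist_apply {G : Type*} [Group G] (f : G →* Br m) (k : G →* Multiplicative ℤ) (b : G) :
    twist f k b = f b * zt m ^ Multiplicative.toAdd (k b) := rfl

/-- Either the identity or the inversion automorphism. -/
def chis (m : ℕ) (e : Bool) : Br m →* Br m := if e then chi m else MonoidHom.id _

theorem chis_chis (e : Bool) (b : Br m) : chis m e (chis m e b) = b := by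
  cases e <;> simp [chis, chi_chi]

theorem chis_incl (e : Bool) (b : Br m) : chis (m + 1) e (incl m b) = incl m (chis m e b) := by
  cases e <;> simp [chis, chi_incl]

theorem perm_chis (e : Bool) (b : Br m) : perm m (chis m e b) = perm m b := by
  cases e <;> simp [chis, perm_chi]

theorem exists_chis_zt_zpow (hm : 1 ≤ m) (e : Bool) (k : ℤ) :
    ∃ l : ℤ, chis m e (zt m ^ k) = zt m ^ l := by
  cases e
  · exact ⟨k, rfl⟩
  · exact ⟨-k, by simp [chis, chi_zt hm]⟩

/-- An endomorphism acting on the first generators as the identity up to central elements. -/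
theorem exists_conj_of_fix_mul {m' : ℕ} (hm : 1 ≤ m') (f : Br (m' + 1 + 1) →* Br (m' + 1 + 1))
    (hp : ∀ b, perm (m' + 1 + 1) (f b) = perm (m' + 1 + 1) b) (s : ℤ)
    (hf : ∀ i < m' + 1, f (sig (m' + 1 + 1) i) =
      incl (m' + 1) (sig (m' + 1) i * zt (m' + 1) ^ s)) :
    ∃ c, perm (m' + 1 + 1) c = 1 ∧ ∀ b, f b = c * b * c⁻¹ := by
  suffices hs : s = 0 by
    refine exists_conj_of_fix hm f hp fun b => ?_
    have : f.comp (incl (m' + 1)) = incl (m' + 1) := by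
      refine hom_ext fun i hi => ?_
      rw [MonoidHom.comp_apply, incl_sig hi, hf i hi, hs, zpow_zero, mul_one, incl_sig hi]
    exact DFunLike.congr_fun this b
  have hpp : perm (m' + 1) (sig (m' + 1) 0 ^ 2) = 1 := by
    rw [map_pow, perm_sig (by omega), pow_two, Equiv.swap_mul_self]
  have h1 : f (sig (m' + 1 + 1) 0 ^ 2) =
      incl (m' + 1) (sig (m' + 1) 0 ^ 2 * zt (m' + 1) ^ (s * 2)) := by
    rw [map_pow, hf 0 (by omega), ← map_pow,
      ((zt_comm (sig (m' + 1) 0)).zpow_left s).symm.mul_pow, zpow_mul, zpow_ofNat]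
  have hpz : perm (m' + 1 + 1) (f (sig (m' + 1 + 1) 0 ^ 2)) = 1 := by
    rw [h1, perm_incl, map_mul, hpp, perm_zt_zpow, one_mul]
  have h2 := lk_conj (f (sig (m' + 1 + 1) (m' + 1))) _ hpz 0 (m' + 1)
  have hc : Commute (sig (m' + 1 + 1) 0 ^ 2) (sig (m' + 1 + 1) (m' + 1)) :=
    (sig_comm (by omega)).pow_left 2
  rw [← (hc.map f).eq, mul_inv_cancel_right, hp, perm_sig (by omega), Equiv.swap_apply_left,
    Equiv.swap_apply_of_ne_of_ne (by omega) (by omega), h1, lk_incl, lk_incl,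
    lk_eq_zero_of_lt (by omega), lk_mul_of_pure _ _ (perm_zt_zpow _),
    lk_zpow_of_pure _ perm_zt, lk_zt (by omega) le_rfl, pow_two, lk_mul,
    perm_sig (by omega), lk_sig (by omega), lk_sig (by omega), if_neg (by omega),
    if_neg (by
      rw [Equiv.swap_apply_left, Equiv.swap_apply_of_ne_of_ne (by omega) (by omega)]; omega)] at h2
  omega

theorem apply_of_commute_swap {α : Type*} [DecidableEq α] {g : Equiv.Perm α} {a b : α}
    (hab : a ≠ b) (h : Commute g (Equiv.swap a b)) : g a = a ∧ g b = b ∨ g a = b ∧ g b = a := by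
  have h1 : Equiv.swap (g a) (g b) = Equiv.swap a b := by
    rw [Equiv.swap_apply_apply, h.eq, mul_inv_cancel_right]
  have h2 : g a ≠ g b := fun h => hab (g.injective h)
  have h3 : g a = a ∨ g a = b := by
    by_contra! h4
    have := congrArg (fun f => f (g a)) h1
    simp only [Equiv.swap_apply_left, Equiv.swap_apply_of_ne_of_ne h4.1 h4.2] at this
    exact h2 this.symm
  have h4 := congrArg (fun f => f (g a)) h1
  simp only [Equiv.swap_apply_left] at h4
  rcases h3 with h3 | h3
  · left; rw [h3, Equiv.swap_apply_left] at h4; exact ⟨h3, h4⟩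
  · right; rw [h3, Equiv.swap_apply_right] at h4; exact ⟨h3, h4⟩

theorem perm_eq_one_of_commute (hm : 2 ≤ m) {c : Br (m + 1)}
    (h : ∀ i < m, Commute (perm (m + 1) c) (Equiv.swap i (i + 1))) : perm (m + 1) c = 1 := by
  have h1 := fun i hi => apply_of_commute_swap (by omega) (h i hi)
  have h2 : ∀ i ≤ m, perm (m + 1) c i = i := by
    intro i hi
    induction i with
    | zero =>
      have a := h1 0 (by omega)
      have b := h1 1 (by omega)
      simp only [Nat.zero_add] at a b
      omega
    | succ i ih =>
      have a := h1 i (by omega)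
      have b := ih (by omega)
      omega
  ext x
  rw [Equiv.Perm.one_apply]
  rcases lt_trichotomy x (m + 1) with hx | rfl | hx
  · exact h2 x (by omega)
  · have h3 := perm_apply_le le_rfl c
    by_contra h4
    have h5 := h2 (perm (m + 1) c (m + 1)) (by omega)
    exact h4 ((perm (m + 1) c).injective h5)
  · exact perm_apply_of_lt hx c

theorem conj_apply {G : Type*} [Group G] (c x : G) : MulAut.conj c x = c * x * c⁻¹ := rfl

/-- A homomorphism to a larger braid group of standard form. -/
def TStd (h : Br m →* Br (m + 1)) : Prop := ∃ (c : Br (m + 1)) (e : Bool) (s t : ℤ), ∀ i < m,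
  h (sig m i) = c * incl m (chis m e (sig m i) * zt m ^ s) * c⁻¹ * zt (m + 1) ^ t

/-- An endomorphism of standard form. -/
def EStd (f : Br m →* Br m) : Prop := ∃ (c : Br m) (e : Bool) (t : ℤ), ∀ i < m,
  f (sig m i) = c * chis m e (sig m i) * c⁻¹ * zt m ^ t

/-- The normalization of a homomorphism to a braid group. -/
def normz {G : Type*} [Group G] (f : G →* Br m) (k : G →* Multiplicative ℤ) (c : Br m) (e : Bool) :
    G →* Br m :=
  (chis m e).comp ((MulAut.conj c⁻¹).toMonoidHom.comp (twist f k))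

theorem normz_apply {G : Type*} [Group G] (f : G →* Br m) (k : G →* Multiplicative ℤ) (c : Br m)
    (e : Bool) (b : G) : normz f k c e b =
      chis m e (c⁻¹ * (f b * zt m ^ Multiplicative.toAdd (k b)) * c) := by
  simp [normz, twist_apply]

theorem eq_of_normz {G : Type*} [Group G] (f : G →* Br m) (k : G →* Multiplicative ℤ) (c : Br m)
    (e : Bool) (b : G) : f b =
      c * chis m e (normz f k c e b) * c⁻¹ * zt m ^ (-Multiplicative.toAdd (k b)) := by
  rw [normz_apply, chis_chis, zpow_neg]
  group

theorem perm_normz {G : Type*} [Group G] (f : G →* Br m) (k : G →* Multiplicative ℤ) (c : Br m)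
    (e : Bool) (b : G) : perm m (normz f k c e b) = (perm m c)⁻¹ * perm m (f b) * perm m c := by
  rw [normz_apply, perm_chis, map_mul, map_mul, map_mul, perm_zt_zpow, mul_one, map_inv]

/-- The powers of the length homomorphism. -/
def lenPow (m : ℕ) (s : ℤ) : Br m →* Multiplicative ℤ := (zpowGroupHom s).comp (len m)

theorem lenPow_sig (s : ℤ) {i : ℕ} (hi : i < m) :
    Multiplicative.toAdd (lenPow m s (sig m i)) = s := by
  simp [lenPow, len_sig hi]

/-- An endomorphism which is standard on the first generators is standard. -/
theorem eStd_of_tStd {m' : ℕ} (hm : 1 ≤ m') (f : Br (m' + 1 + 1) →* Br (m' + 1 + 1))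
    (hp : ∀ b, perm (m' + 1 + 1) (f b) = perm (m' + 1 + 1) b)
    (h : TStd (f.comp (incl (m' + 1)))) : EStd f := by
  obtain ⟨c, e, s, t, hc⟩ := h
  have hc1 : perm (m' + 1 + 1) c = 1 := by
    refine perm_eq_one_of_commute (by omega) fun i hi => ?_
    have h1 := congrArg (perm (m' + 1 + 1)) (hc i hi)
    rw [MonoidHom.comp_apply, hp, map_mul, perm_zt_zpow, mul_one, map_mul, map_mul, map_inv,
      perm_incl, perm_incl, map_mul, perm_zt_zpow, mul_one, perm_chis, perm_sig hi] at h1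
    rw [eq_mul_inv_iff_mul_eq] at h1
    exact h1.symm
  set k := lenPow (m' + 1 + 1) (-t) with hk
  obtain ⟨s', hs'⟩ := exists_chis_zt_zpow (m := m' + 1) (by omega) e s
  obtain ⟨d, hd, hfd⟩ := exists_conj_of_fix_mul hm (normz f k c e)
    (fun b => by rw [perm_normz, hc1, hp]; simp) s' fun i hi => by
      have := hc i hi
      rw [MonoidHom.comp_apply, incl_sig hi] at this
      rw [normz_apply, this, hk, lenPow_sig _ (by omega), zpow_neg, mul_inv_cancel_right,
        ← hs', ← chis_chis e (sig (m' + 1) i), ← map_mul, chis_chis, ← chis_incl]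
      congr 1; group
  refine ⟨c * chis _ e d, e, t, fun i hi => ?_⟩
  rw [eq_of_normz f k c e, hfd, hk, lenPow_sig _ hi, neg_neg, map_mul, map_mul, map_inv, mul_inv_rev]
  simp only [mul_assoc]

/-- The lift of a homomorphism along `J`. -/
noncomputable def liftJ {G : Type*} [Group G] (h : G →* Br (m + 1))
    (hp : ∀ b, perm (m + 1) (h b) (m + 1) = m + 1) : G →* Gm m :=
  MonoidHom.mk' (fun b => (exists_J (hp b)).choose) fun a b => by
    have ha := (exists_J (hp a)).choose_spec
    have hb := (exists_J (hp b)).choose_spec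
    have hab := (exists_J (hp (a * b))).choose_spec
    refine hab.1.symm.trans ((truncG_eq_of_J ?_).trans ((map_mul (truncG m) _ _).trans
      (congrArg₂ _ ha.1 hb.1)))
    refine hab.2.trans ?_
    rw [map_mul h, map_mul (J m)]
    exact (congrArg₂ _ ha.2 hb.2).symm

theorem J_liftJ {G : Type*} [Group G] (h : G →* Br (m + 1))
    (hp : ∀ b, perm (m + 1) (h b) (m + 1) = m + 1) (b : G) : J m (liftJ h hp b) = h b :=
  (exists_J (hp b)).choose_spec.2

theorem truncG_liftJ {G : Type*} [Group G] (h : G →* Br (m + 1))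
    (hp : ∀ b, perm (m + 1) (h b) (m + 1) = m + 1) (b : G) :
    trunc (m + 1) (liftJ h hp b).left = (liftJ h hp b).left := by
  have := congrArg SemidirectProduct.left (exists_J (hp b)).choose_spec.1
  rwa [truncG_apply] at this

theorem exists_chis_push (hm : 1 ≤ m) (e : Bool) (w : Fr) :
    ∃ w', chis (m + 1) e (push m w) = push m w' := by
  have hart : ∀ (b : Br m) (w : Fr), (∃ w', chis (m + 1) e (push m w) = push m w') →
      ∃ w', chis (m + 1) e (push m (artin m b w)) = push m w' := by
    rintro b w ⟨w', hw'⟩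
    refine ⟨artin m (chis m e b) w', ?_⟩
    rw [push_artin, push_artin, map_mul, map_mul, map_inv, hw', chis_incl]
  have hgen : ∀ k ≤ m, ∃ w', chis (m + 1) e (push m (of k)) = push m w' := by
    intro k hk
    induction hk using Nat.decreasingInduction with
    | self =>
      have h1 : push m (of m) = sig (m + 1) m ^ 2 := by
        rw [push_of le_rfl, braidA, tau_last]; group
      cases e
      · exact ⟨of m, rfl⟩
      · refine ⟨(of m)⁻¹, ?_⟩
        rw [map_inv, h1, map_pow]
        simp [chis, chi_sig (Nat.lt_succ_self m)]
    | of_succ k hk ih =>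
      have := hart (sig m k) (of (k + 1)) ih
      rwa [artin_sig_of hk, if_neg (by omega), if_pos rfl] at this
  induction w using FreeGroup.induction_on with
  | C1 => exact ⟨1, by simp⟩
  | of k =>
    change ∃ w', chis (m + 1) e (push m (of k)) = push m w'
    rcases Nat.lt_or_ge m k with hk | hk
    · exact ⟨1, by rw [push_of_gt hk]; simp⟩
    · exact hgen k hk
  | inv_of k ih =>
    obtain ⟨w', hw'⟩ := ih
    exact ⟨w'⁻¹, by rw [map_inv, map_inv, map_inv, ← hw']⟩
  | mul a b ha hb =>
    obtain ⟨a', ha'⟩ := ha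
    obtain ⟨b', hb'⟩ := hb
    exact ⟨a' * b', by rw [map_mul, map_mul, map_mul, ha', hb']⟩

theorem tStd_of_eStd (hm : 2 ≤ m) (hE : ∀ f : Br m →* Br m,
    (∀ b, perm m (f b) = perm m b) → EStd f) (h : Br m →* Br (m + 1))
    (hp : ∀ b, perm (m + 1) (h b) = perm m b) : TStd h := by
  have hp' : ∀ b, perm (m + 1) (h b) (m + 1) = m + 1 := fun b => by
    rw [hp, perm_apply_of_lt (by omega)]
  set ψ := liftJ h hp' with hψ
  obtain ⟨c, e, s, hc⟩ := hE (SemidirectProduct.rightHom.comp ψ) fun b => by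
    change perm m (ψ b).right = _
    rw [← perm_J_eq, hψ, J_liftJ, hp]
  set k := lenPow m (-s) with hk
  set h' := normz h k (incl m c) e with hh'
  have hp'' : ∀ b, perm (m + 1) (h' b) (m + 1) = m + 1 := fun b => by
    rw [hh', perm_normz, hp, perm_incl, ← map_inv, ← map_mul, ← map_mul,
      perm_apply_of_lt (by omega)]
  have hdec : ∀ i < m, ∃ w, h' (sig m i) = push m w * incl m (sig m i) := by
    intro i hi
    have h1 : h (sig m i) = push m (ψ (sig m i)).left *
        incl m (c * chis m e (sig m i) * c⁻¹ * zt m ^ s) := by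
      rw [← hc i hi]
      change _ = _ * incl m (ψ (sig m i)).right
      rw [← J_apply, hψ, J_liftJ]
    have h2 : (incl m c)⁻¹ * (h (sig m i) * zt (m + 1) ^ (-s)) * incl m c =
        push m (artin m c⁻¹ ((ψ (sig m i)).left * T (m + 1) ^ (-s))) *
          incl m (chis m e (sig m i)) := by
      have h3 := ((incl_comm_push_T (c * chis m e (sig m i) * c⁻¹ * zt m ^ s)).zpow_right (-s)).eq
      have h4 : incl m (c * chis m e (sig m i) * c⁻¹ * zt m ^ s) * incl m (zt m ^ (-s)) =
          incl m c * incl m (chis m e (sig m i)) * (incl m c)⁻¹ := by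
        simp only [map_mul, map_inv, map_zpow]
        group
      rw [← map_zpow] at h3
      rw [h1, zt_succ_zpow, push_artin, mul_assoc (push m _), ← mul_assoc (incl m _) (push m _), h3,
        mul_assoc (push m _) (incl m _), h4, map_mul, map_inv]
      group
    obtain ⟨w', hw'⟩ := exists_chis_push (m := m) (by omega) e
      (artin m c⁻¹ ((ψ (sig m i)).left * T (m + 1) ^ (-s)))
    refine ⟨w', ?_⟩
    rw [hh', normz_apply, hk, lenPow_sig _ hi, h2, map_mul, hw', chis_incl, chis_chis]
  set ψ' := liftJ h' hp'' with hψ'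
  have hJ : ∀ b, h' b = push m (ψ' b).left * incl m (ψ' b).right := fun b => by
    rw [← J_apply, hψ', J_liftJ]
  have hright : SemidirectProduct.rightHom.comp ψ' = MonoidHom.id _ := by
    refine hom_ext fun i hi => ?_
    obtain ⟨w, hw⟩ := hdec i hi
    rw [hJ] at hw
    exact (decomp_unique hw).2
  have hright' : ∀ b, (ψ' b).right = b := fun b => DFunLike.congr_fun hright b
  obtain ⟨v, l, -, hv⟩ := exists_section hm ψ' hright' fun b => truncG_liftJ h' hp'' b
  have hgen : ∀ i < m, h' (sig m i) =
      push m v * incl m (sig m i * zt m ^ (-l)) * (push m v)⁻¹ * zt (m + 1) ^ l := by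
    intro i hi
    have h1 := ((zt_comm (push m v)⁻¹).zpow_left l).eq
    have h2 : incl m (sig m i * zt m ^ (-l)) * incl m (zt m ^ l) = incl m (sig m i) := by
      rw [← map_mul]; group
    rw [mul_assoc _ (push m v)⁻¹, ← h1, zt_succ_zpow, hJ, hv, hright', len_sig hi, toAdd_ofAdd,
      mul_one, map_mul, map_mul, push_artin, map_inv, map_zpow]
    have h3 := ((incl_comm_push_T (sig m i * zt m ^ (-l))).zpow_right l).eq
    rw [mul_assoc (push m v) (incl m _), ← mul_assoc (incl m _) (_ * _),
      ← mul_assoc (incl m _) (push m _ ^ l), h3, mul_assoc (_ ^ _) (incl m _), h2]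
    group
  obtain ⟨l1, hl1⟩ := exists_chis_zt_zpow (m := m) (by omega) e (-l)
  obtain ⟨l2, hl2⟩ := exists_chis_zt_zpow (m := m + 1) (by omega) e l
  refine ⟨incl m c * chis (m + 1) e (push m v), e, l1, l2 + s, fun i hi => ?_⟩
  rw [eq_of_normz h k (incl m c) e, ← hh', hgen i hi, hk, lenPow_sig _ hi, neg_neg, map_mul,
    map_mul, map_mul, map_inv, chis_incl, map_mul, hl1, hl2, mul_inv_rev, zpow_add]
  have h1 := ((zt_comm (incl m c)⁻¹).zpow_left l2).eq
  simp only [mul_assoc]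
  rw [← mul_assoc (zt (m + 1) ^ l2), h1]
  simp only [mul_assoc]

theorem eStd_of_three (h3 : ∀ f : Br 3 →* Br 3, (∀ b, perm 3 (f b) = perm 3 b) → EStd f)
    (hm : 3 ≤ m) (f : Br m →* Br m) (hp : ∀ b, perm m (f b) = perm m b) : EStd f := by
  induction m, hm using Nat.le_induction with
  | base => exact h3 f hp
  | succ m hm ih =>
    obtain ⟨m', rfl⟩ : ∃ m', m = m' + 1 := ⟨m - 1, by omega⟩
    refine eStd_of_tStd (by omega) f hp (tStd_of_eStd (by omega) ih _ fun b => ?_)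
    rw [MonoidHom.comp_apply, hp, perm_incl]

theorem tStd_of_three (h3 : ∀ f : Br 3 →* Br 3, (∀ b, perm 3 (f b) = perm 3 b) → EStd f)
    (hm : 3 ≤ m) (h : Br m →* Br (m + 1)) (hp : ∀ b, perm (m + 1) (h b) = perm m b) : TStd h :=
  tStd_of_eStd (by omega) (eStd_of_three h3 hm) h hp

end Br

namespace Br

open FreeGroup (of)
open scoped commutatorElement

variable {m : ℕ}

theorem ev_true {G : Type*} [Group G] (x y : G) : ev x y (of true) = x := by simp [ev]

theorem ev_false {G : Type*} [Group G] (x y : G) : ev x y (of false) = y := by simp [ev]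

theorem hom_ext_bool {G : Type*} [Group G] {f g : FreeGroup Bool →* G}
    (h1 : f (of true) = g (of true)) (h2 : f (of false) = g (of false)) : f = g := by
  ext1 b
  cases b
  · exact h2
  · exact h1

/-! ### The braid group on four strands -/

/-- The free normal subgroup of rank two of the braid group on four strands. -/
def kk : FreeGroup Bool →* Br 3 :=
  ev (sig 3 0 * (sig 3 2)⁻¹) (sig 3 1 * (sig 3 0 * (sig 3 2)⁻¹) * (sig 3 1)⁻¹)

theorem kk_true : kk (of true) = sig 3 0 * (sig 3 2)⁻¹ := ev_true _ _

theorem kk_false : kk (of false) = sig 3 1 * kk (of true) * (sig 3 1)⁻¹ := by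
  rw [kk_true, kk, ev_false]

/-- An automorphism of the free group of rank two. -/
def act0 : MulAut (FreeGroup Bool) :=
  MonoidHom.toMulEquiv (ev (of true) (of false * (of true)⁻¹)) (ev (of true) (of false * of true))
    (hom_ext_bool (by simp [ev_true]) (by simp [ev_true, ev_false]))
    (hom_ext_bool (by simp [ev_true]) (by simp [ev_true, ev_false]))

/-- An automorphism of the free group of rank two. -/
def act1 : MulAut (FreeGroup Bool) :=
  MonoidHom.toMulEquiv (ev (of false) (of false * (of true)⁻¹ * of false))
    (ev (of true * (of false)⁻¹ * of true) (of true))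
    (hom_ext_bool (by simp [ev_true, ev_false]) (by simp [ev_true, ev_false, mul_assoc]))
    (hom_ext_bool (by simp [ev_true, ev_false, mul_assoc]) (by simp [ev_true, ev_false]))

/-- An automorphism of the free group of rank two. -/
def act2 : MulAut (FreeGroup Bool) :=
  MonoidHom.toMulEquiv (ev (of true) ((of true)⁻¹ * of false)) (ev (of true) (of true * of false))
    (hom_ext_bool (by simp [ev_true]) (by simp [ev_true, ev_false]))
    (hom_ext_bool (by simp [ev_true]) (by simp [ev_true, ev_false]))

/-- The generating automorphisms of the action on `kk`. -/
def actGen (i : ℕ) : MulAut (FreeGroup Bool) := if i = 0 then act0 else if i = 1 then act1 else act2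

theorem actGen_zero_true : actGen 0 (of true) = of true :=
  ev_true (of true) (of false * (of true)⁻¹)
theorem actGen_zero_false : actGen 0 (of false) = of false * (of true)⁻¹ :=
  ev_false (of true) (of false * (of true)⁻¹)
theorem actGen_one_true : actGen 1 (of true) = of false :=
  ev_true (of false) (of false * (of true)⁻¹ * of false)
theorem actGen_one_false : actGen 1 (of false) = of false * (of true)⁻¹ * of false :=
  ev_false (of false) (of false * (of true)⁻¹ * of false)
theorem actGen_two_true : actGen 2 (of true) = of true :=
  ev_true (of true) ((of true)⁻¹ * of false)
theorem actGen_two_false : actGen 2 (of false) = (of true)⁻¹ * of false :=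
  ev_false (of true) ((of true)⁻¹ * of false)

theorem mulAut_ext_bool {f g : MulAut (FreeGroup Bool)}
    (h1 : f (of true) = g (of true)) (h2 : f (of false) = g (of false)) : f = g :=
  MulEquiv.toMonoidHom_injective (hom_ext_bool h1 h2)

theorem isBraid_actGen : IsBraid 3 actGen where
  braid i hi := by
    obtain rfl | rfl : i = 0 ∨ i = 1 := by omega
    · refine mulAut_ext_bool ?_ ?_ <;>
      simp only [MulAut.mul_apply, zero_add, actGen_zero_true, actGen_zero_false, actGen_one_true,
        actGen_one_false, map_mul, map_inv] <;> group
    · refine mulAut_ext_bool ?_ ?_ <;>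
      simp only [MulAut.mul_apply, Nat.reduceAdd, actGen_two_true, actGen_two_false,
        actGen_one_true, actGen_one_false, map_mul, map_inv] <;> group
  comm i j h hj := by
    obtain ⟨rfl, rfl⟩ : i = 0 ∧ j = 2 := by omega
    refine mulAut_ext_bool ?_ ?_ <;>
      simp only [MulAut.mul_apply, actGen_two_true, actGen_two_false,
        actGen_zero_true, actGen_zero_false, map_mul, map_inv] <;> group

/-- The conjugation action of the braid group on four strands on its free normal subgroup. -/
def act : Br 3 →* MulAut (FreeGroup Bool) := lift _ isBraid_actGen

theorem act_zero_true : act (sig 3 0) (of true) = of true := by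
  rw [act, lift_sig _ (by omega), actGen_zero_true]
theorem act_zero_false : act (sig 3 0) (of false) = of false * (of true)⁻¹ := by
  rw [act, lift_sig _ (by omega), actGen_zero_false]
theorem act_one_true : act (sig 3 1) (of true) = of false := by
  rw [act, lift_sig _ (by omega), actGen_one_true]
theorem act_one_false : act (sig 3 1) (of false) = of false * (of true)⁻¹ * of false := by
  rw [act, lift_sig _ (by omega), actGen_one_false]
theorem act_two_true : act (sig 3 2) (of true) = of true := by
  rw [act, lift_sig _ (by omega), actGen_two_true]
theorem act_two_false : act (sig 3 2) (of false) = (of true)⁻¹ * of false := by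
  rw [act, lift_sig _ (by omega), actGen_two_false]

theorem sig_zero_kk_true : sig 3 0 * kk (of true) * (sig 3 0)⁻¹ = kk (of true) := by
  rw [kk_true, mul_assoc, mul_assoc, ← mul_inv_rev, sig_comm (m := 3) (i := 0) (j := 2) (by omega)]
  group

theorem sig_zero_kk_false : sig 3 0 * kk (of false) * (sig 3 0)⁻¹ =
    kk (of false) * (kk (of true))⁻¹ := by
  have h1 : sig 3 2 = (kk (of true))⁻¹ * sig 3 0 := by rw [kk_true]; group
  have h2 := sig_braid (m := 3) (i := 1) (by omega)
  have h3 := sig_braid (m := 3) (i := 0) (by omega)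
  simp only [Nat.reduceAdd] at h2 h3
  rw [h1] at h2
  rw [kk_false]
  generalize kk (of true) = x at *
  generalize sig 3 0 = a at *
  generalize sig 3 1 = b at *
  have h4 : a * b * x⁻¹ * a = x * (b * x⁻¹ * a * b) := by
    rw [mul_assoc, mul_assoc, ← mul_assoc b, mul_assoc, mul_assoc] at h2
    rw [mul_assoc b, mul_assoc b, mul_assoc x⁻¹, h2]; group
  have h5 : a * b * x⁻¹ = x * (b * x⁻¹ * b⁻¹) * (a * b) := by
    have : a * b * a⁻¹ = b⁻¹ * (a * b) := by
      rw [mul_inv_eq_iff_eq_mul, mul_assoc, eq_inv_mul_iff_mul_eq]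
      simpa only [mul_assoc] using h3.symm
    rw [eq_mul_inv_of_mul_eq h4]
    calc _ = x * (b * x⁻¹ * (a * b * a⁻¹)) := by group
      _ = _ := by rw [this]; group
  have h6 : a * b * x = (b * x * b⁻¹) * x⁻¹ * (a * b) := by
    have := eq_mul_inv_of_mul_eq h5.symm
    have h7 := congrArg (fun g => g⁻¹) (mul_inv_eq_of_eq_mul h5)
    simp only [mul_inv_rev, inv_inv] at h7
    rw [← mul_inv_eq_iff_eq_mul, mul_inv_rev]
    simp only [mul_assoc] at h7 ⊢
    exact h7
  calc a * (b * x * b⁻¹) * a⁻¹ = (a * b * x) * (a * b)⁻¹ := by group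
    _ = _ := by rw [h6]; group

theorem sig_one_kk_false : sig 3 1 * kk (of false) * (sig 3 1)⁻¹ =
    kk (of false) * (kk (of true))⁻¹ * kk (of false) := by
  have h1 := sig_zero_kk_true
  have h2 := sig_zero_kk_false
  have h3 := sig_braid (m := 3) (i := 0) (by omega)
  simp only [Nat.reduceAdd] at h3
  have h4 := kk_false
  generalize kk (of true) = x at *
  generalize kk (of false) = y at *
  generalize sig 3 0 = a at *
  generalize sig 3 1 = b at *
  have h5 : b * (a * (b * x * b⁻¹) * a⁻¹) * b⁻¹ = a * (b * (a * x * a⁻¹) * b⁻¹) * a⁻¹ := by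
    calc _ = (b * a * b) * x * (b * a * b)⁻¹ := by group
      _ = (a * b * a) * x * (a * b * a)⁻¹ := by rw [← h3]
      _ = _ := by group
  rw [h1, ← h4, h2] at h5
  calc b * y * b⁻¹ = (b * (y * x⁻¹) * b⁻¹) * (b * x * b⁻¹) := by group
    _ = _ := by rw [h5, ← h4]

theorem kk_act (g : Br 3) (w : FreeGroup Bool) : kk (act g w) = g * kk w * g⁻¹ := by
  induction g using induction generalizing w with
  | one => simp
  | gen i hi =>
    have : kk.comp (act (sig 3 i)).toMonoidHom =
        (MulAut.conj (sig 3 i)).toMonoidHom.comp kk := by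
      have hd : sig 3 2 = (kk (of true))⁻¹ * sig 3 0 := by rw [kk_true]; group
      obtain rfl | rfl | rfl : i = 0 ∨ i = 1 ∨ i = 2 := by omega
      · refine hom_ext_bool ?_ ?_ <;>
          simp [act_zero_true, act_zero_false, sig_zero_kk_true, sig_zero_kk_false]
      · refine hom_ext_bool ?_ ?_ <;>
          simp [act_one_true, act_one_false, sig_one_kk_false]
        exact kk_false
      · refine hom_ext_bool ?_ ?_
        · simp only [MonoidHom.comp_apply, MulEquiv.coe_toMonoidHom, act_two_true, conj_apply]
          rw [hd, mul_inv_rev, inv_inv, mul_assoc _ (sig 3 0), mul_assoc, ← mul_assoc _ (sig 3 0)⁻¹,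
            sig_zero_kk_true]
          group
        · simp only [MonoidHom.comp_apply, MulEquiv.coe_toMonoidHom, act_two_false, conj_apply]
          rw [hd, mul_inv_rev, inv_inv, mul_assoc _ (sig 3 0), mul_assoc, ← mul_assoc _ (sig 3 0)⁻¹,
            sig_zero_kk_false, map_mul, map_inv]
          group
    exact DFunLike.congr_fun this w
  | mul x y hx hy => rw [map_mul, MulAut.mul_apply, hx, hy]; group
  | inv x hx =>
    have := hx ((act x)⁻¹ w)
    rw [MulAut.apply_inv_self] at this
    rw [this, map_inv]; group

end Br

namespace Br

open FreeGroup (of)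
open scoped commutatorElement MatrixGroups

/-- The action of the braid group on three strands on the free group of rank two. -/
def act' : Br 2 →* MulAut (FreeGroup Bool) := act.comp (incl 2)

theorem act'_apply (b : Br 2) : act' b = act (incl 2 b) := rfl

theorem act'_sig {i : ℕ} (hi : i < 2) : act' (sig 2 i) = act (sig 3 i) := by
  rw [act'_apply, incl_sig hi]

/-- Images of the generators of the braid group on four strands in a semidirect product. -/
def spltGen (i : ℕ) : FreeGroup Bool ⋊[act'] Br 2 :=
  if i = 2 then SemidirectProduct.inl (of true)⁻¹ * SemidirectProduct.inr (sig 2 0)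
  else SemidirectProduct.inr (sig 2 i)

theorem isBraid_spltGen : IsBraid 3 spltGen where
  braid i hi := by
    obtain rfl | rfl : i = 0 ∨ i = 1 := by omega
    · simp only [spltGen, zero_add, OfNat.zero_ne_ofNat, if_false, OfNat.one_ne_ofNat]
      have := sig_braid (m := 2) (i := 0) (by omega)
      rw [zero_add] at this
      rw [← map_mul, ← map_mul, this, map_mul, map_mul]
    · have hb := sig_braid (m := 2) (i := 0) (by omega)
      rw [zero_add] at hb
      simp only [spltGen, Nat.reduceAdd, if_true, OfNat.one_ne_ofNat, if_false]
      ext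
      · simp only [SemidirectProduct.mul_left, SemidirectProduct.left_inl,
          SemidirectProduct.left_inr, SemidirectProduct.mul_right, SemidirectProduct.right_inl,
          SemidirectProduct.right_inr, map_one, one_mul,
          mul_one, act'_sig (show 0 < 2 by omega), act'_sig (show 1 < 2 by omega)]
        simp only [map_inv, map_mul, MulAut.mul_apply, act_one_true, act_zero_false,
          act'_sig (show 0 < 2 by omega), act'_sig (show 1 < 2 by omega)]
        group
      · simp [hb]
  comm i j h hj := by
    obtain ⟨rfl, rfl⟩ : i = 0 ∧ j = 2 := by omega
    simp only [spltGen, if_true, OfNat.zero_ne_ofNat, if_false]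
    ext
    · simp [act'_sig (show 0 < 2 by omega), act_zero_true]
    · simp

/-- The decomposition of the braid group on four strands as a semidirect product. -/
def splt : Br 3 →* FreeGroup Bool ⋊[act'] Br 2 := lift _ isBraid_spltGen

theorem splt_sig {i : ℕ} (hi : i < 2) : splt (sig 3 i) = SemidirectProduct.inr (sig 2 i) := by
  rw [splt, lift_sig _ (by omega), spltGen, if_neg (by omega)]

theorem splt_sig_two : splt (sig 3 2) =
    SemidirectProduct.inl (of true)⁻¹ * SemidirectProduct.inr (sig 2 0) := by
  rw [splt, lift_sig _ (by omega), spltGen, if_pos rfl]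

theorem splt_kk (w : FreeGroup Bool) : splt (kk w) = SemidirectProduct.inl w := by
  have h1 : splt (kk (of true)) = SemidirectProduct.inl (of true) := by
    rw [kk_true, map_mul, map_inv, splt_sig (by omega), splt_sig_two, map_inv]; group
  have : splt.comp kk = SemidirectProduct.inl := by
    refine hom_ext_bool h1 ?_
    rw [MonoidHom.comp_apply, kk_false, map_mul, map_mul, map_inv, h1, splt_sig (by omega),
      ← map_inv, ← SemidirectProduct.inl_aut, act'_sig (by omega), act_one_true]
  exact DFunLike.congr_fun this w

theorem splt_incl (b : Br 2) : splt (incl 2 b) = SemidirectProduct.inr b := by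
  have : splt.comp (incl 2) = SemidirectProduct.inr := hom_ext fun i hi => by
    rw [MonoidHom.comp_apply, incl_sig hi, splt_sig hi]
  exact DFunLike.congr_fun this b

theorem kk_injective : Function.Injective kk := fun a b h => by
  have := congrArg splt h
  rw [splt_kk, splt_kk] at this
  exact SemidirectProduct.inl_injective this

theorem eq_kk_mul_incl (g : Br 3) : g = kk (splt g).left * incl 2 (splt g).right := by
  set r : FreeGroup Bool ⋊[act'] Br 2 →* Br 3 := SemidirectProduct.lift kk (incl 2) fun b => by
    ext1 w
    simp only [MonoidHom.comp_apply, MulEquiv.coe_toMonoidHom, act'_apply, conj_apply]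
    exact kk_act _ _ with hr
  have h1 : r.comp splt = MonoidHom.id _ := by
    refine hom_ext fun i hi => ?_
    have h0 : ∀ i < 2, r (splt (sig 3 i)) = sig 3 i := fun i hi => by
      rw [splt_sig hi, hr, SemidirectProduct.lift_inr, incl_sig hi]
    rw [MonoidHom.comp_apply, MonoidHom.id_apply]
    rcases Nat.lt_or_ge i 2 with hi' | hi'
    · exact h0 i hi'
    · obtain rfl : i = 2 := by omega
      rw [splt_sig_two, map_mul, hr, SemidirectProduct.lift_inl, SemidirectProduct.lift_inr,
        incl_sig (by omega), map_inv, kk_true]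
      group
  have h2 := DFunLike.congr_fun h1 g
  simp only [MonoidHom.comp_apply, MonoidHom.id_apply, hr] at h2
  exact h2.symm

/-- The exceptional homomorphism from four strands to three strands. -/
def qq : Br 3 →* Br 2 := SemidirectProduct.rightHom.comp splt

theorem qq_apply (g : Br 3) : qq g = (splt g).right := rfl

theorem qq_kk (w : FreeGroup Bool) : qq (kk w) = 1 := by
  rw [qq_apply, splt_kk, SemidirectProduct.right_inl]

theorem qq_incl (b : Br 2) : qq (incl 2 b) = b := by
  rw [qq_apply, splt_incl, SemidirectProduct.right_inr]

theorem qq_two : qq (sig 3 2) = sig 2 0 := by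
  rw [qq_apply, splt_sig_two]; simp

theorem exists_kk_of_qq {g : Br 3} (h : qq g = 1) : ∃ w, g = kk w := by
  refine ⟨(splt g).left, ?_⟩
  conv_lhs => rw [eq_kk_mul_incl g]
  rw [← qq_apply, h, map_one, mul_one]

theorem qq_zt : qq (zt 3) = zt 2 ^ 2 := by
  have hb := sig_braid (m := 2) (i := 0) (by omega)
  rw [zero_add] at hb
  have h2 : dl 2 = sig 2 0 * sig 2 1 := by simp [dl, List.range_succ]
  have h3 : qq (dl 3) = sig 2 0 * sig 2 1 * sig 2 0 := by
    rw [dl_succ, map_mul, qq_incl, qq_two, h2]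
  rw [zt, zt, map_pow, h3, h2]
  have h4 : (sig 2 0 * sig 2 1 * sig 2 0) ^ 2 = (sig 2 0 * sig 2 1) ^ 3 := by
    generalize sig 2 0 = a at *
    generalize sig 2 1 = b at *
    calc _ = (a * b * a) * (a * b * a) := pow_two _
      _ = a * b * a * (b * a * b) := by rw [← hb]
      _ = _ := by simp only [pow_succ, pow_zero, one_mul, mul_assoc]
  calc _ = ((sig 2 0 * sig 2 1 * sig 2 0) ^ 2) ^ 2 := by rw [← pow_mul]
    _ = _ := by rw [h4]

/-! ### The action on the abelianization -/

/-- Exponent vectors. -/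
def vec (w : FreeGroup Bool) : Fin 2 → ℤ :=
  ![Multiplicative.toAdd (exT w), Multiplicative.toAdd (exF w)]

theorem vec_one : vec 1 = 0 := by ext i; fin_cases i <;> simp [vec]

theorem vec_mul (a b : FreeGroup Bool) : vec (a * b) = vec a + vec b := by
  ext i; fin_cases i <;> simp [vec]

theorem vec_inv (a : FreeGroup Bool) : vec a⁻¹ = -vec a := by
  ext i; fin_cases i <;> simp [vec]

theorem vec_zpow (a : FreeGroup Bool) (k : ℤ) : vec (a ^ k) = k • vec a := by
  ext i; fin_cases i <;> simp [vec]

theorem vec_true : vec (of true) = ![1, 0] := by simp [vec, exT, exF, ev_true]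

theorem vec_false : vec (of false) = ![0, 1] := by simp [vec, exT, exF, ev_false]

/-- Homomorphisms of free groups of rank two act linearly on exponent vectors. -/
theorem vec_hom (f : FreeGroup Bool →* FreeGroup Bool) (w : FreeGroup Bool) :
    vec (f w) = (vec w 0) • vec (f (of true)) + (vec w 1) • vec (f (of false)) := by
  induction w using FreeGroup.induction_on with
  | C1 => simp [vec_one]
  | of b =>
    cases b <;> simp [vec_true, vec_false]
  | inv_of b ih =>
    rw [map_inv, vec_inv, ih, vec_inv]
    simp only [Pi.neg_apply, neg_smul, neg_add]
  | mul a b ha hb =>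
    rw [map_mul, vec_mul, ha, hb, vec_mul]
    simp only [Pi.add_apply, add_smul]
    abel

/-- The matrices of the generators. -/
def slGen (i : ℕ) : SL(2, ℤ) :=
  if i = 1 then ⟨!![0, -1; 1, 2], by simp [Matrix.det_fin_two]⟩
  else ⟨!![1, -1; 0, 1], by simp [Matrix.det_fin_two]⟩

theorem isBraid_slGen : IsBraid 3 slGen where
  braid i hi := by
    obtain rfl | rfl : i = 0 ∨ i = 1 := by omega
    · decide
    · decide
  comm i j h hj := by
    obtain ⟨rfl, rfl⟩ : i = 0 ∧ j = 2 := by omega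
    decide

/-- The representation on the abelianization. -/
def sl : Br 3 →* SL(2, ℤ) := lift _ isBraid_slGen

theorem sl_sig_zero : sl (sig 3 0) = ⟨!![1, -1; 0, 1], by simp [Matrix.det_fin_two]⟩ := by
  rw [sl, lift_sig _ (by omega)]; rfl

theorem sl_sig_one : sl (sig 3 1) = ⟨!![0, -1; 1, 2], by simp [Matrix.det_fin_two]⟩ := by
  rw [sl, lift_sig _ (by omega)]; rfl

theorem sl_sig_two : sl (sig 3 2) = ⟨!![1, -1; 0, 1], by simp [Matrix.det_fin_two]⟩ := by
  rw [sl, lift_sig _ (by omega)]; rfl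

theorem vec_act (g : Br 3) (w : FreeGroup Bool) : vec (act g w) = (sl g).1.mulVec (vec w) := by
  induction g using induction generalizing w with
  | one => simp
  | gen i hi =>
    have h := vec_hom (act (sig 3 i)).toMonoidHom w
    simp only [MulEquiv.coe_toMonoidHom] at h
    rw [h]
    obtain rfl | rfl | rfl : i = 0 ∨ i = 1 ∨ i = 2 := by omega
    · rw [sl_sig_zero, act_zero_true, act_zero_false]
      ext i; fin_cases i <;> simp [vec_mul, vec_inv, vec_true, vec_false, Matrix.mulVec, dotProduct]
    · rw [sl_sig_one, act_one_true, act_one_false]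
      ext i; fin_cases i <;> simp [vec_mul, vec_inv, vec_true, vec_false, Matrix.mulVec, dotProduct] <;> ring
    · rw [sl_sig_two, act_two_true, act_two_false]
      ext i; fin_cases i <;> simp [vec_mul, vec_inv, vec_true, vec_false, Matrix.mulVec, dotProduct]
  | mul x y hx hy =>
    rw [map_mul, map_mul, MulAut.mul_apply, hx, hy, Matrix.SpecialLinearGroup.coe_mul,
      Matrix.mulVec_mulVec]
  | inv x hx =>
    have := hx ((act x)⁻¹ w)
    rw [MulAut.apply_inv_self] at this
    rw [this, Matrix.mulVec_mulVec, ← Matrix.SpecialLinearGroup.coe_mul, map_inv, map_inv,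
      inv_mul_cancel, Matrix.SpecialLinearGroup.coe_one, Matrix.one_mulVec]

theorem sl_kk (w : FreeGroup Bool) : sl (kk w) = 1 := by
  have h1 : sl (kk (of true)) = 1 := by
    rw [kk_true, map_mul, map_inv, sl_sig_zero.trans sl_sig_two.symm, mul_inv_cancel]
  have : sl.comp kk = 1 := by
    refine hom_ext_bool h1 ?_
    rw [MonoidHom.comp_apply, kk_false, map_mul, map_mul, map_inv, h1]
    simp
  exact DFunLike.congr_fun this w

theorem sl_surjective : Function.Surjective sl := by
  rw [← MonoidHom.range_eq_top, eq_top_iff, ← SpecialLinearGroup.SL2Z_generators,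
    Subgroup.closure_le]
  have hT : ModularGroup.T = sl (sig 3 0)⁻¹ := by rw [map_inv, sl_sig_zero]; decide
  have hS : ModularGroup.S = sl (sig 3 0 * (sig 3 1 * sig 3 0 * (sig 3 1)⁻¹) * sig 3 0) := by
    simp only [map_mul, map_inv, sl_sig_zero, sl_sig_one]; decide
  rintro y (rfl | rfl)
  · exact ⟨_, hS.symm⟩
  · exact ⟨_, hT.symm⟩

end Br

namespace Br

open FreeGroup (of)
open scoped commutatorElement MatrixGroups

/-! ### The kernel of the action on the abelianization -/

/-- Upper shears. -/
def shU : Multiplicative ℤ →* SL(2, ℤ) where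
  toFun t := ⟨!![1, t.toAdd; 0, 1], by simp [Matrix.det_fin_two]⟩
  map_one' := by ext i j; fin_cases i <;> fin_cases j <;> simp
  map_mul' s t := by
    apply Subtype.ext
    change !![1, s.toAdd + t.toAdd; 0, 1] = !![1, s.toAdd; 0, 1] * !![1, t.toAdd; 0, 1]
    simp [add_comm]

/-- Lower shears. -/
def shL : Multiplicative ℤ →* SL(2, ℤ) where
  toFun t := ⟨!![1, 0; t.toAdd, 1], by simp [Matrix.det_fin_two]⟩
  map_one' := by ext i j; fin_cases i <;> fin_cases j <;> simp
  map_mul' s t := by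
    apply Subtype.ext
    change !![1, 0; s.toAdd + t.toAdd, 1] = !![1, 0; s.toAdd, 1] * !![1, 0; t.toAdd, 1]
    simp

theorem shU_mulVec (t : ℤ) (p : Fin 2 → ℤ) :
    (shU (Multiplicative.ofAdd t)).1.mulVec p = ![p 0 + t * p 1, p 1] := by
  change (!![1, t; 0, 1]).mulVec p = _
  ext i; fin_cases i <;> simp [Matrix.mulVec, dotProduct]

theorem shL_mulVec (t : ℤ) (p : Fin 2 → ℤ) :
    (shL (Multiplicative.ofAdd t)).1.mulVec p = ![p 0, t * p 0 + p 1] := by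
  change (!![1, 0; t, 1]).mulVec p = _
  ext i; fin_cases i <;> simp [Matrix.mulVec, dotProduct]

/-- The action of unimodular matrices on the plane. -/
def slAct : SL(2, ℤ) →* Equiv.Perm (Fin 2 → ℤ) :=
  (glAct ℤ).comp Matrix.SpecialLinearGroup.toGL

theorem slAct_apply (M : SL(2, ℤ)) (p : Fin 2 → ℤ) : slAct M p = M.1.mulVec p := rfl

/-- Generators of the Sanov subgroup. -/
def sanov : FreeGroup Bool →* SL(2, ℤ) :=
  FreeGroup.lift fun b => cond b (shU (Multiplicative.ofAdd (-2))) (shL (Multiplicative.ofAdd 2))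

theorem sanov_injective : Function.Injective sanov := by
  have h := freeGroup_lift_injective
    (fun b : Bool => slAct (sanov (of b)))
    (fun b => {p | cond b (|p 1| < |p 0|) (|p 0| < |p 1|)}) ?_ ?_ ?_
  · have e : FreeGroup.lift (fun b : Bool => slAct (sanov (of b))) = slAct.comp sanov := by
      ext i : 1
      simp
    rw [e, MonoidHom.coe_comp] at h
    exact h.of_comp
  · rintro (_ | _)
    · exact ⟨![0, 1], by simp⟩
    · exact ⟨![1, 0], by simp⟩
  · intro i j hij
    rw [Set.disjoint_left]
    rintro p hp hq
    rcases i <;> rcases j <;> simp at * <;> omega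
  · rintro (_ | _) (_ | _) hij k hk p hp
    · exact absurd rfl hij
    · simp only [Set.mem_ofPred_eq, cond_true, cond_false] at hp ⊢
      rw [← map_zpow, slAct_apply, sanov, FreeGroup.lift_apply_of, cond_false, ← map_zpow,
        ← ofAdd_zsmul, shL_mulVec]
      simp only [Matrix.cons_val_zero, Matrix.cons_val_one, smul_eq_mul]
      have h1 : 2 * |p 0| ≤ |k * 2 * p 0| := by
        rw [abs_mul, abs_mul]
        have : 1 ≤ |k| := Int.one_le_abs hk
        have h2 : |(2 : ℤ)| = 2 := by norm_num
        rw [h2]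
        nlinarith [abs_nonneg (p 0)]
      have h2 := abs_sub_abs_le_abs_sub (k * 2 * p 0) (-p 1)
      rw [abs_neg, sub_neg_eq_add] at h2
      linarith
    · simp only [Set.mem_ofPred_eq, cond_true, cond_false] at hp ⊢
      rw [← map_zpow, slAct_apply, sanov, FreeGroup.lift_apply_of, cond_true, ← map_zpow,
        ← ofAdd_zsmul, shU_mulVec]
      simp only [Matrix.cons_val_zero, Matrix.cons_val_one, smul_eq_mul]
      have h1 : 2 * |p 1| ≤ |k * -2 * p 1| := by
        rw [abs_mul, abs_mul]
        have : 1 ≤ |k| := Int.one_le_abs hk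
        have h2 : |(-2 : ℤ)| = 2 := by norm_num
        rw [h2]
        nlinarith [abs_nonneg (p 1)]
      have h2 := abs_sub_abs_le_abs_sub (k * -2 * p 1) (-p 0)
      rw [abs_neg, sub_neg_eq_add, add_comm] at h2
      linarith
    · exact absurd rfl hij

/-- The reduction modulo two of the action on the abelianization. -/
def slTwo : Br 2 →* SL(2, ZMod 2) :=
  (Matrix.SpecialLinearGroup.map (Int.castRingHom (ZMod 2))).comp (sl.comp (incl 2))

/-- The three nonzero vectors modulo two. -/
def vTwo (j : ℕ) : Fin 2 → ZMod 2 := if j = 0 then ![1, 1] else if j = 1 then ![0, 1] else ![1, 0]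

theorem slTwo_vTwo (b : Br 2) {j : ℕ} (hj : j ≤ 2) :
    (slTwo b).1.mulVec (vTwo j) = vTwo (perm 2 b j) := by
  induction b using induction generalizing j with
  | one => simp
  | gen i hi =>
    rw [perm_sig hi]
    have e0 : slTwo (sig 2 0) = ⟨!![1, 1; 0, 1], by simp [Matrix.det_fin_two]⟩ := by
      rw [slTwo, MonoidHom.comp_apply, MonoidHom.comp_apply, incl_sig (by omega), sl_sig_zero]
      ext i j; fin_cases i <;> fin_cases j <;> decide
    have e1 : slTwo (sig 2 1) = ⟨!![0, 1; 1, 0], by decide⟩ := by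
      rw [slTwo, MonoidHom.comp_apply, MonoidHom.comp_apply, incl_sig (by omega), sl_sig_one]
      ext i j; fin_cases i <;> fin_cases j <;> decide
    obtain rfl | rfl : i = 0 ∨ i = 1 := by omega
    · rw [e0]
      interval_cases j <;> decide
    · rw [e1]
      interval_cases j <;> decide
  | mul x y hx hy =>
    rw [map_mul, map_mul, Equiv.Perm.mul_apply, Matrix.SpecialLinearGroup.coe_mul,
      ← Matrix.mulVec_mulVec, hy hj, hx (perm_apply_le hj y)]
  | inv x hx =>
    have h1 : (perm 2 x)⁻¹ j ≤ 2 := by rw [← map_inv]; exact perm_apply_le hj _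
    have h2 := hx h1
    rw [← Equiv.Perm.mul_apply, mul_inv_cancel, Equiv.Perm.one_apply] at h2
    rw [← h2, Matrix.mulVec_mulVec, ← Matrix.SpecialLinearGroup.coe_mul, map_inv, map_inv,
      inv_mul_cancel, Matrix.SpecialLinearGroup.coe_one, Matrix.one_mulVec]

theorem perm_eq_one_of_sl {b : Br 2} (h : sl (incl 2 b) = 1) : perm 2 b = 1 := by
  have h1 : slTwo b = 1 := by
    rw [slTwo, MonoidHom.comp_apply, MonoidHom.comp_apply, h, map_one]
  ext j
  rcases Nat.lt_or_ge 2 j with hj | hj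
  · rw [perm_apply_of_lt hj, Equiv.Perm.one_apply]
  · have h2 := slTwo_vTwo b hj
    have h3 := perm_apply_le hj b
    rw [h1, Matrix.SpecialLinearGroup.coe_one, Matrix.one_mulVec] at h2
    rw [Equiv.Perm.one_apply]
    generalize perm 2 b j = l at *
    interval_cases j <;> interval_cases l <;> first | rfl | (exact absurd h2 (by decide))

theorem sl_zt : sl (incl 2 (zt 2)) = -1 := by
  have h2 : dl 2 = sig 2 0 * sig 2 1 := by simp [dl, List.range_succ]
  rw [zt, h2, map_pow, map_pow, map_mul, map_mul, incl_sig (by omega), incl_sig (by omega),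
    sl_sig_zero, sl_sig_one]
  decide

theorem exists_eq_push_mul {b : Br 2} (hb : perm 2 b = 1) :
    ∃ (w : Fr) (k : ℤ), trunc 2 w = w ∧ b = push 1 w * zt 2 ^ k := by
  obtain ⟨w, b', hw, h⟩ := exists_decomp (m := 1) (h := b) (by rw [hb]; rfl)
  have hb' : perm 1 b' = 1 := by
    rw [h, map_mul, perm_push, one_mul, perm_incl] at hb
    exact hb
  have hcom : ∀ x y : Br 1, Commute x y := by
    intro x y
    have h1 : ∀ z : Br 1, Commute (sig 1 0) z := fun z => by
      induction z using induction with
      | one => exact Commute.one_right _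
      | gen i hi => obtain rfl : i = 0 := by omega
                    exact Commute.refl _
      | mul x y hx hy => exact hx.mul_right hy
      | inv x hx => exact hx.inv_right
    induction x using induction with
    | one => exact Commute.one_left _
    | gen i hi => obtain rfl : i = 0 := by omega
                  exact h1 y
    | mul x y hx hy => exact hx.mul_left hy
    | inv x hx => exact hx.inv_left
  obtain ⟨k, hk⟩ := eq_zt_zpow_of_commute_pure hb' fun p _ => hcom b' p
  refine ⟨w * (T 2 ^ k)⁻¹, k, ?_, ?_⟩
  · rw [map_mul, map_inv, map_zpow, hw, trunc_T le_rfl]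
  · rw [zt_succ_zpow, h, hk, map_mul, map_inv]
    group

theorem eq_one_of_sl_push {w : Fr} (hw : trunc 2 w = w)
    (h : ∀ M, Commute (sl (incl 2 (push 1 w))) M) : w = 1 := by
  set r : Fr →* FreeGroup Bool := FreeGroup.lift fun k =>
    if k = 0 then of true else if k = 1 then of false else 1 with hr
  set s : FreeGroup Bool →* Fr := FreeGroup.lift fun b => cond b (of 0) (of 1) with hs
  have h1 : s.comp r = trunc 2 := by
    ext k : 1
    rcases Nat.lt_or_ge k 2 with hk | hk
    · rw [trunc_of hk]
      interval_cases k <;> simp [hr, hs]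
    · rw [trunc_of_ge hk]
      simp [hr, show k ≠ 0 by omega, show k ≠ 1 by omega]
  set g : SL(2, ℤ) := sl ((sig 3 0)⁻¹ * sig 3 1) with hg
  have h2 : sanov.comp r = (MulAut.conj g).toMonoidHom.comp (sl.comp ((incl 2).comp (push 1))) := by
    ext k : 1
    simp only [MonoidHom.comp_apply, MulEquiv.coe_toMonoidHom, MulAut.conj_apply]
    rcases Nat.lt_or_ge k 2 with hk | hk
    · rw [push_of (by omega)]
      interval_cases k
      · rw [braidA, tau_eq (by omega), tau_last]
        simp only [map_mul, map_inv, map_pow, mul_one, incl_sig (show 0 < 2 by omega),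
          incl_sig (show 0 + 1 < 2 by omega), hg, hr, FreeGroup.lift_apply_of]
        simp only [zero_add, sl_sig_zero, sl_sig_one, sanov, if_true, FreeGroup.lift_apply_of]
        decide
      · rw [braidA, tau_last]
        simp only [map_mul, map_inv, map_pow, map_one, mul_one, incl_sig (show 1 < 2 by omega),
          hg, hr, FreeGroup.lift_apply_of]
        simp only [sl_sig_zero, sl_sig_one, sanov, if_true]
        decide
    · rw [push_of_gt (by omega)]
      simp [hr, show k ≠ 0 by omega, show k ≠ 1 by omega]
  have h3 : ∀ u, Commute (r w) u := by
    intro u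
    apply sanov_injective
    have h4 := DFunLike.congr_fun h2 w
    simp only [MonoidHom.comp_apply, MulEquiv.coe_toMonoidHom, MulAut.conj_apply] at h4
    rw [map_mul, map_mul, h4]
    have h5 := (h g).eq
    rw [← h5, mul_inv_cancel_right]
    exact h _
  have h4 : r w = 1 :=
    freeGroup_eq_one_of_commute (x := true) (y := false) (by decide) (h3 _) (h3 _)
  have h5 := DFunLike.congr_fun h1 w
  rw [MonoidHom.comp_apply, h4, map_one, hw] at h5
  exact h5.symm

/-- The kernel of the action on the abelianization. -/
theorem exists_of_sl_eq_one {g : Br 3} (h : sl g = 1) : ∃ w k, g = kk w * zt 3 ^ (k : ℤ) := by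
  set b := (splt g).right with hb
  have h0 := eq_kk_mul_incl g
  rw [← hb] at h0
  have h1 : sl (incl 2 b) = 1 := by
    rw [h0, map_mul, sl_kk, one_mul] at h
    exact h
  obtain ⟨w, k, hw, hk⟩ := exists_eq_push_mul (perm_eq_one_of_sl h1)
  have h2 : sl (incl 2 (push 1 w)) * (-1) ^ k = 1 := by
    rw [hk, map_mul, map_mul, map_zpow, map_zpow, sl_zt] at h1
    exact h1
  have h3 : w = 1 := by
    refine eq_one_of_sl_push hw fun M => ?_
    rw [eq_inv_of_mul_eq_one_left h2]
    refine Commute.inv_left (Commute.zpow_left ?_ _)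
    rw [Commute, SemiconjBy, neg_mul, mul_neg, one_mul, mul_one]
  have h4 : Even k := by
    rw [h3, map_one, map_one, map_one, one_mul] at h2
    by_contra h5
    rw [Int.not_even_iff_odd] at h5
    rw [h5.neg_one_zpow] at h2
    exact absurd h2 (by decide)
  obtain ⟨l, rfl⟩ := h4
  obtain ⟨w', hw'⟩ := exists_kk_of_qq (g := g * (zt 3 ^ l)⁻¹) (by
    rw [h0, map_mul, map_mul, qq_kk, qq_incl, map_inv, map_zpow, qq_zt, hk, h3, map_one]
    rw [← zpow_natCast, ← zpow_mul, ← zpow_neg, one_mul, one_mul, ← zpow_add]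
    have : l + l + -(((2 : ℕ) : ℤ) * l) = 0 := by push_cast; ring
    rw [this, zpow_zero])
  exact ⟨w', l, by rw [← hw', inv_mul_cancel_right]⟩

end Br

namespace Br

open FreeGroup (of)
open scoped commutatorElement MatrixGroups

/-! ### Permutations on four and three strands -/

/-- The pair partition of four points determined by two of them. -/
def cls (p q : ℕ) : ℕ := if p + q = 3 then 0 else if (p + q) % 2 = 0 then 1 else 2

theorem cls_perm (g : Br 3) {p q : ℕ} (hp : p ≤ 3) (hq : q ≤ 3) (hpq : p ≠ q) :
    cls (perm 3 g p) (perm 3 g q) = perm 2 (qq g) (cls p q) := by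
  induction g using induction generalizing p q with
  | one => simp
  | gen i hi =>
    rw [perm_sig hi]
    have h : ∃ j < 2, qq (sig 3 i) = sig 2 j ∧ j = (if i = 1 then 1 else 0) := by
      obtain rfl | rfl | rfl : i = 0 ∨ i = 1 ∨ i = 2 := by omega
      · exact ⟨0, by omega, by rw [← incl_sig (by omega), qq_incl], rfl⟩
      · exact ⟨1, by omega, by rw [← incl_sig (by omega), qq_incl], rfl⟩
      · exact ⟨0, by omega, qq_two, rfl⟩
    obtain ⟨j, hj, h1, h2⟩ := h
    rw [h1, perm_sig hj, h2]
    clear h2 h1 hj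
    interval_cases i <;> interval_cases p <;> interval_cases q <;>
      first | (exact absurd rfl hpq) | decide
  | mul x y hx hy =>
    rw [map_mul, map_mul, map_mul, Equiv.Perm.mul_apply, Equiv.Perm.mul_apply,
      Equiv.Perm.mul_apply, hx (perm_apply_le hp y) (perm_apply_le hq y)
        (fun h => hpq ((perm 3 y).injective h)), hy hp hq hpq]
  | inv x hx =>
    have h1 := hx (perm_apply_le hp x⁻¹) (perm_apply_le hq x⁻¹)
      (fun h => hpq ((perm 3 x⁻¹).injective h))
    rw [← Equiv.Perm.mul_apply, ← Equiv.Perm.mul_apply, ← map_mul, mul_inv_cancel, map_one,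
      Equiv.Perm.one_apply, Equiv.Perm.one_apply] at h1
    rw [h1, ← Equiv.Perm.mul_apply, ← map_mul, ← map_mul, inv_mul_cancel, map_one, map_one,
      Equiv.Perm.one_apply]

theorem perm_qq_eq {g h : Br 3} (e : perm 3 g = perm 3 h) : perm 2 (qq g) = perm 2 (qq h) := by
  have key : ∀ p q, p ≤ 3 → q ≤ 3 → p ≠ q → perm 2 (qq g) (cls p q) = perm 2 (qq h) (cls p q) :=
    fun p q hp hq hpq => by rw [← cls_perm g hp hq hpq, ← cls_perm h hp hq hpq, e]
  ext j
  rcases Nat.lt_or_ge 2 j with hj | hj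
  · rw [perm_apply_of_lt hj, perm_apply_of_lt hj]
  · interval_cases j
    · exact key 0 3 (by omega) (by omega) (by omega)
    · exact key 0 2 (by omega) (by omega) (by omega)
    · exact key 0 1 (by omega) (by omega) (by omega)

/-- A conjugate of the first generator. -/
def sgL : Br 3 := sig 3 1 * sig 3 0 * (sig 3 1)⁻¹

theorem act_sgL_true : act sgL (of true) = of false * of true := by
  have h : (act (sig 3 1))⁻¹ (of true) = of true * (of false)⁻¹ * of true := by
    rw [← MulAut.inv_apply_self _ (act (sig 3 1)) (of true * (of false)⁻¹ * of true)]
    simp only [map_mul, map_inv, act_one_true, act_one_false]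
    group
  rw [sgL, map_mul, map_mul, map_inv, MulAut.mul_apply, MulAut.mul_apply, h]
  simp only [map_mul, map_inv, act_one_true, act_one_false, act_zero_true, act_zero_false]
  group

theorem act_sgL_false : act sgL (of false) = of false := by
  have h : (act (sig 3 1))⁻¹ (of false) = of true := by
    rw [← act_one_true, MulAut.inv_apply_self]
  rw [sgL, map_mul, map_mul, map_inv, MulAut.mul_apply, MulAut.mul_apply, h, act_zero_true,
    act_one_true]

theorem act_zero_zpow (N : ℤ) :
    (act (sig 3 0 ^ N)).toMonoidHom = ev (of true) (of false * of true ^ (-N)) := by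
  have h1 := kk_act (sig 3 0) (of true)
  have h2 := kk_act (sig 3 0) (of false)
  rw [act_zero_true] at h1
  rw [act_zero_false, map_mul, map_inv] at h2
  have h3 : Commute (sig 3 0) (kk (of true)) := (mul_inv_eq_iff_eq_mul.mp h1.symm)
  refine hom_ext_bool ?_ ?_
  · apply kk_injective
    rw [ev_true, MulEquiv.coe_toMonoidHom, kk_act, (h3.zpow_left N).eq, mul_inv_cancel_right]
  · apply kk_injective
    rw [ev_false, MulEquiv.coe_toMonoidHom, kk_act, map_mul, map_zpow]
    have h4 : (kk (of false))⁻¹ * sig 3 0 * kk (of false) = (kk (of true))⁻¹ * sig 3 0 := by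
      have := mul_inv_eq_iff_eq_mul.mp h2.symm
      rw [mul_assoc, this]
      group
    have h5 : (kk (of false))⁻¹ * sig 3 0 ^ N * kk (of false) = kk (of true) ^ (-N) * sig 3 0 ^ N := by
      have h6 := conj_zpow (i := N) (a := (kk (of false))⁻¹) (b := sig 3 0)
      rw [inv_inv] at h6
      rw [← h6, h4, h3.symm.inv_left.mul_zpow, inv_zpow, zpow_neg]
    rw [mul_inv_eq_iff_eq_mul, mul_assoc, ← h5]
    group

theorem act_sgL_zpow (N : ℤ) :
    (act (sgL ^ N)).toMonoidHom = ev (of false ^ N * of true) (of false) := by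
  have h1 := kk_act sgL (of true)
  have h2 := kk_act sgL (of false)
  rw [act_sgL_false] at h2
  rw [act_sgL_true, map_mul] at h1
  have h3 : Commute sgL (kk (of false)) := (mul_inv_eq_iff_eq_mul.mp h2.symm)
  refine hom_ext_bool ?_ ?_
  · apply kk_injective
    rw [ev_true, MulEquiv.coe_toMonoidHom, kk_act, map_mul, map_zpow]
    have h4 : kk (of true) * sgL * (kk (of true))⁻¹ = (kk (of false))⁻¹ * sgL := by
      have := mul_inv_eq_iff_eq_mul.mp h1.symm
      rw [mul_inv_eq_iff_eq_mul, mul_assoc, this]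
      group
    have h5 : kk (of true) * sgL ^ N * (kk (of true))⁻¹ = kk (of false) ^ (-N) * sgL ^ N := by
      rw [← conj_zpow, h4, h3.symm.inv_left.mul_zpow, inv_zpow, zpow_neg]
    have h6 := mul_inv_eq_iff_eq_mul.mp h5
    rw [mul_inv_eq_iff_eq_mul, mul_assoc, h6]
    group
  · apply kk_injective
    rw [ev_false, MulEquiv.coe_toMonoidHom, kk_act, (h3.zpow_left N).eq, mul_inv_cancel_right]

/-- Endomorphisms preserving permutations preserve the free normal subgroup. -/
theorem exists_endo (f : Br 3 →* Br 3) (hf : ∀ b, perm 3 (f b) = perm 3 b) :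
    ∃ i : FreeGroup Bool →* FreeGroup Bool, ∀ w, f (kk w) = kk (i w) := by
  have hq : ∀ g, perm 2 (qq (f g)) = perm 2 (qq g) := fun g => perm_qq_eq (hf g)
  have h0 : qq (sig 3 0) = sig 2 0 := by rw [← incl_sig (by omega), qq_incl]
  have hpow : ∀ i < 2, perm 2 (sig 2 i ^ 2) = 1 := fun i hi => by
    rw [map_pow, perm_sig hi, pow_two, Equiv.swap_mul_self]
  have e2 : ∀ x : Br 3, x ^ 2 = x ^ (2 : ℤ) := fun x => by norm_cast
  have hr : qq (f (kk (of true))) = 1 ∧ qq (f (kk (of false))) = 1 := by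
    refine eq_one_of_pure_relations (A := qq (f (sig 3 0 ^ 2)))
      (B := qq (f ((kk (of false) ^ 2)⁻¹ * sgL ^ 2)))
      (N := -2) (M := 2) ?_ ?_ ?_ ?_ (by norm_num) (by norm_num) ?_ ?_
    · rw [hq, map_pow, h0, hpow 0 (by omega)]
    · have : qq ((kk (of false) ^ 2)⁻¹ * sgL ^ 2) = qq (sig 3 1) * sig 2 0 ^ 2 * (qq (sig 3 1))⁻¹ := by
        rw [map_mul, map_inv, map_pow, qq_kk, map_pow, sgL, map_mul, map_mul, map_inv, h0, conj_pow,
          one_pow, inv_one, one_mul]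
      rw [hq, this, map_mul, map_mul, map_inv, hpow 0 (by omega), mul_one, mul_inv_cancel]
    · rw [hq, qq_kk, map_one]
    · rw [hq, qq_kk, map_one]
    · simp only [← map_inv, ← map_mul, ← map_zpow]
      rw [← kk_act, ← MulEquiv.coe_toMonoidHom, e2, act_zero_zpow, ev_false]
    · simp only [← map_inv, ← map_mul, ← map_zpow]
      have : (kk (of false) ^ 2)⁻¹ * sgL ^ 2 * kk (of true) * ((kk (of false) ^ 2)⁻¹ * sgL ^ 2)⁻¹ =
          (kk (of false) ^ 2)⁻¹ * (sgL ^ 2 * kk (of true) * (sgL ^ 2)⁻¹) * kk (of false) ^ 2 := by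
        group
      rw [this, ← kk_act, ← MulEquiv.coe_toMonoidHom, e2 sgL, act_sgL_zpow, ev_true, ← map_pow,
        ← map_inv, ← map_mul, ← map_mul]
      congr 3
      group
  obtain ⟨u, hu⟩ := exists_kk_of_qq hr.1
  obtain ⟨v, hv⟩ := exists_kk_of_qq hr.2
  refine ⟨ev u v, fun w => ?_⟩
  have : f.comp kk = kk.comp (ev u v) := hom_ext_bool
    (by rw [MonoidHom.comp_apply, MonoidHom.comp_apply, ev_true, hu])
    (by rw [MonoidHom.comp_apply, MonoidHom.comp_apply, ev_false, hv])
  exact DFunLike.congr_fun this w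

/-! ### Integer matrices -/

theorem exists_primitive (M : Fin 2 → Fin 2 → ℤ) (hM : M ≠ 0) :
    ∃ (g : ℤ) (N : Fin 2 → Fin 2 → ℤ), g ≠ 0 ∧ (∀ i j, M i j = g * N i j) ∧
      ∀ q : ℤ, Prime q → ¬ ∀ i j, q ∣ N i j := by
  obtain ⟨N, h1, h2⟩ := Finset.extract_gcd (s := Finset.univ) (fun p : Fin 2 × Fin 2 => M p.1 p.2)
    Finset.univ_nonempty
  refine ⟨Finset.gcd Finset.univ fun p : Fin 2 × Fin 2 => M p.1 p.2, fun i j => N (i, j), ?_,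
    fun i j => h1 (i, j) (Finset.mem_univ _), fun q hq h => ?_⟩
  · intro h
    rw [Finset.gcd_eq_zero_iff] at h
    exact hM (funext fun i => funext fun j => h (i, j) (Finset.mem_univ _))
  · have : q ∣ Finset.gcd Finset.univ N := Finset.dvd_gcd fun p _ => h p.1 p.2
    rw [h2] at this
    exact hq.not_isUnit (isUnit_of_dvd_one this)

theorem exists_unimodular {M A B : Matrix (Fin 2) (Fin 2) ℤ} (hM : M ≠ 0)
    (hA : M * !![1, -1; 0, 1] = A * M) (hB : M * !![1, 0; 1, 1] = B * M) :
    ∃ (g : ℤ) (N : Matrix (Fin 2) (Fin 2) ℤ), g ≠ 0 ∧ M = g • N ∧ (N.det = 1 ∨ N.det = -1) := by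
  obtain ⟨g, N, hg, h1, h2⟩ := exists_primitive (fun i j => M i j) hM
  have hMN : M = g • Matrix.of N := by ext i j; exact h1 i j
  refine ⟨g, Matrix.of N, hg, hMN, Int.isUnit_iff.mp ?_⟩
  rw [hMN, Matrix.smul_mul, Matrix.mul_smul] at hA hB
  replace hA := smul_right_injective _ hg hA
  replace hB := smul_right_injective _ hg hB
  have a00 := congrFun (congrFun hA 0) 0
  have a01 := congrFun (congrFun hA 0) 1
  have a10 := congrFun (congrFun hA 1) 0
  have a11 := congrFun (congrFun hA 1) 1
  have b00 := congrFun (congrFun hB 0) 0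
  have b01 := congrFun (congrFun hB 0) 1
  have b10 := congrFun (congrFun hB 1) 0
  have b11 := congrFun (congrFun hB 1) 1
  simp [Matrix.mul_apply, Fin.sum_univ_two] at a00 a01 a10 a11 b00 b01 b10 b11
  have d : (Matrix.of N).det = N 0 0 * N 1 1 - N 0 1 * N 1 0 := by simp [Matrix.det_fin_two]
  rw [d]
  have e1 : N 0 0 * N 1 1 - N 0 1 * N 1 0 ∣ N 0 0 ^ 2 := ⟨-A 0 1, by
    linear_combination N 0 1 * a00 - N 0 0 * a01⟩
  have e2 : N 0 0 * N 1 1 - N 0 1 * N 1 0 ∣ N 1 0 ^ 2 := ⟨A 1 0, by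
    linear_combination N 1 1 * a10 - N 1 0 * a11⟩
  have e3 : N 0 0 * N 1 1 - N 0 1 * N 1 0 ∣ N 0 1 ^ 2 := ⟨-B 0 1, by
    linear_combination N 0 1 * b00 - N 0 0 * b01⟩
  have e4 : N 0 0 * N 1 1 - N 0 1 * N 1 0 ∣ N 1 1 ^ 2 := ⟨B 1 0, by
    linear_combination N 1 1 * b10 - N 1 0 * b11⟩
  by_contra hu
  have hq : ∃ q : ℤ, Prime q ∧ q ∣ N 0 0 * N 1 1 - N 0 1 * N 1 0 := by
    rcases eq_or_ne (N 0 0 * N 1 1 - N 0 1 * N 1 0) 0 with h0 | h0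
    · exact ⟨2, Int.prime_two, by rw [h0]; exact dvd_zero _⟩
    · obtain ⟨q, hq, hd⟩ := WfDvdMonoid.exists_irreducible_factor hu h0
      exact ⟨q, hq.prime, hd⟩
  obtain ⟨q, hq, hd⟩ := hq
  refine h2 q hq fun i j => ?_
  fin_cases i <;> fin_cases j
  · exact hq.dvd_of_dvd_pow (hd.trans e1)
  · exact hq.dvd_of_dvd_pow (hd.trans e3)
  · exact hq.dvd_of_dvd_pow (hd.trans e2)
  · exact hq.dvd_of_dvd_pow (hd.trans e4)

end Br

namespace Br

open FreeGroup (of)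
open scoped commutatorElement MatrixGroups

variable {m : ℕ}

theorem exists_chis_chis (e e' : Bool) : ∃ e'', ∀ b : Br m, chis m e (chis m e' b) = chis m e'' b := by
  cases e
  · exact ⟨e', fun b => rfl⟩
  · cases e'
    · exact ⟨true, fun b => rfl⟩
    · exact ⟨false, fun b => chis_chis true b⟩

theorem tStd_of_normz (hm : 1 ≤ m) (h : Br m →* Br (m + 1)) (c : Br (m + 1)) (e : Bool)
    (H : TStd (normz h 1 c e)) : TStd h := by
  obtain ⟨c', e', s, t, hc⟩ := H
  obtain ⟨e'', he⟩ := exists_chis_chis (m := m) e e'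
  obtain ⟨l1, hl1⟩ := exists_chis_zt_zpow hm e s
  obtain ⟨l2, hl2⟩ := exists_chis_zt_zpow (m := m + 1) (by omega) e t
  refine ⟨c * chis (m + 1) e c', e'', l1, l2, fun i hi => ?_⟩
  rw [eq_of_normz h 1 c e, hc i hi, map_mul, map_mul, map_mul, map_inv, chis_incl, map_mul, he, hl1,
    hl2, MonoidHom.one_apply, toAdd_one, neg_zero, zpow_zero, mul_one, mul_inv_rev]
  have h1 := ((zt_comm c⁻¹).zpow_left l2).eq
  simp only [mul_assoc]
  rw [h1]

/-- Permutations of elements of the free normal subgroup depend on exponents only. -/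
theorem perm_kk_eq_one {w : FreeGroup Bool} (hw : vec w = 0) : perm 3 (kk w) = 1 := by
  set X : Equiv.Perm ℕ := Equiv.swap 0 1 * Equiv.swap 2 3 with hX
  set Y : Equiv.Perm ℕ := Equiv.swap 0 2 * Equiv.swap 1 3 with hY
  have ext4 : ∀ g h : Equiv.Perm ℕ, (∀ j < 4, g j = h j) → (∀ j ≥ 4, g j = h j) → g = h :=
    fun g h h1 h2 => by
      ext j
      rcases Nat.lt_or_ge j 4 with hj | hj
      · exact h1 j hj
      · exact h2 j hj
  have hsw : ∀ a b j : ℕ, a < 4 → b < 4 → 4 ≤ j → Equiv.swap a b j = j := fun a b j ha hb hj =>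
    Equiv.swap_apply_of_ne_of_ne (by omega) (by omega)
  have hXY : Commute X Y := by
    refine ext4 _ _ ?_ fun j hj => ?_
    · intro j hj; rw [hX, hY]; interval_cases j <;> decide
    · simp only [hX, hY, Equiv.Perm.mul_apply]
      repeat rw [hsw _ _ j (by omega) (by omega) hj]
  have hx : perm 3 (kk (of true)) = X := by
    rw [kk_true, map_mul, map_inv, perm_sig (by omega), perm_sig (by omega), Equiv.swap_inv]
  have hy : perm 3 (kk (of false)) = Y := by
    rw [kk_false, map_mul, map_mul, map_inv, hx, perm_sig (by omega), Equiv.swap_inv]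
    refine ext4 _ _ ?_ fun j hj => ?_
    · intro j hj; rw [hX, hY]; interval_cases j <;> decide
    · simp only [hX, hY, Equiv.Perm.mul_apply]
      repeat rw [hsw _ _ j (by omega) (by omega) hj]
  have key : ∀ w, perm 3 (kk w) = X ^ vec w 0 * Y ^ vec w 1 := fun w => by
    induction w using FreeGroup.induction_on with
    | C1 => simp [vec_one]
    | of b =>
      cases b
      · simp [vec_false, hy]
      · simp [vec_true, hx]
    | inv_of b ih =>
      rw [map_inv, map_inv, ih, vec_inv, Pi.neg_apply, Pi.neg_apply, mul_inv_rev, zpow_neg, zpow_neg]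
      exact (((hXY.zpow_zpow _ _).inv_inv).eq).symm
    | mul a b ha hb =>
      rw [map_mul, map_mul, ha, hb, vec_mul, Pi.add_apply, Pi.add_apply, zpow_add, zpow_add]
      have h := (hXY.zpow_zpow (vec b 0) (vec a 1)).eq
      simp only [mul_assoc]
      rw [← mul_assoc (Y ^ _) (X ^ _), ← h, mul_assoc]
  rw [key, hw]
  simp

/-- The action of the inversion automorphism on the free normal subgroup. -/
theorem exists_chi_kk : ∃ j : FreeGroup Bool →* FreeGroup Bool, (∀ w, chi 3 (kk w) = kk (j w)) ∧
    ∀ w, vec (j w) = (!![-1, -2; 0, 1] : Matrix (Fin 2) (Fin 2) ℤ).mulVec (vec w) := by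
  set j : FreeGroup Bool →* FreeGroup Bool :=
    ev (of true)⁻¹ ((of true)⁻¹ * of false * (of true)⁻¹) with hj
  have h1 : chi 3 (kk (of true)) = kk (of true)⁻¹ := by
    have h := (sig_comm (m := 3) (i := 0) (j := 2) (by omega)).eq
    rw [map_inv, kk_true, map_mul, map_inv, chi_sig (by omega), chi_sig (by omega), inv_inv,
      mul_inv_rev, inv_inv]
    exact (inv_mul_eq_iff_eq_mul.mpr (by rw [← mul_assoc, h, mul_inv_cancel_right]))
  refine ⟨j, fun w => ?_, fun w => ?_⟩
  · have : (chi 3 : Br 3 →* Br 3).comp kk = kk.comp j := by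
      refine hom_ext_bool ?_ ?_
      · rw [MonoidHom.comp_apply, MonoidHom.comp_apply, h1, hj, ev_true]
      · rw [MonoidHom.comp_apply, MonoidHom.comp_apply, hj, ev_false, kk_false, map_mul, map_mul,
          map_inv, h1, chi_sig (by omega), inv_inv, mul_assoc, inv_mul_eq_iff_eq_mul, ← eq_mul_inv_iff_mul_eq,
          ← kk_act]
        simp only [map_mul, map_inv, act_one_true, act_one_false]
        group
    exact DFunLike.congr_fun this w
  · rw [vec_hom, hj, ev_true, ev_false]
    ext k
    fin_cases k <;>
      simp [vec_mul, vec_inv, vec_true, vec_false, Matrix.mulVec, dotProduct, Fin.sum_univ_two] <;> ring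

/-- Endomorphisms preserving permutations can be normalized to act by scalars. -/
theorem exists_scalar (f : Br 3 →* Br 3) (hf : ∀ b, perm 3 (f b) = perm 3 b) :
    ∃ (c : Br 3) (e : Bool) (i : FreeGroup Bool →* FreeGroup Bool) (g : ℤ), g ≠ 0 ∧
      ∀ w, normz f 1 c e (kk w) = kk (i w) ∧ vec (i w) = g • vec w := by
  obtain ⟨i, hi⟩ := exists_endo f hf
  have hact : ∀ g w, i (act g w) = act (f g) (i w) := fun g w => kk_injective (by
    rw [← hi, kk_act, kk_act, ← hi, map_mul, map_mul, map_inv])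
  set M : Matrix (Fin 2) (Fin 2) ℤ :=
    Matrix.of fun k l => vec (i (of (if l = 0 then true else false))) k with hM
  have hMv : ∀ w, vec (i w) = M.mulVec (vec w) := fun w => by
    rw [vec_hom]
    ext k
    simp [hM, Matrix.mulVec, dotProduct, Fin.sum_univ_two]
    ring
  have ext_vec : ∀ A B : Matrix (Fin 2) (Fin 2) ℤ, (∀ w, A.mulVec (vec w) = B.mulVec (vec w)) →
      A = B := fun A B h => by
    have h1 := h (of true)
    have h2 := h (of false)
    rw [vec_true] at h1
    rw [vec_false] at h2
    ext k l
    have h1 := congrFun h1 k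
    have h2 := congrFun h2 k
    simp [Matrix.mulVec, dotProduct, Fin.sum_univ_two] at h1 h2
    fin_cases l
    · exact h1
    · exact h2
  have hS : ∀ g, M * (sl g).1 = (sl (f g)).1 * M := fun g => ext_vec _ _ fun w => by
    rw [← Matrix.mulVec_mulVec, ← Matrix.mulVec_mulVec, ← vec_act, ← hMv, ← hMv, ← vec_act, hact]
  have hM0 : M ≠ 0 := fun h => by
    have h1 : vec (i (of true)) = 0 := by rw [hMv, h, Matrix.zero_mulVec]
    have h2 := perm_kk_eq_one h1
    rw [← hi, hf, kk_true, map_mul, map_inv, perm_sig (by omega), perm_sig (by omega)] at h2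
    have := DFunLike.congr_fun h2 0
    revert this
    decide
  have hL : (sl sgL).1 = !![1, 0; 1, 1] := by
    rw [sgL, map_mul, map_mul, map_inv, sl_sig_zero, sl_sig_one]
    decide
  have hA := hS (sig 3 0)
  rw [sl_sig_zero] at hA
  have hB := hS sgL
  rw [hL] at hB
  obtain ⟨g, N, hg, hgN, hdet⟩ := exists_unimodular hM0 hA hB
  have hvact : ∀ d v u, vec v = (sl d).1.mulVec u → vec (act d⁻¹ v) = u := fun d v u h => by
    rw [vec_act, h, Matrix.mulVec_mulVec, ← Matrix.SpecialLinearGroup.coe_mul, ← map_mul,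
      inv_mul_cancel, map_one, Matrix.SpecialLinearGroup.coe_one, Matrix.one_mulVec]
  have happ : ∀ d e w, normz f 1 d e (kk w) = chis 3 e (kk (act d⁻¹ (i w))) := fun d e w => by
    rw [normz_apply, kk_act, inv_inv, MonoidHom.one_apply, toAdd_one, zpow_zero, mul_one, hi]
  rcases hdet with h1 | h1
  · obtain ⟨d, hd⟩ := sl_surjective ⟨N, h1⟩
    refine ⟨d, false, (act d⁻¹).toMonoidHom.comp i, g, hg, fun w => ⟨happ _ _ _, ?_⟩⟩
    refine hvact d _ _ ?_
    rw [hd, hMv, hgN, Matrix.smul_mulVec, Matrix.mulVec_smul]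
  · obtain ⟨j, hj1, hj2⟩ := exists_chi_kk
    set D : Matrix (Fin 2) (Fin 2) ℤ := !![-1, -2; 0, 1] with hD
    have hDD : D * D = 1 := by decide
    obtain ⟨d, hd⟩ := sl_surjective ⟨N * D, by rw [Matrix.det_mul, h1]; decide⟩
    refine ⟨d, true, j.comp ((act d⁻¹).toMonoidHom.comp i), g, hg, fun w => ⟨?_, ?_⟩⟩
    · rw [happ]
      exact hj1 _
    · have h2 : vec (act d⁻¹ (i w)) = D.mulVec (g • vec w) := by
        refine hvact d _ _ ?_
        rw [hd, hMv, hgN, Matrix.smul_mulVec, Matrix.mulVec_mulVec, Matrix.mulVec_smul, mul_assoc,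
          hDD, mul_one]
      rw [MonoidHom.comp_apply, hj2, MonoidHom.comp_apply, MulEquiv.coe_toMonoidHom, h2,
        Matrix.mulVec_mulVec, hDD, Matrix.one_mulVec]

/-- A word fixed by the first two generators. -/
def kap : FreeGroup Bool := (of true)⁻¹ * of false * of true * (of false)⁻¹

theorem act_kap {j : ℕ} (hj : j < 2) : act (sig 3 j) kap = kap := by
  interval_cases j
  · simp only [kap, map_mul, map_inv, act_zero_true, act_zero_false]
    group
  · simp only [kap, map_mul, map_inv, act_one_true, act_one_false]
    group

theorem commute_kk {g : Br 3} {w : FreeGroup Bool} (h : act g w = w) : Commute g (kk w) := by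
  have := kk_act g w
  rw [h] at this
  exact mul_inv_eq_iff_eq_mul.mp this.symm

theorem eq_zt_zpow_mul_of_fix {w : FreeGroup Bool} (h : ∀ j < 2, act (sig 3 j) w = w) :
    ∃ s t : ℤ, kk w = zt 3 ^ t * incl 2 (zt 2 ^ s) := by
  have hv : vec w = 0 := by
    have h0 := vec_act (sig 3 0) w
    have h1 := vec_act (sig 3 1) w
    rw [h 0 (by omega), sl_sig_zero] at h0
    rw [h 1 (by omega), sl_sig_one] at h1
    have h0 := congrFun h0 0
    have h1 := congrFun h1 0
    simp [Matrix.mulVec, dotProduct, Fin.sum_univ_two] at h0 h1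
    ext k
    fin_cases k
    · simpa [h0] using h1
    · exact h0
  obtain ⟨l, k, hk⟩ := eq_push_T_zpow_mul (perm_kk_eq_one hv) fun b => by
    induction b using induction with
    | one => simp
    | gen i hi => rw [incl_sig hi]; exact (commute_kk (h i hi)).symm
    | mul x y hx hy => rw [map_mul]; exact hx.mul_right hy
    | inv x hx => rw [map_inv]; exact hx.inv_right
  refine ⟨k - l, l, ?_⟩
  rw [hk, show zt 3 ^ l = push 2 (T 3 ^ l) * incl 2 (zt 2 ^ l) from zt_succ_zpow l, mul_assoc, ← map_mul, ← zpow_add, add_sub_cancel]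

end Br

namespace Br

open FreeGroup (of)
open scoped commutatorElement

theorem ext_vec {A B : Matrix (Fin 2) (Fin 2) ℤ}
    (h : ∀ w, A.mulVec (vec w) = B.mulVec (vec w)) : A = B := by
  have h1 := h (of true)
  have h2 := h (of false)
  rw [vec_true] at h1
  rw [vec_false] at h2
  ext k l
  have h1 := congrFun h1 k
  have h2 := congrFun h2 k
  simp [Matrix.mulVec, dotProduct, Fin.sum_univ_two] at h1 h2
  fin_cases l
  · exact h1
  · exact h2

theorem map_act_of_map_kk {f : Br 3 →* Br 3} {i : FreeGroup Bool →* FreeGroup Bool}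
    (hi : ∀ w, f (kk w) = kk (i w)) (b : Br 3) (w : FreeGroup Bool) :
    i (act b w) = act (f b) (i w) := kk_injective (by
  rw [← hi, kk_act, kk_act, ← hi, map_mul, map_mul, map_inv])

theorem act_zpow_kap {b : Br 3} (h : act b kap = kap) (N : ℤ) : act (b ^ N) kap = kap := by
  have h1 : b ∈ (MulAction.stabilizer (MulAut (FreeGroup Bool)) kap).comap act := h
  exact zpow_mem h1 N

theorem act_sgL_kap : act sgL kap = kap := by
  simp only [kap, map_mul, map_inv, act_sgL_true, act_sgL_false]
  group

section
variable {f : Br 3 →* Br 3} {i : FreeGroup Bool →* FreeGroup Bool} {g : ℤ}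

theorem sl_map_of_scalar (hg : g ≠ 0) (hi : ∀ w, f (kk w) = kk (i w))
    (hv : ∀ w, vec (i w) = g • vec w) (b : Br 3) : sl (f b) = sl b := by
  apply Subtype.ext
  refine ext_vec fun w => ?_
  have h := congrArg vec (map_act_of_map_kk hi b w)
  rw [vec_act, hv, hv, vec_act, Matrix.mulVec_smul] at h
  exact (smul_right_injective _ hg h).symm

theorem map_kap_ne_one (hg : g ≠ 0) (hv : ∀ w, vec (i w) = g • vec w) : i kap ≠ 1 := by
  intro h
  have hx : i (of true) ≠ 1 := fun h => by
    have h1 := congrFun (hv (of true)) 0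
    rw [h, vec_one, vec_true] at h1
    simp at h1
    exact hg h1.symm
  have hc : Commute (i (of false)) (i (of true)) := by
    simp only [kap, map_mul, map_inv] at h
    have h := mul_inv_eq_one.mp h
    rw [mul_assoc, inv_mul_eq_iff_eq_mul] at h
    exact h
  obtain ⟨r, hr⟩ := exists_zpow_of_commute hx
  obtain ⟨k, hk⟩ := hr _ (Commute.refl _)
  obtain ⟨l, hl⟩ := hr _ hc
  have h1 := hv (of true)
  have h2 := hv (of false)
  rw [hk, vec_zpow, vec_true] at h1
  rw [hl, vec_zpow, vec_false] at h2
  have a0 := congrFun h1 0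
  have a1 := congrFun h1 1
  have b1 := congrFun h2 1
  simp at a0 a1 b1
  rcases a1 with a1 | a1
  · rw [a1] at a0
    simp at a0
    exact hg a0.symm
  · rw [a1] at b1
    simp at b1
    exact hg b1.symm

theorem isConj_act_of_scalar (hg : g ≠ 0) (hi : ∀ w, f (kk w) = kk (i w))
    (hv : ∀ w, vec (i w) = g • vec w) {b : Br 3} (hb : act b kap = kap) :
    IsConj (act b (i kap)) (i kap) := by
  have h1 := map_act_of_map_kk hi b kap
  rw [hb] at h1
  have h2 : sl (f b * b⁻¹) = 1 := by
    rw [map_mul, map_inv, sl_map_of_scalar hg hi hv, mul_inv_cancel]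
  obtain ⟨w, c, hw⟩ := exists_of_sl_eq_one h2
  rw [isConj_iff]
  refine ⟨w, kk_injective ?_⟩
  rw [map_mul, map_mul, map_inv, kk_act]
  have h3 := congrArg kk h1
  rw [kk_act, mul_inv_eq_iff_eq_mul.mp hw] at h3
  refine Eq.trans ?_ h3.symm
  have hz := ((zt_comm (m := 3) (b * kk (i kap) * b⁻¹)).zpow_left c).eq
  generalize zt 3 ^ c = z at *
  calc kk w * (b * kk (i kap) * b⁻¹) * (kk w)⁻¹
      = kk w * ((b * kk (i kap) * b⁻¹) * z) * z⁻¹ * (kk w)⁻¹ := by group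
    _ = _ := by rw [← hz]; group

theorem exists_conj_kap (hg : g ≠ 0) (hi : ∀ w, f (kk w) = kk (i w))
    (hv : ∀ w, vec (i w) = g • vec w) :
    ∃ v k, k ≠ 0 ∧ i kap = v * kap ^ (k : ℤ) * v⁻¹ := by
  obtain ⟨k, hk⟩ := exists_isConj_commutator (u := i kap)
    (fun N => by
      have h := isConj_act_of_scalar hg hi hv (act_zpow_kap (act_kap (j := 0) (by omega)) (-N))
      have h1 := DFunLike.congr_fun (act_zero_zpow (-N)) (i kap)
      rw [neg_neg] at h1
      rw [← h1]
      exact h)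
    (fun N => by
      have h := isConj_act_of_scalar hg hi hv (act_zpow_kap act_sgL_kap N)
      have h1 := DFunLike.congr_fun (act_sgL_zpow N) (i kap)
      rw [MulEquiv.coe_toMonoidHom] at h1
      rw [h1] at h
      have h2 := map_ev (MulAut.conj (of false ^ (-N))).toMonoidHom (of false ^ N * of true)
        (of false) (i kap)
      simp only [MulEquiv.coe_toMonoidHom, MulAut.conj_apply] at h2
      rw [show of false ^ (-N) * (of false ^ N * of true) * (of false ^ (-N))⁻¹ =
        of true * of false ^ N by group,
        show of false ^ (-N) * of false * (of false ^ (-N))⁻¹ = of false by group] at h2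
      rw [← h2]
      refine IsConj.trans ?_ h
      exact (isConj_iff.mpr ⟨_, rfl⟩ : IsConj _ _).symm)
  obtain ⟨v, hv'⟩ := isConj_iff.mp hk
  have hcm : (⁅of true, of false⁆ : FreeGroup Bool) = of true * kap⁻¹ * (of true)⁻¹ := by
    rw [commutatorElement_def, kap]
    group
  have h1 : i kap = (v⁻¹ * of true) * kap ^ (-k) * (v⁻¹ * of true)⁻¹ := by
    rw [hcm, conj_zpow, inv_zpow'] at hv'
    rw [show (v⁻¹ * of true) * kap ^ (-k) * (v⁻¹ * of true)⁻¹ =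
      v⁻¹ * (of true * kap ^ (-k) * (of true)⁻¹) * v by group, ← hv']
    group
  refine ⟨_, _, ?_, h1⟩
  rintro h0
  rw [h0, zpow_zero, mul_one, mul_inv_cancel] at h1
  exact map_kap_ne_one hg hv h1

end

theorem eq_of_zt_relation {s t : ℤ} (h : incl 2 (zt 2 ^ s) = zt 3 ^ t) : s = 0 ∧ t = 0 := by
  have h0 := congrArg (fun b => lk b 0 3) h
  have h1 := congrArg (fun b => lk b 0 1) h
  simp only [lk_incl, lk_zpow_of_pure _ perm_zt, lk_zt (m := 3) (i := 0) (j := 3) (by omega) (by omega),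
    lk_eq_zero_of_lt (m := 2) (i := 0) (j := 3) (by omega)] at h0
  simp only [lk_incl, lk_zpow_of_pure _ perm_zt, lk_zt (m := 3) (i := 0) (j := 1) (by omega) (by omega),
    lk_zt (m := 2) (i := 0) (j := 1) (by omega) (by omega)] at h1
  omega

theorem tStd_of_scalar {f : Br 3 →* Br 3} {i : FreeGroup Bool →* FreeGroup Bool} {g : ℤ}
    (hg : g ≠ 0) (hi : ∀ w, f (kk w) = kk (i w)) (hv : ∀ w, vec (i w) = g • vec w) :
    TStd (f.comp (incl 2)) := by
  obtain ⟨v, k, hk, hvk⟩ := exists_conj_kap hg hi hv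
  have hkap : kap ≠ 1 := fun h => map_kap_ne_one hg hv (by rw [h, map_one])
  have hkk : kap ^ k ≠ 1 := fun h => hkap ((IsMulTorsionFree.zpow_eq_one_iff_left hk).mp h)
  refine tStd_of_normz (by omega) _ (kk v) false ?_
  have key : ∀ j < 2, ∃ s t : ℤ, (kk v)⁻¹ * f (sig 3 j) * kk v =
      incl 2 (sig 2 j * zt 2 ^ s) * zt 3 ^ t := by
    intro j hj
    set a := (kk v)⁻¹ * f (sig 3 j) * kk v with ha
    have h1 : sl (a * (sig 3 j)⁻¹) = 1 := by
      rw [ha, map_mul, map_mul, map_mul, map_inv, map_inv, sl_kk, sl_map_of_scalar hg hi hv]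
      group
    obtain ⟨w, c, hw⟩ := exists_of_sl_eq_one h1
    have hw := mul_inv_eq_iff_eq_mul.mp hw
    have hc1 : Commute (sig 3 j) (kk (kap ^ k)) :=
      commute_kk (by rw [map_zpow, act_kap hj])
    have hc2 : Commute a (kk (kap ^ k)) := by
      have h2 : Commute (f (sig 3 j)) (kk (i kap)) := by
        rw [← hi]
        exact (commute_kk (act_kap hj)).map f
      rw [hvk, map_mul, map_mul, map_inv] at h2
      have h3 := h2.map (MulAut.conj (kk v)⁻¹)
      simp only [MulAut.conj_apply, inv_inv] at h3
      rw [show (kk v)⁻¹ * (kk v * kk (kap ^ k) * (kk v)⁻¹) * kk v = kk (kap ^ k) by group] at h3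
      exact h3
    have hc3 : Commute w (kap ^ k) := by
      have h2 : Commute (kk w) (kk (kap ^ k)) := by
        have h3 : kk w = a * (sig 3 j)⁻¹ * zt 3 ^ (-c) := by rw [hw]; group
        rw [h3]
        exact (hc2.mul_left hc1.inv_left).mul_left ((zt_comm _).zpow_left _)
      exact kk_injective (by rw [map_mul, map_mul]; exact h2)
    obtain ⟨r, hr⟩ := exists_zpow_of_commute hkk
    obtain ⟨n, hn⟩ := hr kap (Commute.self_zpow kap k)
    obtain ⟨m, hm⟩ := hr w hc3
    have hn0 : n ≠ 0 := fun h => hkap (by rw [hn, h, zpow_zero])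
    have hfix : ∀ l < 2, act (sig 3 l) w = w := fun l hl => by
      have h2 := act_kap hl
      rw [hn, map_zpow] at h2
      rw [hm, map_zpow, zpow_left_injective hn0 h2]
    obtain ⟨s, t, hst⟩ := eq_zt_zpow_mul_of_fix hfix
    refine ⟨s, t + c, ?_⟩
    rw [hw, hst, map_mul, incl_sig hj]
    have e1 := ((zt_comm (m := 2) (sig 2 j)).zpow_left s).map (incl 2)
    rw [incl_sig hj] at e1
    have e1 := e1.eq
    have e2 := ((zt_comm (m := 3) (incl 2 (zt 2 ^ s) * sig 3 j)).zpow_left (t + c)).eq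
    have e3 := ((zt_comm (m := 3) (incl 2 (zt 2 ^ s))).zpow_left c).eq
    rw [← e1, ← e2, zpow_add, mul_assoc (zt 3 ^ t) (incl 2 (zt 2 ^ s)), ← e3]
    simp only [mul_assoc]
  obtain ⟨s0, t0, h0⟩ := key 0 (by omega)
  obtain ⟨s1, t1, h1⟩ := key 1 (by omega)
  have hbr := congrArg (fun b => (kk v)⁻¹ * f b * kk v) (sig_braid (m := 3) (i := 0) (by omega))
  simp only [map_mul] at hbr
  have hrel : incl 2 (zt 2 ^ (s0 - s1)) = zt 3 ^ (t1 - t0) := by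
    have e : ∀ p q : Br 3, (kk v)⁻¹ * (p * q * p) * kk v =
      ((kk v)⁻¹ * p * kk v) * ((kk v)⁻¹ * q * kk v) * ((kk v)⁻¹ * p * kk v) := fun p q => by group
    rw [e, e, h0, h1] at hbr
    simp only [map_mul] at hbr
    have c0 : ∀ (b : Br 2) (s : ℤ), Commute (incl 2 (zt 2 ^ s)) (incl 2 b) := fun b s =>
      ((zt_comm b).zpow_left s).map (incl 2)
    have c1 : ∀ b (t : ℤ), Commute (zt 3 ^ t) b := fun b t => (zt_comm b).zpow_left t
    have e2 : ∀ p q : Br 2, ∀ s t s' t' : ℤ,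
        incl 2 p * incl 2 (zt 2 ^ s) * zt 3 ^ t * (incl 2 q * incl 2 (zt 2 ^ s') * zt 3 ^ t') *
        (incl 2 p * incl 2 (zt 2 ^ s) * zt 3 ^ t) =
        incl 2 (p * q * p) * incl 2 (zt 2 ^ (2 * s + s')) * zt 3 ^ (2 * t + t') := by
      intro p q s t s' t'
      rw [map_mul, map_mul, two_mul, two_mul, zpow_add, zpow_add, zpow_add, zpow_add, map_mul,
        map_mul]
      have a1 := fun b => (c1 b t).eq
      have a2 := fun b => (c1 b t').eq
      have a3 := (c0 q s).eq
      have a4 := (c0 p s).eq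
      have a5 := (c0 p s').eq
      have a6 := ((Commute.refl (zt 2)).zpow_zpow s s').map (incl 2)
      have a6 := a6.eq
      generalize zt 3 ^ t = T at *
      generalize zt 3 ^ t' = T' at *
      generalize incl 2 (zt 2 ^ s) = S at *
      generalize incl 2 (zt 2 ^ s') = S' at *
      generalize incl 2 p = P at *
      generalize incl 2 q = Q at *
      calc P * S * T * (Q * S' * T') * (P * S * T)
          = P * S * (T * (Q * S')) * (T' * (P * S)) * T := by group
        _ = P * (S * Q) * S' * (T * P) * S * (T' * T) := by rw [a1, a2]; group
        _ = P * Q * S * (S' * P) * (T * S) * (T' * T) := by rw [a3, a1]; group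
        _ = P * Q * (S * P) * S' * S * T * (T' * T) := by rw [a5, a1]; group
        _ = P * Q * P * S * (S' * S) * T * (T' * T) := by rw [a4]; group
        _ = P * Q * P * (S * S * S') * (T * (T' * T)) := by rw [← a6]; group
        _ = _ := by rw [← a1 T']; group
    rw [e2, e2, sig_braid (m := 2) (i := 0) (by omega)] at hbr
    rw [mul_assoc (incl 2 _), mul_assoc (incl 2 _) (incl 2 _)] at hbr
    have hbr := mul_left_cancel hbr
    have x1 : (2 * s0 + s1) = (s0 - s1) + (s0 + 2 * s1) := by ring
    have x2 : (2 * s1 + s0) = (s0 + 2 * s1) := by ring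
    have x3 : (2 * t1 + t0) = (t1 - t0) + (2 * t0 + t1) := by ring
    rw [x1, x2, x3, zpow_add _ (s0 - s1), zpow_add _ (t1 - t0), map_mul] at hbr
    have x4 := (c1 (incl 2 (zt 2 ^ (s0 + 2 * s1))) (t1 - t0)).eq
    rw [← mul_assoc (incl 2 (zt 2 ^ (s0 + 2 * s1))), ← x4] at hbr
    simp only [mul_assoc] at hbr
    simpa only [← mul_assoc, mul_left_inj] using hbr
  have h2 := eq_of_zt_relation hrel
  obtain rfl : s0 = s1 := by omega
  obtain rfl : t0 = t1 := by omega
  refine ⟨1, false, s0, t0, fun j hj => ?_⟩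
  have h3 : normz (f.comp (incl 2)) 1 (kk v) false (sig 2 j) =
      (kk v)⁻¹ * f (sig 3 j) * kk v := by
    rw [normz_apply, MonoidHom.one_apply, toAdd_one, zpow_zero, mul_one, MonoidHom.comp_apply,
      incl_sig hj]
    rfl
  rw [h3, one_mul, inv_one, mul_one]
  interval_cases j
  · exact h0
  · exact h1

theorem eStd_three (f : Br 3 →* Br 3) (hf : ∀ b, perm 3 (f b) = perm 3 b) : EStd f := by
  obtain ⟨c, e, i, g, hg, hi⟩ := exists_scalar f hf
  refine eStd_of_tStd (m' := 1) (by omega) f hf (tStd_of_normz (by omega) _ c e ?_)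
  exact tStd_of_scalar hg (fun w => (hi w).1) (fun w => (hi w).2)

end Br

namespace Br

open FreeGroup (of)

variable {m : ℕ}

/-- The permutation of a braid on the set of its strands. -/
noncomputable def permS (m : ℕ) : Br m →* Equiv.Perm (Set.Iic m) where
  toFun b := (perm m b).subtypePerm fun x => by
    constructor
    · intro h
      by_contra hx
      rw [perm_apply_of_lt (by simpa using hx)] at h
      exact hx h
    · exact fun h => perm_apply_le h b
  map_one' := by ext x; simp
  map_mul' a b := Equiv.ext fun x => Subtype.ext (by
    change perm m (a * b) x = perm m a (perm m b x)
    rw [map_mul]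
    rfl)

theorem coe_permS (b : Br m) (x : Set.Iic m) : (permS m b x : ℕ) = perm m b x := rfl

theorem permS_eq_iff {a b : Br m} : permS m a = permS m b ↔ perm m a = perm m b := by
  constructor
  · intro h
    ext x
    by_cases hx : x ≤ m
    · exact congrArg Subtype.val (DFunLike.congr_fun h ⟨x, hx⟩)
    · rw [perm_apply_of_lt (by omega), perm_apply_of_lt (by omega)]
  · intro h
    ext x
    rw [coe_permS, coe_permS, h]

theorem exists_pow_pure (m : ℕ) : ∃ N : ℕ, N ≠ 0 ∧ ∀ b : Br m, perm m (b ^ N) = 1 := by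
  refine ⟨Fintype.card (Equiv.Perm (Set.Iic m)), Fintype.card_ne_zero, fun b => ?_⟩
  rw [← map_one (perm m), ← permS_eq_iff, map_pow, pow_card_eq_one, map_one]

/-- Homomorphisms of the braid group on four strands identifying the permutations of two
commuting generators identify these generators. -/
theorem eq_of_perm_eq (h : Br 3 →* Br m) (hp : perm m (h (sig 3 0)) = perm m (h (sig 3 2))) :
    h (sig 3 0) = h (sig 3 2) := by
  have hx : perm m (h (kk (of true))) = 1 := by
    rw [kk_true, map_mul, map_mul, map_inv, map_inv, hp, mul_inv_cancel]
  have hy : perm m (h (kk (of false))) = 1 := by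
    rw [kk_false, map_mul, map_mul, map_inv, map_mul, map_mul, map_inv, hx]
    group
  obtain ⟨N, hN, hpure⟩ := exists_pow_pure m
  have h0 : (N : ℤ) ≠ 0 := by exact_mod_cast hN
  have hp0 : ∀ b : Br m, perm m (b ^ (N : ℤ)) = 1 := fun b => by rw [zpow_natCast]; exact hpure b
  have k1 : sig 3 0 ^ (N : ℤ) * kk (of false) * (sig 3 0 ^ (N : ℤ))⁻¹ =
      kk (of false) * kk (of true) ^ (-(N : ℤ)) := by
    have h := DFunLike.congr_fun (act_zero_zpow N) (of false)
    rw [ev_false] at h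
    rw [← kk_act]
    exact (congrArg kk h).trans (by rw [map_mul, map_zpow])
  have k2 : sgL ^ (N : ℤ) * kk (of true) * (sgL ^ (N : ℤ))⁻¹ =
      kk (of false) ^ (N : ℤ) * kk (of true) := by
    have h := DFunLike.congr_fun (act_sgL_zpow N) (of true)
    rw [ev_true] at h
    rw [← kk_act]
    exact (congrArg kk h).trans (by rw [map_mul, map_zpow])
  have key := eq_one_of_pure_relations (m := m) (A := h (sig 3 0 ^ (N : ℤ)))
    (B := h (kk (of false) ^ (-(N : ℤ)) * sgL ^ (N : ℤ))) (p := h (kk (of true)))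
    (q := h (kk (of false))) (N := -N) (M := N)
    (by rw [map_zpow, hp0]) (by rw [map_mul, map_mul, map_zpow h sgL, hp0, map_zpow, map_zpow, hy,
      one_zpow, one_mul]) hx hy (by omega) h0
    (by rw [← map_inv, ← map_mul, ← map_mul, k1, map_mul, map_zpow])
    (by
      rw [← map_inv h, ← map_mul h, ← map_mul h, ← map_zpow h, ← map_mul h]
      refine congrArg h ?_
      calc _ = kk (of false) ^ (-(N : ℤ)) * (sgL ^ (N : ℤ) * kk (of true) * (sgL ^ (N : ℤ))⁻¹) *
            kk (of false) ^ (N : ℤ) := by group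
        _ = _ := by rw [k2]; group)
  have h1 := key.1
  rw [kk_true, map_mul, map_inv, mul_inv_eq_one] at h1
  exact h1

/-- The homomorphism shifting the indices of the generators. -/
noncomputable def shift {k m M : ℕ} (h : m + k ≤ M) : Br m →* Br M :=
  lift (fun i => sig M (i + k))
    { braid := fun i hi => by
        have := sig_braid (m := M) (i := i + k) (by omega)
        rw [show i + 1 + k = i + k + 1 by omega]
        exact this
      comm := fun i j hij hj => sig_comm (m := M) (i := i + k) (j := j + k) (by omega) }

theorem shift_sig {k m M : ℕ} (h : m + k ≤ M) {i : ℕ} (hi : i < m) :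
    shift h (sig m i) = sig M (i + k) := lift_sig _ hi

theorem perm_ne_of_injective {m' : ℕ} (hm : 3 ≤ m) (f : Br m →* Br m') (hf : Function.Injective f) :
    perm m' (f (sig m 0)) ≠ perm m' (f (sig m 2)) := by
  intro h
  have h1 := eq_of_perm_eq (f.comp (shift (k := 0) hm)) (by
    rw [MonoidHom.comp_apply, MonoidHom.comp_apply, shift_sig _ (by omega), shift_sig _ (by omega)]
    exact h)
  rw [MonoidHom.comp_apply, MonoidHom.comp_apply, shift_sig _ (by omega), shift_sig _ (by omega)]
    at h1
  have h2 : perm m (sig m 0) 0 = perm m (sig m 2) 0 := by rw [hf h1]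
  rw [perm_sig (by omega), perm_sig (by omega)] at h2
  revert h2
  decide

section
variable {G : Type*} [Group G] (f : Br m →* G)

theorem map_sig_braid {i : ℕ} (hi : i + 1 < m) :
    f (sig m i) * f (sig m (i + 1)) * f (sig m i) =
      f (sig m (i + 1)) * f (sig m i) * f (sig m (i + 1)) := by
  simp only [← map_mul, sig_braid hi]

theorem map_sig_comm {i j : ℕ} (h : i + 2 ≤ j) : Commute (f (sig m i)) (f (sig m j)) :=
  (sig_comm h).map f

theorem eq_of_braid_of_commute {a b : G} (h : a * b * a = b * a * b) (hc : Commute a b) : a = b := by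
  rw [hc.eq, mul_assoc, mul_assoc] at h
  exact mul_left_cancel (mul_left_cancel h)

theorem map_sig_eq_of_succ {i : ℕ} (hi : i + 2 < m) (h : f (sig m (i + 1)) = f (sig m (i + 2))) :
    f (sig m i) = f (sig m (i + 1)) := by
  refine eq_of_braid_of_commute (map_sig_braid f (by omega)) ?_
  rw [h]
  exact map_sig_comm f (by omega)

theorem map_sig_eq_succ_of {i : ℕ} (hi : i + 2 < m) (h : f (sig m i) = f (sig m (i + 1))) :
    f (sig m (i + 1)) = f (sig m (i + 2)) := by
  refine eq_of_braid_of_commute (map_sig_braid f (by omega)) ?_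
  rw [← h]
  exact map_sig_comm f (by omega)

theorem map_sig_eq_of_adjacent {i j : ℕ} (hi : i + 1 < m) (h : f (sig m i) = f (sig m (i + 1)))
    (hj : j < m) : f (sig m j) = f (sig m 0) := by
  have h0 : f (sig m 0) = f (sig m (0 + 1)) := by
    induction i with
    | zero => exact h
    | succ i ih => exact ih (by omega) (map_sig_eq_of_succ f (by omega) h)
  have h1 : ∀ k, k + 1 < m → f (sig m k) = f (sig m (k + 1)) := by
    intro k hk
    induction k with
    | zero => exact h0
    | succ k ih => exact map_sig_eq_succ_of f (by omega) (ih (by omega))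
  induction j with
  | zero => rfl
  | succ j ih => rw [← h1 j hj, ih (by omega)]

theorem map_sig_eq_of_far {i j k : ℕ} (hij : i + 3 ≤ j) (hj : j < m)
    (h : f (sig m i) = f (sig m j)) (hk : k < m) : f (sig m k) = f (sig m 0) := by
  refine map_sig_eq_of_adjacent f (i := j - 1) (by omega) ?_ hk
  refine eq_of_braid_of_commute (map_sig_braid f (by omega)) ?_
  rw [show j - 1 + 1 = j by omega, ← h]
  exact (map_sig_comm f (by omega)).symm

theorem map_sig_eq_of_two {i k : ℕ} (hm : 4 ≤ m) (hi : i + 2 < m)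
    (h : f (sig m i) = f (sig m (i + 2))) (hk : k < m) : f (sig m k) = f (sig m 0) := by
  rcases Nat.eq_zero_or_pos i with rfl | hi0
  · refine map_sig_eq_of_adjacent f (i := 2) (by omega) ?_ hk
    refine eq_of_braid_of_commute (map_sig_braid f (by omega)) ?_
    rw [zero_add] at h
    rw [← h]
    exact map_sig_comm f (by omega)
  · refine map_sig_eq_of_adjacent f (i := i - 1) (by omega) ?_ hk
    refine eq_of_braid_of_commute (map_sig_braid f (by omega)) ?_
    rw [show i - 1 + 1 = i by omega, h]
    exact map_sig_comm f (by omega)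

/-- Generators with distinct images. -/
theorem map_sig_ne {f : Br m →* G} (hm : 3 ≤ m) (h : f (sig m 0) ≠ f (sig m 2)) {i j : ℕ}
    (hij : i < j) (hj : j < m) : f (sig m i) ≠ f (sig m j) := by
  intro h'
  by_cases h1 : j = i + 1
  · subst h1
    exact h (map_sig_eq_of_adjacent f hj h' (by omega)).symm
  by_cases h2 : j = i + 2
  · subst h2
    by_cases h3 : m = 3
    · subst h3
      obtain rfl : i = 0 := by omega
      exact h h'
    · exact h (map_sig_eq_of_two f (by omega) hj h' (by omega)).symm
  · exact h (map_sig_eq_of_far f (by omega) hj h' (by omega)).symm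

/-- A homomorphism with the first generator trivial is trivial on generators. -/
theorem map_sig_eq_one {f : Br m →* G} {i j : ℕ} (hi : i < m) (hj : j < m) (h : f (sig m i) = 1) :
    f (sig m j) = 1 := by
  have key : ∀ k, k + 1 < m → (f (sig m k) = 1 ↔ f (sig m (k + 1)) = 1) := by
    intro k hk
    have := map_sig_braid f hk
    constructor <;> intro h <;> rw [h] at this <;> simpa using this
  have h0 : ∀ k, k < m → (f (sig m k) = 1 ↔ f (sig m 0) = 1) := by
    intro k hk
    induction k with
    | zero => rfl
    | succ k ih => rw [← key k hk, ih (by omega)]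
  rw [h0 j hj, ← h0 i hi, h]

end

end Br

namespace Br

namespace Search

/-- Boolean bounded quantification. -/
def allN (f : ℕ → Bool) : ℕ → Bool
  | 0 => true
  | k + 1 => and (f k) (allN f k)

/-- The digits of a number in base eight. -/
def ap (A i : ℕ) : ℕ := Nat.mod (Nat.div A (Nat.pow 8 i)) 8

/-- Application to a number, which is evaluated first in kernel reduction. -/
def force (X : ℕ) (f : ℕ → Bool) : Bool := Nat.rec (f 0) (fun y _ => f y) (Nat.add X 1)

/-- Depth first search through the sequences of `n` digits extending a sequence of length `i`. -/
def enum (k : ℕ) (Q : ℕ → ℕ → Bool) (P : ℕ → Bool) : ℕ → ℕ → ℕ → Bool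
  | 0, _, A => P A
  | n + 1, i, A =>
    allN (fun x => force (Nat.add A (Nat.mul x (Nat.pow 8 i)))
      fun A' => or (not (Q i A')) (enum k Q P n (Nat.add i 1) A')) k

/-- The number with prescribed digits. -/
def part (c : ℕ → ℕ) : ℕ → ℕ
  | 0 => 0
  | i + 1 => part c i + c i * 8 ^ i

theorem allN_iff {f : ℕ → Bool} {k : ℕ} : allN f k = true ↔ ∀ i < k, f i = true := by
  induction k with
  | zero => simp [allN]
  | succ k ih =>
    simp only [allN, Bool.and_eq_true, ih, Nat.lt_succ_iff_lt_or_eq]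
    constructor
    · rintro ⟨h1, h2⟩ i (h | rfl)
      exacts [h2 i h, h1]
    · exact fun h => ⟨h k (Or.inr rfl), fun i hi => h i (Or.inl hi)⟩

theorem part_lt {c : ℕ → ℕ} (hc : ∀ i, c i < 8) (i : ℕ) : part c i < 8 ^ i := by
  induction i with
  | zero => simp [part]
  | succ i ih =>
    have := Nat.mul_le_mul_right (8 ^ i) (Nat.le_of_lt_succ (hc i))
    rw [part, pow_succ]
    omega

theorem ap_part {c : ℕ → ℕ} (hc : ∀ i, c i < 8) {i j : ℕ} (h : j < i) : ap (part c i) j = c j := by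
  change part c i / 8 ^ j % 8 = c j
  induction i with
  | zero => omega
  | succ i ih =>
    rcases Nat.lt_succ_iff_lt_or_eq.mp h with h | rfl
    · rw [← ih h, part]
      obtain ⟨d, rfl⟩ := Nat.exists_eq_add_of_lt h
      rw [show c (j + d + 1) * 8 ^ (j + d + 1) = 8 ^ j * (8 * (c (j + d + 1) * 8 ^ d)) by ring,
        Nat.add_mul_div_left _ _ (by positivity), Nat.add_mul_mod_self_left]
    · rw [part, Nat.add_mul_div_right _ _ (by positivity), Nat.div_eq_of_lt (part_lt hc _),
        zero_add, Nat.mod_eq_of_lt (hc _)]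

theorem enum_sound {k : ℕ} {Q : ℕ → ℕ → Bool} {P : ℕ → Bool} {c : ℕ → ℕ} {N : ℕ}
    (hc : ∀ i < N, c i < k) (hQ : ∀ i < N, Q i (part c (i + 1)) = true) {n i : ℕ} (hn : i + n = N)
    (h : enum k Q P n i (part c i) = true) : P (part c N) = true := by
  induction n generalizing i with
  | zero => subst hn; exact h
  | succ n ih =>
    have h1 : or (not (Q i (part c (i + 1)))) (enum k Q P n (i + 1) (part c (i + 1))) = true :=
      allN_iff.mp h (c i) (hc i (by omega))
    rw [hQ i (by omega)] at h1
    exact ih (by omega) h1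

/-- The last of the first `i + 1` digits is distinct from the other ones. -/
def inj (i A : ℕ) : Bool := allN (fun j => not (Nat.beq (ap A j) (ap A i))) i

/-- Partial commutation test. -/
def commP (A i B : ℕ) : Bool :=
  allN (fun j => or (Nat.blt i (ap A j)) (Nat.beq (ap B (ap A j)) (ap A (ap B j)))) (Nat.add i 1)

/-- Partial test of the braid relation. -/
def braidP (A i B : ℕ) : Bool :=
  allN (fun j => or (Nat.blt i (ap A j)) (or (Nat.blt i (ap A (ap B j)))
    (Nat.beq (ap A (ap B (ap A j))) (ap B (ap A (ap B j)))))) (Nat.add i 1)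

/-- The first digit is one. -/
def first (i A : ℕ) : Bool := and (inj i A) (Nat.beq (ap A 0) 1)

/-- Boolean equality of all digits. -/
def eqN (k A B : ℕ) : Bool := allN (fun j => Nat.beq (ap A j) (ap B j)) k

/-- Possible pairs of commuting generators on five points. -/
def good5 (A C : ℕ) : Bool :=
  or (eqN 5 A C) (or
    (allN (fun k => or (Nat.beq k 0) (or (Nat.beq k 1) (Nat.beq (ap A k) k))) 5)
    (and (allN (fun k => Nat.beq (ap C (ap A k)) k) 5)
      (and (Nat.beq (ap A (ap A (ap A (ap A 0)))) 0) (and (not (Nat.beq (ap A (ap A 0)) 0))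
        (allN (fun k => or (Nat.beq (ap A k) k) (or (Nat.beq k 0) (or (Nat.beq k (ap A 0))
          (or (Nat.beq k (ap A (ap A 0))) (Nat.beq k (ap A (ap A (ap A 0)))))))) 5)))))

/-- The search on five points. -/
def check5 : Bool :=
  enum 5 first (fun A => enum 5 (fun i C => and (inj i C) (commP A i C))
    (fun C => or (good5 A C) (enum 5 (fun i B => and (inj i B) (and (braidP A i B) (braidP C i B)))
      (fun _ => false) 5 0 0)) 5 0 0) 5 0 0

/-- Involution without fixed points. -/
def fpf (k A : ℕ) : Bool :=
  allN (fun j => and (Nat.beq (ap A (ap A j)) j) (not (Nat.beq (ap A j) j))) k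

/-- Permutations with third power one. -/
def cube (k A : ℕ) : Bool := allN (fun j => Nat.beq (ap A (ap A (ap A j))) j) k

/-- Possible pairs of commuting generators on six points. -/
def good6 (A C : ℕ) : Bool :=
  or (allN (fun k => or (Nat.beq (ap A k) k) (or (Nat.beq k 0) (or (Nat.beq k (ap A 0))
      (Nat.beq k (ap A (ap A 0)))))) 6)
    (or (and (cube 6 A) (not (cube 6 C))) (and (fpf 6 A)
      (or (not (fpf 6 C)) (allN (fun i => or (Nat.beq (ap C i) (ap A i)) (allN (fun j =>
        or (Nat.beq (ap C j) (ap A j)) (or (Nat.beq j i) (or (Nat.beq j (ap C i))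
          (or (Nat.beq j (ap A i)) (Nat.beq j (ap A (ap C i))))))) 6)) 6))))

/-- The search on six points. -/
def check6 : Bool :=
  enum 6 first (fun A => enum 6 (fun i C => and (inj i C) (commP A i C))
    (fun C => or (good6 A C) (enum 6 (fun i D => and (inj i D) (and (commP A i D) (braidP C i D)))
      (fun D => eqN 6 C D) 6 0 0)) 6 0 0) 6 0 0

end Search

open Search

theorem check5_eq : check5 = true := by decide +kernel

theorem check6_eq : check6 = true := by decide +kernel

end Br

namespace Br

open Search

section
variable {Ω : Type*} {k : ℕ} (e : Ω ≃ Fin k)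

/-- The digits of a permutation with respect to a numbering. -/
def dg (a : Equiv.Perm Ω) (j : ℕ) : ℕ := if h : j < k then e (a (e.symm ⟨j, h⟩)) else 0

theorem dg_apply (a : Equiv.Perm Ω) (x : Ω) : dg e a (e x) = e (a x) := by
  rw [dg, dif_pos (e x).2]
  simp

theorem dg_lt (a : Equiv.Perm Ω) {j : ℕ} (hj : j < k) : dg e a j < k := by
  rw [dg, dif_pos hj]
  exact Fin.is_lt _

theorem dg_lt_eight (hk : k ≤ 8) (a : Equiv.Perm Ω) (j : ℕ) : dg e a j < 8 := by
  rw [dg]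
  split_ifs with h
  · exact lt_of_lt_of_le (Fin.is_lt _) hk
  · omega

theorem ap_part_dg (hk : k ≤ 8) (a : Equiv.Perm Ω) {x : Ω} {i : ℕ} (h : (e x : ℕ) < i) :
    ap (part (dg e a) i) (e x) = e (a x) := by
  rw [ap_part (dg_lt_eight e hk a) h, dg_apply]

theorem ap_code (hk : k ≤ 8) (a : Equiv.Perm Ω) (x : Ω) :
    ap (part (dg e a) k) (e x) = e (a x) := ap_part_dg e hk a (e x).2

theorem allN_iff_forall {f : ℕ → Bool} : allN f k = true ↔ ∀ x : Ω, f (e x) = true := by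
  rw [allN_iff]
  constructor
  · exact fun h x => h _ (e x).2
  · intro h i hi
    have := h (e.symm ⟨i, hi⟩)
    simpa using this

theorem allN_iff_forall_le {f : ℕ → Bool} {i : ℕ} (hi : i ≤ k) :
    allN f i = true ↔ ∀ x : Ω, (e x : ℕ) < i → f (e x) = true := by
  rw [allN_iff]
  constructor
  · exact fun h x hx => h _ hx
  · intro h j hj
    have := h (e.symm ⟨j, by omega⟩)
    simpa [hj] using this

theorem beq_iff (x y : Ω) : Nat.beq (e x) (e y) = true ↔ x = y := by
  rw [Nat.beq_eq, Fin.val_inj, e.apply_eq_iff_eq]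

theorem inj_part (hk : k ≤ 8) (a : Equiv.Perm Ω) {i : ℕ} (hi : i < k) :
    inj i (part (dg e a) (i + 1)) = true := by
  obtain ⟨y, hy⟩ : ∃ y, (e y : ℕ) = i := ⟨e.symm ⟨i, hi⟩, by simp⟩
  rw [inj, allN_iff_forall_le e hi.le]
  intro x hx
  rw [← hy] at hx ⊢
  rw [ap_part_dg e hk a (by omega), ap_part_dg e hk a (by omega), Bool.not_eq_true',
    ← Bool.not_eq_true, beq_iff, a.apply_eq_iff_eq]
  rintro rfl
  omega

theorem commP_part (hk : k ≤ 8) {a b : Equiv.Perm Ω} (h : Commute a b) {i : ℕ} (hi : i < k) :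
    commP (part (dg e a) k) i (part (dg e b) (i + 1)) = true := by
  rw [commP]
  refine (allN_iff_forall_le e (show i + 1 ≤ k from hi)).mpr fun x hx => ?_
  rw [ap_part_dg e hk b hx, ap_code e hk, ap_code e hk, Bool.or_eq_true]
  by_cases h1 : (e (a x) : ℕ) < i + 1
  · right
    rw [ap_part_dg e hk b h1, beq_iff]
    exact (DFunLike.congr_fun h.eq x).symm
  · left
    rw [Nat.blt_eq]
    omega

theorem braidP_part (hk : k ≤ 8) {a b : Equiv.Perm Ω} (h : a * b * a = b * a * b) {i : ℕ}
    (hi : i < k) : braidP (part (dg e a) k) i (part (dg e b) (i + 1)) = true := by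
  rw [braidP]
  refine (allN_iff_forall_le e (show i + 1 ≤ k from hi)).mpr fun x hx => ?_
  rw [ap_part_dg e hk b hx, ap_code e hk, ap_code e hk, Bool.or_eq_true, Bool.or_eq_true]
  by_cases h1 : (e (a x) : ℕ) < i + 1
  · by_cases h2 : (e (a (b x)) : ℕ) < i + 1
    · right; right
      rw [ap_part_dg e hk b h1, ap_part_dg e hk b h2, ap_code e hk, beq_iff]
      exact DFunLike.congr_fun h x
    · right; left
      rw [Nat.blt_eq]
      omega
  · left
    rw [Nat.blt_eq]
    omega

theorem first_part (hk : k ≤ 8) (h1 : 1 < k) {a : Equiv.Perm Ω} {x : Ω} (hx : (e x : ℕ) = 0)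
    (hax : (e (a x) : ℕ) = 1) {i : ℕ} (hi : i < k) : first i (part (dg e a) (i + 1)) = true := by
  rw [first, inj_part e hk a hi, Bool.true_and, Nat.beq_eq, ← hx, ap_part_dg e hk a (by omega),
    hax]

theorem exists_numbering {Ω : Type*} {k : ℕ} (e : Ω ≃ Fin k) (h1 : 1 < k) {x y : Ω} (hxy : x ≠ y) :
    ∃ e : Ω ≃ Fin k, (e x : ℕ) = 0 ∧ (e y : ℕ) = 1 := by
  classical
  let e1 := e.trans (Equiv.swap (e x) ⟨0, by omega⟩)
  have hx : e1 x = ⟨0, by omega⟩ := by simp [e1]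
  refine ⟨e1.trans (Equiv.swap (e1 y) ⟨1, h1⟩), ?_, by simp⟩
  rw [Equiv.trans_apply, hx, Equiv.swap_apply_of_ne_of_ne]
  · rw [← hx]
    exact fun h => hxy (e1.injective h)
  · simp

end

theorem five_points {Ω : Type*} [Finite Ω] (hΩ : Nat.card Ω = 5) {a b c : Equiv.Perm Ω}
    (hab : a * b * a = b * a * b) (hbc : b * c * b = c * b * c) (hac : Commute a c) (hne : a ≠ c)
    {x : Ω} (hx : a x ≠ x) :
    (∀ y, y = x ∨ y = a x ∨ a y = y) ∨
      (∀ y, c (a y) = y) ∧ a (a (a (a x))) = x ∧ a (a x) ≠ x ∧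
        ∀ y, a y = y ∨ y = x ∨ y = a x ∨ y = a (a x) ∨ y = a (a (a x)) := by
  obtain ⟨e, he0, he1⟩ := exists_numbering (Finite.equivFinOfCardEq hΩ) (by omega) hx.symm
  have hk : 5 ≤ 8 := by omega
  have h1 := enum_sound (c := dg e a) (N := 5) (n := 5) (i := 0) (fun i hi => dg_lt e a hi)
    (fun i hi => first_part e hk (by omega) he0 he1 hi) rfl check5_eq
  have h2 := enum_sound (c := dg e c) (N := 5) (n := 5) (i := 0) (fun i hi => dg_lt e c hi)
    (fun i hi => by rw [inj_part e hk c hi, commP_part e hk hac hi]; rfl) rfl h1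
  rcases Bool.or_eq_true_iff.mp h2 with h3 | h3
  · rw [good5, Bool.or_eq_true, Bool.or_eq_true, eqN, allN_iff_forall e, allN_iff_forall e] at h3
    rcases h3 with h3 | h3 | h3
    · refine absurd (Equiv.ext fun y => ?_) hne
      have := h3 y
      rwa [ap_code e hk, ap_code e hk, beq_iff] at this
    · left
      intro y
      have := h3 y
      rw [Bool.or_eq_true, Bool.or_eq_true, ap_code e hk, ← he0, ← he1, beq_iff, beq_iff, beq_iff]
        at this
      exact this
    · right
      simp only [Bool.and_eq_true, allN_iff_forall e, ← he0, ap_code e hk, beq_iff, Bool.or_eq_true,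
        Bool.not_eq_true', ← Bool.not_eq_true] at h3
      exact h3
  · have h4 := enum_sound (c := dg e b) (N := 5) (n := 5) (i := 0) (fun i hi => dg_lt e b hi)
      (fun i hi => by
        rw [inj_part e hk b hi, braidP_part e hk hab hi, braidP_part e hk hbc.symm hi]; rfl) rfl h3
    exact absurd h4 Bool.false_ne_true

theorem six_points {Ω : Type*} [Finite Ω] (hΩ : Nat.card Ω = 6) {a c d : Equiv.Perm Ω}
    (hcd : c * d * c = d * c * d) (hac : Commute a c) (had : Commute a d) (hne : c ≠ d)
    {x : Ω} (hx : a x ≠ x) :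
    (∀ y, a y = y ∨ y = x ∨ y = a x ∨ y = a (a x)) ∨
      ((∀ y, a (a (a y)) = y) ∧ ¬ ∀ y, c (c (c y)) = y) ∨
      (∀ y, a (a y) = y ∧ a y ≠ y) ∧
        ((¬ ∀ y, c (c y) = y ∧ c y ≠ y) ∨
          ∀ y, c y = a y ∨ ∀ z, c z = a z ∨ z = y ∨ z = c y ∨ z = a y ∨ z = a (c y)) := by
  obtain ⟨e, he0, he1⟩ := exists_numbering (Finite.equivFinOfCardEq hΩ) (by omega) hx.symm
  have hk : 6 ≤ 8 := by omega
  have h1 := enum_sound (c := dg e a) (N := 6) (n := 6) (i := 0) (fun i hi => dg_lt e a hi)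
    (fun i hi => first_part e hk (by omega) he0 he1 hi) rfl check6_eq
  have h2 := enum_sound (c := dg e c) (N := 6) (n := 6) (i := 0) (fun i hi => dg_lt e c hi)
    (fun i hi => by rw [inj_part e hk c hi, commP_part e hk hac hi]; rfl) rfl h1
  rcases Bool.or_eq_true_iff.mp h2 with h3 | h3
  · simp only [good6, cube, fpf, Bool.and_eq_true, allN_iff_forall e, ← he0, ap_code e hk, beq_iff,
      Bool.or_eq_true, Bool.not_eq_true', ← Bool.not_eq_true] at h3
    exact h3
  · have h4 := enum_sound (c := dg e d) (N := 6) (n := 6) (i := 0) (fun i hi => dg_lt e d hi)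
      (fun i hi => by
        rw [inj_part e hk d hi, commP_part e hk had hi, braidP_part e hk hcd hi]; rfl) rfl h3
    refine absurd (Equiv.ext fun y => ?_) hne
    have := allN_iff_forall e |>.mp h4 y
    rwa [ap_code e hk, ap_code e hk, beq_iff] at this

end Br

namespace Br

open Equiv.Perm OnCycleFactors

variable {m : ℕ}

theorem eq_of_braid_three : ∀ k ≤ 3, ∀ a c : Equiv.Perm (Fin k), a * c = c * a →
    ∀ b : Equiv.Perm (Fin k), a * b * a = b * a * b → b * c * b = c * b * c → a = c := by
  intro k hk
  interval_cases k <;> decide +kernel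

theorem eq_of_braid_four : ∀ k ≤ 4, ∀ a c : Equiv.Perm (Fin k), a * c = c * a → a ≠ 1 →
    ∀ d : Equiv.Perm (Fin k), a * d = d * a → c * d * c = d * c * d → c = d := by
  intro k hk
  interval_cases k <;> decide +kernel

theorem commute_of_two : ∀ k ≤ 2, ∀ a c : Equiv.Perm (Fin k), a * c = c * a := by
  intro k hk
  interval_cases k <;> decide +kernel

theorem sq_of_braid_three : ∀ k ≤ 3, ∀ a c : Equiv.Perm (Fin k), a * c * a = c * a * c → a ≠ c →
    a * a = 1 := by
  intro k hk
  interval_cases k <;> decide +kernel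

/-- Permutations of a finite type, as permutations of an initial segment. -/
noncomputable def permFin (Ω : Type) [Finite Ω] :
    Equiv.Perm Ω ≃* Equiv.Perm (Fin (Nat.card Ω)) :=
  (Finite.equivFinOfCardEq rfl).permCongrHom

section
variable {Ω : Type} (a : Equiv.Perm Ω)

/-- The action of the centralizer of a permutation on the fixed points. -/
def fixHom : Subgroup.centralizer {a} →* Equiv.Perm {x // a x = x} where
  toFun g := g.1.subtypePerm fun x => by
    have h := DFunLike.congr_fun (Subgroup.mem_centralizer_singleton_iff.mp g.2) x
    rw [Equiv.Perm.mul_apply, Equiv.Perm.mul_apply] at h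
    rw [← h, g.1.apply_eq_iff_eq]
  map_one' := rfl
  map_mul' _ _ := rfl

variable {a}

theorem eq_on_fix {g h : Subgroup.centralizer {a}} (hgh : fixHom a g = fixHom a h) {x : Ω}
    (hx : a x = x) : g.1 x = h.1 x :=
  congrArg Subtype.val (DFunLike.congr_fun hgh (⟨x, hx⟩ : {x // a x = x}) : _)

variable [Fintype Ω] [DecidableEq Ω]

theorem exists_zpow_apply {g : Subgroup.centralizer {a}} (hg : toPermHom a g = 1) (x : Ω)
    (hx : a x ≠ x) : ∃ j : ℤ, g.1 x = (a ^ j) x := by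
  have h1 := (mem_ker_toPermHom_iff a g).mp (MonoidHom.mem_ker.mpr hg) (a.cycleOf x)
    (cycleOf_mem_cycleFactorsFinset_iff.mpr (mem_support.mpr hx))
  have h2 : g.1 x ∈ (a.cycleOf x).support := by
    rw [mem_support]
    have h3 := DFunLike.congr_fun h1.eq x
    rw [Equiv.Perm.mul_apply, Equiv.Perm.mul_apply, cycleOf_apply_self] at h3
    rw [← h3]
    exact fun h => hx (g.1.injective h)
  obtain ⟨j, hj⟩ := (mem_support_cycleOf_iff.mp h2).1
  exact ⟨j, hj.symm⟩

theorem centralizer_zpow (g : Subgroup.centralizer {a}) (j : ℤ) (x : Ω) :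
    g.1 ((a ^ j) x) = (a ^ j) (g.1 x) := by
  have h : Commute g.1 a := Subgroup.mem_centralizer_singleton_iff.mp g.2
  exact DFunLike.congr_fun (h.zpow_right j).eq x

theorem commute_of_ker {d e : Subgroup.centralizer {a}} (hd : toPermHom a d = 1)
    (he : toPermHom a e = 1) (hdf : fixHom a d = 1) : Commute d e := by
  refine Subtype.ext (Equiv.ext fun x => ?_)
  change d.1 (e.1 x) = e.1 (d.1 x)
  have hfix : ∀ {y}, a y = y → d.1 y = y := fun hy => eq_on_fix (h := 1) (hdf.trans (map_one _).symm) hy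
  by_cases hx : a x = x
  · rw [hfix hx, hfix]
    have := centralizer_zpow e 1 x
    rw [zpow_one, hx] at this
    exact this.symm
  · obtain ⟨j, hj⟩ := exists_zpow_apply hd x hx
    obtain ⟨l, hl⟩ := exists_zpow_apply he x hx
    rw [hj, hl, centralizer_zpow, centralizer_zpow, hj, hl, ← Equiv.Perm.mul_apply,
      ← Equiv.Perm.mul_apply, ← zpow_add, ← zpow_add, add_comm]

theorem card_cycles_le : 2 * Nat.card a.cycleFactorsFinset ≤ a.support.card := by
  rw [← sum_cycleType, Nat.card_eq_fintype_card, Fintype.card_coe, cycleType_def]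
  have := Multiset.card_nsmul_le_sum (s := a.cycleType) (a := 2)
    fun x hx => two_le_of_mem_cycleType hx
  rw [cycleType_def, Multiset.card_map, smul_eq_mul, mul_comm] at this
  exact this

theorem card_fix : Nat.card {x // a x = x} + a.support.card = Nat.card Ω := by
  rw [Nat.card_eq_fintype_card, Nat.card_eq_fintype_card, Fintype.card_subtype, support,
    Finset.card_filter_add_card_filter_not, Finset.card_univ]

end

/-- The action of the last generators on the centralizer of the image of the first one. -/
noncomputable def centHom {G : Type*} [Group G] (f : Br m →* G) {k : ℕ} (h : k + 2 ≤ m) :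
    Br k →* Subgroup.centralizer {f (sig m 0)} :=
  (f.comp (shift h)).codRestrict _ fun b => by
    induction b using induction with
    | one => rw [map_one]; exact one_mem _
    | gen i hi =>
      rw [Subgroup.mem_centralizer_singleton_iff, MonoidHom.comp_apply, shift_sig h hi]
      exact (map_sig_comm f (by omega)).symm
    | mul a b ha hb => rw [map_mul]; exact mul_mem ha hb
    | inv a ha => rw [map_inv]; exact inv_mem ha

theorem coe_centHom {G : Type*} [Group G] (f : Br m →* G) {k : ℕ} (h : k + 2 ≤ m) (b : Br k) :
    (centHom f h b : G) = f (shift h b) := rfl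

theorem eq_of_braid_of_commute_mul {G : Type*} [Group G] {x y z : G} (hxy : x * y * x = y * x * y)
    (hyz : y * z * y = z * y * z) (hx : Commute (x * z⁻¹) x) (hy : Commute (x * z⁻¹) y) :
    x = z := by
  obtain ⟨d, hd⟩ : ∃ d, d = x * z⁻¹ := ⟨_, rfl⟩
  obtain rfl : z = d⁻¹ * x := by rw [hd]; group
  rw [← hd] at hx hy
  have h1 : y * (d⁻¹ * x) * y = d⁻¹ * (y * x * y) := by
    rw [← mul_assoc, ← hy.inv_left.eq]; group
  have h2 : d⁻¹ * x * y * (d⁻¹ * x) = d⁻¹ * (d⁻¹ * (x * y * x)) := by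
    rw [← mul_assoc, mul_assoc d⁻¹ x y, mul_assoc d⁻¹ (x * y),
      ← (hx.inv_left.mul_right hy.inv_left).eq]; group
  rw [h1, h2, hxy] at hyz
  have h3 : d⁻¹ * (y * x * y) = 1 * (y * x * y) := by
    rw [one_mul]
    exact (mul_left_cancel hyz).symm
  rw [mul_right_cancel h3, one_mul]

/-- Generators acting in the same way on the cycles and the fixed points of the first one. -/
theorem map_eq_of_cycles {Ω : Type} [Fintype Ω] [DecidableEq Ω] {f : Br m →* Equiv.Perm Ω}
    {k : ℕ} (h : k + 2 ≤ m) (hk : 3 ≤ k)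
    (h1 : toPermHom _ (centHom f h (sig k 0)) = toPermHom _ (centHom f h (sig k 1)))
    (h2 : fixHom _ (centHom f h (sig k 0)) = fixHom _ (centHom f h (sig k 2))) :
    f (sig m 2) = f (sig m 4) := by
  have h3 : toPermHom _ (centHom f h (sig k 2)) = toPermHom _ (centHom f h (sig k 0)) :=
    map_sig_eq_of_adjacent ((toPermHom _).comp (centHom f h)) (i := 0) (by omega) h1 (by omega)
  set s := centHom f h with hs
  have hc : Commute (s (sig k 0) * (s (sig k 2))⁻¹) (s (sig k 0) * (s (sig k 1))⁻¹) :=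
    commute_of_ker (by rw [map_mul, map_inv, h3, mul_inv_cancel])
      (by rw [map_mul, map_inv, h1, mul_inv_cancel]) (by rw [map_mul, map_inv, h2, mul_inv_cancel])
  have hc0 : Commute (s (sig k 0) * (s (sig k 2))⁻¹) (s (sig k 0)) :=
    (Commute.refl _).mul_left (map_sig_comm s (by omega : 0 + 2 ≤ 2)).symm.inv_left
  have hc1 : Commute (s (sig k 0) * (s (sig k 2))⁻¹) (s (sig k 1)) := by
    have := hc.inv_right.mul_right hc0
    rwa [mul_inv_rev, inv_inv, inv_mul_cancel_right] at this
  have hb := map_sig_braid s (i := 0) (by omega)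
  have hb' := map_sig_braid s (i := 1) (by omega)
  have key : s (sig k 0) = s (sig k 2) := by
    exact eq_of_braid_of_commute_mul hb hb' hc0 hc1
  have := congrArg Subtype.val key
  rw [hs, coe_centHom, coe_centHom, shift_sig _ (by omega), shift_sig _ (by omega)] at this
  exact this

/-- Noncyclic actions of braid groups have more points than generators. -/
theorem map_sig_eq_of_card (hm : 3 ≤ m) {Ω : Type} [Finite Ω] (hΩ : Nat.card Ω ≤ m)
    (f : Br m →* Equiv.Perm Ω) : f (sig m 0) = f (sig m 2) := by
  classical
  induction m using Nat.strong_induction_on generalizing Ω with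
  | _ m ih =>
  by_contra hne
  rcases Nat.lt_or_ge m 5 with h5 | h5
  · refine hne ((permFin Ω).injective ?_)
    obtain rfl | rfl : m = 3 ∨ m = 4 := by omega
    · refine eq_of_braid_three _ hΩ _ _ ?_ (permFin Ω (f (sig 3 1))) ?_ ?_
      · simp only [← map_mul, (sig_comm (m := 3) (show 0 + 2 ≤ 2 by omega)).eq]
      · simp only [← map_mul, sig_braid (m := 3) (i := 0) (by omega)]
      · simp only [← map_mul, sig_braid (m := 3) (i := 1) (by omega)]
    · have h23 := eq_of_braid_four _ hΩ (permFin Ω (f (sig 4 0))) (permFin Ω (f (sig 4 2))) ?_ ?_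
        (permFin Ω (f (sig 4 3))) ?_ ?_
      · exact absurd ((permFin Ω).injective h23) (map_sig_ne hm hne (by omega) (by omega))
      · simp only [← map_mul, (sig_comm (m := 4) (show 0 + 2 ≤ 2 by omega)).eq]
      · intro h
        have h0 := (map_eq_one_iff _ (permFin Ω).injective).mp h
        exact hne (h0.trans (map_sig_eq_one (by omega) (by omega) h0).symm)
      · simp only [← map_mul, (sig_comm (m := 4) (show 0 + 2 ≤ 3 by omega)).eq]
      · simp only [← map_mul, sig_braid (m := 4) (i := 2) (by omega)]
  · have := Fintype.ofFinite Ω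
    have ha : f (sig m 0) ≠ 1 := fun h0 =>
      hne (h0.trans (map_sig_eq_one (by omega) (by omega) h0).symm)
    have hs := two_le_card_support_of_ne_one ha
    have hF := card_fix (a := f (sig m 0))
    have hC := card_cycles_le (a := f (sig m 0))
    have hk : m - 2 + 2 ≤ m := by omega
    have h2 := ih (m - 2) (by omega) (by omega) (by omega) ((fixHom _).comp (centHom f hk))
    refine map_sig_ne hm hne (i := 2) (j := 4) (by omega) (by omega)
      (map_eq_of_cycles hk (by omega) ?_ h2)
    by_cases h6 : m = 5
    · refine eq_of_braid_of_commute (map_sig_braid ((toPermHom _).comp (centHom f hk)) (i := 0)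
        (by omega)) ((permFin _).injective ?_)
      rw [map_mul, map_mul]
      exact commute_of_two _ (by omega) _ _
    · have h3 := ih (m - 2) (by omega) (by omega) (by omega) ((toPermHom _).comp (centHom f hk))
      exact (map_sig_eq_of_two _ (i := 0) (by omega) (by omega) h3 (by omega)).symm

end Br

namespace Br

open FreeGroup (of)
open Equiv.Perm OnCycleFactors

variable {m : ℕ}

/-- A permutation preserves a pair of points. -/
def Pres {Ω : Type*} (p : Equiv.Perm Ω) (i j : Ω) : Prop := (p i = i ∧ p j = j) ∨ (p i = j ∧ p j = i)

theorem lk_of_pres (a : Br m) {p : Equiv.Perm ℕ} {i j : ℕ} (h : Pres p i j) :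
    lk a (p i) (p j) = lk a i j := by
  rcases h with ⟨h1, h2⟩ | ⟨h1, h2⟩ <;> rw [h1, h2]
  exact lk_symm a j i

theorem lk_conj_of_pres {g X : Br m} {i j : ℕ} (h : Pres (perm m X) i j) :
    lk (g * X * g⁻¹) (perm m g i) (perm m g j) = lk X i j := by
  have hg : ∀ x, (perm m g)⁻¹ (perm m g x) = x := (perm m g).symm_apply_apply
  rw [lk_mul, lk_inv, lk_mul, map_inv, hg, hg, lk_of_pres g h]
  ring

theorem lk_of_commute {g X : Br m} (hg : Commute g X) {i j : ℕ} (h : Pres (perm m X) i j) :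
    lk X (perm m g i) (perm m g j) = lk X i j := by
  have := lk_conj_of_pres (g := g) h
  rwa [hg.eq, mul_inv_cancel_right] at this

theorem lk_ne_zero {X : Br m} {i j : ℕ} (hij : i ≠ j) (h1 : perm m X i = j) (h2 : perm m X j = i) :
    lk X i j ≠ 0 := by
  intro h
  have := (lk_odd_iff X hij).mpr (by rw [h1, h2]; omega)
  rw [h] at this
  exact absurd this (by decide)

theorem Pres.conj {Ω : Type*} {p g : Equiv.Perm Ω} {i j : Ω} (h : Pres p i j) :
    Pres (g * p * g⁻¹) (g i) (g j) := by
  rcases h with ⟨h1, h2⟩ | ⟨h1, h2⟩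
  · left; simp [h1, h2]
  · right; simp [h1, h2]

theorem sig_three_conj : sig 3 1 * sig 3 0 * sig 3 2 * sig 3 1 * kk (of true) *
    (sig 3 1 * sig 3 0 * sig 3 2 * sig 3 1)⁻¹ = (kk (of true))⁻¹ := by
  have h01 := sig_braid (m := 3) (i := 0) (by omega)
  have h12 := sig_braid (m := 3) (i := 1) (by omega)
  have h02 : sig 3 0 * sig 3 2 = sig 3 2 * sig 3 0 := (sig_comm (by omega)).eq
  rw [kk_true]
  simp only [zero_add, show 1 + 1 = 2 from rfl] at h01 h12
  generalize sig 3 0 = a at *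
  generalize sig 3 1 = b at *
  generalize sig 3 2 = c at *
  have h1 : b * a * c * b * a = c * (b * a * c * b) := by
    calc b * a * c * b * a = b * (a * c) * b * a := by group
      _ = b * c * (a * b * a) := by rw [h02]; group
      _ = (b * c * b) * a * b := by rw [h01]; group
      _ = c * b * (c * a) * b := by rw [h12]; group
      _ = _ := by rw [← h02]; group
  have h2 : b * a * c * b * c = a * (b * a * c * b) := by
    calc b * a * c * b * c = b * a * (c * b * c) := by group
      _ = (b * a * b) * c * b := by rw [← h12]; group
      _ = _ := by rw [← h01]; group
  generalize b * a * c * b = g at *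
  rw [mul_inv_eq_iff_eq_mul, mul_inv_rev, inv_inv, ← mul_assoc, h1, mul_inv_eq_iff_eq_mul,
    mul_assoc, h2]
  group

theorem sig_three_conj_kk : sig 3 0 * kk (of false) * (sig 3 0)⁻¹ =
    kk (of false) * (kk (of true))⁻¹ := by
  have h := DFunLike.congr_fun (act_zero_zpow 1) (of false)
  rw [ev_false, zpow_one] at h
  rw [← kk_act]
  exact (congrArg kk h).trans (by rw [map_mul, map_zpow, zpow_neg_one])

/-- Braids with two exchanged strands, linked to their inverses. -/
theorem false_of_exchange (f : Br 3 →* Br m) {i j : ℕ} (hij : i ≠ j)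
    (h1 : perm m (f (kk (of true))) i = j) (h2 : perm m (f (kk (of true))) j = i)
    (h3 : ∀ k, perm m (f (kk (of true))) k ≠ k →
      k = i ∨ k = j ∨ k = perm m (f (sig 3 0)) i ∨ k = perm m (f (sig 3 0)) j) : False := by
  have hc : Commute (sig 3 0) (kk (of true)) := by
    rw [kk_true]
    exact (Commute.refl _).mul_right (sig_comm (by omega)).inv_right
  have hc' := hc.map f
  obtain ⟨X, hX⟩ : ∃ X, X = f (kk (of true)) := ⟨_, rfl⟩
  obtain ⟨S, hS⟩ : ∃ S, S = f (sig 3 0) := ⟨_, rfl⟩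
  obtain ⟨g, hg⟩ : ∃ g, g = f (sig 3 1 * sig 3 0 * sig 3 2 * sig 3 1) := ⟨_, rfl⟩
  have hgX : g * X * g⁻¹ = X⁻¹ := by
    rw [hg, hX, ← map_inv f, ← map_inv f, ← map_mul f, ← map_mul f, sig_three_conj]
  rw [← hS, ← hX] at hc'
  rw [← hX, ← hS] at h3
  rw [← hX] at h1 h2
  have hp : Pres (perm m X) i j := Or.inr ⟨h1, h2⟩
  have hXg : ∀ x, perm m X (perm m g (perm m X x)) = perm m g x := by
    intro x
    have : X * g * X = g := by
      rw [mul_inv_eq_iff_eq_mul] at hgX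
      rw [mul_assoc, hgX, mul_inv_cancel_left]
    conv_rhs => rw [← this, map_mul, map_mul]
    rfl
  have hXS : ∀ x, perm m X (perm m S x) = perm m S (perm m X x) := fun x =>
    DFunLike.congr_fun (hc'.map (perm m)).symm.eq x
  have hgi := hXg i
  have hgj := hXg j
  rw [h1] at hgi
  rw [h2] at hgj
  have hl := lk_conj_of_pres (g := g) hp
  have hs := lk_of_commute hc' hp
  rw [hgX, lk_inv, Equiv.Perm.inv_eq_iff_eq.mpr hgj.symm, Equiv.Perm.inv_eq_iff_eq.mpr hgi.symm]
    at hl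
  have key : lk X (perm m g j) (perm m g i) = lk X i j := by
    rcases h3 (perm m g i) (by rw [hgj]; exact fun h => hij ((perm m g).injective h).symm) with
      h | h | h | h
    · rw [h] at hgj ⊢
      rw [← hgj, h1, lk_symm]
    · rw [h] at hgj ⊢
      rw [← hgj, h2]
    · rw [h] at hgj ⊢
      rw [← hgj, hXS, h1, lk_symm, hs]
    · rw [h] at hgj ⊢
      rw [← hgj, hXS, h2, hs]
  rw [key] at hl
  exact lk_ne_zero hij h1 h2 (by omega)

theorem false_of_transvection (f : Br 3 →* Br m) {i j : ℕ} (hij : i ≠ j)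
    (h1 : perm m (f (kk (of true))) i = j) (h2 : perm m (f (kk (of true))) j = i)
    (h3 : Pres (perm m (f (kk (of false)))) i j)
    (h4 : Pres (perm m (f (kk (of false)))) (perm m (f (sig 3 0)) i) (perm m (f (sig 3 0)) j))
    (h5 : Pres (perm m (f (sig 3 0)) * perm m (f (sig 3 0))) i j) : False := by
  have hc : Commute (sig 3 0) (kk (of true)) := by
    rw [kk_true]
    exact (Commute.refl _).mul_right (sig_comm (by omega)).inv_right
  have hc' := hc.map f
  have hy := congrArg f sig_three_conj_kk
  rw [map_mul, map_mul, map_inv, map_mul, map_inv] at hy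
  generalize f (kk (of true)) = X at *
  generalize f (kk (of false)) = Y at *
  generalize f (sig 3 0) = S at *
  have hp : Pres (perm m X) i j := Or.inr ⟨h1, h2⟩
  have hY : Y = S * Y * S⁻¹ * X := by rw [hy, inv_mul_cancel_right]
  have hstep : ∀ {i j}, Pres (perm m X) i j → Pres (perm m Y) i j →
      lk Y (perm m S i) (perm m S j) = lk X i j + lk Y i j := by
    intro i j hX hY'
    have hXS : Pres (perm m X) (perm m S i) (perm m S j) := by
      have := hX.conj (g := perm m S)
      rwa [← map_inv, ← map_mul, ← map_mul, hc'.eq, mul_inv_cancel_right] at this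
    conv_lhs => rw [hY]
    rw [lk_mul, lk_of_pres _ hXS, lk_of_commute hc' hX, lk_conj_of_pres hY']
  have hXS : Pres (perm m X) (perm m S i) (perm m S j) := by
    have := hp.conj (g := perm m S)
    rwa [← map_inv, ← map_mul, ← map_mul, hc'.eq, mul_inv_cancel_right] at this
  have e1 := hstep hp h3
  have e2 := hstep hXS h4
  have e3 : lk Y (perm m S (perm m S i)) (perm m S (perm m S j)) = lk Y i j := lk_of_pres Y h5
  rw [e3, e1, lk_of_commute hc' hp] at e2
  exact lk_ne_zero hij h1 h2 (by omega)

end Br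

namespace Br

open FreeGroup (of)
open Equiv.Perm OnCycleFactors

variable {m : ℕ}

theorem conj_of_braid {G : Type*} [Group G] {a b : G} (h : a * b * a = b * a * b) :
    (a * b) * a * (a * b)⁻¹ = b := by
  rw [h]
  group

theorem isConj_map_sig {G : Type*} [Group G] (f : Br m →* G) {i : ℕ} (hi : i < m) :
    IsConj (f (sig m 0)) (f (sig m i)) := by
  induction i with
  | zero => exact IsConj.refl _
  | succ i ih =>
    exact (ih (by omega)).trans (isConj_iff.mpr ⟨_, conj_of_braid (map_sig_braid f hi)⟩)

section
variable {Ω : Type} [Fintype Ω] [DecidableEq Ω]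

theorem card_support_map_sig (f : Br m →* Equiv.Perm Ω) {i : ℕ} (hi : i < m) :
    (f (sig m i)).support.card = (f (sig m 0)).support.card := by
  obtain ⟨g, hg⟩ := isConj_iff.mp (isConj_map_sig f hi)
  rw [← hg, card_support_conj]

theorem eq_zpow_of_three {a c : Equiv.Perm Ω} (ha : a.support.card = 3) (hc : c.support.card = 3)
    (hac : Commute a c) {x : Ω} (hxa : x ∈ a.support) (hxc : x ∈ c.support) :
    ∃ j : ℤ, c = a ^ j := by
  have hcyc := (card_support_eq_three_iff.mp ha).isCycle
  have hcz : ∀ (l : ℤ) y, c ((a ^ l) y) = (a ^ l) (c y) := fun l y =>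
    (DFunLike.congr_fun (hac.zpow_left l).eq y).symm
  rw [mem_support] at hxa hxc
  have h1 : a (c x) ≠ c x := by
    rw [← Equiv.Perm.mul_apply, hac.eq, Equiv.Perm.mul_apply]
    exact fun h => hxa (c.injective h)
  obtain ⟨j, hj⟩ := hcyc.sameCycle hxa h1
  have hsub : a.support ⊆ c.support := by
    intro y hy
    obtain ⟨l, rfl⟩ := hcyc.sameCycle hxa (mem_support.mp hy)
    rw [mem_support, hcz]
    exact fun h => hxc ((a ^ l).injective h)
  have heq := Finset.eq_of_subset_of_card_le hsub (by omega)
  refine ⟨j, Equiv.ext fun y => ?_⟩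
  by_cases hy : y ∈ a.support
  · obtain ⟨l, rfl⟩ := hcyc.sameCycle hxa (mem_support.mp hy)
    rw [hcz, ← hj, ← Equiv.Perm.mul_apply, ← Equiv.Perm.mul_apply, ← zpow_add, ← zpow_add,
      add_comm]
  · have hy' := hy
    rw [heq] at hy'
    rw [notMem_support] at hy hy'
    rw [hy']
    exact (zpow_apply_eq_self_of_apply_eq_self hy j).symm

theorem two_le_card_inter {a b : Equiv.Perm Ω} (ha : a.support.card = 3)
    (h : a * b * a = b * a * b) (hne : a ≠ b) : 2 ≤ (a.support ∩ b.support).card := by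
  by_contra! hlt
  rcases Nat.lt_or_ge 0 (a.support ∩ b.support).card with h1 | h1
  · obtain ⟨u, hu⟩ := Finset.card_eq_one.mp (show (a.support ∩ b.support).card = 1 by omega)
    have hmem : ∀ y, y ∈ a.support → y ∈ b.support → y = u := fun y h1 h2 =>
      Finset.mem_singleton.mp (hu ▸ Finset.mem_inter.mpr ⟨h1, h2⟩)
    obtain ⟨hua, hub⟩ := Finset.mem_inter.mp (hu ▸ Finset.mem_singleton_self u)
    have hau : b (a u) = a u := by
      by_contra hb
      exact mem_support.mp hua (hmem _ (apply_mem_support.mpr hua) (mem_support.mpr hb))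
    have hbu : a (b u) = b u := by
      by_contra hb
      exact mem_support.mp hub (hmem _ (mem_support.mpr hb) (apply_mem_support.mpr hub))
    have h2 : a (b (a u)) = b (a (b u)) := DFunLike.congr_fun h u
    rw [hau, hbu] at h2
    have h3 : a (a u) = u := hmem _ (apply_mem_support.mpr (apply_mem_support.mpr hua))
      (h2 ▸ apply_mem_support.mpr (apply_mem_support.mpr hub))
    have h4 : a ^ 3 = 1 := by
      rw [← (card_support_eq_three_iff.mp ha).orderOf, pow_orderOf_eq_one]
    have h5 : a (a (a u)) = u := DFunLike.congr_fun h4 u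
    rw [h3] at h5
    exact mem_support.mp hua h5
  · refine hne (eq_of_braid_of_commute h (Equiv.Perm.Disjoint.commute ?_))
    rw [disjoint_iff_disjoint_support, Finset.disjoint_iff_inter_eq_empty, ← Finset.card_eq_zero]
    omega

theorem isSwap_of_card_support_le (hm : 4 ≤ m) (f : Br m →* Equiv.Perm Ω)
    (hne : f (sig m 0) ≠ f (sig m 2)) (hs : (f (sig m 0)).support.card ≤ 3) :
    (f (sig m 0)).IsSwap := by
  have h1 : f (sig m 0) ≠ 1 := fun h0 =>
    hne (h0.trans (map_sig_eq_one (by omega) (by omega) h0).symm)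
  have h2 := two_le_card_support_of_ne_one h1
  rw [← card_support_eq_two]
  by_contra h3
  have ha : (f (sig m 0)).support.card = 3 := by omega
  have hs : ∀ i < m, (f (sig m i)).support.card = 3 := fun i hi =>
    (card_support_map_sig f hi).trans ha
  have hd : Disjoint (f (sig m 0)).support (f (sig m 2)).support := by
    rw [Finset.disjoint_left]
    intro x hx hx'
    obtain ⟨j, hj⟩ := eq_zpow_of_three ha (hs 2 (by omega)) (map_sig_comm f (by omega)) hx hx'
    refine map_sig_ne (by omega) hne (i := 2) (j := 3) (by omega) (by omega)
      (eq_of_braid_of_commute (map_sig_braid f (by omega)) ?_)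
    rw [hj]
    exact (map_sig_comm f (by omega)).zpow_left j
  have h01 := two_le_card_inter ha (map_sig_braid f (i := 0) (by omega))
    (map_sig_ne (by omega) hne (by omega) (by omega))
  have h21 := two_le_card_inter (hs 2 (by omega)) (map_sig_braid f (i := 1) (by omega)).symm
    (map_sig_ne (by omega) hne (i := 1) (j := 2) (by omega) (by omega)).symm
  have hd' : Disjoint ((f (sig m 0)).support ∩ (f (sig m 1)).support)
      ((f (sig m 2)).support ∩ (f (sig m 1)).support) :=
    hd.mono Finset.inter_subset_left Finset.inter_subset_left
  have h4 := Finset.card_le_card (Finset.union_subset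
    (Finset.inter_subset_right (s₁ := (f (sig m 0)).support) (s₂ := (f (sig m 1)).support))
    (Finset.inter_subset_right (s₁ := (f (sig m 2)).support) (s₂ := (f (sig m 1)).support)))
  rw [Finset.card_union_of_disjoint hd', hs 1 (by omega)] at h4
  rw [zero_add] at h01
  omega

end

theorem false_of_exchange_permS {M : ℕ} (hm : 3 ≤ m) (ρ : Br m →* Br M) {x : Set.Iic M}
    (h1 : permS M (ρ (sig m 0 * (sig m 2)⁻¹)) x ≠ x)
    (h2 : permS M (ρ (sig m 0 * (sig m 2)⁻¹)) (permS M (ρ (sig m 0 * (sig m 2)⁻¹)) x) = x)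
    (h3 : ∀ k, permS M (ρ (sig m 0 * (sig m 2)⁻¹)) k ≠ k →
      k = x ∨ k = permS M (ρ (sig m 0 * (sig m 2)⁻¹)) x ∨ k = permS M (ρ (sig m 0)) x ∨
        k = permS M (ρ (sig m 0)) (permS M (ρ (sig m 0 * (sig m 2)⁻¹)) x)) : False := by
  have e0 : shift (k := 0) (m := 3) (M := m) hm (sig 3 0) = sig m 0 := shift_sig _ (by omega)
  have e2 : shift (k := 0) (m := 3) (M := m) hm (sig 3 2) = sig m 2 := shift_sig _ (by omega)
  have ex : shift (k := 0) (m := 3) (M := m) hm (kk (of true)) = sig m 0 * (sig m 2)⁻¹ := by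
    rw [kk_true, map_mul, map_inv, e0, e2]
  refine false_of_exchange (ρ.comp (shift (k := 0) hm)) (i := x)
    (j := permS M (ρ (sig m 0 * (sig m 2)⁻¹)) x) ?_ ?_ ?_ ?_
  · exact fun h => h1 (Subtype.ext h.symm)
  · rw [MonoidHom.comp_apply, ex, coe_permS]
  · rw [MonoidHom.comp_apply, ex, ← coe_permS, h2]
  · intro k hk
    rw [MonoidHom.comp_apply, ex] at hk
    have hkM : k ≤ M := by
      by_contra h
      exact hk (perm_apply_of_lt (by omega) _)
    rw [MonoidHom.comp_apply, e0]
    rcases h3 ⟨k, hkM⟩ (fun h => hk (congrArg Subtype.val h)) with h | h | h | h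
    · exact Or.inl (congrArg Subtype.val h)
    · exact Or.inr (Or.inl (congrArg Subtype.val h))
    · exact Or.inr (Or.inr (Or.inl (congrArg Subtype.val h)))
    · exact Or.inr (Or.inr (Or.inr (congrArg Subtype.val h)))

theorem card_Iic_succ (m : ℕ) : Nat.card (Set.Iic m) = m + 1 := by simp

theorem permS_ne_of_injective (hm : 3 ≤ m) {M : ℕ} {ρ : Br m →* Br M}
    (hρ : Function.Injective ρ) : (permS M).comp ρ (sig m 0) ≠ (permS M).comp ρ (sig m 2) := fun h =>
  perm_ne_of_injective hm ρ hρ (permS_eq_iff.mp h)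

theorem isSwap_three {ρ : Br 3 →* Br 4} (hρ : Function.Injective ρ) :
    (permS 4 (ρ (sig 3 0))).IsSwap := by
  classical
  have hne := permS_ne_of_injective (by omega) hρ
  set f := (permS 4).comp ρ with hf
  change (f (sig 3 0)).IsSwap
  have h1 : f (sig 3 0) ≠ 1 := fun h0 =>
    hne (h0.trans (map_sig_eq_one (by omega) (by omega) h0).symm)
  obtain ⟨x, hx⟩ : ∃ x, f (sig 3 0) x ≠ x := by
    by_contra! h
    exact h1 (Equiv.ext h)
  rcases five_points (card_Iic_succ 4) (map_sig_braid f (i := 0) (by omega))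
    (map_sig_braid f (i := 1) (by omega)) (map_sig_comm f (by omega)) hne hx with h | ⟨h2, h3, h4, h5⟩
  · rw [← card_support_eq_two]
    refine le_antisymm ?_ (two_le_card_support_of_ne_one h1)
    refine (Finset.card_le_card (t := {x, f (sig 3 0) x}) fun y hy => ?_).trans Finset.card_le_two
    rw [Finset.mem_insert, Finset.mem_singleton]
    rcases h y with h | h | h
    · exact Or.inl h
    · exact Or.inr h
    · exact absurd h (mem_support.mp hy)
  · exfalso
    have hp : ∀ y, permS 4 (ρ (sig 3 0 * (sig 3 2)⁻¹)) y = f (sig 3 0) (f (sig 3 0) y) := by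
      intro y
      rw [map_mul, map_mul, map_inv, map_inv, Equiv.Perm.mul_apply]
      exact congrArg _ (Equiv.Perm.inv_eq_iff_eq.mpr (h2 y).symm)
    refine false_of_exchange_permS (by omega) ρ (x := x) ?_ ?_ fun k hk => ?_
    · rw [hp]; exact h4
    · rw [hp, hp]; exact h3
    · rw [hp] at hk ⊢
      rcases h5 k with h | h | h | h | h
      · rw [h, h] at hk; exact absurd rfl hk
      · exact Or.inl h
      · exact Or.inr (Or.inr (Or.inl h))
      · exact Or.inr (Or.inl h)
      · exact Or.inr (Or.inr (Or.inr h))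

theorem isSwap_four {ρ : Br 4 →* Br 5} (hρ : Function.Injective ρ) :
    (permS 5 (ρ (sig 4 0))).IsSwap := by
  classical
  have hne := permS_ne_of_injective (by omega) hρ
  set f := (permS 5).comp ρ with hf
  change (f (sig 4 0)).IsSwap
  have h1 : f (sig 4 0) ≠ 1 := fun h0 =>
    hne (h0.trans (map_sig_eq_one (by omega) (by omega) h0).symm)
  obtain ⟨x, hx⟩ : ∃ x, f (sig 4 0) x ≠ x := by
    by_contra! h
    exact h1 (Equiv.ext h)
  have hac : Commute (f (sig 4 0)) (f (sig 4 2)) := map_sig_comm f (by omega)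
  obtain ⟨g, hg⟩ := isConj_iff.mp (isConj_map_sig f (i := 2) (by omega))
  have hgi : ∀ y, g (g⁻¹ y) = y := g.apply_symm_apply
  have hgi' : ∀ y, g⁻¹ (g y) = y := g.symm_apply_apply
  have hgc : ∀ y, f (sig 4 2) y = g (f (sig 4 0) (g⁻¹ y)) := fun y => by rw [← hg]; rfl
  rcases six_points (card_Iic_succ 5) (map_sig_braid f (i := 2) (by omega)) hac
    (map_sig_comm f (i := 0) (j := 3) (by omega))
    (map_sig_ne (by omega) hne (by omega) (by omega)) hx with h | ⟨h, h'⟩ | ⟨h, h'⟩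
  · refine isSwap_of_card_support_le (by omega) f hne ?_
    refine (Finset.card_le_card
      (t := {x, f (sig 4 0) x, f (sig 4 0) (f (sig 4 0) x)}) fun y hy => ?_).trans
        Finset.card_le_three
    rw [Finset.mem_insert, Finset.mem_insert, Finset.mem_singleton]
    rcases h y with h | h
    · exact absurd h (mem_support.mp hy)
    · exact h
  · refine absurd (fun y => ?_) h'
    rw [hgc, hgc, hgc, hgi', hgi', h, hgi]
  · exfalso
    have hc : ∀ y, f (sig 4 2) (f (sig 4 2) y) = y := fun y => by rw [hgc, hgc, hgi', (h _).1, hgi]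
    replace h' := h'.resolve_left (not_not.mpr fun y => ⟨hc y, fun hy => by
      rw [hgc] at hy
      exact (h (g⁻¹ y)).2 (by rw [← hgi' (f (sig 4 0) (g⁻¹ y)), hy])⟩)
    have hp : ∀ y, permS 5 (ρ (sig 4 0 * (sig 4 2)⁻¹)) y = f (sig 4 0) (f (sig 4 2) y) := by
      intro y
      rw [map_mul, map_mul, map_inv, map_inv, Equiv.Perm.mul_apply]
      exact congrArg _ (Equiv.Perm.inv_eq_iff_eq.mpr (hc y).symm)
    have hca : ∀ y, f (sig 4 2) (f (sig 4 0) y) = f (sig 4 0) (f (sig 4 2) y) :=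
      fun y => (DFunLike.congr_fun hac.eq y).symm
    have hpne : ∀ y, f (sig 4 0) (f (sig 4 2) y) ≠ y ↔ f (sig 4 2) y ≠ f (sig 4 0) y := by
      intro y
      rw [ne_eq, ne_eq, ← (f (sig 4 0)).apply_eq_iff_eq (y := f (sig 4 0) y), (h y).1]
    obtain ⟨y, hy⟩ : ∃ y, f (sig 4 2) y ≠ f (sig 4 0) y := by
      by_contra! h0
      exact hne (Equiv.ext fun y => (h0 y).symm)
    refine false_of_exchange_permS (by omega) ρ (x := y) ?_ ?_ fun k hk => ?_
    · rw [hp, hpne]; exact hy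
    · rw [hp, hp, hca, hc, (h _).1]
    · rw [hp, hpne] at hk
      rw [hp]
      change _ ∨ _ ∨ _ ∨ k = f (sig 4 0) (f (sig 4 0) (f (sig 4 2) y))
      rw [(h _).1]
      rcases h' y with h0 | h0
      · exact absurd h0 hy
      · rcases h0 k with h | h | h | h | h
        · exact absurd h hk
        · exact Or.inl h
        · exact Or.inr (Or.inr (Or.inr h))
        · exact Or.inr (Or.inr (Or.inl h))
        · exact Or.inr (Or.inl h)

end Br

namespace Br

open FreeGroup (of)
open Equiv.Perm OnCycleFactors

variable {m : ℕ}

section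
variable {Ω : Type} [Fintype Ω] [DecidableEq Ω] {a : Equiv.Perm Ω}

theorem centralizer_apply (g : Subgroup.centralizer {a}) (x : Ω) : g.1 (a x) = a (g.1 x) := by
  simpa using centralizer_zpow g 1 x

theorem pres_of_ker {g : Subgroup.centralizer {a}} (hg : toPermHom a g = 1) {x : Ω}
    (hx : a x ≠ x) (hax : a (a x) = x) : Pres g.1 x (a x) := by
  have h1 : g.1 x = x ∨ g.1 x = a x := by
    obtain ⟨j, hj⟩ := exists_zpow_apply hg x hx
    have h2 : ∀ l : ℤ, (a ^ (2 * l)) x = x := fun l => by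
      rw [zpow_mul]
      exact zpow_apply_eq_self_of_apply_eq_self hax l
    obtain ⟨l, rfl | rfl⟩ := Int.even_or_odd' j
    · exact Or.inl (hj.trans (h2 l))
    · right
      rw [hj, add_comm, zpow_add, zpow_one, Equiv.Perm.mul_apply, h2]
  rcases h1 with h1 | h1
  · exact Or.inl ⟨h1, by rw [centralizer_apply, h1]⟩
  · exact Or.inr ⟨h1, by rw [centralizer_apply, h1, hax]⟩

theorem card_cycleOf_le (hq : Nat.card a.cycleFactorsFinset = 3) (hs : a.support.card ≤ 7) {x : Ω}
    (hx : a x ≠ x) : (a.cycleOf x).support.card ≤ 3 := by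
  have hmem := cycleOf_mem_cycleFactorsFinset_iff.mpr (mem_support.mpr hx)
  rw [Nat.card_eq_fintype_card, Fintype.card_coe] at hq
  have h1 : ∑ c ∈ a.cycleFactorsFinset, c.support.card = a.support.card := by
    rw [← sum_cycleType, cycleType_def]
    rfl
  rw [← Finset.add_sum_erase _ _ hmem] at h1
  have h2 := Finset.card_nsmul_le_sum (a.cycleFactorsFinset.erase (a.cycleOf x))
    (fun c => c.support.card) 2 fun c hc =>
      (mem_cycleFactorsFinset_iff.mp (Finset.mem_of_mem_erase hc)).1.two_le_card_support
  rw [Finset.card_erase_of_mem hmem, hq, smul_eq_mul] at h2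
  omega

theorem apply_apply_of_ker {g : Subgroup.centralizer {a}} (hg : toPermHom a g = 1)
    (hgg : g * g = 1) {x : Ω} (hx : a x ≠ x) (hgx : g.1 x ≠ x)
    (hs : (a.cycleOf x).support.card ≤ 3) : a (a x) = x := by
  have h2 := two_le_card_support_cycleOf_iff.mpr hx
  have h3 := pow_mod_card_support_cycleOf_self_apply a (a.cycleOf x).support.card x
  rw [Nat.mod_self, pow_zero, Equiv.Perm.one_apply] at h3
  have h4 : (a.cycleOf x).support.card = 2 ∨ (a.cycleOf x).support.card = 3 := by omega
  rcases h4 with h4 | h4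
  · rw [h4] at h3
    exact h3.symm
  · exfalso
    rw [h4] at h3
    obtain ⟨j, hj⟩ := exists_zpow_apply hg x hx
    have h5 : g.1 (g.1 x) = x := DFunLike.congr_fun (congrArg Subtype.val hgg) x
    rw [hj, centralizer_zpow, hj, ← Equiv.Perm.mul_apply, ← zpow_add] at h5
    have h6 : (a ^ (3 * j)) x = x := by
      rw [zpow_mul]
      exact zpow_apply_eq_self_of_apply_eq_self h3.symm j
    rw [show 3 * j = j + (j + j) by ring, zpow_add, Equiv.Perm.mul_apply, h5] at h6
    exact hgx (hj.trans h6)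

end

theorem Pres.coe {b : Br m} {x y : Set.Iic m} (h : Pres (permS m b) x y) : Pres (perm m b) x y :=
  h.imp (fun h => ⟨congrArg Subtype.val h.1, congrArg Subtype.val h.2⟩)
    (fun h => ⟨congrArg Subtype.val h.1, congrArg Subtype.val h.2⟩)

theorem sq_eq_one_of_transvection {G : Type*} [Group G] {s x y : G} (hs : s * y * s⁻¹ = y * x⁻¹)
    (hx : Commute s x) (hy : Commute y (s * s)) : x * x = 1 := by
  have h1 : y = y * (x * x)⁻¹ := by
    calc y = s * s * y * (s * s)⁻¹ := by rw [← hy.eq, mul_inv_cancel_right]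
      _ = s * (s * y * s⁻¹) * s⁻¹ := by group
      _ = s * (y * x⁻¹) * s⁻¹ := by rw [hs]
      _ = s * y * s⁻¹ * (s * x⁻¹ * s⁻¹) := by group
      _ = y * (x * x)⁻¹ := by rw [hs, hx.inv_right.eq, mul_inv_cancel_right]; group
  rw [left_eq_mul, inv_eq_one] at h1
  exact h1

theorem isSwap_five_of_cycles {ρ : Br 5 →* Br 6}
    (hne : (permS 6).comp ρ (sig 5 0) ≠ (permS 6).comp ρ (sig 5 2))
    (h1 : fixHom _ (centHom ((permS 6).comp ρ) (k := 3) le_rfl (sig 3 0)) =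
      fixHom _ (centHom ((permS 6).comp ρ) (k := 3) le_rfl (sig 3 2)))
    (h2 : toPermHom _ (centHom ((permS 6).comp ρ) (k := 3) le_rfl (sig 3 0)) =
      toPermHom _ (centHom ((permS 6).comp ρ) (k := 3) le_rfl (sig 3 2)))
    (h3 : toPermHom _ (centHom ((permS 6).comp ρ) (k := 3) le_rfl (sig 3 0)) ≠
      toPermHom _ (centHom ((permS 6).comp ρ) (k := 3) le_rfl (sig 3 1))) : False := by
  set f := (permS 6).comp ρ with hf
  set s := centHom f (k := 3) le_rfl with hs
  have hcard := card_fix (a := f (sig 5 0))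
  have hcyc := card_cycles_le (a := f (sig 5 0))
  rw [card_Iic_succ] at hcard
  have hb := map_sig_braid ((toPermHom _).comp s) (i := 0) (by omega)
  have hsq : toPermHom _ (s (sig 3 0) * s (sig 3 0)) = 1 := by
    apply (permFin _).injective
    rw [map_mul, map_mul, map_one]
    refine sq_of_braid_three _ (by omega) _ (permFin _ (toPermHom _ (s (sig 3 1)))) ?_
      fun h => h3 ((permFin _).injective h)
    have hb' := congrArg (permFin _) hb
    simp only [map_mul, MonoidHom.comp_apply] at hb'
    exact hb'
  have hq : Nat.card (f (sig 5 0)).cycleFactorsFinset = 3 := by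
    refine le_antisymm (by omega) (Nat.lt_of_not_le fun h => h3 ?_)
    refine eq_of_braid_of_commute hb ((permFin _).injective ?_)
    rw [map_mul, map_mul]
    exact commute_of_two _ h _ _
  obtain ⟨x, hx⟩ : ∃ x, x = s (kk (of true)) := ⟨_, rfl⟩
  obtain ⟨y, hy⟩ : ∃ y, y = s (kk (of false)) := ⟨_, rfl⟩
  have hxT : toPermHom _ x = 1 := by
    rw [hx, kk_true, map_mul, map_mul, map_inv, map_inv, h2, mul_inv_cancel]
  have hxF : fixHom _ x = 1 := by
    rw [hx, kk_true, map_mul, map_mul, map_inv, map_inv, h1, mul_inv_cancel]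
  have hyT : toPermHom _ y = 1 := by
    rw [hy, kk_false, map_mul, map_mul, map_mul, map_mul, ← hx, hxT, mul_one, ← map_mul, ← map_mul,
      mul_inv_cancel, map_one, map_one]
  have hyF : fixHom _ y = 1 := by
    rw [hy, kk_false, map_mul, map_mul, map_mul, map_mul, ← hx, hxF, mul_one, ← map_mul, ← map_mul,
      mul_inv_cancel, map_one, map_one]
  have hrel : s (sig 3 0) * y * (s (sig 3 0))⁻¹ = y * x⁻¹ := by
    rw [hx, hy, ← map_inv, ← map_inv, ← map_mul, ← map_mul, ← map_mul, sig_three_conj_kk]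
  have hcomm : Commute (s (sig 3 0)) x := by
    rw [hx, kk_true]
    exact ((Commute.refl _).mul_right (sig_comm (by omega)).inv_right).map s
  have hxx : x * x = 1 := sq_eq_one_of_transvection hrel hcomm (commute_of_ker hyT hsq hyF)
  obtain ⟨i, hi⟩ : ∃ i, x.1 i ≠ i := by
    by_contra! h
    have : x = 1 := Subtype.ext (Equiv.ext h)
    rw [hx, kk_true, map_mul, map_inv, mul_inv_eq_one] at this
    have h' := congrArg Subtype.val this
    rw [hs, coe_centHom, coe_centHom, shift_sig _ (by omega), shift_sig _ (by omega)] at h'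
    exact map_sig_ne (by omega) hne (by omega) (by omega) h'
  have hai : f (sig 5 0) i ≠ i := fun h =>
    hi (eq_on_fix (h := 1) (hxF.trans (map_one _).symm) h)
  have haai := apply_apply_of_ker hxT hxx hai hi (card_cycleOf_le hq (by omega) hai)
  have hxi : x.1 i = f (sig 5 0) i ∧ x.1 (f (sig 5 0) i) = i :=
    (pres_of_ker hxT hai haai).resolve_left fun h => hi h.1
  have hsa := centralizer_apply (s (sig 3 0))
  have hyi := pres_of_ker hyT (x := (s (sig 3 0)).1 i)
    (by rw [← hsa]; exact fun h => hai ((s (sig 3 0)).1.injective h)) (by rw [← hsa, ← hsa, haai])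
  rw [← hsa] at hyi
  refine false_of_transvection (ρ.comp (shift (k := 2) (m := 3) (M := 5) le_rfl)) (i := i)
    (j := (f (sig 5 0) i : ℕ)) (fun h => hai (Subtype.ext h.symm)) ?_ ?_ ?_ ?_ ?_
  · rw [hx] at hxi
    exact congrArg Subtype.val hxi.1
  · rw [hx] at hxi
    exact congrArg Subtype.val hxi.2
  · have := pres_of_ker hyT hai haai
    rw [hy] at this
    exact this.coe
  · rw [hy] at hyi
    exact hyi.coe
  · have := pres_of_ker hsq hai haai
    rw [← map_mul] at this ⊢
    rw [← map_mul]
    exact this.coe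

theorem isSwap_of_injective (hm : 3 ≤ m) {ρ : Br m →* Br (m + 1)} (hρ : Function.Injective ρ) :
    (permS (m + 1) (ρ (sig m 0))).IsSwap := by
  classical
  by_cases h3 : m = 3
  · subst h3; exact isSwap_three hρ
  by_cases h4 : m = 4
  · subst h4; exact isSwap_four hρ
  have hne := permS_ne_of_injective hm hρ
  have hk : m - 2 + 2 ≤ m := by omega
  have hcard := card_fix (a := (permS (m + 1)).comp ρ (sig m 0))
  have hcyc := card_cycles_le (a := (permS (m + 1)).comp ρ (sig m 0))
  rw [card_Iic_succ] at hcard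
  by_cases hF : fixHom _ (centHom ((permS (m + 1)).comp ρ) hk (sig (m - 2) 0)) =
      fixHom _ (centHom ((permS (m + 1)).comp ρ) hk (sig (m - 2) 2))
  · have hT := map_sig_eq_of_card (m := m - 2) (by omega) (by omega)
      ((toPermHom _).comp (centHom ((permS (m + 1)).comp ρ) hk))
    have h24 := map_sig_ne hm hne (i := 2) (j := 4) (by omega) (by omega)
    by_cases h01 : toPermHom _ (centHom ((permS (m + 1)).comp ρ) hk (sig (m - 2) 0)) =
        toPermHom _ (centHom ((permS (m + 1)).comp ρ) hk (sig (m - 2) 1))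
    · exact absurd (map_eq_of_cycles hk (by omega) h01 hF) h24
    · by_cases h5 : m = 5
      · subst h5
        exact (isSwap_five_of_cycles hne hF hT h01).elim
      · exact absurd (map_sig_eq_of_two _ (i := 0) (by omega) (by omega) hT (by omega)).symm h01
  · refine isSwap_of_card_support_le (by omega) _ hne ?_
    by_contra! hs
    exact hF (map_sig_eq_of_card (m := m - 2) (by omega) (by omega)
      ((fixHom _).comp (centHom ((permS (m + 1)).comp ρ) hk)))

end Br

namespace Br

variable {m M : ℕ}

theorem exists_perm_eq_swap {x y : ℕ} (hx : x ≤ M) (hy : y ≤ M) :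
    ∃ c : Br M, perm M c = Equiv.swap x y := by
  wlog hxy : x ≤ y generalizing x y
  · rw [Equiv.swap_comm]
    exact this hy hx (by omega)
  induction y, hxy using Nat.le_induction with
  | base => exact ⟨1, by rw [map_one, Equiv.swap_self]; rfl⟩
  | succ y hxy ih =>
    obtain ⟨c, hc⟩ := ih (by omega)
    by_cases h : x = y
    · exact ⟨sig M y, by rw [perm_sig (by omega), h]⟩
    · refine ⟨sig M y * c * (sig M y)⁻¹, ?_⟩
      rw [map_mul, map_mul, map_inv, hc, perm_sig (by omega), ← Equiv.swap_apply_apply,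
        Equiv.swap_apply_left, Equiv.swap_apply_of_ne_of_ne h (by omega)]

theorem disjoint_of_commute_swap {a b x y : ℕ}
    (h : Commute (Equiv.swap x y) (Equiv.swap a b)) (hne : Equiv.swap x y ≠ Equiv.swap a b)
    (hab : a ≠ b) (hxy : x ≠ y) : a ≠ x ∧ a ≠ y ∧ b ≠ x ∧ b ≠ y := by
  have h1 : ∀ u, Equiv.swap x y (Equiv.swap a b u) = Equiv.swap a b (Equiv.swap x y u) :=
    fun u => DFunLike.congr_fun h.eq u
  have ha := h1 a
  have hb := h1 b
  have e1 : ¬(a = x ∧ b = y) := by rintro ⟨rfl, rfl⟩; exact hne rfl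
  have e2 : ¬(a = y ∧ b = x) := by rintro ⟨rfl, rfl⟩; exact hne (Equiv.swap_comm _ _)
  simp only [Equiv.swap_apply_def] at ha hb
  grind

theorem meet_of_braid_swap {a b x y : ℕ}
    (h : Equiv.swap x y * Equiv.swap a b * Equiv.swap x y =
      Equiv.swap a b * Equiv.swap x y * Equiv.swap a b) (hne : Equiv.swap x y ≠ Equiv.swap a b)
    (hab : a ≠ b) (hxy : x ≠ y) : a = x ∨ a = y ∨ b = x ∨ b = y := by
  by_contra! hc
  refine hne (eq_of_braid_of_commute h ?_)
  exact (Equiv.Perm.disjoint_swap_swap (by simp; grind)).commute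

theorem exists_conj_perm (hm : 3 ≤ m) (f : Br m →* Equiv.Perm ℕ)
    (hf : ∀ i < m, ∃ a ≤ M, ∃ b ≤ M, a ≠ b ∧ f (sig m i) = Equiv.swap a b)
    (hne : f (sig m 0) ≠ f (sig m 2)) {k : ℕ} (hk : k ≤ m) :
    ∃ c : Br M, ∀ j < k, perm M c * f (sig m j) * (perm M c)⁻¹ = Equiv.swap j (j + 1) := by
  induction k with
  | zero => exact ⟨1, fun j hj => absurd hj (by omega)⟩
  | succ k ih =>
    obtain ⟨c, hc⟩ := ih (by omega)
    have key : ∀ c : Br M, (∀ j < k, perm M c * f (sig m j) * (perm M c)⁻¹ = Equiv.swap j (j + 1)) →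
        ∃ a ≤ M, ∃ b ≤ M, a ≠ b ∧ perm M c * f (sig m k) * (perm M c)⁻¹ = Equiv.swap a b ∧
        (∀ j, j + 1 < k → a ≠ j ∧ a ≠ j + 1 ∧ b ≠ j ∧ b ≠ j + 1) ∧
        (∀ j, j + 1 = k → a ≠ b ∧ (a = j ∨ a = j + 1 ∨ b = j ∨ b = j + 1)) ∧
        ∀ j, j + 1 = k → Equiv.swap j (j + 1) ≠ Equiv.swap a b := by
      intro c hc
      obtain ⟨a, ha, b, hb, hab, he⟩ := hf k (by omega)
      have he' : perm M c * f (sig m k) * (perm M c)⁻¹ = Equiv.swap (perm M c a) (perm M c b) := by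
        rw [he, ← Equiv.swap_apply_apply]
      have hne' : ∀ j < k, Equiv.swap j (j + 1) ≠ Equiv.swap (perm M c a) (perm M c b) := by
        intro j hj h
        rw [← hc j hj, ← he', mul_left_inj, mul_right_inj] at h
        exact map_sig_ne hm hne hj (by omega) h
      have hcc : ∀ i, perm M c * f (sig m i) * (perm M c)⁻¹ =
          ((MulAut.conj (perm M c)).toMonoidHom.comp f) (sig m i) := fun i => rfl
      have hab' : perm M c a ≠ perm M c b := fun h => hab ((perm M c).injective h)
      refine ⟨_, perm_apply_le ha c, _, perm_apply_le hb c, hab', he', fun j hj => ?_,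
        fun j hj => ⟨hab', ?_⟩, fun j hj => hne' j (by omega)⟩
      · refine disjoint_of_commute_swap ?_ (hne' j (by omega)) hab' (by omega)
        rw [← he', ← hc j (by omega), hcc, hcc]
        exact map_sig_comm _ (by omega)
      · refine meet_of_braid_swap ?_ (hne' j (by omega)) hab' (by omega)
        rw [← he', ← hc j (by omega), hcc, hcc]
        subst hj
        exact map_sig_braid _ (by omega)
    have step : ∀ c d : Br M, (perm M (d * c)) = perm M d * perm M c := fun c d => map_mul _ _ _
    have conj : ∀ (c d : Br M) (i u v : ℕ),
        perm M c * f (sig m i) * (perm M c)⁻¹ = Equiv.swap u v →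
        perm M (d * c) * f (sig m i) * (perm M (d * c))⁻¹ =
          Equiv.swap (perm M d u) (perm M d v) := by
      intro c d i u v h
      rw [Equiv.swap_apply_apply, ← h, step]
      group
    -- it suffices to bring one end of the transposition to `k`
    have fin : ∀ c : Br M,
        (∀ j < k, perm M c * f (sig m j) * (perm M c)⁻¹ = Equiv.swap j (j + 1)) →
        (∃ b ≤ M, k < b ∧ perm M c * f (sig m k) * (perm M c)⁻¹ = Equiv.swap k b) →
        ∃ c : Br M, ∀ j < k + 1,
          perm M c * f (sig m j) * (perm M c)⁻¹ = Equiv.swap j (j + 1) := by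
      rintro c hc ⟨b, hb, hkb, he⟩
      obtain ⟨d, hd⟩ := exists_perm_eq_swap (M := M) (x := k + 1) (y := b) (by omega) hb
      refine ⟨d * c, fun j hj => ?_⟩
      by_cases hjk : j = k
      · subst hjk
        rw [conj c d _ _ _ he, hd, Equiv.swap_apply_of_ne_of_ne (by omega) (by omega),
          Equiv.swap_apply_right]
      · rw [conj c d _ _ _ (hc j (by omega)), hd, Equiv.swap_apply_of_ne_of_ne (by omega) (by omega),
          Equiv.swap_apply_of_ne_of_ne (by omega) (by omega)]
    obtain ⟨a, ha, b, hb, hab, he, hlo, hmeet, hns⟩ := key c hc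
    rcases k with _ | _ | k
    · obtain ⟨d, hd⟩ := exists_perm_eq_swap (M := M) (x := 0) (y := a) (by omega) ha
      refine fin (d * c) (fun j hj => absurd hj (by omega)) ⟨perm M d b, perm_apply_le hb d, ?_, ?_⟩
      · rw [Nat.pos_iff_ne_zero, hd]
        intro h
        exact hab ((Equiv.swap 0 a).injective (h.trans (Equiv.swap_apply_right 0 a).symm)).symm
      · rw [conj c d _ _ _ he, hd, Equiv.swap_apply_right]
    · have h0 := hmeet 0 rfl
      have h1 := hns 0 rfl
      by_cases hc1 : a = 1 ∨ b = 1
      · refine fin c hc ?_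
        rcases hc1 with rfl | rfl
        · refine ⟨b, hb, ?_, he⟩
          by_contra! hlt
          have : b = 0 := by omega
          exact h1 (by rw [this, Equiv.swap_comm])
        · refine ⟨a, ha, ?_, by rw [he, Equiv.swap_comm]⟩
          by_contra! hlt
          have : a = 0 := by omega
          exact h1 (by rw [this])
      · have hM : 1 ≤ M := by omega
        obtain ⟨d, hd⟩ := exists_perm_eq_swap (M := M) (x := 0) (y := 1) (by omega) hM
        refine fin (d * c) (fun j hj => ?_) ?_
        · obtain rfl : j = 0 := by omega
          rw [conj c d _ _ _ (hc 0 (by omega)), hd, zero_add, Equiv.swap_apply_left,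
            Equiv.swap_apply_right, Equiv.swap_comm]
        · rcases (by omega : a = 0 ∨ b = 0) with rfl | rfl
          · refine ⟨b, hb, by omega, ?_⟩
            rw [conj c d _ _ _ he, hd, Equiv.swap_apply_left,
              Equiv.swap_apply_of_ne_of_ne (by omega) (by omega)]
          · refine ⟨a, ha, by omega, ?_⟩
            rw [conj c d _ _ _ he, hd, Equiv.swap_apply_left,
              Equiv.swap_apply_of_ne_of_ne (by omega) (by omega), Equiv.swap_comm]
    · have h2 := hmeet (k + 1) rfl
      have h3 := hlo k (by omega)
      have hlow : ∀ u, (u = a ∨ u = b) → k + 1 < u := by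
        intro u hu
        by_contra! hlt
        rcases Nat.eq_zero_or_pos u with h | h
        · have := hlo 0 (by omega)
          omega
        · have := hlo (u - 1) (by omega)
          omega
      have hla := hlow a (Or.inl rfl)
      have hlb := hlow b (Or.inr rfl)
      refine fin c hc ?_
      rcases (by omega : a = k + 1 + 1 ∨ b = k + 1 + 1) with h | h
      · exact ⟨b, hb, by omega, by rw [he, h]⟩
      · exact ⟨a, ha, by omega, by rw [he, h, Equiv.swap_comm]⟩

theorem tStd_of_injective (hm : 3 ≤ m) {ρ : Br m →* Br (m + 1)} (hρ : Function.Injective ρ) :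
    TStd ρ := by
  classical
  have hne := permS_ne_of_injective hm hρ
  have hsw : ∀ i < m, ∃ a ≤ m + 1, ∃ b ≤ m + 1, a ≠ b ∧
      (perm (m + 1)).comp ρ (sig m i) = Equiv.swap a b := by
    intro i hi
    have h0 := isSwap_of_injective hm hρ
    rw [← Equiv.Perm.card_support_eq_two] at h0
    have h1 := card_support_map_sig ((permS (m + 1)).comp ρ) hi
    rw [MonoidHom.comp_apply, MonoidHom.comp_apply, h0, Equiv.Perm.card_support_eq_two] at h1
    obtain ⟨a, b, hab, h⟩ := h1
    refine ⟨a, a.2, b, b.2, fun h => hab (Subtype.ext h), Equiv.ext fun x => ?_⟩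
    rw [MonoidHom.comp_apply]
    by_cases hx : x ≤ m + 1
    · have := congrArg Subtype.val (DFunLike.congr_fun h ⟨x, hx⟩)
      rw [coe_permS] at this
      rw [this]
      simp only [Equiv.swap_apply_def]
      grind
    · have ha : (a : ℕ) ≤ m + 1 := a.2
      have hb : (b : ℕ) ≤ m + 1 := b.2
      rw [perm_apply_of_lt (by omega), Equiv.swap_apply_of_ne_of_ne (by omega) (by omega)]
  obtain ⟨c, hc⟩ := exists_conj_perm hm ((perm (m + 1)).comp ρ) hsw
    (fun h => hne (permS_eq_iff.mpr h)) le_rfl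
  obtain ⟨c', e, s, t, H⟩ := tStd_of_three eStd_three hm ((MulAut.conj c).toMonoidHom.comp ρ) (by
    have : (perm (m + 1)).comp ((MulAut.conj c).toMonoidHom.comp ρ) = perm m := by
      refine hom_ext fun i hi => ?_
      rw [perm_sig hi, ← hc i hi]
      simp
    exact DFunLike.congr_fun this)
  refine ⟨c⁻¹ * c', e, s, t, fun i hi => ?_⟩
  have h : c * ρ (sig m i) * c⁻¹ = _ := H i hi
  have hz := ((zt_comm c⁻¹).zpow_left t).eq
  calc ρ (sig m i) = c⁻¹ * (c * ρ (sig m i) * c⁻¹) * c := by group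
    _ = c⁻¹ * (c' * incl m (chis m e (sig m i) * zt m ^ s) * c'⁻¹) * (zt (m + 1) ^ t * c) := by
      rw [h]; group
    _ = _ := by
      rw [((zt_comm c).zpow_left t).eq]
      group

end Br

namespace Br

variable {m : ℕ}

theorem zt_zpow_hom (k : Br m →* Multiplicative ℤ) (s : ℤ) (a b : Br m) :
    zt m ^ (s * Multiplicative.toAdd (k (a * b))) =
      zt m ^ (s * Multiplicative.toAdd (k a)) * zt m ^ (s * Multiplicative.toAdd (k b)) := by
  rw [map_mul k, toAdd_mul, mul_add, zpow_add]

theorem toAdd_len_eq {ℓ : Br m → ℤ} (h : ∀ a b, ℓ (a * b) = ℓ a + ℓ b)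
    (h1 : ∀ i < m, ℓ (sig m i) = 1) (b : Br m) : Multiplicative.toAdd (len m b) = ℓ b := by
  have : len m = MonoidHom.mk' (fun b => Multiplicative.ofAdd (ℓ b))
      (fun a b => by rw [h, ofAdd_add]) :=
    hom_ext fun i hi => by rw [len_sig hi, MonoidHom.mk'_apply, h1 i hi]
  rw [this, MonoidHom.mk'_apply, toAdd_ofAdd]

theorem TStd.apply {h : Br m →* Br (m + 1)} (H : TStd h) :
    ∃ (c : Br (m + 1)) (e : Bool) (s t : ℤ), ∀ g : Br m,
      h g = c * incl m (chis m e g * zt m ^ (s * Multiplicative.toAdd (len m g))) * c⁻¹ *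
        zt (m + 1) ^ (t * Multiplicative.toAdd (len m g)) := by
  obtain ⟨c, e, s, t, H⟩ := H
  let F : Br m →* Br (m + 1) := MonoidHom.mk' (fun g =>
    c * incl m (chis m e g * zt m ^ (s * Multiplicative.toAdd (len m g))) * c⁻¹ *
        zt (m + 1) ^ (t * Multiplicative.toAdd (len m g))) (fun a b => by
      have h1 : chis m e (a * b) *
          zt m ^ (s * Multiplicative.toAdd (len m (a * b))) =
          chis m e a * zt m ^ (s * Multiplicative.toAdd (len m a)) *
          (chis m e b * zt m ^ (s * Multiplicative.toAdd (len m b))) := by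
        have h2 := ((zt_comm (chis m e b)).zpow_left (s * Multiplicative.toAdd (len m a))).eq
        rw [zt_zpow_hom, map_mul (chis m e), mul_assoc, mul_assoc (chis m e a),
          ← mul_assoc (zt m ^ _), h2, mul_assoc]
      rw [h1, map_mul (incl m), map_mul (len m), toAdd_mul, mul_add, zpow_add]
      generalize incl m (chis m e a * _) = A
      generalize incl m (chis m e b * _) = B
      have h2 := ((zt_comm (c * B * c⁻¹)).zpow_left (t * Multiplicative.toAdd (len m a))).eq
      generalize zt (m + 1) ^ (t * Multiplicative.toAdd (len m a)) = Z at h2 ⊢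
      calc _ = c * A * c⁻¹ * ((c * B * c⁻¹) * Z) *
            zt (m + 1) ^ (t * Multiplicative.toAdd (len m b)) := by group
        _ = _ := by rw [← h2]; group)
  have hF : h = F := hom_ext fun i hi => by
    rw [H i hi, MonoidHom.mk'_apply, len_sig hi, toAdd_ofAdd, mul_one, mul_one]
  exact ⟨c, e, s, t, fun g => DFunLike.congr_fun hF g⟩

end Br

theorem braidGroup_inj_into_succ_geometric (n : ℕ) (hn : 4 ≤ n)
    (ι : BraidGroup n →* BraidGroup (n + 1))
    (hι : ∀ i : Fin (n - 1),
      ι (braidσ n i) = braidσ (n + 1) (Fin.castLE (by omega) i))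
    (χ : MulAut (BraidGroup n))
    (hχ : ∀ i : Fin (n - 1), χ (braidσ n i) = (braidσ n i)⁻¹)
    (ℓ : BraidGroup n → ℤ) (hℓ : ∀ a b, ℓ (a * b) = ℓ a + ℓ b)
    (hℓσ : ∀ i : Fin (n - 1), ℓ (braidσ n i) = 1)
    (ρ : BraidGroup n →* BraidGroup (n + 1)) (hρ : Function.Injective ρ) :
    ∃ (c : BraidGroup (n + 1)) (e : ℕ) (s t : ℤ), (e = 0 ∨ e = 1) ∧
      ∀ g : BraidGroup n,
        ρ g = c * ι ((χ ^ e) g * fullTwist n ^ (s * ℓ g)) * c⁻¹ *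
          fullTwist (n + 1) ^ (t * ℓ g) := by
  obtain ⟨m, rfl⟩ : ∃ m, n = m + 1 := ⟨n - 1, by omega⟩
  have hι' : ι = Br.incl m := Br.hom_ext (m := m) fun i hi => by
    rw [Br.incl_sig hi, ← Br.of_eq_sig ⟨i, hi⟩]
    exact (hι ⟨i, hi⟩).trans (Br.of_eq_sig (m := m + 1) _)
  have hχ' : ∀ g, χ g = Br.chi m g := DFunLike.congr_fun <|
    show χ.toMonoidHom = Br.chi m from Br.hom_ext (m := m) fun i hi => by
      rw [Br.chi_sig hi, ← Br.of_eq_sig ⟨i, hi⟩]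
      exact hχ ⟨i, hi⟩
  have hℓ' : ∀ g, Multiplicative.toAdd (Br.len m g) = ℓ g := Br.toAdd_len_eq hℓ fun i hi => by
    rw [← Br.of_eq_sig ⟨i, hi⟩]
    exact hℓσ ⟨i, hi⟩
  obtain ⟨c, e, s, t, H⟩ := (Br.tStd_of_injective (m := m) (by omega) (ρ := ρ) hρ).apply
  refine ⟨c, cond e 1 0, s, t, by cases e <;> simp, fun g => ?_⟩
  have he : (χ ^ (cond e 1 0 : ℕ)) g = Br.chis m e g := by
    cases e
    · rfl
    · exact hχ' g
  rw [he, hι', ← hℓ', Br.fullTwist_eq, Br.fullTwist_eq]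
  exact H g
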